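/- Let P_n be a graph sampled uniformly at random from 𝒫_n. Then there exist c > 0 and n₀ such that for all n ≥ n₀, | P(P_n is Hamiltonian) − (1 − (1/2)·Σ_{k ∈ {0,…,n}, k > n/2} ℓ_{n,k}/𝓛_n) | ≤ e^{−cn}. (Here Σ_{k > n/2} ℓ_{n,k}/𝓛_n = P(X > n/2) for X ~ L(n).) In particular, almost all perfect graphs are Hamiltonian. -/

import Mathlib

open scoped Classical
open Filter

noncomputable section

/-- A finite simple graph is perfect if every induced subgraph has chromatic number
equal to clique number. -/
def IsPerfect {V : Type*} (G : SimpleGraph V) : Prop :=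
  ∀ s : Set V, (G.induce s).chromaticNumber = ((G.induce s).cliqueNum : ℕ∞)

/-- `(G, C)` is a unipolar arrangement: `C` is a clique (the central clique) and every
connected component of the subgraph induced on the complement of `C` is a clique. -/
def IsUnipolarArrangement {V : Type*} (G : SimpleGraph V) (C : Set V) : Prop :=
  G.IsClique C ∧
    ∀ u v : (Cᶜ : Set V), (G.induce Cᶜ).Reachable u v → u ≠ v → (G.induce Cᶜ).Adj u v

def IsUnipolar {V : Type*} (G : SimpleGraph V) : Prop :=
  ∃ C : Set V, IsUnipolarArrangement G C

def IsCoUnipolar {V : Type*} (G : SimpleGraph V) : Prop := IsUnipolar Gᶜ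

def IsGenSplit {V : Type*} (G : SimpleGraph V) : Prop := IsUnipolar G ∨ IsCoUnipolar G

/-- the `m`-th Bell number: the number of partitions of an `m`-element set. -/
def bell (m : ℕ) : ℕ := Nat.card (Finpartition (Finset.univ : Finset (Fin m)))

/-- `ℓ_{n,k} = C(n,k) · 2^{k(n-k)} · B_{n-k}` -/
def ell (n k : ℕ) : ℕ := Nat.choose n k * 2 ^ (k * (n - k)) * bell (n - k)

/-- `𝓛_n = Σ_{k=0}^n ℓ_{n,k}` -/
def scrL (n : ℕ) : ℕ := ∑ k ∈ Finset.range (n + 1), ell n k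

/-- the number of perfect graphs on `{1,…,n}` -/
def perfectCount (n : ℕ) : ℕ := Nat.card {G : SimpleGraph (Fin n) // IsPerfect G}

/-- independence number -/
def indepNum {V : Type*} (G : SimpleGraph V) : ℕ := Gᶜ.cliqueNum

/-- the probability that a uniformly random perfect graph on `{1,…,n}` is Hamiltonian -/
def hamProb (n : ℕ) : ℝ :=
  (Nat.card {G : SimpleGraph (Fin n) // IsPerfect G ∧ G.IsHamiltonian} : ℝ) /
    (perfectCount n : ℝ)

set_option linter.unusedSectionVars false

/-- `x log₂ x`. -/
def ent (x : ℝ) : ℝ := x * Real.logb 2 x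

/-- The entropy, in bits, of splitting a set of size `a + b` into parts of sizes `a` and `b`. -/
def eta (a b : ℝ) : ℝ := ent (a + b) - ent a - ent b

lemma ent_zero : ent 0 = 0 := by simp [ent]

lemma eta_comm (a b : ℝ) : eta a b = eta b a := by
  unfold eta; rw [add_comm a b]; ring

lemma eta_zero_right (a : ℝ) : eta a 0 = 0 := by simp [eta, ent_zero]

lemma eta_zero_left (a : ℝ) : eta 0 a = 0 := by simp [eta, ent_zero]

lemma logTwo_pos : 0 < Real.log 2 := Real.log_pos (by norm_num)

lemma ent_gibbs {a s p : ℝ} (ha : 0 ≤ a) (hs : 0 < s) (hp : 0 < p) :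
    a * (Real.log s - Real.log a + Real.log p) ≤ s * p - a := by
  rcases ha.eq_or_lt with rfl | ha
  · simp; positivity
  · have h := Real.log_le_sub_one_of_pos (x := s * p / a) (by positivity)
    rw [Real.log_div (by positivity) (by positivity), Real.log_mul (by positivity) (by positivity)]
      at h
    have := mul_le_mul_of_nonneg_left h ha.le
    have e : a * (s * p / a - 1) = s * p - a := by field_simp
    linarith

lemma eta_gibbs {a b p q : ℝ} (ha : 0 ≤ a) (hb : 0 ≤ b) (hp : 0 < p) (hq : 0 < q)
    (hpq : p + q ≤ 1) : eta a b ≤ -(a * Real.logb 2 p) - b * Real.logb 2 q := by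
  rcases (add_nonneg ha hb).eq_or_lt with h | h
  · have ha' : a = 0 := by linarith
    have hb' : b = 0 := by linarith
    subst ha' hb'; simp [eta, ent_zero]
  · have h1 := ent_gibbs ha h hp
    have h2 := ent_gibbs hb h hq
    have h3 : (a + b) * p + (a + b) * q ≤ a + b := by nlinarith
    have h4 := logTwo_pos
    rw [← sub_nonneg]
    have : -(a * Real.logb 2 p) - b * Real.logb 2 q - eta a b =
      (-(a * (Real.log (a + b) - Real.log a + Real.log p)) -
        b * (Real.log (a + b) - Real.log b + Real.log q)) / Real.log 2 := by
      unfold eta ent Real.logb; field_simp; ring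
    rw [this]
    apply div_nonneg _ h4.le
    linarith

lemma eta_le_add {a b : ℝ} (ha : 0 ≤ a) (hb : 0 ≤ b) : eta a b ≤ a + b := by
  have := eta_gibbs (p := 1 / 2) (q := 1 / 2) ha hb (by norm_num) (by norm_num) (by norm_num)
  have h : Real.logb 2 (1 / 2) = -1 := by
    rw [one_div, Real.logb_inv, Real.logb_self_eq_one (by norm_num)]
  rw [h] at this; linarith

lemma eta_eq {a b : ℝ} (ha : 0 < a) (hb : 0 < b) :
    eta a b = -(a * Real.logb 2 (a / (a + b))) - b * Real.logb 2 (b / (a + b)) := by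
  rw [Real.logb_div (by positivity) (by positivity), Real.logb_div (by positivity) (by positivity)]
  unfold eta ent; ring

lemma eta_nonneg {a b : ℝ} (ha : 0 ≤ a) (hb : 0 ≤ b) : 0 ≤ eta a b := by
  rcases ha.eq_or_lt with rfl | ha
  · simp [eta_zero_left]
  rcases hb.eq_or_lt with rfl | hb
  · simp [eta_zero_right]
  rw [eta_eq ha hb]
  have h1 : Real.logb 2 (a / (a + b)) ≤ 0 :=
    Real.logb_nonpos (by norm_num) (by positivity) (by rw [div_le_one (by positivity)]; linarith)
  have h2 : Real.logb 2 (b / (a + b)) ≤ 0 :=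
    Real.logb_nonpos (by norm_num) (by positivity) (by rw [div_le_one (by positivity)]; linarith)
  nlinarith

lemma eta_superadd {a b c d : ℝ} (ha : 0 ≤ a) (hb : 0 ≤ b) (hc : 0 ≤ c) (hd : 0 ≤ d) :
    eta a b + eta c d ≤ eta (a + c) (b + d) := by
  rcases (add_nonneg ha hc).eq_or_lt with h | h
  · obtain rfl : a = 0 := by linarith
    obtain rfl : c = 0 := by linarith
    simp [eta_zero_left]
  rcases (add_nonneg hb hd).eq_or_lt with h' | h'
  · obtain rfl : b = 0 := by linarith
    obtain rfl : d = 0 := by linarith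
    simp [eta_zero_right]
  rw [eta_eq h h']
  have hp : 0 < (a + c) / ((a + c) + (b + d)) := by positivity
  have hq : 0 < (b + d) / ((a + c) + (b + d)) := by positivity
  have hpq : (a + c) / ((a + c) + (b + d)) + (b + d) / ((a + c) + (b + d)) ≤ 1 := by
    rw [← add_div, div_self (by positivity)]
  have h1 := eta_gibbs ha hb hp hq hpq
  have h2 := eta_gibbs hc hd hp hq hpq
  linarith

lemma eta_mono {a b c d : ℝ} (ha : 0 ≤ a) (hb : 0 ≤ b) (hac : a ≤ c) (hbd : b ≤ d) :
    eta a b ≤ eta c d := by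
  have h := eta_superadd ha hb (sub_nonneg.2 hac) (sub_nonneg.2 hbd)
  have h2 := eta_nonneg (sub_nonneg.2 hac) (sub_nonneg.2 hbd)
  simp only [add_sub_cancel] at h
  linarith

/-- A quadratic lower bound for the entropy of a split. -/
lemma eta_quadratic {a b : ℝ} (ha : 0 ≤ a) (hb : 0 ≤ b) : a * b / (a + b) ≤ eta a b := by
  rcases ha.eq_or_lt with rfl | ha
  · simp [eta_zero_left]
  rcases hb.eq_or_lt with rfl | hb
  · simp [eta_zero_right]
  rw [eta_eq ha hb]
  have h0 : Real.logb 2 (b / (a + b)) ≤ 0 :=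
    Real.logb_nonpos (by norm_num) (by positivity) (by rw [div_le_one (by positivity)]; linarith)
  have h1 : Real.logb 2 (a / (a + b)) ≤ a / (a + b) - 1 := by
    have h2 := Real.log_le_sub_one_of_pos (x := a / (a + b)) (by positivity)
    have h3 : a / (a + b) - 1 ≤ 0 := by
      rw [sub_nonpos, div_le_one (by positivity)]; linarith
    unfold Real.logb
    rw [div_le_iff₀ logTwo_pos]
    have : Real.log 2 ≤ 1 := by linarith [Real.log_two_lt_d9]
    nlinarith
  have : a * (a / (a + b) - 1) = - (a * b / (a + b)) := by field_simp; ring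
  nlinarith

/-- An unbalanced split has entropy bounded away from the maximum. -/
lemma eta_unbalanced {a b : ℝ} (ha : 0 ≤ a) (hb : 0 ≤ b) (h : a ≤ (a + b) / 4) :
    eta a b ≤ 9 / 10 * (a + b) := by
  have h1 := eta_gibbs (p := 1 / 4) (q := 3 / 4) ha hb (by norm_num) (by norm_num) (by norm_num)
  have h4 : Real.logb 2 (1 / 4) = -2 := by
    rw [show (1 / 4 : ℝ) = 2 ^ (-2 : ℝ) by
      rw [Real.rpow_neg (by norm_num)]; norm_num]
    exact Real.logb_rpow (by norm_num) (by norm_num)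
  have h3 : -(1 / 2 : ℝ) ≤ Real.logb 2 (3 / 4) := by
    rw [Real.le_logb_iff_rpow_le (by norm_num) (by norm_num), Real.rpow_neg (by norm_num),
      ← Real.sqrt_eq_rpow, inv_le_comm₀ (by positivity) (by norm_num)]
    rw [Real.le_sqrt (by norm_num) (by norm_num)]; norm_num
  have hx : Real.logb 2 (3 / 4) ≤ 0 := Real.logb_nonpos (by norm_num) (by norm_num) (by norm_num)
  rw [h4] at h1
  nlinarith

lemma eta_small {a b : ℝ} (ha : 0 ≤ a) (hb : 0 ≤ b) (j : ℕ) (hj : 1 ≤ j) :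
    eta a b ≤ j * a + 4 / 2 ^ j * b := by
  have hp : (0 : ℝ) < 1 / 2 ^ j := by positivity
  have hj2 : (2 : ℝ) ≤ 2 ^ j := by
    calc (2 : ℝ) = 2 ^ 1 := by norm_num
      _ ≤ 2 ^ j := pow_le_pow_right₀ (by norm_num) hj
  have hp2 : 1 / (2 : ℝ) ^ j ≤ 1 / 2 := one_div_le_one_div_of_le (by norm_num) hj2
  have h1 := eta_gibbs (p := 1 / 2 ^ j) (q := 1 - 1 / 2 ^ j) ha hb hp (by linarith) (by linarith)
  have h4 : Real.logb 2 (1 / 2 ^ j) = -j := by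
    rw [one_div, Real.logb_inv, Real.logb_pow, Real.logb_self_eq_one (by norm_num)]; ring
  have h5 : -(4 / 2 ^ j) ≤ Real.logb 2 (1 - 1 / 2 ^ j) := by
    set p : ℝ := 1 / 2 ^ j with hpdef
    have e : (4 : ℝ) / 2 ^ j = 4 * p := by rw [hpdef]; ring
    rw [e]
    have h6 := Real.one_sub_inv_le_log_of_pos (x := 1 - p) (by linarith)
    have h7 : -(2 * p) ≤ 1 - (1 - p)⁻¹ := by
      have : (1 - p)⁻¹ ≤ 1 + 2 * p := by
        rw [inv_le_iff_one_le_mul₀ (by linarith)]; nlinarith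
      linarith
    unfold Real.logb
    rw [le_div_iff₀ logTwo_pos]
    have := Real.log_two_gt_d9
    nlinarith
  rw [h4] at h1
  nlinarith

lemma choose_le_two_rpow_eta (a b : ℕ) :
    ((a + b).choose a : ℝ) ≤ (2 : ℝ) ^ (eta a b) := by
  rcases Nat.eq_zero_or_pos a with rfl | ha
  · simp [eta_zero_left]
  rcases Nat.eq_zero_or_pos b with rfl | hb
  · simp [eta_zero_right]
  have ha' : (0 : ℝ) < a := by exact_mod_cast ha
  have hb' : (0 : ℝ) < b := by exact_mod_cast hb
  have key : ((a + b).choose a : ℝ) * ((a : ℝ) ^ a * (b : ℝ) ^ b) ≤ ((a : ℝ) + b) ^ (a + b) := by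
    have h := add_pow (a : ℝ) b (a + b)
    rw [h]
    have := Finset.single_le_sum (f := fun m => (a : ℝ) ^ m * (b : ℝ) ^ (a + b - m) *
      ((a + b).choose m : ℝ)) (s := Finset.range (a + b + 1)) (fun i _ => by positivity)
      (show a ∈ Finset.range (a + b + 1) by simp)
    simp only [Nat.add_sub_cancel_left] at this
    linarith
  have e : ∀ m : ℕ, 0 < m → (m : ℝ) ^ m = (2 : ℝ) ^ ent m := by
    intro m hm
    have hm' : (0 : ℝ) < m := by exact_mod_cast hm
    rw [ent, mul_comm, Real.rpow_mul (by norm_num), Real.rpow_logb (by norm_num) (by norm_num) hm',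
      Real.rpow_natCast]
  have e3 := e (a + b) (by omega)
  push_cast at e3
  rw [e a ha, e b hb, e3] at key
  unfold eta
  rw [Real.rpow_sub (by norm_num), Real.rpow_sub (by norm_num), div_div, le_div_iff₀ (by positivity)]
  exact key

section Entropy

variable {V : Type*} [DecidableEq V]

/-- The trace of `v` on `R`. -/
def tr (r : V → V → Prop) (R : Finset V) (v : V) : Finset V := R.filter fun u => r v u

/-- The members of `A` with trace `T` on `R`. -/
def cell (r : V → V → Prop) (A R T : Finset V) : Finset V := A.filter fun v => tr r R v = T

/-- The information on the position of a member of `A` in its `R`-cell that `x` reveals. -/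
def inc (r : V → V → Prop) (A R : Finset V) (x : V) : ℝ :=
  ∑ T ∈ R.powerset, eta ((cell r A R T).filter fun v => r v x).card
    ((cell r A R T).filter fun v => ¬ r v x).card

/-- The unnormalised entropy of the trace on `S` of a random member of `A`. -/
def jnt (r : V → V → Prop) (A S : Finset V) : ℝ :=
  ent A.card - ∑ T ∈ S.powerset, ent (cell r A S T).card

/-- `A` is determined by the trace on `R`. -/
def Det (r : V → V → Prop) (R A : Finset V) : Prop :=
  ∀ u v, tr r R u = tr r R v → u ∈ A → v ∈ A

variable {r : V → V → Prop} {A B R S T : Finset V} {x : V}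

lemma tr_subset (v : V) : tr r R v ⊆ R := Finset.filter_subset _ _

lemma mem_tr {u v : V} : u ∈ tr r R v ↔ u ∈ R ∧ r v u := Finset.mem_filter

lemma tr_inter (h : R ⊆ S) (v : V) : tr r R v = tr r S v ∩ R := by
  ext u; simp only [mem_tr, Finset.mem_inter]; constructor
  · exact fun ⟨a, b⟩ => ⟨⟨h a, b⟩, a⟩
  · exact fun ⟨⟨_, b⟩, a⟩ => ⟨a, b⟩

lemma Det.mono (h : Det r R A) (hRS : R ⊆ S) : Det r S A := by
  intro u v huv
  exact h u v (by rw [tr_inter hRS, tr_inter hRS, huv])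

lemma Det.union (h : Det r R A) (h' : Det r R B) : Det r R (A ∪ B) := by
  intro u v huv hu
  rw [Finset.mem_union] at *
  exact hu.imp (h u v huv) (h' u v huv)

lemma mem_cell {v : V} : v ∈ cell r A R T ↔ v ∈ A ∧ tr r R v = T := Finset.mem_filter

lemma sum_card_cell (r : V → V → Prop) (A R : Finset V) :
    ∑ T ∈ R.powerset, (cell r A R T).card = A.card :=
  (Finset.card_eq_sum_card_fiberwise
    (fun v _ => Finset.mem_coe.2 (Finset.mem_powerset.2 (tr_subset v)))).symm

lemma sum_card_cell_real (r : V → V → Prop) (A R : Finset V) :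
    ∑ T ∈ R.powerset, ((cell r A R T).card : ℝ) = A.card := by
  exact_mod_cast sum_card_cell r A R

lemma cell_insert_left (hx : x ∉ R) (hT : T ⊆ R) :
    cell r A (insert x R) T = (cell r A R T).filter fun v => ¬ r v x := by
  have hxT : x ∉ T := fun h => hx (hT h)
  ext v
  simp only [mem_cell, Finset.mem_filter, tr, Finset.filter_insert]
  by_cases h : r v x
  · simp only [h, if_true, not_true, and_false, iff_false, not_and]
    rintro _ rfl
    exact hxT (Finset.mem_insert_self _ _)
  · simp [h]

lemma cell_insert_right (hx : x ∉ R) (hT : T ⊆ R) :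
    cell r A (insert x R) (insert x T) = (cell r A R T).filter fun v => r v x := by
  have hxT : x ∉ T := fun h => hx (hT h)
  ext v
  simp only [mem_cell, Finset.mem_filter, tr, Finset.filter_insert]
  by_cases h : r v x
  · simp only [h, if_true, and_true, and_congr_right_iff]
    intro _
    constructor
    · intro e
      have := congrArg (fun s => s.erase x) e
      simpa [Finset.erase_insert, hxT, hx] using this
    · rintro rfl; rfl
  · simp only [h, if_false, and_false, iff_false, not_and]
    intro _ e
    have : x ∈ R.filter fun u => r v u := by rw [e]; exact Finset.mem_insert_self _ _
    exact hx (Finset.mem_filter.1 this).1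

lemma card_filter_split (A : Finset V) (p : V → Prop) [DecidablePred p] :
    ((A.filter p).card : ℝ) + (A.filter fun v => ¬ p v).card = A.card := by
  exact_mod_cast Finset.card_filter_add_card_filter_not p

lemma inc_le_card : inc r A R x ≤ A.card := by
  rw [← sum_card_cell_real r A R]
  refine Finset.sum_le_sum fun T _ => ?_
  rw [← card_filter_split (cell r A R T) (fun v => r v x)]
  exact eta_le_add (Nat.cast_nonneg _) (Nat.cast_nonneg _)

lemma inc_mono (h : A ⊆ B) : inc r A R x ≤ inc r B R x := by
  refine Finset.sum_le_sum fun T _ => ?_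
  refine eta_mono (Nat.cast_nonneg _) (Nat.cast_nonneg _) ?_ ?_ <;>
  exact Nat.cast_le.2 (Finset.card_le_card
    (Finset.filter_subset_filter _ (Finset.filter_subset_filter _ h)))

lemma inc_union_of_det (hA : Det r R A) (hAB : Disjoint A B) :
    inc r (A ∪ B) R x = inc r A R x + inc r B R x := by
  unfold inc
  rw [← Finset.sum_add_distrib]
  refine Finset.sum_congr rfl fun T _ => ?_
  by_cases h : (cell r A R T).Nonempty
  · obtain ⟨u, hu⟩ := h
    have hB : cell r B R T = ∅ := by
      rw [Finset.eq_empty_iff_forall_notMem]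
      intro v hv
      have := hA u v ((mem_cell.1 hu).2.trans (mem_cell.1 hv).2.symm) (mem_cell.1 hu).1
      exact Finset.disjoint_left.1 hAB this (mem_cell.1 hv).1
    have : cell r (A ∪ B) R T = cell r A R T ∪ cell r B R T := Finset.filter_union _ _ _
    rw [this, hB]; simp [eta_zero_right]
  · rw [Finset.not_nonempty_iff_eq_empty] at h
    have : cell r (A ∪ B) R T = cell r A R T ∪ cell r B R T := Finset.filter_union _ _ _
    rw [this, h]; simp [eta_zero_right]

lemma card_filter_filter_split (A : Finset V) (p q : V → Prop) [DecidablePred p]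
    [DecidablePred q] :
    (((A.filter fun v => ¬ q v).filter p).card : ℝ) + ((A.filter q).filter p).card =
      (A.filter p).card := by
  rw [Finset.filter_comm, Finset.filter_comm q p, add_comm, card_filter_split]

lemma inc_insert_le {y : V} (hy : y ∉ R) : inc r A (insert y R) x ≤ inc r A R x := by
  unfold inc
  rw [Finset.sum_powerset_insert hy, ← Finset.sum_add_distrib]
  refine Finset.sum_le_sum fun T hT => ?_
  rw [Finset.mem_powerset] at hT
  rw [cell_insert_left hy hT, cell_insert_right hy hT]
  refine (eta_superadd (Nat.cast_nonneg _) (Nat.cast_nonneg _) (Nat.cast_nonneg _)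
    (Nat.cast_nonneg _)).trans (le_of_eq ?_)
  rw [card_filter_filter_split, card_filter_filter_split]

lemma inc_union_le (S : Finset V) : inc r A (S ∪ R) x ≤ inc r A R x := by
  induction S using Finset.induction_on with
  | empty => simp
  | insert y S hy ih =>
    rw [Finset.insert_union]
    by_cases h : y ∈ S ∪ R
    · rwa [Finset.insert_eq_of_mem h]
    · exact (inc_insert_le h).trans ih

lemma inc_anti (h : R ⊆ S) : inc r A S x ≤ inc r A R x := by
  have := inc_union_le (r := r) (A := A) (R := R) (x := x) S
  rwa [Finset.union_eq_left.2 h] at this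

lemma inc_not (r : V → V → Prop) (A R : Finset V) (x : V) :
    inc (fun u v => ¬ r u v) A R x = inc r A R x := by
  unfold inc
  refine Finset.sum_bij' (fun T _ => R \ T) (fun T _ => R \ T) ?_ ?_ ?_ ?_ ?_
  · intro T _; exact Finset.mem_powerset.2 Finset.sdiff_subset
  · intro T _; exact Finset.mem_powerset.2 Finset.sdiff_subset
  · intro T hT; exact Finset.sdiff_sdiff_eq_self (Finset.mem_powerset.1 hT)
  · intro T hT; exact Finset.sdiff_sdiff_eq_self (Finset.mem_powerset.1 hT)
  · intro T hT
    have : cell (fun u v => ¬ r u v) A R T = cell r A R (R \ T) := by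
      ext v
      simp only [mem_cell, and_congr_right_iff]
      intro _
      have e : tr (fun u v => ¬ r u v) R v = R \ tr r R v := by
        ext u; simp only [tr, Finset.mem_filter, Finset.mem_sdiff]; tauto
      rw [e]
      constructor
      · rintro rfl; exact (Finset.sdiff_sdiff_eq_self (tr_subset v)).symm
      · intro h; rw [h]; exact Finset.sdiff_sdiff_eq_self (Finset.mem_powerset.1 hT)
    rw [this, eta_comm]
    simp only [not_not]

lemma jnt_empty : jnt r A ∅ = 0 := by
  simp [jnt, cell, tr]

lemma jnt_insert (hx : x ∉ S) : jnt r A (insert x S) = jnt r A S + inc r A S x := by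
  unfold jnt inc
  rw [Finset.sum_powerset_insert hx, ← Finset.sum_add_distrib, sub_add, ← Finset.sum_sub_distrib]
  congr 1
  refine Finset.sum_congr rfl fun T hT => ?_
  rw [Finset.mem_powerset] at hT
  rw [cell_insert_left hx hT, cell_insert_right hx hT, eta, card_filter_split]
  ring

lemma jnt_union_le (hAB : Disjoint A B) :
    jnt r (A ∪ B) S ≤ jnt r A S + jnt r B S + (A ∪ B).card := by
  unfold jnt
  have h1 : ent (A ∪ B).card ≤ ent A.card + ent B.card + (A ∪ B).card := by
    have := eta_le_add (Nat.cast_nonneg (α := ℝ) A.card) (Nat.cast_nonneg B.card)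
    rw [Finset.card_union_of_disjoint hAB]
    push_cast
    unfold eta at this; linarith
  have h2 : ∑ T ∈ S.powerset, ent (cell r A S T).card + ∑ T ∈ S.powerset, ent (cell r B S T).card ≤
      ∑ T ∈ S.powerset, ent (cell r (A ∪ B) S T).card := by
    rw [← Finset.sum_add_distrib]
    refine Finset.sum_le_sum fun T _ => ?_
    have := eta_nonneg (Nat.cast_nonneg (α := ℝ) (cell r A S T).card)
      (Nat.cast_nonneg (cell r B S T).card)
    have e : cell r (A ∪ B) S T = cell r A S T ∪ cell r B S T := Finset.filter_union _ _ _
    have hd : Disjoint (cell r A S T) (cell r B S T) := Finset.disjoint_filter_filter hAB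
    rw [e, Finset.card_union_of_disjoint hd]
    push_cast
    unfold eta at this; linarith
  linarith

lemma jnt_le_log (t : ℝ) (ht : ((A.image (tr r S)).card : ℝ) ≤ t) (ht0 : 0 < t) :
    jnt r A S ≤ A.card * Real.logb 2 t := by
  have e : ∑ T ∈ S.powerset, ent (cell r A S T).card =
      ∑ T ∈ A.image (tr r S), ent (cell r A S T).card := by
    symm
    apply Finset.sum_subset
    · intro T hT
      obtain ⟨v, _, rfl⟩ := Finset.mem_image.1 hT
      exact Finset.mem_powerset.2 (tr_subset v)
    · intro T _ hT
      have : cell r A S T = ∅ := by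
        rw [Finset.eq_empty_iff_forall_notMem]
        intro v hv
        exact hT (Finset.mem_image.2 ⟨v, (mem_cell.1 hv).1, (mem_cell.1 hv).2⟩)
      simp [this, ent_zero]
  have hcard : ∑ T ∈ A.image (tr r S), ((cell r A S T).card : ℝ) = A.card := by
    have := Finset.card_eq_sum_card_fiberwise (f := tr r S) (s := A) (t := A.image (tr r S))
      (fun v hv => Finset.mem_coe.2 (Finset.mem_image_of_mem _ hv))
    exact_mod_cast this.symm
  unfold jnt
  rw [e]
  rcases Nat.eq_zero_or_pos A.card with h0 | h0
  · rw [Finset.card_eq_zero] at h0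
    subst h0; simp [ent_zero]
  have h0' : (0 : ℝ) < A.card := by exact_mod_cast h0
  have key : ∑ T ∈ A.image (tr r S), ((cell r A S T).card : ℝ) *
      (Real.log A.card - Real.log (cell r A S T).card + Real.log (1 / t)) ≤ 0 := by
    calc _ ≤ ∑ T ∈ A.image (tr r S), ((A.card : ℝ) * (1 / t) - (cell r A S T).card) :=
          Finset.sum_le_sum fun T _ => ent_gibbs (Nat.cast_nonneg _) h0' (by positivity)
      _ = (A.image (tr r S)).card * ((A.card : ℝ) * (1 / t)) - A.card := by
          rw [Finset.sum_sub_distrib, hcard]; simp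
      _ ≤ t * ((A.card : ℝ) * (1 / t)) - A.card := by gcongr
      _ = 0 := by field_simp; ring
  have h5 : ∑ T ∈ A.image (tr r S), ((cell r A S T).card : ℝ) *
      (Real.log A.card - Real.log (cell r A S T).card + Real.log (1 / t)) =
      A.card * Real.log A.card - A.card * Real.log t -
      ∑ T ∈ A.image (tr r S), ((cell r A S T).card : ℝ) * Real.log (cell r A S T).card := by
    have : ∀ T, ((cell r A S T).card : ℝ) *
      (Real.log A.card - Real.log (cell r A S T).card + Real.log (1 / t)) =
      ((cell r A S T).card : ℝ) * (Real.log A.card - Real.log t) -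
      (cell r A S T).card * Real.log (cell r A S T).card := by
      intro T; rw [one_div, Real.log_inv]; ring
    simp only [this]
    rw [Finset.sum_sub_distrib, ← Finset.sum_mul, hcard]; ring
  have h6 : ent A.card - ∑ T ∈ A.image (tr r S), ent (cell r A S T).card - A.card * Real.logb 2 t =
      (∑ T ∈ A.image (tr r S), ((cell r A S T).card : ℝ) *
      (Real.log A.card - Real.log (cell r A S T).card + Real.log (1 / t))) / Real.log 2 := by
    rw [h5]
    unfold ent Real.logb
    simp only [← mul_div_assoc]
    rw [← Finset.sum_div]
    ring
  have := div_nonpos_of_nonpos_of_nonneg key logTwo_pos.le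
  linarith

lemma jnt_le_card_mul : jnt r A S ≤ A.card * S.card := by
  have h : ((A.image (tr r S)).card : ℝ) ≤ 2 ^ S.card := by
    have : (A.image (tr r S)).card ≤ S.powerset.card :=
      Finset.card_le_card (Finset.image_subset_iff.2 fun v _ => Finset.mem_powerset.2 (tr_subset v))
    rw [Finset.card_powerset] at this
    exact_mod_cast this
  have := jnt_le_log _ h (by positivity)
  rwa [Real.logb_pow, Real.logb_self_eq_one (by norm_num), mul_one] at this

lemma jnt_lower {c : ℝ} (h : ∀ R ⊆ S, ∀ x ∈ S, x ∉ R → c ≤ inc r A R x) :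
    c * S.card ≤ jnt r A S := by
  induction S using Finset.induction_on with
  | empty => simp [jnt_empty]
  | insert x S hx ih =>
    rw [jnt_insert hx, Finset.card_insert_of_notMem hx]
    have h1 := ih fun R hR y hy hyR =>
      h R (hR.trans (Finset.subset_insert _ _)) y (Finset.mem_insert_of_mem hy) hyR
    have h2 := h S (Finset.subset_insert _ _) x (Finset.mem_insert_self _ _) hx
    push_cast; linarith

/-- Along a chain of vertices each revealing much information, every subset reveals much. -/
lemma jnt_chain {c : ℝ} {L : ℕ} (v : ℕ → V) (hv : Set.InjOn v (Finset.range L))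
    (h : ∀ i < L, c ≤ inc r A (R ∪ (Finset.range i).image v) (v i)) (I : Finset ℕ)
    (hI : I ⊆ Finset.range L) : c * (I.image v).card ≤ jnt r A (I.image v) := by
  induction I using Finset.induction_on_max with
  | empty => simp [jnt_empty]
  | insert i I hi ih =>
    have hI' : I ⊆ Finset.range L := (Finset.subset_insert _ _).trans hI
    have hiL : i ∈ Finset.range L := hI (Finset.mem_insert_self _ _)
    have hni : v i ∉ I.image v := by
      intro hc
      obtain ⟨j, hj, e⟩ := Finset.mem_image.1 hc
      have := hv (Finset.mem_coe.2 (hI' hj)) (Finset.mem_coe.2 hiL) e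
      exact (hi j hj).ne this
    rw [Finset.image_insert, jnt_insert hni, Finset.card_insert_of_notMem hni]
    have h1 := ih hI'
    have h2 := h i (Finset.mem_range.1 hiL)
    have h3 : inc r A (R ∪ (Finset.range i).image v) (v i) ≤ inc r A (I.image v) (v i) := by
      apply inc_anti
      refine Finset.Subset.trans ?_ Finset.subset_union_right
      exact Finset.image_subset_image fun j hj => Finset.mem_range.2 (hi j hj)
    push_cast; linarith

end Entropy

section Config

variable {V : Type*} [DecidableEq V]

/-- `r` has no induced pentagon. -/
def NoC5 (r : V → V → Prop) : Prop :=
  ∀ a b c d e, r a b → r b c → r c d → r d e → r e a →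
    ¬ r a c → ¬ r a d → ¬ r b d → ¬ r b e → ¬ r c e → False

/-- `X` is a clique or a stable set. -/
def Hom (r : V → V → Prop) (X : Finset V) : Prop :=
  (∀ x ∈ X, ∀ y ∈ X, x ≠ y → r x y) ∨ (∀ x ∈ X, ∀ y ∈ X, x ≠ y → ¬ r x y)

/-- Every set of `s²` vertices contains a homogeneous set of size `s`. -/
def Ram (r : V → V → Prop) : Prop :=
  ∀ (A : Finset V) (s : ℕ), s ^ 2 ≤ A.card → ∃ X ⊆ A, X.card = s ∧ Hom r X

/-- Every pattern appears between any two pairs of sequences of length `q`. -/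
def PStar {α β : Type*} (q : ℕ) (r : α → β → Prop) (X : Set α) (Y : Set β) : Prop :=
  ∀ (a a' : Fin q → α) (b b' : Fin q → β), (∀ i, a i ∈ X) → (∀ i, a' i ∈ X) → (∀ i, b i ∈ Y) →
    (∀ i, b' i ∈ Y) → a.Injective → a'.Injective → b.Injective → b'.Injective →
    (∀ i j, a i ≠ a' j) → (∀ i j, b i ≠ b' j) → ∀ p₁ p₂ p₃ p₄ : Bool, ∃ i j,
      (r (a i) (b j) ↔ p₁) ∧ (r (a i) (b' j) ↔ p₂) ∧ (r (a' i) (b j) ↔ p₃) ∧ (r (a' i) (b' j) ↔ p₄)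

/-- The vertices with many neighbours and many non-neighbours in `X`. -/
def dset [Fintype V] (r : V → V → Prop) (q : ℕ) (X : Finset V) : Finset V :=
  Finset.univ.filter fun z =>
    q + 1 ≤ (X.filter fun x => r z x).card ∧ q + 1 ≤ (X.filter fun x => ¬ r z x).card

variable {r : V → V → Prop} {A B R S T X Y Z : Finset V} {x : V}

lemma NoC5.not (hsym : ∀ ⦃u v⦄, r u v → r v u) (h : NoC5 r) : NoC5 (fun u v => ¬ r u v) := by
  intro a b c d e h1 h2 h3 h4 h5 h6 h7 h8 h9 h10
  simp only [not_not] at h6 h7 h8 h9 h10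
  refine h a c e b d h6 h10 (hsym h9) h8 (hsym h7) ?_ h1 (fun h => h2 (hsym h)) h3
    (fun h => h4 (hsym h))
  exact fun h => h5 (hsym h)

lemma Hom.mono (h : Hom r X) (hY : Y ⊆ X) : Hom r Y :=
  h.imp (fun h x hx y hy => h x (hY hx) y (hY hy)) (fun h x hx y hy => h x (hY hx) y (hY hy))

lemma PStar.mono {α β : Type*} {q : ℕ} {r : α → β → Prop} {X X' : Set α} {Y Y' : Set β}
    (h : PStar q r X Y) (hX : X' ⊆ X) (hY : Y' ⊆ Y) : PStar q r X' Y' :=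
  fun a a' b b' ha ha' hb hb' => h a a' b b' (fun i => hX (ha i)) (fun i => hX (ha' i))
    (fun i => hY (hb i)) (fun i => hY (hb' i))

lemma PStar.transfer {α β γ ε : Type*} {q : ℕ} {r : α → β → Prop} {s : γ → ε → Prop}
    {I : Set α} {J : Set β} (h : PStar q r I J) {c : α → γ} {y : β → ε}
    (hcy : ∀ i j, s (c i) (y j) ↔ r i j) : PStar q s (c '' I) (y '' J) := by
  intro a a' b b' ha ha' hb hb' ia ia' ib ib' haa hbb p₁ p₂ p₃ p₄
  choose fa hfa ea using ha
  choose fa' hfa' ea' using ha'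
  choose fb hfb eb using hb
  choose fb' hfb' eb' using hb'
  obtain ⟨i, j, h1, h2, h3, h4⟩ := h fa fa' fb fb' hfa hfa' hfb hfb'
    (fun i j e => ia (by rw [← ea, ← ea, e])) (fun i j e => ia' (by rw [← ea', ← ea', e]))
    (fun i j e => ib (by rw [← eb, ← eb, e])) (fun i j e => ib' (by rw [← eb', ← eb', e]))
    (fun i j e => haa i j (by rw [← ea, ← ea', e])) (fun i j e => hbb i j (by rw [← eb, ← eb', e]))
    p₁ p₂ p₃ p₄
  refine ⟨i, j, ?_, ?_, ?_, ?_⟩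
  · rw [← ea, ← eb, hcy]; exact h1
  · rw [← ea, ← eb', hcy]; exact h2
  · rw [← ea', ← eb, hcy]; exact h3
  · rw [← ea', ← eb', hcy]; exact h4

lemma exists_two_sequences {q : ℕ} (h : 2 * q ≤ S.card) : ∃ a a' : Fin q → V,
    (∀ i, a i ∈ S) ∧ (∀ i, a' i ∈ S) ∧ a.Injective ∧ a'.Injective ∧ ∀ i j, a i ≠ a' j := by
  have hc : Fintype.card (Fin (q + q)) ≤ Fintype.card S := by simp; omega
  obtain ⟨f⟩ := Function.Embedding.nonempty_of_card_le hc
  refine ⟨fun i => f (Fin.castAdd q i), fun i => f (Fin.natAdd q i), fun i => (f _).2,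
    fun i => (f _).2, ?_, ?_, ?_⟩
  · intro i j e
    exact Fin.castAdd_injective _ _ (f.injective (Subtype.ext e))
  · intro i j e
    have := f.injective (Subtype.ext e)
    exact Fin.natAdd_injective _ _ this
  · intro i j e
    have := f.injective (Subtype.ext e)
    have := congrArg Fin.val this
    simp at this
    omega

variable [Fintype V]

lemma mem_dset {q : ℕ} {z : V} : z ∈ dset r q X ↔
    q + 1 ≤ (X.filter fun x => r z x).card ∧ q + 1 ≤ (X.filter fun x => ¬ r z x).card := by
  simp [dset]

lemma dset_mono {q : ℕ} (h : X ⊆ Y) : dset r q X ⊆ dset r q Y := by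
  intro z hz
  rw [mem_dset] at *
  exact ⟨hz.1.trans (Finset.card_le_card (Finset.filter_subset_filter _ h)),
    hz.2.trans (Finset.card_le_card (Finset.filter_subset_filter _ h))⟩

lemma dset_det {q : ℕ} : Det r X (dset r q X) := by
  intro u v h hu
  have hneg : (X.filter fun x => ¬ r u x) = X.filter fun x => ¬ r v x := by
    rw [Finset.filter_not, Finset.filter_not]
    exact congrArg _ h
  rw [mem_dset] at *
  unfold tr at h
  rwa [← h, ← hneg]

/-- Two homogeneous sets with all patterns between them are not split by a common vertex. -/
lemma disjoint_dset (hsym : ∀ ⦃u v⦄, r u v → r v u) (h5 : NoC5 r) {q : ℕ} (hX : Hom r X) (hY : Hom r Y)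
    (hP : PStar q r X Y) : Disjoint (dset r (2 * q) X) (dset r (2 * q) Y) := by
  rw [Finset.disjoint_left]
  intro z hzX hzY
  rw [mem_dset] at hzX hzY
  have key : ∀ (W : Finset V) (p : V → Prop) [DecidablePred p], 2 * q + 1 ≤ (W.filter p).card →
      ∃ a a' : Fin q → V,
    (∀ i, a i ∈ W ∧ p (a i)) ∧ (∀ i, a' i ∈ W ∧ p (a' i)) ∧
    a.Injective ∧ a'.Injective ∧ ∀ i j, a i ≠ a' j := by
    intro W p _ h
    obtain ⟨a, a', h1, h2, h3⟩ := exists_two_sequences (V := V) (S := W.filter p) (q := q)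
      (by omega)
    exact ⟨a, a', fun i => by simpa using h1 i, fun i => by simpa using h2 i, h3⟩
  obtain ⟨a, a', ha, ha', ia, ia', haa⟩ := key X _ hzX.1
  obtain ⟨c, c', hc, hc', ic, ic', hcc⟩ := key X _ hzX.2
  obtain ⟨b, b', hb, hb', ib, ib', hbb⟩ := key Y _ hzY.1
  obtain ⟨d, d', hd, hd', id, id', hdd⟩ := key Y _ hzY.2
  rcases hX with hX | hX <;> rcases hY with hY | hY
  · obtain ⟨i, j, h1, h2, h3, h4⟩ := hP a c b d (fun i => (ha i).1) (fun i => (hc i).1)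
      (fun i => (hb i).1) (fun i => (hd i).1) ia ic ib id
      (fun i j e => (hc j).2 (e ▸ (ha i).2)) (fun i j e => (hd j).2 (e ▸ (hb i).2))
      false false false true
    simp only [Bool.false_eq_true, iff_false, iff_true] at h1 h2 h3 h4
    exact h5 z (a i) (c i) (d j) (b j) (ha i).2
      (hX _ (ha i).1 _ (hc i).1 (fun e => (hc i).2 (e ▸ (ha i).2))) h4
      (hY _ (hd j).1 _ (hb j).1 (fun e => (hd j).2 (e ▸ (hb j).2))) (hsym (hb j).2)
      (hc i).2 (hd j).2 h2 h1 h3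
  · obtain ⟨i, j, h1, h2, h3, h4⟩ := hP c c' b b' (fun i => (hc i).1) (fun i => (hc' i).1)
      (fun i => (hb i).1) (fun i => (hb' i).1) ic ic' ib ib' hcc hbb true false false true
    simp only [Bool.false_eq_true, iff_false, iff_true] at h1 h2 h3 h4
    exact h5 z (b j) (c i) (c' i) (b' j) (hb j).2 (hsym h1)
      (hX _ (hc i).1 _ (hc' i).1 (hcc i i)) h4 (hsym (hb' j).2)
      (hc i).2 (hc' i).2 (fun h => h3 (hsym h)) (hY _ (hb j).1 _ (hb' j).1 (hbb j j)) h2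
  · obtain ⟨i, j, h1, h2, h3, h4⟩ := hP a a' d d' (fun i => (ha i).1) (fun i => (ha' i).1)
      (fun i => (hd i).1) (fun i => (hd' i).1) ia ia' id id' haa hdd true false false true
    simp only [Bool.false_eq_true, iff_false, iff_true] at h1 h2 h3 h4
    exact h5 z (a i) (d j) (d' j) (a' i) (ha i).2 h1
      (hY _ (hd j).1 _ (hd' j).1 (hdd j j)) (hsym h4) (hsym (ha' i).2)
      (hd j).2 (hd' j).2 h2 (hX _ (ha i).1 _ (ha' i).1 (haa i i)) (fun h => h3 (hsym h))
  · obtain ⟨i, j, h1, h2, h3, h4⟩ := hP a c b d (fun i => (ha i).1) (fun i => (hc i).1)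
      (fun i => (hb i).1) (fun i => (hd i).1) ia ic ib id
      (fun i j e => (hc j).2 (e ▸ (ha i).2)) (fun i j e => (hd j).2 (e ▸ (hb i).2))
      false true true true
    simp only [Bool.false_eq_true, iff_false, iff_true] at h1 h2 h3 h4
    exact h5 z (a i) (d j) (c i) (b j) (ha i).2 h2 (hsym h4) h3 (hsym (hb j).2)
      (hd j).2 (hc i).2 (hX _ (ha i).1 _ (hc i).1 (fun e => (hc i).2 (e ▸ (ha i).2))) h1
      (hY _ (hd j).1 _ (hb j).1 (fun e => (hd j).2 (e ▸ (hb j).2)))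

end Config

section Counting

lemma sum_choose_le_pow (k q : ℕ) : ∑ i ∈ Finset.range (q + 1), k.choose i ≤ (k + 1) ^ q := by
  induction q with
  | zero => simp
  | succ q ih =>
    rw [Finset.sum_range_succ]
    have h1 : k.choose (q + 1) ≤ k ^ (q + 1) := Nat.choose_le_pow _ _
    have h2 : k ^ (q + 1) ≤ k * (k + 1) ^ q := by
      rw [pow_succ, mul_comm]; gcongr; omega
    calc _ ≤ (k + 1) ^ q + k * (k + 1) ^ q := by omega
      _ = _ := by ring

lemma card_powerset_filter_card_le {V : Type*} (X : Finset V) (q : ℕ) :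
    (X.powerset.filter fun T => T.card ≤ q).card ≤ (X.card + 1) ^ q := by
  refine le_trans ?_ (sum_choose_le_pow X.card q)
  rw [Finset.card_eq_sum_card_fiberwise (f := Finset.card) (t := Finset.range (q + 1))
    (fun T hT => by
      have := (Finset.mem_filter.1 hT).2
      simpa using Nat.lt_succ_of_le this)]
  refine Finset.sum_le_sum fun i _ => ?_
  rw [← Finset.card_powersetCard]
  refine Finset.card_le_card fun T hT => ?_
  simp only [Finset.mem_filter, Finset.mem_powerset] at hT
  exact Finset.mem_powersetCard.2 ⟨hT.1.1, hT.2⟩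

/-- The number of maps avoiding a prescribed pattern on each of several disjoint blocks. -/
lemma card_avoid {α ι β : Type*} [Fintype α] [Fintype ι] [Fintype β] (e : ι × β → α)
    (he : e.Injective) (p : ι → β → Bool) :
    Nat.card {ω : α → Bool // ∀ i, ∃ t, ω (e (i, t)) ≠ p i t} *
      (2 ^ Fintype.card β) ^ Fintype.card ι ≤
    (2 ^ Fintype.card β - 1) ^ Fintype.card ι * 2 ^ Fintype.card α := by
  let F : {ω : α → Bool // ∀ i, ∃ t, ω (e (i, t)) ≠ p i t} →
      ((i : ι) → {f : β → Bool // f ≠ p i}) × ({x : α // x ∉ Set.range e} → Bool) :=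
    fun ω => (fun i => ⟨fun t => ω.1 (e (i, t)), fun h => by
      obtain ⟨t, ht⟩ := ω.2 i
      exact ht (congrFun h t)⟩, fun x => ω.1 x.1)
  have hF : F.Injective := by
    intro ω ω' h
    simp only [F, Prod.mk.injEq] at h
    ext x
    by_cases hx : x ∈ Set.range e
    · obtain ⟨⟨i, t⟩, rfl⟩ := hx
      have := congrArg Subtype.val (congrFun h.1 i)
      rw [congrFun this t]
    · rw [congrFun h.2 ⟨x, hx⟩]
  have h1 := Nat.card_le_card_of_injective F hF
  have h2 : Nat.card (((i : ι) → {f : β → Bool // f ≠ p i}) × ({x : α // x ∉ Set.range e} → Bool))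
      = (2 ^ Fintype.card β - 1) ^ Fintype.card ι *
        2 ^ (Fintype.card α - Fintype.card ι * Fintype.card β) := by
    rw [Nat.card_prod, Nat.card_pi]
    congr 1
    · rw [Finset.prod_congr rfl (fun i _ => ?_), Finset.prod_const, Finset.card_univ]
      rw [Nat.card_eq_fintype_card, Fintype.card_subtype_compl]
      simp
    · rw [Nat.card_eq_fintype_card, Fintype.card_fun, Fintype.card_bool,
        Fintype.card_subtype_compl]
      congr 2
      rw [← Fintype.card_prod]
      exact Fintype.card_congr (Equiv.ofInjective e he).symm
  have h3 : Fintype.card ι * Fintype.card β ≤ Fintype.card α := by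
    rw [← Fintype.card_prod]; exact Fintype.card_le_of_injective e he
  calc _ ≤ _ := Nat.mul_le_mul_right _ (h1.trans_eq h2)
    _ = _ := by
      rw [mul_assoc, ← pow_mul, ← pow_add, mul_comm (Fintype.card β), Nat.sub_add_cancel h3]

/-- Random bipartite graphs have all patterns. -/
lemma exists_pStar {q M : ℕ} (h : M ^ (4 * q) * 16 * 15 ^ (q ^ 2) < 16 ^ (q ^ 2)) :
    ∃ bip : Fin M → Fin M → Bool,
      PStar q (fun i j => bip i j = true) Set.univ Set.univ := by
  by_contra hcon
  push Not at hcon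
  let Q := (Fin q → Fin M) × (Fin q → Fin M) × (Fin q → Fin M) × (Fin q → Fin M)
  let P := Bool × Bool × Bool × Bool
  let good : Q → Prop := fun Q => Q.1.Injective ∧ Q.2.1.Injective ∧ Q.2.2.1.Injective ∧
    Q.2.2.2.Injective ∧ (∀ i j, Q.1 i ≠ Q.2.1 j) ∧ (∀ i j, Q.2.2.1 i ≠ Q.2.2.2 j)
  let cl : Q → (Fin q × Fin q) × (Bool × Bool) → Fin M × Fin M := fun Q t =>
    (if t.2.1 then Q.1 t.1.1 else Q.2.1 t.1.1, if t.2.2 then Q.2.2.1 t.1.2 else Q.2.2.2 t.1.2)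
  let pt : P → Bool × Bool → Bool := fun p t =>
    if t.1 then (if t.2 then p.1 else p.2.1) else (if t.2 then p.2.2.1 else p.2.2.2)
  let bad : Q × P → Finset (Fin M × Fin M → Bool) := fun z =>
    Finset.univ.filter fun ω => good z.1 ∧ ∀ ij, ∃ t, ω (cl z.1 (ij, t)) ≠ pt z.2 t
  have hbad : ∀ z, (bad z).card * 16 ^ (q ^ 2) ≤ 15 ^ (q ^ 2) * 2 ^ (M * M) := by
    intro z
    by_cases hg : good z.1
    · have hinj : (cl z.1).Injective := by
        rintro ⟨⟨i, j⟩, s, t⟩ ⟨⟨i', j'⟩, s', t'⟩ h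
        obtain ⟨g1, g2, g3, g4, g5, g6⟩ := hg
        simp only [cl, Prod.mk.injEq] at h
        obtain ⟨ha, hb⟩ := h
        have e1 : i = i' ∧ s = s' := by
          cases s <;> cases s' <;> simp at ha
          · exact ⟨g2 ha, rfl⟩
          · exact absurd ha.symm (g5 _ _)
          · exact absurd ha (g5 _ _)
          · exact ⟨g1 ha, rfl⟩
        have e2 : j = j' ∧ t = t' := by
          cases t <;> cases t' <;> simp at hb
          · exact ⟨g4 hb, rfl⟩
          · exact absurd hb.symm (g6 _ _)
          · exact absurd hb (g6 _ _)
          · exact ⟨g3 hb, rfl⟩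
        rw [e1.1, e1.2, e2.1, e2.2]
      have := card_avoid (cl z.1) hinj (fun _ => pt z.2)
      simp only [Fintype.card_prod, Fintype.card_bool, Fintype.card_fin,
        show 2 ^ (2 * 2) = 16 from rfl, show 16 - 1 = 15 from rfl] at this
      rw [pow_two]
      convert this using 2
      rw [Nat.card_eq_fintype_card, Fintype.card_subtype]
      simp [bad, hg]
    · have : bad z = ∅ := by simp [bad, hg]
      simp [this]
  have hcov : (Finset.univ : Finset (Fin M × Fin M → Bool)) ⊆
      (Finset.univ : Finset (Q × P)).biUnion bad := by
    intro ω _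
    have := hcon (fun i j => ω (i, j))
    unfold PStar at this
    push Not at this
    obtain ⟨a, a', b, b', -, -, -, -, h1, h2, h3, h4, h5, h6, p₁, p₂, p₃, p₄, hp⟩ := this
    rw [Finset.mem_biUnion]
    refine ⟨((a, a', b, b'), (p₁, p₂, p₃, p₄)), Finset.mem_univ _, ?_⟩
    simp only [bad, Finset.mem_filter, Finset.mem_univ, true_and]
    refine ⟨⟨h1, h2, h3, h4, h5, h6⟩, ?_⟩
    rintro ⟨i, j⟩
    by_contra hc
    push Not at hc
    have e1 := hc (true, true)
    have e2 := hc (true, false)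
    have e3 := hc (false, true)
    have e4 := hc (false, false)
    simp [cl, pt] at e1 e2 e3 e4
    have := hp i j (by rw [e1]) (by rw [e2]) (by rw [e3])
    rw [e4] at this
    simp at this
  have h1 := (Finset.card_le_card hcov).trans Finset.card_biUnion_le
  have hc : (Finset.univ : Finset (Fin M × Fin M → Bool)).card = 2 ^ (M * M) := by simp
  have hz : Fintype.card (Q × P) = M ^ (4 * q) * 16 := by
    simp only [Q, P, Fintype.card_prod, Fintype.card_fun, Fintype.card_fin, Fintype.card_bool]
    ring
  have h2 : 2 ^ (M * M) * 16 ^ (q ^ 2) ≤ M ^ (4 * q) * 16 * (15 ^ (q ^ 2) * 2 ^ (M * M)) := by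
    calc _ ≤ (∑ z, (bad z).card) * 16 ^ (q ^ 2) := by rw [← hc]; gcongr
      _ = ∑ z, (bad z).card * 16 ^ (q ^ 2) := Finset.sum_mul _ _ _
      _ ≤ ∑ _z : Q × P, (15 ^ (q ^ 2) * 2 ^ (M * M)) := Finset.sum_le_sum fun z _ => hbad z
      _ = _ := by rw [Finset.sum_const, Finset.card_univ, hz, smul_eq_mul]
  have h3 : 2 ^ (M * M) * 16 ^ (q ^ 2) ≤ 2 ^ (M * M) * (M ^ (4 * q) * 16 * 15 ^ (q ^ 2)) := by
    calc _ ≤ _ := h2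
      _ = _ := by ring
  exact absurd (Nat.le_of_mul_le_mul_left h3 (by positivity)) (not_le.2 h)

end Counting

section Splitting

variable {V : Type*} [DecidableEq V] [Fintype V] {r : V → V → Prop} {A B R S T X Y Z : Finset V}
  {x : V}

lemma card_image_tr_le {q : ℕ} (h : Disjoint A (dset r q X)) :
    (A.image (tr r X)).card ≤ 2 * (X.card + 1) ^ q := by
  have hsub : A.image (tr r X) ⊆ (X.powerset.filter fun T => T.card ≤ q) ∪
      (X.powerset.filter fun T => T.card ≤ q).image (X \ ·) := by
    intro T hT
    obtain ⟨v, hv, rfl⟩ := Finset.mem_image.1 hT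
    have hv' := Finset.disjoint_left.1 h hv
    rw [mem_dset, not_and_or, not_le, not_le] at hv'
    rw [Finset.mem_union]
    rcases hv' with hv' | hv'
    · left
      simp only [Finset.mem_filter, Finset.mem_powerset]
      exact ⟨tr_subset v, Nat.le_of_lt_succ hv'⟩
    · right
      refine Finset.mem_image.2 ⟨X \ tr r X v, ?_, Finset.sdiff_sdiff_eq_self (tr_subset v)⟩
      simp only [Finset.mem_filter, Finset.mem_powerset]
      refine ⟨Finset.sdiff_subset, ?_⟩
      unfold tr
      rw [← Finset.filter_not]
      exact Nat.le_of_lt_succ hv'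
  calc _ ≤ _ := Finset.card_le_card hsub
    _ ≤ _ := Finset.card_union_le _ _
    _ ≤ (X.card + 1) ^ q + (X.card + 1) ^ q := by
      gcongr
      · exact card_powerset_filter_card_le _ _
      · exact Finset.card_image_le.trans (card_powerset_filter_card_le _ _)
    _ = _ := by ring

lemma jnt_le_dset {q : ℕ} {δ : ℝ} (hs : (4 : ℝ) * (X.card + 1) ^ q ≤ 2 ^ (δ * X.card)) :
    jnt r A X ≤ (A ∩ dset r q X).card * X.card + δ * X.card * A.card := by
  have hd : Disjoint (A ∩ dset r q X) (A \ dset r q X) := by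
    rw [Finset.disjoint_left]; intro v h1 h2
    exact (Finset.mem_sdiff.1 h2).2 (Finset.mem_inter.1 h1).2
  have hu : (A ∩ dset r q X) ∪ (A \ dset r q X) = A := by
    rw [Finset.union_comm]; exact Finset.sdiff_union_inter _ _
  have h1 := jnt_union_le (r := r) (S := X) hd
  rw [hu] at h1
  have h2 : jnt r (A ∩ dset r q X) X ≤ (A ∩ dset r q X).card * X.card := jnt_le_card_mul
  have h3 : jnt r (A \ dset r q X) X ≤
      (A \ dset r q X).card * Real.logb 2 (2 * (X.card + 1) ^ q) := by
    refine jnt_le_log _ ?_ (by positivity)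
    exact_mod_cast card_image_tr_le (r := r) (q := q) (X := X) (A := A \ dset r q X)
      Finset.sdiff_disjoint
  have h4 : (0 : ℝ) ≤ Real.logb 2 (2 * (X.card + 1) ^ q) := by
    apply Real.logb_nonneg (by norm_num)
    have : (1 : ℝ) ≤ (X.card + 1) ^ q := one_le_pow₀ (by simp)
    linarith
  have h5 : ((A \ dset r q X).card : ℝ) ≤ A.card := by
    exact_mod_cast Finset.card_le_card Finset.sdiff_subset
  have h6 : Real.logb 2 (2 * (X.card + 1) ^ q) + 1 ≤ δ * X.card := by
    have : Real.logb 2 (4 * (X.card + 1) ^ q) ≤ δ * X.card := by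
      rw [Real.logb_le_iff_le_rpow (by norm_num) (by positivity)]; exact hs
    calc _ = Real.logb 2 (2 * (X.card + 1) ^ q) + Real.logb 2 2 := by
          rw [Real.logb_self_eq_one (by norm_num)]
      _ = Real.logb 2 (4 * (X.card + 1) ^ q) := by
          rw [← Real.logb_mul (by positivity) (by norm_num)]; ring_nf
      _ ≤ _ := this
  have h7 : (0 : ℝ) ≤ A.card := by positivity
  nlinarith [mul_le_mul_of_nonneg_right h5 h4, mul_le_mul_of_nonneg_left h6 h7]

/-- Revealing any further vertex after at most `m` others gives nearly `|V| / 2` bits. -/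
def Rich (r : V → V → Prop) (δ : ℝ) (m : ℕ) : Prop :=
  ∀ (R : Finset V) (x : V), R.card ≤ m → x ∉ R →
    (1 / 2 - δ) * Fintype.card V ≤ inc r Finset.univ R x

lemma Rich.not {δ : ℝ} {m : ℕ} (h : Rich r δ m) : Rich (fun u v => ¬ r u v) δ m :=
  fun R x hR hx => (h R x hR hx).trans_eq (inc_not r _ R x).symm

lemma Rich.jnt_univ {δ : ℝ} {m : ℕ} (h : Rich r δ m) (hX : X.card ≤ m) :
    (1 / 2 - δ) * Fintype.card V * X.card ≤ jnt r Finset.univ X :=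
  jnt_lower fun R hR x _ hxR => h R x ((Finset.card_le_card hR).trans hX) hxR

lemma Rich.card_dset {δ : ℝ} {m q : ℕ} (h : Rich r δ m) (hX : X.card ≤ m) (hX0 : 0 < X.card)
    (hs : (4 : ℝ) * (X.card + 1) ^ q ≤ 2 ^ (δ * X.card)) :
    (1 / 2 - 2 * δ) * Fintype.card V ≤ (dset r q X).card := by
  have h1 := h.jnt_univ hX
  have h2 := jnt_le_dset (r := r) (A := Finset.univ) hs
  rw [Finset.univ_inter, Finset.card_univ] at h2
  have h3 : (0 : ℝ) < X.card := by exact_mod_cast hX0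
  refine le_of_mul_le_mul_right ?_ h3
  linarith

end Splitting

section Config

variable {V : Type*} [DecidableEq V] [Fintype V] {r : V → V → Prop} {A B R S T X Y Z : Finset V}
  {x : V} {q M k K : ℕ} {bip : Fin M → Fin M → Bool}

/-- A shattered set supports every bipartite pattern. -/
lemma exists_rows (hS : (B.image (tr r Z)).Shatters S) {c₁ c₂ d : Fin M → V}
    (hc₁ : ∀ i, c₁ i ∈ S) (hc₂ : ∀ i, c₂ i ∈ S) (hd : ∀ i, d i ∈ S) (i₁ : c₁.Injective)
    (i₂ : c₂.Injective) (id : d.Injective) (h₁₂ : ∀ i j, c₁ i = c₂ j → i = j)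
    (h₁ : ∀ i j, c₁ i ≠ d j) (h₂ : ∀ i j, c₂ i ≠ d j) :
    ∃ y : Fin M → V, y.Injective ∧ (∀ j, y j ∈ B) ∧ (∀ i j, r (y j) (c₁ i) ↔ bip i j = true) ∧
      ∀ i j, r (y j) (c₂ i) ↔ bip i j = true := by
  have hSZ : S ⊆ Z := by
    obtain ⟨u, hu, h⟩ := hS Finset.Subset.rfl
    obtain ⟨v, -, rfl⟩ := Finset.mem_image.1 hu
    exact (Finset.inter_eq_left.1 h).trans (tr_subset v)
  have key : ∀ j : Fin M, ∃ v ∈ B, ∀ s ∈ S, r v s ↔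
      ((∃ i, s = c₁ i ∧ bip i j = true) ∨ (∃ i, s = c₂ i ∧ bip i j = true) ∨ s = d j) := by
    intro j
    obtain ⟨u, hu, h⟩ := hS (t := S.filter fun s => (∃ i, s = c₁ i ∧ bip i j = true) ∨
      (∃ i, s = c₂ i ∧ bip i j = true) ∨ s = d j) (Finset.filter_subset _ _)
    obtain ⟨v, hv, rfl⟩ := Finset.mem_image.1 hu
    refine ⟨v, hv, fun s hs => ?_⟩
    have := Finset.ext_iff.1 h s
    simp only [Finset.mem_inter, mem_tr, Finset.mem_filter, hs, true_and] at this
    rw [← this]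
    exact ⟨fun h => ⟨hSZ hs, h⟩, fun h => h.2⟩
  choose y hyB hy using key
  refine ⟨y, ?_, hyB, ?_, ?_⟩
  · intro j j' e
    have h1 := (hy j (d j) (hd j)).2 (Or.inr (Or.inr rfl))
    rw [e, hy j' _ (hd j)] at h1
    rcases h1 with ⟨i, h, -⟩ | ⟨i, h, -⟩ | h
    · exact absurd h.symm (h₁ _ _)
    · exact absurd h.symm (h₂ _ _)
    · exact id h
  · intro i j
    rw [hy j _ (hc₁ i)]
    constructor
    · rintro (⟨i', h, hb⟩ | ⟨i', h, hb⟩ | h)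
      · rwa [i₁ h]
      · rwa [h₁₂ _ _ h]
      · exact absurd h (h₁ _ _)
    · exact fun h => Or.inl ⟨i, rfl, h⟩
  · intro i j
    rw [hy j _ (hc₂ i)]
    constructor
    · rintro (⟨i', h, hb⟩ | ⟨i', h, hb⟩ | h)
      · rwa [← h₁₂ _ _ h.symm]
      · rwa [i₂ h]
      · exact absurd h (h₂ _ _)
    · exact fun h => Or.inr (Or.inl ⟨i, rfl, h⟩)

lemma exists_image_subset {c : Fin M → V} (hc : c.Injective) (hk : k ≤ M) :
    ∃ X : Finset V, X.card = k ∧ (X : Set V) ⊆ c '' Set.univ := by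
  have h : (Finset.univ.image c).card = M := by
    rw [Finset.card_image_of_injective _ hc]; simp
  obtain ⟨X, hX, hXk⟩ := Finset.exists_subset_card_eq (h.symm ▸ hk : k ≤ (Finset.univ.image c).card)
  refine ⟨X, hXk, fun x hx => ?_⟩
  have := hX hx
  simpa using this

/-- Two homogeneous sets of size `k` inside `A` and `B` that no vertex splits simultaneously. -/
lemma exists_config_of_rows (hsym : ∀ ⦃u v⦄, r u v → r v u) (h5 : NoC5 r) (hr : Ram r)
    (hbip : PStar q (fun i j => bip i j = true) Set.univ Set.univ) (hk : k ^ 2 ≤ M)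
    {Z₁ Z₂ : Finset V} (hZ₁ : Hom r Z₁) (hZ₂ : Hom r Z₂) {c₁ c₂ y : Fin M → V}
    (hc₁ : ∀ i, c₁ i ∈ Z₁) (hc₂ : ∀ i, c₂ i ∈ Z₂) (i₁ : c₁.Injective) (i₂ : c₂.Injective)
    (iy : y.Injective) (hy : ∀ j, y j ∈ B) (h₁ : ∀ i j, r (y j) (c₁ i) ↔ bip i j = true)
    (h₂ : ∀ i j, r (y j) (c₂ i) ↔ bip i j = true) :
    ∃ X₁ ⊆ Z₁, ∃ X₂ ⊆ Z₂, ∃ Y ⊆ B, X₁.card = k ∧ X₂.card = k ∧ Y.card = k ∧ Hom r Y ∧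
      Disjoint (dset r (2 * q) X₁) (dset r (2 * q) Y) ∧
      Disjoint (dset r (2 * q) X₂) (dset r (2 * q) Y) := by
  have hkM : k ≤ M := (Nat.le_self_pow two_ne_zero k).trans hk
  obtain ⟨X₁, hX₁, hX₁c⟩ := exists_image_subset i₁ hkM
  obtain ⟨X₂, hX₂, hX₂c⟩ := exists_image_subset i₂ hkM
  obtain ⟨Y, hY, hYk, hYh⟩ := hr (Finset.univ.image y) k (by
    rw [Finset.card_image_of_injective _ iy]; simpa using hk)
  have hYc : (Y : Set V) ⊆ y '' Set.univ := fun v hv => by simpa using hY hv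
  have hX₁Z : X₁ ⊆ Z₁ := fun v hv => by
    obtain ⟨i, -, rfl⟩ := hX₁c hv; exact hc₁ i
  have hX₂Z : X₂ ⊆ Z₂ := fun v hv => by
    obtain ⟨i, -, rfl⟩ := hX₂c hv; exact hc₂ i
  refine ⟨X₁, hX₁Z, X₂, hX₂Z, Y, fun v hv => ?_, hX₁, hX₂, hYk, hYh, ?_, ?_⟩
  · obtain ⟨j, -, rfl⟩ := hYc hv; exact hy j
  · refine disjoint_dset hsym h5 (hZ₁.mono hX₁Z) hYh ?_
    refine (hbip.transfer (c := c₁) (y := y) (s := r) fun i j => ?_).mono hX₁c hYc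
    rw [← h₁ i j]; exact ⟨fun h => hsym h, fun h => hsym h⟩
  · refine disjoint_dset hsym h5 (hZ₂.mono hX₂Z) hYh ?_
    refine (hbip.transfer (c := c₂) (y := y) (s := r) fun i j => ?_).mono hX₂c hYc
    rw [← h₂ i j]; exact ⟨fun h => hsym h, fun h => hsym h⟩

lemma exists_two_columns (h : 2 * M ≤ S.card) : ∃ c d : Fin M → V,
    (∀ i, c i ∈ S) ∧ (∀ i, d i ∈ S) ∧ c.Injective ∧ d.Injective ∧ ∀ i j, c i ≠ d j :=
  exists_two_sequences h

lemma config_one (hsym : ∀ ⦃u v⦄, r u v → r v u) (h5 : NoC5 r) (hr : Ram r)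
    (hbip : PStar q (fun i j => bip i j = true) Set.univ Set.univ) (hk : k ^ 2 ≤ M)
    (hZ : Hom r Z) (hB : (Z.card + 1) ^ (2 * M) < (B.image (tr r Z)).card) :
    ∃ X ⊆ Z, ∃ Y ⊆ B, X.card = k ∧ Y.card = k ∧ Hom r Y ∧
      Disjoint (dset r (2 * q) X) (dset r (2 * q) Y) := by
  have hsub : ∀ S ∈ (B.image (tr r Z)).shatterer, S ⊆ Z := by
    intro S hS
    obtain ⟨u, hu, h⟩ := Finset.mem_shatterer.1 hS Finset.Subset.rfl
    obtain ⟨v, -, rfl⟩ := Finset.mem_image.1 hu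
    exact (Finset.inter_eq_left.1 h).trans (tr_subset v)
  obtain ⟨S, hS, hSc⟩ : ∃ S ∈ (B.image (tr r Z)).shatterer, 2 * M ≤ S.card := by
    by_contra! hcon
    have : (B.image (tr r Z)).shatterer ⊆ Z.powerset.filter fun T => T.card ≤ 2 * M := by
      intro S hS
      simp only [Finset.mem_filter, Finset.mem_powerset]
      exact ⟨hsub S hS, (hcon S hS).le⟩
    have h1 := Finset.card_le_card this
    have h2 := Finset.card_le_card_shatterer (B.image (tr r Z))
    have h3 := card_powerset_filter_card_le Z (2 * M)
    omega
  obtain ⟨c, d, hc, hd, ic, id, hcd⟩ := exists_two_columns hSc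
  obtain ⟨y, iy, hy, h1, h2⟩ := exists_rows (bip := bip) (Finset.mem_shatterer.1 hS) hc hc hd
    ic ic id (fun i j h => ic h) hcd hcd
  obtain ⟨X, hX, -, -, Y, hY, hXk, -, hYk, hYh, hdis, -⟩ := exists_config_of_rows hsym h5 hr hbip hk
    hZ hZ (fun i => hsub S hS (hc i)) (fun i => hsub S hS (hc i)) ic ic iy hy h1 h2
  exact ⟨X, hX, Y, hY, hXk, hYk, hYh, hdis⟩

lemma config_two (hsym : ∀ ⦃u v⦄, r u v → r v u) (h5 : NoC5 r) (hr : Ram r)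
    (hbip : PStar q (fun i j => bip i j = true) Set.univ Set.univ) (hk : k ^ 2 ≤ M)
    {Z₁ Z₂ : Finset V} (hZ₁ : Hom r Z₁) (hZ₂ : Hom r Z₂) (hK₁ : Z₁.card = K) (hK₂ : Z₂.card = K)
    (hZ : Disjoint Z₁ Z₂)
    (hB : 2 * (2 ^ K * (K + 1) ^ (2 * M)) < (B.image (tr r (Z₁ ∪ Z₂))).card) :
    ∃ X₁ ⊆ Z₁, ∃ X₂ ⊆ Z₂, ∃ Y ⊆ B, X₁.card = k ∧ X₂.card = k ∧ Y.card = k ∧ Hom r Y ∧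
      Disjoint (dset r (2 * q) X₁) (dset r (2 * q) Y) ∧
      Disjoint (dset r (2 * q) X₂) (dset r (2 * q) Y) := by
  have hsub : ∀ S ∈ (B.image (tr r (Z₁ ∪ Z₂))).shatterer, S ⊆ Z₁ ∪ Z₂ := by
    intro S hS
    obtain ⟨u, hu, h⟩ := Finset.mem_shatterer.1 hS Finset.Subset.rfl
    obtain ⟨v, -, rfl⟩ := Finset.mem_image.1 hu
    exact (Finset.inter_eq_left.1 h).trans (tr_subset v)
  obtain ⟨S, hS, hSc₁, hSc₂⟩ : ∃ S ∈ (B.image (tr r (Z₁ ∪ Z₂))).shatterer,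
      2 * M ≤ (S ∩ Z₁).card ∧ 2 * M ≤ (S ∩ Z₂).card := by
    by_contra! hcon
    have : (B.image (tr r (Z₁ ∪ Z₂))).shatterer ⊆
        ((Z₁.powerset.filter fun T => T.card ≤ 2 * M) ×ˢ Z₂.powerset ∪
        Z₁.powerset ×ˢ (Z₂.powerset.filter fun T => T.card ≤ 2 * M)).image
          fun p => p.1 ∪ p.2 := by
      intro S hS
      refine Finset.mem_image.2 ⟨(S ∩ Z₁, S ∩ Z₂), ?_, ?_⟩
      · simp only [Finset.mem_union, Finset.mem_product, Finset.mem_filter, Finset.mem_powerset,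
          Finset.inter_subset_right, true_and, and_true]
        by_cases h : 2 * M ≤ (S ∩ Z₁).card
        · exact Or.inr (hcon S hS h).le
        · exact Or.inl (by omega)
      · rw [← Finset.inter_union_distrib_left]
        exact Finset.inter_eq_left.2 (hsub S hS)
    have h1 := (Finset.card_le_card this).trans (Finset.card_image_le.trans
      (Finset.card_union_le _ _))
    rw [Finset.card_product, Finset.card_product, Finset.card_powerset, Finset.card_powerset,
      hK₁, hK₂] at h1
    have h2 := Finset.card_le_card_shatterer (B.image (tr r (Z₁ ∪ Z₂)))
    have h3 := card_powerset_filter_card_le Z₁ (2 * M)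
    have h4 := card_powerset_filter_card_le Z₂ (2 * M)
    rw [hK₁] at h3
    rw [hK₂] at h4
    have h5 := Nat.mul_le_mul_right (2 ^ K) h3
    have h6 := Nat.mul_le_mul_left (2 ^ K) h4
    rw [mul_comm ((K + 1) ^ (2 * M))] at h5
    omega
  obtain ⟨c₁, d, hc₁, hd, i₁, id, h₁d⟩ := exists_two_columns hSc₁
  obtain ⟨c₂, -, hc₂, -, i₂, -, -⟩ := exists_two_columns hSc₂
  simp only [Finset.mem_inter] at hc₁ hc₂ hd
  have hne : ∀ {u v}, u ∈ Z₁ → v ∈ Z₂ → u ≠ v := fun hu hv h =>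
    Finset.disjoint_left.1 hZ hu (h ▸ hv)
  obtain ⟨y, iy, hy, h1, h2⟩ := exists_rows (bip := bip) (Finset.mem_shatterer.1 hS)
    (fun i => (hc₁ i).1) (fun i => (hc₂ i).1) (fun i => (hd i).1)
    i₁ i₂ id (fun i j h => absurd h (hne (hc₁ i).2 (hc₂ j).2)) h₁d
    (fun i j h => hne (hd j).2 (hc₂ i).2 h.symm)
  exact exists_config_of_rows hsym h5 hr hbip hk hZ₁ hZ₂ (fun i => (hc₁ i).2) (fun i => (hc₂ i).2)
    i₁ i₂ iy hy h1 h2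

end Config

section Structure

/-- Sufficiently fast growing sizes `q ≪ k ≪ K ≪ K₂`. -/
structure Scales (δ : ℝ) (q k K K₂ : ℕ) : Prop where
  δ_pos : 0 < δ
  δ_le : δ ≤ 1 / 100
  k_pos : 0 < k
  split_k : (4 : ℝ) * (k + 1) ^ (2 * q) ≤ 2 ^ (δ * k)
  split_K : (4 : ℝ) * (K + 1) ^ (2 * q) ≤ 2 ^ (δ * K)
  K_large : 3 ≤ δ * K
  two_row : (2 : ℝ) * (2 ^ K * (K + 1) ^ (2 * k ^ 2)) ≤ 2 ^ ((3 / 2 : ℝ) * K)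
  K₂_large : (4 : ℝ) * (K₂ + 1) ^ (2 * K ^ 2) < 2 ^ ((1 / 4 : ℝ) * K₂)
  pattern : ∀ M ≤ K ^ 2, ∃ bip : Fin M → Fin M → Bool,
    PStar q (fun i j => bip i j = true) Set.univ Set.univ
  k_le : k ≤ K
  K_le : K ≤ K₂

lemma Scales.K_pos {δ : ℝ} {q k K K₂ : ℕ} (P : Scales δ q k K K₂) : 0 < K :=
  P.k_pos.trans_le P.k_le

lemma Scales.one_row {δ : ℝ} {q k K K₂ : ℕ} (P : Scales δ q k K K₂) :
    ((K : ℝ) + 1) ^ (2 * k ^ 2) ≤ 2 ^ ((1 / 2 : ℝ) * K) := by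
  have h := P.two_row
  have e : (2 : ℝ) ^ ((3 / 2 : ℝ) * K) = 2 ^ K * 2 ^ ((1 / 2 : ℝ) * K) := by
    rw [← Real.rpow_natCast, ← Real.rpow_add (by norm_num)]; ring_nf
  rw [e] at h
  have h1 : (0 : ℝ) < 2 ^ K := by positivity
  have h2 : (0 : ℝ) ≤ ((K : ℝ) + 1) ^ (2 * k ^ 2) := by positivity
  have h3 : (2 : ℝ) ^ K * (2 * ((K : ℝ) + 1) ^ (2 * k ^ 2)) ≤ 2 ^ K * 2 ^ ((1 / 2 : ℝ) * K) := by
    linarith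
  have := le_of_mul_le_mul_left h3 h1
  linarith

/-- A graph without induced pentagons, with large homogeneous sets, and rich. -/
structure Tame {V : Type*} [DecidableEq V] [Fintype V] (r : V → V → Prop) (δ : ℝ) (m : ℕ) :
    Prop where
  symm : ∀ ⦃u v⦄, r u v → r v u
  noC5 : NoC5 r
  ram : Ram r
  rich : Rich r δ m

variable {V : Type*} [DecidableEq V] [Fintype V] {r : V → V → Prop} {A B R S T X Y Z F W : Finset V}
  {x : V} {q k K K₂ m : ℕ} {δ η : ℝ}

lemma lt_card_image_tr {t : ℝ} (ht : 0 < t) (h : A.card * Real.logb 2 t < jnt r A S) :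
    t < (A.image (tr r S)).card := by
  by_contra! hc
  exact absurd (jnt_le_log t hc ht) (not_le.2 h)

/-- Large homogeneous sets contain configurations whose other side avoids a small set. -/
lemma exists_config (P : Scales δ q k K K₂) (G : Tame r δ m) (hZ : Hom r Z) (hK : Z.card = K₂)
    (hm : K₂ ≤ m) (hF : F.card * K₂ ≤ Fintype.card V) (hV : 0 < Fintype.card V) :
    ∃ X ⊆ Z, ∃ Y : Finset V, Disjoint Y F ∧ X.card = K ∧ Y.card = K ∧ Hom r Y ∧
      Disjoint (dset r (2 * q) X) (dset r (2 * q) Y) := by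
  obtain ⟨bip, hbip⟩ := P.pattern (K ^ 2) le_rfl
  obtain ⟨X, hX, Y, hY, h1, h2, h3, h4⟩ := config_one (B := Fᶜ) G.symm G.noC5 G.ram hbip le_rfl hZ (by
    have h1 := G.rich.jnt_univ (hK.trans_le hm)
    have h2 := jnt_union_le (r := r) (S := Z) (disjoint_compl_right (a := F))
    rw [Finset.union_compl, Finset.card_univ] at h2
    have h3 : jnt r F Z ≤ F.card * Z.card := jnt_le_card_mul
    rw [hK] at h1 h3
    have h4 : (F.card : ℝ) * K₂ ≤ Fintype.card V := by exact_mod_cast hF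
    have hn : (0 : ℝ) < Fintype.card V := by exact_mod_cast hV
    rw [hK]
    have : ((K₂ : ℝ) + 1) ^ (2 * K ^ 2) < ((Fᶜ).image (tr r Z)).card := by
      refine lt_card_image_tr (by positivity) ?_
      have h5 : (Fᶜ.card : ℝ) ≤ Fintype.card V := by
        exact_mod_cast Finset.card_le_univ _
      have h6 : Real.logb 2 (((K₂ : ℝ) + 1) ^ (2 * K ^ 2)) + 2 < 1 / 4 * K₂ := by
        calc _ = Real.logb 2 (((K₂ : ℝ) + 1) ^ (2 * K ^ 2)) + Real.logb 2 4 := by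
              congr 1; rw [eq_comm, Real.logb_eq_iff_rpow_eq] <;> norm_num
          _ = Real.logb 2 (4 * ((K₂ : ℝ) + 1) ^ (2 * K ^ 2)) := by
              rw [← Real.logb_mul (by positivity) (by norm_num), mul_comm]
          _ < _ := by
              rw [Real.logb_lt_iff_lt_rpow (by norm_num) (by positivity)]
              exact P.K₂_large
      have h7 : 0 ≤ Real.logb 2 (((K₂ : ℝ) + 1) ^ (2 * K ^ 2)) :=
        Real.logb_nonneg (by norm_num) (one_le_pow₀ (by simp))
      have h8 := mul_le_mul_of_nonneg_right h5 h7
      have h9 := mul_lt_mul_of_pos_left h6 hn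
      have h10 : 0 ≤ (1 / 4 - δ) * (Fintype.card V * K₂) := by
        have := P.δ_le
        exact mul_nonneg (by linarith) (by positivity)
      nlinarith
    exact_mod_cast this)
  exact ⟨X, hX, Y, Finset.disjoint_left.2 fun v hv hF => Finset.mem_compl.1 (hY hv) hF, h1, h2, h3, h4⟩

lemma card_real_union (h : Disjoint A B) : ((A ∪ B).card : ℝ) = A.card + B.card := by
  rw [Finset.card_union_of_disjoint h]; push_cast; rfl

lemma card_real_inter_add_sdiff (A B : Finset V) :
    ((A ∩ B).card : ℝ) + (A \ B).card = A.card := by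
  exact_mod_cast Finset.card_inter_add_card_sdiff A B

lemma card_real_mono (h : A ⊆ B) : (A.card : ℝ) ≤ B.card := by
  exact_mod_cast Finset.card_le_card h

lemma card_real_le_univ (A : Finset V) : (A.card : ℝ) ≤ Fintype.card V := by
  exact_mod_cast Finset.card_le_univ A

/-- Disjoint large sets have complementary size bounds. -/
lemma card_le_of_disjoint {c : ℝ} (h : Disjoint A B)
    (hA : (1 / 2 - c) * Fintype.card V ≤ A.card) :
    (B.card : ℝ) ≤ (1 / 2 + c) * Fintype.card V := by
  have := card_real_le_univ (A ∪ B)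
  rw [card_real_union h] at this
  linarith

lemma Scales.card_dset_k (P : Scales δ q k K K₂) (G : Tame r δ m) (hm : k ≤ m) (hX : X.card = k) :
    (1 / 2 - 2 * δ) * Fintype.card V ≤ (dset r (2 * q) X).card :=
  G.rich.card_dset (hX.trans_le hm) (hX ▸ P.k_pos) (by rw [hX]; exact P.split_k)

lemma Scales.card_dset_K (P : Scales δ q k K K₂) (G : Tame r δ m) (hm : K ≤ m) (hX : X.card = K) :
    (1 / 2 - 2 * δ) * Fintype.card V ≤ (dset r (2 * q) X).card :=
  G.rich.card_dset (hX.trans_le hm) (hX ▸ P.K_pos) (by rw [hX]; exact P.split_K)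

lemma card_image_tr_union_le : (A.image (tr r (X ∪ Z))).card ≤
    (A.image (tr r X)).card * (A.image (tr r Z)).card := by
  rw [← Finset.card_product]
  refine Finset.card_le_card_of_injOn (fun T => (T ∩ X, T ∩ Z)) ?_ ?_
  · intro T hT
    obtain ⟨v, hv, rfl⟩ := Finset.mem_image.1 hT
    beta_reduce
    rw [← tr_inter Finset.subset_union_left, ← tr_inter Finset.subset_union_right]
    exact Finset.mem_product.2 ⟨Finset.mem_image_of_mem _ hv, Finset.mem_image_of_mem _ hv⟩
  · intro T hT T' hT' h
    obtain ⟨v, hv, rfl⟩ := Finset.mem_image.1 hT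
    obtain ⟨v', hv', rfl⟩ := Finset.mem_image.1 hT'
    simp only [Prod.mk.injEq] at h
    have : ∀ w, tr r (X ∪ Z) w = (tr r (X ∪ Z) w ∩ X) ∪ (tr r (X ∪ Z) w ∩ Z) := fun w => by
      rw [← Finset.inter_union_distrib_left]
      exact (Finset.inter_eq_left.2 (tr_subset w)).symm
    rw [this v, this v', h.1, h.2]

lemma card_image_tr_le_pow : (A.image (tr r X)).card ≤ 2 ^ X.card := by
  rw [← Finset.card_powerset]
  exact Finset.card_le_card (Finset.image_subset_iff.2 fun v _ =>
    Finset.mem_powerset.2 (tr_subset v))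

lemma logb_two_mul_pow_le {Q : ℕ} (hs : (4 : ℝ) * (K + 1) ^ Q ≤ 2 ^ (δ * K)) :
    Real.logb 2 (2 * (K + 1) ^ Q) ≤ δ * K := by
  rw [Real.logb_le_iff_le_rpow (by norm_num) (by positivity)]
  refine le_trans ?_ hs
  gcongr; norm_num

/-- Two homogeneous sets split by many common vertices split nearly the same vertices. -/
lemma dichotomy (P : Scales δ q k K K₂) (G : Tame r δ m) (hm : 2 * K ≤ m) (hX : Hom r X)
    (hZ : Hom r Z) (hXK : X.card = K) (hZK : Z.card = K) (hd : Disjoint X Z)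
    (hDX : ((dset r (2 * q) X).card : ℝ) ≤ (1 / 2 + 2 * δ) * Fintype.card V)
    (hDZ : ((dset r (2 * q) Z).card : ℝ) ≤ (1 / 2 + 2 * δ) * Fintype.card V)
    (hI : 20 * δ * Fintype.card V ≤ (dset r (2 * q) X ∩ dset r (2 * q) Z).card)
    (hV : 0 < Fintype.card V) :
    ((dset r (2 * q) Z \ dset r (2 * q) X).card : ℝ) ≤ 8 * δ * Fintype.card V := by
  set DX := dset r (2 * q) X with hDXdef
  set DZ := dset r (2 * q) Z with hDZdef
  have hn : (0 : ℝ) < Fintype.card V := by exact_mod_cast hV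
  have hK0 : (0 : ℝ) < K := by exact_mod_cast P.K_pos
  have hkm : k ≤ m := by have := P.k_le; omega
  obtain ⟨bip, hbip⟩ := P.pattern (k ^ 2) (Nat.pow_le_pow_left P.k_le 2)
  have hmany : (2 : ℝ) ^ ((3 / 2 : ℝ) * K) < ((DX ∩ DZ).image (tr r (X ∪ Z))).card := by
    refine lt_card_image_tr (by positivity) ?_
    rw [Real.logb_rpow (by norm_num) (by norm_num)]
    have hcard : (X ∪ Z).card = 2 * K := by
      rw [Finset.card_union_of_disjoint hd, hXK, hZK]; ring
    have h0 := G.rich.jnt_univ (X := X ∪ Z) (by omega)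
    have d1 : Disjoint (DX ∩ DZ) (DX \ DZ) := by
      rw [Finset.disjoint_left]; intro v; simp; tauto
    have d2 : Disjoint (DX ∩ DZ ∪ DX \ DZ) (DZ \ DX) := by
      rw [Finset.disjoint_left]; intro v; simp; tauto
    have d3 : Disjoint (DX ∩ DZ ∪ DX \ DZ ∪ DZ \ DX) (DX ∪ DZ)ᶜ := by
      rw [Finset.disjoint_left]; intro v; simp; tauto
    have hu : DX ∩ DZ ∪ DX \ DZ ∪ DZ \ DX ∪ (DX ∪ DZ)ᶜ = Finset.univ := by
      ext v; simp; tauto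
    have j1 := jnt_union_le (r := r) (S := X ∪ Z) d1
    have j2 := jnt_union_le (r := r) (S := X ∪ Z) d2
    have j3 := jnt_union_le (r := r) (S := X ∪ Z) d3
    rw [hu] at j3
    have l1 := card_real_le_univ (DX ∩ DZ ∪ DX \ DZ)
    have l2 := card_real_le_univ (DX ∩ DZ ∪ DX \ DZ ∪ DZ \ DX)
    rw [Finset.card_univ] at j3
    have hlog := logb_two_mul_pow_le P.split_K
    have hpos : (0 : ℝ) < 2 * ((K : ℝ) + 1) ^ (2 * q) := by positivity
    have hpw : Real.logb 2 ((2 : ℝ) ^ K) = K := by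
      rw [← Real.rpow_natCast, Real.logb_rpow (by norm_num) (by norm_num)]
    have m1 : jnt r (DX \ DZ) (X ∪ Z) ≤ (DX \ DZ).card * (K + δ * K) := by
      refine (jnt_le_log (2 ^ K * (2 * ((K : ℝ) + 1) ^ (2 * q))) ?_ (by positivity)).trans ?_
      · have := card_image_tr_union_le (r := r) (A := DX \ DZ) (X := X) (Z := Z)
        have a := card_image_tr_le_pow (r := r) (A := DX \ DZ) (X := X)
        have b := card_image_tr_le (r := r) (A := DX \ DZ) (X := Z) (q := 2 * q)
          Finset.sdiff_disjoint
        rw [hXK] at a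
        rw [hZK] at b
        exact_mod_cast this.trans (Nat.mul_le_mul a b)
      · rw [Real.logb_mul (by positivity) (by positivity), hpw]
        gcongr
    have m2 : jnt r (DZ \ DX) (X ∪ Z) ≤ (DZ \ DX).card * (δ * K + K) := by
      refine (jnt_le_log ((2 * ((K : ℝ) + 1) ^ (2 * q)) * 2 ^ K) ?_ (by positivity)).trans ?_
      · have := card_image_tr_union_le (r := r) (A := DZ \ DX) (X := X) (Z := Z)
        have a := card_image_tr_le_pow (r := r) (A := DZ \ DX) (X := Z)
        have b := card_image_tr_le (r := r) (A := DZ \ DX) (X := X) (q := 2 * q)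
          Finset.sdiff_disjoint
        rw [hZK] at a
        rw [hXK] at b
        exact_mod_cast this.trans (Nat.mul_le_mul b a)
      · rw [Real.logb_mul (by positivity) (by positivity), hpw]
        gcongr
    have m3 : jnt r (DX ∪ DZ)ᶜ (X ∪ Z) ≤ ((DX ∪ DZ)ᶜ : Finset V).card * (δ * K + δ * K) := by
      refine (jnt_le_log ((2 * ((K : ℝ) + 1) ^ (2 * q)) * (2 * ((K : ℝ) + 1) ^ (2 * q))) ?_
        (by positivity)).trans ?_
      · have := card_image_tr_union_le (r := r) (A := (DX ∪ DZ)ᶜ) (X := X) (Z := Z)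
        have a := card_image_tr_le (r := r) (A := (DX ∪ DZ)ᶜ) (X := Z) (q := 2 * q)
          (Finset.disjoint_left.2 fun v h1 h2 => by
            rw [Finset.mem_compl, Finset.mem_union] at h1; exact h1 (Or.inr h2))
        have b := card_image_tr_le (r := r) (A := (DX ∪ DZ)ᶜ) (X := X) (q := 2 * q)
          (Finset.disjoint_left.2 fun v h1 h2 => by
            rw [Finset.mem_compl, Finset.mem_union] at h1; exact h1 (Or.inl h2))
        rw [hZK] at a
        rw [hXK] at b
        exact_mod_cast this.trans (Nat.mul_le_mul b a)
      · rw [Real.logb_mul (by positivity) (by positivity)]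
        gcongr
    rw [hcard] at h0
    push_cast at h0
    have e1 := card_real_inter_add_sdiff DX DZ
    have e2 := card_real_inter_add_sdiff DZ DX
    rw [Finset.inter_comm] at e2
    have e3 : ((DX ∩ DZ).card : ℝ) + (DX \ DZ).card + (DZ \ DX).card + ((DX ∪ DZ)ᶜ : Finset V).card
        = Fintype.card V := by
      rw [← card_real_union d1, ← card_real_union d2, ← card_real_union d3, hu, Finset.card_univ]
    have hKδ := mul_le_mul_of_nonneg_left P.K_large hn.le
    have hδ := P.δ_pos
    have hi : (0 : ℝ) ≤ (DX ∩ DZ).card := by positivity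
    have ha : (0 : ℝ) ≤ (DX \ DZ).card := by positivity
    have hb : (0 : ℝ) ≤ (DZ \ DX).card := by positivity
    clear_value DX DZ
    generalize ((DX ∩ DZ).card : ℝ) = i at *
    generalize ((DX \ DZ).card : ℝ) = a at *
    generalize ((DZ \ DX).card : ℝ) = b at *
    generalize (((DX ∪ DZ)ᶜ : Finset V).card : ℝ) = c at *
    generalize (Fintype.card V : ℝ) = n at *
    by_contra! hcon
    have hsum : (1 / 2 - δ) * n * (2 * K) ≤ i * (3 / 2 * K) + a * (K + δ * K) + b * (δ * K + K)
      + c * (δ * K + δ * K) + 3 * n := by linarith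
    have : (1 - 2 * δ) * n ≤ i * (3 / 2) + a + b + 3 * δ * n := by
      refine le_of_mul_le_mul_right ?_ hK0
      have e4 : δ * K * (i + a + b + c) = δ * K * n := by rw [e3]
      have : 0 ≤ δ * K * (a + b + 2 * i) := by positivity
      linarith
    have := mul_pos hδ hn
    linarith
  have hmany' : 2 * (2 ^ K * (K + 1) ^ (2 * k ^ 2)) < ((DX ∩ DZ).image (tr r (X ∪ Z))).card := by
    exact_mod_cast P.two_row.trans_lt hmany
  obtain ⟨X₁, hX₁, Z₁, hZ₁, W, hW, cX, cZ, cW, -, dX, dZ⟩ :=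
    config_two G.symm G.noC5 G.ram hbip le_rfl hX hZ hXK hZK hd hmany'
  have b1 := P.card_dset_k G hkm cX
  have b2 := P.card_dset_k G hkm cZ
  have b3 := P.card_dset_k G hkm cW
  have s1 : dset r (2 * q) X₁ ⊆ DX := dset_mono hX₁
  have s2 : dset r (2 * q) Z₁ ⊆ DZ := dset_mono hZ₁
  set EX := dset r (2 * q) X₁
  set EZ := dset r (2 * q) Z₁
  have b4 : ((EX ∪ EZ).card : ℝ) ≤ (1 / 2 + 2 * δ) * Fintype.card V :=
    card_le_of_disjoint (Finset.disjoint_union_right.2 ⟨dX.symm, dZ.symm⟩) b3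
  have b5 : ((EX ∪ EZ).card : ℝ) = EX.card + (EZ \ EX).card := by
    rw [← card_real_union Finset.disjoint_sdiff, Finset.union_sdiff_self_eq_union]
  have b6 : (DZ \ DX).card ≤ (DZ \ EZ ∪ EZ \ EX).card := by
    refine Finset.card_le_card fun v hv => ?_
    simp only [Finset.mem_sdiff, Finset.mem_union] at hv ⊢
    by_cases h : v ∈ EZ
    · exact Or.inr ⟨h, fun h' => hv.2 (s1 h')⟩
    · exact Or.inl ⟨hv.1, h⟩
  have b7 : ((DZ \ DX).card : ℝ) ≤ (DZ \ EZ).card + (EZ \ EX).card := by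
    exact_mod_cast b6.trans (Finset.card_union_le _ _)
  have b8 := card_real_inter_add_sdiff DZ EZ
  rw [Finset.inter_eq_right.2 s2] at b8
  linarith

end Structure

section Structure

variable {V : Type*} [DecidableEq V] [Fintype V] {r : V → V → Prop} {A B C D R S T X Y Z F W : Finset V}
  {x : V} {q k K K₂ m : ℕ} {δ η η₁ η₂ : ℝ}

/-- A greedy choice of successive vertices. -/
lemma exists_chain {P : Finset V → V → Prop} {R₀ : Finset V} {L : ℕ}
    (h : ∀ R, R₀ ⊆ R → (∀ v ∈ R \ R₀, v ∉ F) → R.card ≤ R₀.card + L → ∃ v, v ∉ R ∧ v ∉ F ∧ P R v) :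
    ∃ v : ℕ → V, Set.InjOn v (Finset.range L) ∧ ∀ i < L, v i ∉ R₀ ∧
      P (R₀ ∪ (Finset.range i).image v) (v i) := by
  rcases Nat.eq_zero_or_pos L with rfl | hL
  · obtain ⟨v, -⟩ := h R₀ Finset.Subset.rfl (by simp) (by simp)
    exact ⟨fun _ => v, by simp, by simp⟩
  have : Nonempty V := ⟨(h R₀ Finset.Subset.rfl (by simp) (by omega)).choose⟩
  have h' : ∀ R, ∃ v, (R₀ ⊆ R ∧ (∀ v ∈ R \ R₀, v ∉ F) ∧ R.card ≤ R₀.card + L) →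
      v ∉ R ∧ v ∉ F ∧ P R v := by
    intro R
    by_cases hR : R₀ ⊆ R ∧ (∀ v ∈ R \ R₀, v ∉ F) ∧ R.card ≤ R₀.card + L
    · obtain ⟨v, hv⟩ := h R hR.1 hR.2.1 hR.2.2
      exact ⟨v, fun _ => hv⟩
    · exact ⟨Classical.arbitrary V, fun h => absurd h hR⟩
  choose f hf using h'
  let S : ℕ → Finset V := fun i => Nat.rec R₀ (fun _ R => insert (f R) R) i
  have hS0 : S 0 = R₀ := rfl
  have hSs : ∀ i, S (i + 1) = insert (f (S i)) (S i) := fun _ => rfl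
  have hSim : ∀ i, S i = R₀ ∪ (Finset.range i).image fun j => f (S j) := by
    intro i
    induction i with
    | zero => simp [hS0]
    | succ i ih =>
      rw [hSs, Finset.range_add_one, Finset.image_insert, Finset.union_insert, ← ih]
  have hgood : ∀ i ≤ L, R₀ ⊆ S i ∧ (∀ v ∈ S i \ R₀, v ∉ F) ∧ (S i).card ≤ R₀.card + i := by
    intro i
    induction i with
    | zero => intro _; simp [hS0]
    | succ i ih =>
      intro hi
      obtain ⟨h1, h2, h3⟩ := ih (by omega)
      have h4 := hf (S i) ⟨h1, h2, by omega⟩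
      rw [hSs]
      refine ⟨h1.trans (Finset.subset_insert _ _), ?_, ?_⟩
      · intro v hv
        rw [Finset.mem_sdiff, Finset.mem_insert] at hv
        rcases hv with ⟨rfl | hv, hv'⟩
        · exact h4.2.1
        · exact h2 v (Finset.mem_sdiff.2 ⟨hv, hv'⟩)
      · rw [Finset.card_insert_of_notMem h4.1]; omega
  have hspec : ∀ i < L, f (S i) ∉ S i ∧ P (S i) (f (S i)) := fun i hi => by
    obtain ⟨h1, h2, h3⟩ := hgood i hi.le
    have := hf (S i) ⟨h1, h2, by omega⟩
    exact ⟨this.1, this.2.2⟩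
  refine ⟨fun i => f (S i), ?_, ?_⟩
  · have key : ∀ i j, j < L → i < j → f (S i) ≠ f (S j) := by
      intro i j hj hij e
      apply (hspec j hj).1
      rw [← e, hSim j]
      exact Finset.mem_union_right _ (Finset.mem_image_of_mem _ (Finset.mem_range.2 hij))
    intro i hi j hj e
    simp only [Finset.coe_range, Set.mem_Iio] at hi hj
    rcases lt_trichotomy i j with h | h | h
    · exact absurd e (key i j hj h)
    · exact h
    · exact absurd e.symm (key j i hi h)
  · intro i hi
    obtain ⟨h1, h2⟩ := hspec i hi
    refine ⟨fun h => h1 ((hgood i hi.le).1 h), ?_⟩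
    rw [← hSim i]; exact h2

/-- After exposing boundedly many vertices, no vertex splits both sides substantially. -/
lemma exists_exhausted_set (P : Scales δ q k K K₂) (G : Tame r δ m) (hX : Hom r X) (hXK : X.card = K)
    (hYK : Y.card = K) (hdis : Disjoint (dset r (2 * q) X) (dset r (2 * q) Y))
    (hm : 2 * K + K₂ ^ 2 ≤ m) (hm2 : 2 * K₂ ≤ m)
    (hV : 0 < Fintype.card V) (hη : 21 * δ < η) :
    ∃ R, X ∪ Y ⊆ R ∧ (∀ v ∈ R \ (X ∪ Y), v ∉ F) ∧ R.card ≤ 2 * K + K₂ ^ 2 ∧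
      ∀ v ∉ R, v ∉ F → inc r (dset r (2 * q) Y) R v < η * Fintype.card V ∨
        inc r (dset r (2 * q) X) R v < η * Fintype.card V := by
  by_contra! hcon
  have hXY : (X ∪ Y).card ≤ 2 * K := (Finset.card_union_le _ _).trans (by omega)
  have hnpos : (0 : ℝ) < Fintype.card V := by exact_mod_cast hV
  obtain ⟨v, hv, hvP⟩ := exists_chain (F := F) (R₀ := X ∪ Y) (L := K₂ ^ 2)
    (P := fun R v => η * Fintype.card V ≤ inc r (dset r (2 * q) Y) R v ∧
      η * Fintype.card V ≤ inc r (dset r (2 * q) X) R v)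
    (fun R h1 h2 h3 => by
      obtain ⟨v, h4, h5, h6, h7⟩ := hcon R h1 h2 (by omega)
      exact ⟨v, h4, h5, h6, h7⟩)
  obtain ⟨Z', hZ', hZ'K, hZ'h⟩ := G.ram ((Finset.range (K₂ ^ 2)).image v) K₂ (by
    rw [Finset.card_image_of_injOn hv, Finset.card_range])
  obtain ⟨Z, hZ, Y', -, hZK, hY'K, -, hd⟩ := exists_config (F := ∅) P G hZ'h hZ'K (by omega)
    (by simp) hV
  obtain ⟨I, hI, hIZ⟩ := Finset.subset_image_iff.1 (hZ.trans hZ')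
  have hK0 : (0 : ℝ) < K := by exact_mod_cast P.K_pos
  have key : ∀ A : Finset V, (∀ i < K₂ ^ 2,
      η * Fintype.card V ≤ inc r A (X ∪ Y ∪ (Finset.range i).image v) (v i)) →
      (η - δ) * Fintype.card V ≤ (A ∩ dset r (2 * q) Z).card := by
    intro A hA
    have h1 := jnt_chain v hv hA I hI
    rw [hIZ, hZK] at h1
    have h2 := jnt_le_dset (r := r) (A := A) (X := Z) (q := 2 * q) (δ := δ)
      (by rw [hZK]; exact P.split_K)
    rw [hZK] at h2
    have h3 := mul_le_mul_of_nonneg_left (card_real_le_univ A) (mul_pos P.δ_pos hK0).le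
    refine le_of_mul_le_mul_right ?_ hK0
    linarith
  have kY := key _ fun i hi => (hvP i hi).2.1
  have kX := key _ fun i hi => (hvP i hi).2.2
  have hXZ : Disjoint X Z := by
    rw [Finset.disjoint_right]
    intro z hz hzX
    obtain ⟨i, hi, rfl⟩ := Finset.mem_image.1 (hZ' (hZ hz))
    exact (hvP i (Finset.mem_range.1 hi)).1 (Finset.mem_union_left _ hzX)
  have bY := P.card_dset_K G (by omega) hYK
  have bY' := P.card_dset_K G (by omega) hY'K
  have hδn := mul_pos P.δ_pos hnpos
  have hηn := mul_lt_mul_of_pos_right hη hnpos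
  have := dichotomy P G (by omega) hX (hZ'h.mono hZ) hXK hZK hXZ
    (card_le_of_disjoint hdis.symm bY) (card_le_of_disjoint hd.symm bY')
    (by linarith) hV
  have h2 : dset r (2 * q) Y ∩ dset r (2 * q) Z ⊆ dset r (2 * q) Z \ dset r (2 * q) X := by
    intro u hu
    rw [Finset.mem_inter] at hu
    exact Finset.mem_sdiff.2 ⟨hu.2, fun h => Finset.disjoint_left.1 hdis h hu.1⟩
  have h3 := card_real_mono h2
  linarith

/-- Few vertices of the side `D` are typed with the other side `C`. -/
lemma few_wrong (P : Scales δ q k K K₂) (G : Tame r δ m) (hX : Hom r X) (hXK : X.card = K)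
    (hD : D = dset r (2 * q) X) (hCD : Disjoint C D) (hC : Det r R C) (hDet : Det r R D)
    (hCc : (1 / 2 - 2 * δ) * Fintype.card V ≤ C.card) (hm : R.card + k ≤ m) (hKm : K ≤ m)
    (hV : 0 < Fintype.card V) (hη₁ : η₁ + 10 * δ < 1 / 2) :
    (((D \ (R ∪ F)).filter fun v => inc r C R v < η₁ * Fintype.card V).card : ℝ) ≤
      10 * δ * Fintype.card V := by
  set W₀ := (D \ (R ∪ F)).filter fun v => inc r C R v < η₁ * Fintype.card V with hW₀
  by_contra! hcon
  have hnpos : (0 : ℝ) < Fintype.card V := by exact_mod_cast hV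
  have hK0 : (0 : ℝ) < K := by exact_mod_cast P.K_pos
  have hk0 : (0 : ℝ) < k := by exact_mod_cast P.k_pos
  have hWD : W₀ ⊆ D := (Finset.filter_subset _ _).trans Finset.sdiff_subset
  have hDc := card_le_of_disjoint hCD hCc
  have hDn : (1 / 2 - 2 * δ) * Fintype.card V ≤ D.card := hD ▸ P.card_dset_K G hKm hXK
  have hδn := mul_pos P.δ_pos hnpos
  have hmany : (2 : ℝ) ^ ((1 / 2 : ℝ) * K) < (W₀.image (tr r X)).card := by
    refine lt_card_image_tr (by positivity) ?_
    rw [Real.logb_rpow (by norm_num) (by norm_num)]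
    have h0 := G.rich.jnt_univ (hXK.trans_le hKm)
    have h1 := jnt_union_le (r := r) (S := X) (disjoint_compl_right (a := W₀))
    rw [Finset.union_compl, Finset.card_univ] at h1
    have h2 := jnt_le_dset (r := r) (A := W₀ᶜ) (X := X) (q := 2 * q) (δ := δ)
      (by rw [hXK]; exact P.split_K)
    rw [← hD] at h2
    have h3 : W₀ᶜ ∩ D = D \ W₀ := by ext v; simp; tauto
    have h4 := card_real_inter_add_sdiff D W₀
    rw [Finset.inter_eq_right.2 hWD] at h4
    rw [h3, hXK] at h2
    rw [hXK] at h0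
    have h5 := mul_le_mul_of_nonneg_left (card_real_le_univ W₀ᶜ) (mul_pos P.δ_pos hK0).le
    have h6 := mul_le_mul_of_nonneg_left P.K_large hnpos.le
    have h7 : ((D \ W₀).card : ℝ) = D.card - W₀.card := by linarith
    rw [h7] at h2
    have h8 := mul_le_mul_of_nonneg_right hDc hK0.le
    have h9 := mul_lt_mul_of_pos_right hcon hK0
    have h10 := mul_pos hδn hK0
    linarith
  obtain ⟨bip, hbip⟩ := P.pattern (k ^ 2) (Nat.pow_le_pow_left P.k_le 2)
  obtain ⟨X', hX', W, hW, hX'k, hWk, hWh, hd⟩ := config_one (B := W₀) G.symm G.noC5 G.ram hbip le_rfl hX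
    (by rw [hXK]; exact_mod_cast P.one_row.trans_lt hmany)
  have b1 := P.card_dset_k G (by omega) hX'k
  have s1 : dset r (2 * q) X' ⊆ D := hD ▸ dset_mono hX'
  have hDW : ((D ∩ dset r (2 * q) W).card : ℝ) ≤ 4 * δ * Fintype.card V := by
    have h1 : D ∩ dset r (2 * q) W ⊆ D \ dset r (2 * q) X' := by
      intro v hv
      rw [Finset.mem_inter] at hv
      exact Finset.mem_sdiff.2 ⟨hv.1, fun h => Finset.disjoint_left.1 hd h hv.2⟩
    have h2 := card_real_mono h1
    have h3 := card_real_inter_add_sdiff D (dset r (2 * q) X')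
    rw [Finset.inter_eq_right.2 s1] at h3
    linarith
  have hE : Disjoint (C ∪ D) (C ∪ D)ᶜ := disjoint_compl_right
  have hEc : (((C ∪ D)ᶜ : Finset V).card : ℝ) ≤ 4 * δ * Fintype.card V := by
    have := card_real_union hE
    rw [Finset.union_compl, Finset.card_univ, card_real_union hCD] at this
    linarith
  have hinc : ∀ W' ⊆ W, (1 / 2 - δ) * Fintype.card V * W'.card ≤
      W'.card * ((η₁ + 4 * δ) * Fintype.card V) + jnt r D W' := by
    intro W' hW'
    induction W' using Finset.induction_on with
    | empty => simp [jnt_empty]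
    | insert w W' hw ih =>
      have hW's := (Finset.subset_insert w W').trans hW'
      have hwW := hW' (Finset.mem_insert_self w W')
      have hw0 := Finset.mem_filter.1 (hW hwW)
      have hwR : w ∉ R := fun h => (Finset.mem_sdiff.1 hw0.1).2 (Finset.mem_union_left _ h)
      have hcard : (R ∪ W').card ≤ m := by
        have := Finset.card_union_le R W'
        have := Finset.card_le_card hW's
        omega
      have g1 := G.rich (R ∪ W') w hcard (by rw [Finset.mem_union]; tauto)
      have g2 : inc r Finset.univ (R ∪ W') w = inc r C (R ∪ W') w + inc r D (R ∪ W') w +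
          inc r (C ∪ D)ᶜ (R ∪ W') w := by
        rw [← inc_union_of_det (hC.mono Finset.subset_union_left) hCD,
          ← inc_union_of_det ((hC.union hDet).mono Finset.subset_union_left) hE,
          Finset.union_compl]
      have g3 : inc r C (R ∪ W') w ≤ inc r C R w := inc_anti Finset.subset_union_left
      have g4 : inc r D (R ∪ W') w ≤ inc r D W' w := inc_anti Finset.subset_union_right
      have g5 : inc r (C ∪ D)ᶜ (R ∪ W') w ≤ ((C ∪ D)ᶜ : Finset V).card := inc_le_card
      rw [jnt_insert hw, Finset.card_insert_of_notMem hw]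
      push_cast
      have := ih hW's
      have := hw0.2
      linarith
  have f1 := hinc W Finset.Subset.rfl
  have f2 := jnt_le_dset (r := r) (A := D) (X := W) (q := 2 * q) (δ := δ)
      (by rw [hWk]; exact P.split_k)
  rw [hWk] at f1 f2
  have f3 := mul_le_mul_of_nonneg_left (card_real_le_univ D) (mul_pos P.δ_pos hk0).le
  have f4 := mul_le_mul_of_nonneg_right hDW hk0.le
  have f5 := mul_pos hnpos hk0
  have f6 := mul_lt_mul_of_pos_right hη₁ f5
  have f7 := mul_pos P.δ_pos f5
  linarith

/-- A near bipartition of the vertices, determined by a bounded set `R`, such that each vertex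
outside `R ∪ F` hardly splits the cells of one of the sides. -/
structure Str (r : V → V → Prop) (δ η : ℝ) (m : ℕ) (F R C D : Finset V) : Prop where
  card_R : R.card ≤ m
  disj_F : Disjoint R F
  disj : Disjoint C D
  detC : Det r R C
  detD : Det r R D
  cardC : (1 / 2 - 2 * δ) * Fintype.card V ≤ C.card
  cardD : (1 / 2 - 2 * δ) * Fintype.card V ≤ D.card
  typ : ∀ v ∉ R, v ∉ F → inc r C R v < η * Fintype.card V ∨ inc r D R v < η * Fintype.card V
  fewC : (((D \ (R ∪ F)).filter fun v => inc r C R v < η * Fintype.card V).card : ℝ) ≤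
      10 * δ * Fintype.card V
  fewD : (((C \ (R ∪ F)).filter fun v => inc r D R v < η * Fintype.card V).card : ℝ) ≤
      10 * δ * Fintype.card V

lemma Str.swap (h : Str r δ η m F R C D) : Str r δ η m F R D C :=
  ⟨h.card_R, h.disj_F, h.disj.symm, h.detD, h.detC, h.cardD, h.cardC,
    fun v hv hF => (h.typ v hv hF).symm, h.fewD, h.fewC⟩

lemma Det.not (h : Det r R A) : Det (fun u v => ¬ r u v) R A := by
  intro u v huv
  refine h u v ?_
  unfold tr at *
  ext w
  have := Finset.ext_iff.1 huv w
  simp only [Finset.mem_filter] at *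
  tauto

lemma Str.not (h : Str r δ η m F R C D) : Str (fun u v => ¬ r u v) δ η m F R C D := by
  refine ⟨h.card_R, h.disj_F, h.disj, h.detC.not, h.detD.not, h.cardC, h.cardD, ?_, ?_, ?_⟩
  · intro v hv hF
    rw [inc_not, inc_not]; exact h.typ v hv hF
  · simp only [inc_not]; exact h.fewC
  · simp only [inc_not]; exact h.fewD

theorem exists_str (P : Scales δ q k K K₂) (G : Tame r δ m) (hm : 2 * K + K₂ ^ 2 + 2 * K₂ ≤ m)
    (hn : (K₂ + F.card + 2 * K + K₂ ^ 2) ^ 2 ≤ Fintype.card V) (hη : 21 * δ < η)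
    (hη' : η + 10 * δ < 1 / 2) :
    ∃ R C D, Str r δ η (2 * K + K₂ ^ 2) F R C D := by
  have hK := P.K_pos
  have hK₂ := P.K_le
  have hkK := P.k_le
  have hV : 0 < Fintype.card V := lt_of_lt_of_le (by positivity) hn
  obtain ⟨Z, hZ, hZK, hZh⟩ := G.ram Fᶜ K₂ (by
    rw [Finset.card_compl]
    apply Nat.le_sub_of_add_le
    nlinarith)
  obtain ⟨X, hX, Y, hY, hXK, hYK, hYh, hd⟩ := exists_config (F := F) P G hZh hZK (by omega)
    (by nlinarith) hV
  obtain ⟨R, h1, h2, h3, h4⟩ := exists_exhausted_set (F := F) P G (hZh.mono hX) hXK hYK hd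
    (by omega) (by omega) hV hη
  have cX := P.card_dset_K G (by omega) hXK
  have cY := P.card_dset_K G (by omega) hYK
  have dX : Det r R (dset r (2 * q) X) := dset_det.mono (Finset.subset_union_left.trans h1)
  have dY : Det r R (dset r (2 * q) Y) := dset_det.mono (Finset.subset_union_right.trans h1)
  refine ⟨R, dset r (2 * q) Y, dset r (2 * q) X, h3, ?_, hd.symm, dY, dX, cY, cX, h4, ?_, ?_⟩
  · rw [Finset.disjoint_left]
    intro v hv hF
    by_cases h : v ∈ X ∪ Y
    · rcases Finset.mem_union.1 h with h | h
      · exact Finset.mem_compl.1 (hZ (hX h)) hF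
      · exact Finset.disjoint_left.1 hY h hF
    · exact h2 v (Finset.mem_sdiff.2 ⟨hv, h⟩) hF
  · exact few_wrong P G (hZh.mono hX) hXK rfl hd.symm dY dX cY (by omega) (by omega) hV hη'
  · exact few_wrong P G hYh hYK rfl hd dX dY cX (by omega) (by omega) hV hη'

end Structure

section Splitting

lemma eta_deficit {a b : ℝ} (ha : 0 ≤ a) (hb : 0 ≤ b) :
    (a + b) / 4 - 10 * (a + b - eta a b) ≤ a := by
  by_cases h : a ≤ (a + b) / 4
  · have := eta_unbalanced ha hb h; linarith
  · have := eta_le_add ha hb; linarith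

variable {V : Type*} [DecidableEq V] {r : V → V → Prop} {A B C D R R' S T : Finset V}
  {x y z : V} {κ : ℝ} {m : ℕ}

/-- The information about `A` that revealing `x` fails to give. -/
def dfc (r : V → V → Prop) (A R : Finset V) (x : V) : ℝ := A.card - inc r A R x

lemma dfc_nonneg : 0 ≤ dfc r A R x := sub_nonneg.2 inc_le_card

lemma dfc_le_of_det (hA : Det r R A) (hAD : A ⊆ D) : dfc r A R x ≤ dfc r D R x := by
  have h := inc_union_of_det (x := x) hA (Finset.disjoint_sdiff (s := A) (t := D))
  rw [Finset.union_sdiff_of_subset hAD] at h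
  have h1 : inc r (D \ A) R x ≤ (D \ A).card := inc_le_card
  have h2 : ((D \ A).card : ℝ) = D.card - A.card := by
    rw [Finset.card_sdiff_of_subset hAD, Nat.cast_sub (Finset.card_le_card hAD)]
  unfold dfc; linarith

lemma dfc_union (hA : Det r R A) (hAB : Disjoint A B) :
    dfc r (A ∪ B) R x = dfc r A R x + dfc r B R x := by
  unfold dfc
  rw [inc_union_of_det hA hAB, Finset.card_union_of_disjoint hAB]; push_cast; ring

lemma det_cell (h : Det r R A) : Det r R (cell r A R T) := by
  intro u v huv hu
  rw [mem_cell] at *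
  exact ⟨h u v huv hu.1, huv ▸ hu.2⟩

lemma sum_dfc_cell (hD : Det r R D) (hR : R ⊆ R') :
    ∑ T ∈ R.powerset, dfc r (cell r D R T) R' x = dfc r D R' x := by
  have key : ∀ 𝒯 : Finset (Finset V), Det r R' (𝒯.biUnion (cell r D R)) ∧
      ∑ T ∈ 𝒯, dfc r (cell r D R T) R' x = dfc r (𝒯.biUnion (cell r D R)) R' x := by
    intro 𝒯
    induction 𝒯 using Finset.induction_on with
    | empty =>
      refine ⟨fun u v _ h => by simp at h, by simp [dfc, inc, cell, eta_zero_left]⟩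
    | insert T 𝒯 hT ih =>
      have hd : Det r R' (cell r D R T) := (det_cell hD).mono hR
      have hdis : Disjoint (cell r D R T) (𝒯.biUnion (cell r D R)) := by
        rw [Finset.disjoint_left]
        intro v hv hv'
        rw [Finset.mem_biUnion] at hv'
        obtain ⟨T', hT', hv'⟩ := hv'
        rw [mem_cell] at hv hv'
        exact hT (hv.2 ▸ hv'.2 ▸ hT')
      rw [Finset.biUnion_insert, Finset.sum_insert hT, ih.2, dfc_union hd hdis]
      exact ⟨hd.union ih.1, rfl⟩
  rw [(key _).2]
  congr 1
  ext v
  simp only [Finset.mem_biUnion, Finset.mem_powerset, mem_cell]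
  exact ⟨fun ⟨_, _, h, _⟩ => h, fun h => ⟨_, tr_subset v, h, rfl⟩⟩

/-- The members of `A` related to `x` as prescribed. -/
def side (r : V → V → Prop) (x : V) (b : Bool) (A : Finset V) : Finset V :=
  A.filter fun v => (r v x ↔ b = true)

lemma mem_side {b : Bool} {v : V} : v ∈ side r x b A ↔ v ∈ A ∧ (r v x ↔ b = true) :=
  Finset.mem_filter

lemma side_subset {b : Bool} : side r x b A ⊆ A := Finset.filter_subset _ _

lemma Det.side {b : Bool} (h : Det r R A) : Det r (insert x R) (side r x b A) := by
  intro u v huv hu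
  rw [mem_side] at *
  refine ⟨h.mono (Finset.subset_insert x R) u v huv hu.1, ?_⟩
  rw [← hu.2]
  have := Finset.ext_iff.1 huv x
  simp only [mem_tr, Finset.mem_insert_self, true_and] at this
  exact this.symm

lemma card_side_ge {b : Bool} : (A.card : ℝ) / 4 - 10 * dfc r A R x ≤ (side r x b A).card := by
  have h1 : dfc r A R x = ∑ T ∈ R.powerset, (((cell r A R T).card : ℝ) -
      eta ((cell r A R T).filter fun v => r v x).card
        ((cell r A R T).filter fun v => ¬ r v x).card) := by
    rw [Finset.sum_sub_distrib, sum_card_cell_real]; rfl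
  have h2 : side r x b A = side r x b A := rfl
  rw [h1, ← sum_card_cell_real r A R, ← sum_card_cell_real r (side r x b A) R, Finset.sum_div,
    Finset.mul_sum, ← Finset.sum_sub_distrib]
  refine Finset.sum_le_sum fun T _ => ?_
  have h3 : cell r (side r x b A) R T = (cell r A R T).filter fun v => (r v x ↔ b = true) := by
    unfold cell side; rw [Finset.filter_comm]
  have h4 := card_filter_split (cell r A R T) (fun v => r v x)
  rw [h3, ← h4]
  cases b
  · simp only [Bool.false_eq_true, iff_false]
    have := eta_deficit (a := ((cell r A R T).filter fun v => ¬ r v x).card)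
      (b := ((cell r A R T).filter fun v => r v x).card) (Nat.cast_nonneg _) (Nat.cast_nonneg _)
    rw [eta_comm] at this
    linarith
  · simp only [iff_true]
    exact eta_deficit (Nat.cast_nonneg _) (Nat.cast_nonneg _)

/-- Exposing `x` after any few vertices nearly halves the cells of `D`. -/
def Spl (r : V → V → Prop) (D R : Finset V) (m : ℕ) (κ : ℝ) (x : V) : Prop :=
  ∀ R', R ⊆ R' → R'.card ≤ m → x ∉ R' → dfc r D R' x ≤ κ

lemma Spl.mono_base (h : Spl r D R m κ x) (hR : R ⊆ R') : Spl r D R' m κ x :=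
  fun S hS => h S (hR.trans hS)

lemma Spl.mono_set (h : Spl r D R m κ x) (hA : Det r R A) (hAD : A ⊆ D) : Spl r A R m κ x :=
  fun S hS hc hx => (dfc_le_of_det (hA.mono hS) hAD).trans (h S hS hc hx)

lemma card_two_sides (hA : Det r R A) (hx : Spl r A R m κ x) (hy : Spl r A R m κ y) (hxy : x ≠ y)
    (hxR : x ∉ R) (hyR : y ∉ R) (hm : R.card + 1 ≤ m) (b c : Bool) :
    (A.card : ℝ) / 16 - 20 * κ ≤ (side r y c (side r x b A)).card := by
  have h1 := card_side_ge (r := r) (A := A) (R := R) (x := x) (b := b)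
  have h2 := card_side_ge (r := r) (A := side r x b A) (R := insert x R) (x := y) (b := c)
  have hc : (insert x R).card ≤ m := by rw [Finset.card_insert_of_notMem hxR]; exact hm
  have h3 := hx R Finset.Subset.rfl (by omega) hxR
  have h4 := (hy.mono_base (Finset.subset_insert x R)).mono_set hA.side
    (side_subset (b := b)) (insert x R) Finset.Subset.rfl hc (by simp [hxy.symm, hyR])
  have h5 := (dfc_nonneg (r := r) (A := A) (R := R) (x := x)).trans h3
  linarith

lemma card_three_sides (hA : Det r R A) (a b c : Bool) :
    (A.card : ℝ) / 64 - 10 * (dfc r A R x + dfc r A (insert x R) y +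
      dfc r A (insert y (insert x R)) z) ≤ (side r z c (side r y b (side r x a A))).card := by
  have h1 := card_side_ge (r := r) (A := A) (R := R) (x := x) (b := a)
  have d1 : Det r (insert x R) (side r x a A) := hA.side
  have h2 := card_side_ge (r := r) (A := side r x a A) (R := insert x R) (x := y) (b := b)
  have d2 : Det r (insert y (insert x R)) (side r y b (side r x a A)) := d1.side
  have h3 := card_side_ge (r := r) (A := side r y b (side r x a A)) (R := insert y (insert x R))
    (x := z) (b := c)
  have h4 := dfc_le_of_det (x := y) d1 side_subset
  have h5 := dfc_le_of_det (x := z) d2 (side_subset.trans side_subset)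
  have h6 := dfc_nonneg (r := r) (A := A) (R := R) (x := x)
  have h7 := dfc_nonneg (r := r) (A := A) (R := insert x R) (x := y)
  linarith

lemma card_three_sides' (hA : Det r R A) (hx : x ∉ R) (hy : y ∉ R) (hz : z ∉ R) (hxy : x ≠ y)
    (hxz : x ≠ z) (hyz : y ≠ z) (hm : R.card + 2 ≤ m) (sx : Spl r A R m κ x) (sy : Spl r A R m κ y)
    (sz : Spl r A R m κ z) (a b c : Bool) :
    (A.card : ℝ) / 64 - 30 * κ ≤ (side r z c (side r y b (side r x a A))).card := by
  have := card_three_sides (x := x) (y := y) (z := z) hA a b c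
  have c1 : (insert x R).card = R.card + 1 := Finset.card_insert_of_notMem hx
  have c2 : (insert y (insert x R)).card ≤ R.card + 2 := by
    have := Finset.card_insert_le y (insert x R); omega
  have h1 := sx R Finset.Subset.rfl (by omega) hx
  have h2 := sy (insert x R) (Finset.subset_insert _ _) (by omega) (by simp [hxy.symm, hy])
  have h3 := sz (insert y (insert x R)) ((Finset.subset_insert _ _).trans
    (Finset.subset_insert _ _)) (by omega) (by simp [hxz.symm, hyz.symm, hz])
  linarith

lemma cell_side {b : Bool} : cell r (side r x b A) R T = side r x b (cell r A R T) := by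
  unfold cell side; rw [Finset.filter_comm]

/-- A dense union of pieces of cells meets neighbourhoods in the expected proportion. -/
lemma card_filter_le_of_dense (hSA : S ⊆ A) (d : Finset V → ℝ) (hd : ∀ T, 0 ≤ d T)
    (hS : ∀ T ∈ R.powerset, ((cell r A R T).card : ℝ) / 64 - d T ≤ (cell r S R T).card) :
    ((A.filter fun v => r v x).card : ℝ) / 64 ≤
      (S.filter fun v => r v x).card + ∑ T ∈ R.powerset, d T + 2 * inc r A R x := by
  have e : ∀ B : Finset V, ((B.filter fun v => r v x).card : ℝ) =
      ∑ T ∈ R.powerset, (((cell r B R T).filter fun v => r v x).card : ℝ) := by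
    intro B
    rw [← sum_card_cell_real r (B.filter fun v => r v x) R]
    exact Finset.sum_congr rfl fun T _ => by unfold cell; rw [Finset.filter_comm]
  rw [e A, e S, inc, Finset.mul_sum, ← Finset.sum_add_distrib, ← Finset.sum_add_distrib,
    Finset.sum_div]
  refine Finset.sum_le_sum fun T hT => ?_
  have h1 := hS T hT
  have h0 := hd T
  have h2 := card_filter_split (cell r A R T) (fun v => r v x)
  have h3 := card_filter_split (cell r S R T) (fun v => r v x)
  have h4 : (((cell r S R T).filter fun v => ¬ r v x).card : ℝ) ≤
      ((cell r A R T).filter fun v => ¬ r v x).card := by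
    exact_mod_cast Finset.card_le_card (Finset.filter_subset_filter _
      (Finset.filter_subset_filter _ hSA))
  have h5 : (0 : ℝ) ≤ ((cell r S R T).filter fun v => r v x).card := Nat.cast_nonneg _
  have ha : (0 : ℝ) ≤ ((cell r A R T).filter fun v => r v x).card := Nat.cast_nonneg _
  have hb : (0 : ℝ) ≤ ((cell r A R T).filter fun v => ¬ r v x).card := Nat.cast_nonneg _
  have hq := eta_quadratic ha hb
  revert h1 h2 h3 h4 h5 ha hb hq
  generalize (((cell r A R T).filter fun v => r v x).card : ℝ) = a
  generalize (((cell r A R T).filter fun v => ¬ r v x).card : ℝ) = b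
  intro h1 h2 h3 h4 h5 ha hb hq
  rcases (add_nonneg ha hb).eq_or_lt with h | h
  · rw [← h, div_zero] at hq
    linarith
  · rw [div_le_iff₀ h] at hq
    by_cases hab : a ≤ b
    · have : a / 2 ≤ eta a b := by
        by_contra hc
        push Not at hc
        have := mul_lt_mul_of_pos_right hc h
        have := mul_le_mul_of_nonneg_left hab ha
        linarith
      linarith
    · have : b / 2 ≤ eta a b := by
        by_contra hc
        push Not at hc
        have := mul_lt_mul_of_pos_right hc h
        have := mul_le_mul_of_nonneg_left (le_of_not_ge hab) hb
        linarith
      linarith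

end Splitting

section Alpha

variable {V : Type*} [DecidableEq V] [Fintype V] {r : V → V → Prop} {A B C D R R' S T F : Finset V}
  {x y z : V} {κ δ η ρ : ℝ} {m m' : ℕ}

lemma Str.card_compl (h : Str r δ η m F R C D) :
    (((C ∪ D)ᶜ : Finset V).card : ℝ) ≤ 4 * δ * Fintype.card V := by
  have := card_real_union (disjoint_compl_right (a := C ∪ D))
  rw [Finset.union_compl, Finset.card_univ, card_real_union h.disj] at this
  have := h.cardC
  have := h.cardD
  linarith

/-- A vertex revealing little about `C` nearly halves the cells of `D`. -/
lemma Str.spl (h : Str r δ η m' F R C D) (hr : Rich r δ m) {τ : ℝ} 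
    (hx : ∀ R', R ⊆ R' → x ∉ R' → inc r C R' x ≤ τ * Fintype.card V) :
    Spl r D R m ((7 * δ + τ) * Fintype.card V) x := by
  intro R' hR hm hxR
  have g1 := hr R' x hm hxR
  have hE : Disjoint (C ∪ D) (C ∪ D)ᶜ := disjoint_compl_right
  have g2 : inc r Finset.univ R' x = inc r C R' x + inc r D R' x + inc r (C ∪ D)ᶜ R' x := by
    rw [← inc_union_of_det (h.detC.mono hR) h.disj,
      ← inc_union_of_det ((h.detC.union h.detD).mono hR) hE, Finset.union_compl]
  have g5 : inc r (C ∪ D)ᶜ R' x ≤ ((C ∪ D)ᶜ : Finset V).card := inc_le_card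
  have g6 := h.card_compl
  have g7 := card_le_of_disjoint h.disj h.cardC
  have g8 := hx R' hR hxR
  unfold dfc
  linarith

lemma Str.spl_of_typ (h : Str r δ η m' F R C D) (hr : Rich r δ m)
    (hx : inc r C R x < η * Fintype.card V) :
    Spl r D R m ((7 * δ + η) * Fintype.card V) x :=
  h.spl hr fun _ hR _ => (inc_anti hR).trans hx.le

/-- The number of ordered related pairs in `A`. -/
def edg (r : V → V → Prop) (A : Finset V) : ℝ := ((A ×ˢ A).filter fun p => r p.1 p.2).card

lemma edg_eq_sum (r : V → V → Prop) (A : Finset V) :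
    edg r A = ∑ u ∈ A, ((A.filter fun v => r v u).card : ℝ) := by
  unfold edg
  have : ((A ×ˢ A).filter fun p => r p.1 p.2).card = ∑ u ∈ A, (A.filter fun v => r v u).card := by
    rw [Finset.card_filter, Finset.sum_product_right]
    exact Finset.sum_congr rfl fun u _ => (Finset.card_filter _ _).symm
  exact_mod_cast this

lemma sum_card_filter_symm (hs : ∀ ⦃u v⦄, r u v → r v u) (A B : Finset V) :
    ∑ u ∈ A, ((B.filter fun v => r v u).card : ℝ) = ∑ u ∈ B, ((A.filter fun v => r v u).card : ℝ) := by
  simp only [Finset.card_filter, Nat.cast_sum]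
  rw [Finset.sum_comm]
  refine Finset.sum_congr rfl fun u _ => Finset.sum_congr rfl fun v _ => ?_
  rw [show r u v ↔ r v u from ⟨fun h => hs h, fun h => hs h⟩]

lemma Str.few_atyp (h : Str r δ η m' F R C D)
    (hF : (m' + F.card : ℝ) ≤ δ * Fintype.card V) :
    ((D.filter fun u => ¬ inc r D R u < η * Fintype.card V).card : ℝ) ≤
      11 * δ * Fintype.card V := by
  have : (D.filter fun u => ¬ inc r D R u < η * Fintype.card V) ⊆
      ((D \ (R ∪ F)).filter fun v => inc r C R v < η * Fintype.card V) ∪ (R ∪ F) := by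
    intro u hu
    rw [Finset.mem_filter] at hu
    by_cases hRF : u ∈ R ∪ F
    · exact Finset.mem_union_right _ hRF
    · refine Finset.mem_union_left _ ?_
      rw [Finset.mem_filter, Finset.mem_sdiff]
      rw [Finset.mem_union, not_or] at hRF
      exact ⟨⟨hu.1, by rw [Finset.mem_union, not_or]; exact hRF⟩,
        (h.typ u hRF.1 hRF.2).resolve_right hu.2⟩
  have h1 := Finset.card_le_card this
  have h2 := Finset.card_union_le ((D \ (R ∪ F)).filter fun v => inc r C R v < η * Fintype.card V)
    (R ∪ F)
  have h3 := Finset.card_union_le R F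
  have h4 := h.card_R
  have h5 : ((D.filter fun u => ¬ inc r D R u < η * Fintype.card V).card : ℝ) ≤
      ((D \ (R ∪ F)).filter fun v => inc r C R v < η * Fintype.card V).card + (m' + F.card : ℝ) := by
    exact_mod_cast h1.trans (h2.trans (by omega))
  linarith [h.fewC]

lemma sum_le_of_exceptions (A : Finset V) (p : V → Prop) (f : V → ℝ) {a b N : ℝ} (ha : 0 ≤ a)
    (hN : 0 ≤ N) (h1 : ∀ u ∈ A, p u → f u ≤ a) (h2 : ∀ u ∈ A, f u ≤ N)
    (hp : ((A.filter fun u => ¬ p u).card : ℝ) ≤ b) (hA : (A.card : ℝ) ≤ N) :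
    ∑ u ∈ A, f u ≤ a * N + b * N := by
  rw [← Finset.sum_filter_add_sum_filter_not A p]
  have g1 : ∑ u ∈ A with p u, f u ≤ (A.filter p).card * a := by
    rw [← nsmul_eq_mul]
    exact Finset.sum_le_card_nsmul _ _ _ fun u hu => h1 u (Finset.mem_filter.1 hu).1
      (Finset.mem_filter.1 hu).2
  have g2 : ∑ u ∈ A with ¬ p u, f u ≤ (A.filter fun u => ¬ p u).card * N := by
    rw [← nsmul_eq_mul]
    exact Finset.sum_le_card_nsmul _ _ _ fun u hu => h2 u (Finset.mem_filter.1 hu).1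
  have g3 : ((A.filter p).card : ℝ) ≤ N :=
    (Nat.cast_le.2 (Finset.card_le_card (Finset.filter_subset _ _))).trans hA
  have g4 := mul_le_mul_of_nonneg_right g3 ha
  have g5 := mul_le_mul_of_nonneg_right hp hN
  linarith

/-- If `D` is not sparse then the vertices typed with `C` induce no path on three vertices. -/
theorem Str.no_path (h : Str r δ η m' F R C D) (G : Tame r δ m) (hm : m' + 2 ≤ m)
    (hF : (m' + F.card : ℝ) ≤ δ * Fintype.card V) (hδ : 0 ≤ δ) (hη : 0 ≤ η)
    (hD : 200000 * (7 * δ + η) * (Fintype.card V : ℝ) ^ 2 < edg r D)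
    (hxR : x ∉ R) (hyR : y ∉ R) (hzR : z ∉ R) (hx : inc r C R x < η * Fintype.card V)
    (hy : inc r C R y < η * Fintype.card V) (hz : inc r C R z < η * Fintype.card V)
    (nxz : x ≠ z) (hxy : r x y) (hyz : r y z) : r x z := by
  by_contra hxz
  have nxy : x ≠ y := by rintro rfl; exact hxz hyz
  have nyz : y ≠ z := by rintro rfl; exact hxz hxy
  set n : ℝ := (Fintype.card V : ℝ) with hn
  have hn0 : 0 ≤ n := Nat.cast_nonneg _
  set κ := 7 * δ + η with hκ
  have hR := h.card_R
  have cx : (insert x R).card = R.card + 1 := Finset.card_insert_of_notMem hxR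
  have cy : (insert y (insert x R)).card ≤ R.card + 2 := by
    have := Finset.card_insert_le y (insert x R); omega
  have sx := h.spl_of_typ G.rich hx R Finset.Subset.rfl (by omega) hxR
  have sy := h.spl_of_typ G.rich hy (insert x R) (Finset.subset_insert _ _) (by omega)
    (by simp [nxy.symm, hyR])
  have sz := h.spl_of_typ G.rich hz (insert y (insert x R)) ((Finset.subset_insert _ _).trans
    (Finset.subset_insert _ _)) (by omega) (by simp [nxz.symm, nyz.symm, hzR])
  rw [← hn, ← hκ] at sx sy sz
  set d : Finset V → ℝ := fun T => 10 * (dfc r (cell r D R T) R x +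
    dfc r (cell r D R T) (insert x R) y + dfc r (cell r D R T) (insert y (insert x R)) z) with hd
  have hsum : ∑ T ∈ R.powerset, d T ≤ 30 * (κ * n) := by
    rw [hd, ← Finset.mul_sum, Finset.sum_add_distrib, Finset.sum_add_distrib,
      sum_dfc_cell h.detD Finset.Subset.rfl, sum_dfc_cell h.detD (Finset.subset_insert _ _),
      sum_dfc_cell h.detD ((Finset.subset_insert x R).trans (Finset.subset_insert _ _))]
    linarith
  have key : ∀ (a b c : Bool) (u : V), ((D.filter fun v => r v u).card : ℝ) / 64 ≤
      ((side r z c (side r y b (side r x a D))).filter fun v => r v u).card + 30 * (κ * n) +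
        2 * inc r D R u := by
    intro a b c u
    have := card_filter_le_of_dense (x := u) (R := R) (r := r)
      (S := side r z c (side r y b (side r x a D)))
      ((side_subset.trans side_subset).trans side_subset) d ?_ ?_
    · linarith
    · intro T
      have h1 := dfc_nonneg (r := r) (A := cell r D R T) (R := R) (x := x)
      have h2 := dfc_nonneg (r := r) (A := cell r D R T) (R := insert x R) (x := y)
      have h3 := dfc_nonneg (r := r) (A := cell r D R T) (R := insert y (insert x R)) (x := z)
      rw [hd]; dsimp only; linarith
    · intro T _
      rw [cell_side, cell_side, cell_side]
      exact card_three_sides (det_cell h.detD) a b c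
  have hηκ : η ≤ κ := by rw [hκ]; linarith
  have hηκn := mul_le_mul_of_nonneg_right hηκ hn0
  have hδκn := mul_le_mul_of_nonneg_right (show 7 * δ ≤ κ by rw [hκ]; linarith) hn0
  have hκ0 : 0 ≤ κ * n := mul_nonneg (by rw [hκ]; linarith) hn0
  have hle : ∀ S : Finset V, (S.card : ℝ) ≤ n := fun S => by
    rw [hn]; exact_mod_cast Finset.card_le_univ S
  set A₁ := side r z false (side r y false (side r x true D)) with hA₁
  set A₃ := side r z true (side r y false (side r x false D)) with hA₃
  have hA₁D : A₁ ⊆ D := (side_subset.trans side_subset).trans side_subset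
  have few := h.few_atyp hF
  rw [← hn] at few
  have step1 : ∀ u ∈ A₁, inc r D R u < η * n →
      ((D.filter fun v => r v u).card : ℝ) ≤ 2048 * (κ * n) := by
    intro u hu hi
    have h1 := key false false true u
    rw [← hA₃] at h1
    have h2 : A₃.filter (fun v => r v u) = ∅ := by
      rw [Finset.filter_eq_empty_iff]
      intro w hw hwu
      simp only [hA₁, hA₃, mem_side, iff_true, Bool.false_eq_true, iff_false] at hu hw
      exact G.noC5 x y z w u hxy hyz (G.symm hw.2) hwu hu.1.1.2 hxz
        (fun h' => hw.1.1.2 (G.symm h')) (fun h' => hw.1.2 (G.symm h'))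
        (fun h' => hu.1.2 (G.symm h')) (fun h' => hu.2 (G.symm h'))
    rw [h2, Finset.card_empty, Nat.cast_zero] at h1
    linarith
  have sum1 : ∑ u ∈ A₁, ((D.filter fun v => r v u).card : ℝ) ≤
      2048 * (κ * n) * n + 11 * δ * n * n :=
    sum_le_of_exceptions A₁ (fun u => inc r D R u < η * n) _ (by linarith) hn0 step1
      (fun u _ => hle _) ((Nat.cast_le.2 (Finset.card_le_card
        (Finset.filter_subset_filter _ hA₁D))).trans few) (hle _)
  have sum2 : ∑ u ∈ D, (((D.filter fun v => r v u).card : ℝ) / 64 -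
      (A₁.filter fun v => r v u).card) ≤ 32 * (κ * n) * n + 11 * δ * n * n := by
    refine sum_le_of_exceptions D (fun u => inc r D R u < η * n) _ (by linarith) hn0 ?_ ?_ few (hle _)
    · intro u _ hi
      have h1 := key true false false u
      rw [← hA₁] at h1
      linarith
    · intro u _
      have := hle (D.filter fun v => r v u)
      have h2 : (0 : ℝ) ≤ (A₁.filter fun v => r v u).card := Nat.cast_nonneg _
      linarith
  rw [Finset.sum_sub_distrib, ← Finset.sum_div, ← edg_eq_sum,
    ← sum_card_filter_symm G.symm A₁ D] at sum2
  have h3 := mul_le_mul_of_nonneg_right hδκn hn0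
  have h4 := mul_nonneg hκ0 hn0
  have h5 : 200000 * κ * n ^ 2 = 200000 * (κ * n * n) := by ring
  linarith

end Alpha

section Stability

variable {V : Type*} [DecidableEq V] [Fintype V] {r : V → V → Prop} {A B C D R R' S T F K : Finset V}
  {C' D' F' : Finset V} {x y z : V} {κ δ η ρ : ℝ} {m m' : ℕ}

lemma Hom.not {X : Finset V} (h : Hom r X) : Hom (fun u v => ¬ r u v) X :=
  h.symm.imp id fun h x hx y hy hxy => not_not.2 (h x hx y hy hxy)

lemma Tame.not (h : Tame r δ m) : Tame (fun u v => ¬ r u v) δ m where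
  symm _ _ huv hvu := huv (h.symm hvu)
  noC5 := h.noC5.not h.symm
  ram A s hs := by
    obtain ⟨X, h1, h2, h3⟩ := h.ram A s hs
    exact ⟨X, h1, h2, h3.not⟩
  rich := h.rich.not

/-- A structure in which `C` is nearly a clique and `D` nearly stable. -/
structure SplitStr (r : V → V → Prop) (δ η ρ : ℝ) (m : ℕ) (F R C D : Finset V) : Prop extends
    Str r δ η m F R C D where
  dense : edg (fun u v => ¬ r u v) C ≤ ρ * (Fintype.card V : ℝ) ^ 2
  sparse : edg r D ≤ ρ * (Fintype.card V : ℝ) ^ 2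

lemma SplitStr.dual (h : SplitStr r δ η ρ m F R C D) :
    SplitStr (fun u v => ¬ r u v) δ η ρ m F R D C where
  toStr := h.toStr.not.swap
  dense := by simp only [not_not]; exact h.sparse
  sparse := h.dense

lemma exists_not_rel (hA : A ⊆ D) (hB : B ⊆ D) (h : edg r D < (A.card : ℝ) * B.card) :
    ∃ a ∈ A, ∃ b ∈ B, ¬ r a b := by
  by_contra hc
  push Not at hc
  have : A ×ˢ B ⊆ (D ×ˢ D).filter fun p => r p.1 p.2 := by
    rintro ⟨a, b⟩ hab
    rw [Finset.mem_product] at hab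
    rw [Finset.mem_filter, Finset.mem_product]
    exact ⟨⟨hA hab.1, hB hab.2⟩, hc a hab.1 b hab.2⟩
  have h1 := Finset.card_le_card this
  rw [Finset.card_product] at h1
  have h2 : (A.card : ℝ) * B.card ≤ edg r D := by unfold edg; exact_mod_cast h1
  linarith

lemma edg_not (r : V → V → Prop) (A : Finset V) :
    edg (fun u v => ¬ r u v) A = ((A ×ˢ A).filter fun p => ¬ r p.1 p.2).card := by
  unfold edg; congr!

lemma card_offDiag_real (A : Finset V) : (A.offDiag.card : ℝ) = A.card * (A.card - 1) := by
  rw [Finset.offDiag_card, Nat.cast_sub (Nat.le_mul_self _)]; push_cast; ring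

lemma exists_rel (hA : A ⊆ C)
    (h : edg (fun u v => ¬ r u v) C < (A.card : ℝ) * (A.card - 1)) :
    ∃ a ∈ A, ∃ b ∈ A, a ≠ b ∧ r a b := by
  by_contra hc
  push Not at hc
  have : A.offDiag ⊆ (C ×ˢ C).filter fun p => ¬ r p.1 p.2 := by
    rintro ⟨a, b⟩ hab
    rw [Finset.mem_offDiag] at hab
    rw [Finset.mem_filter, Finset.mem_product]
    exact ⟨⟨hA hab.1, hA hab.2.1⟩, hc a hab.1 b hab.2.1 hab.2.2⟩
  have h1 : (A.offDiag.card : ℝ) ≤ edg (fun u v => ¬ r u v) C := by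
    rw [edg_not]; exact_mod_cast Finset.card_le_card this
  rw [card_offDiag_real] at h1
  linarith

lemma SplitStr.card_inter (h : SplitStr r δ η ρ m F R C D) (h' : SplitStr r δ η ρ m F' R' C' D') :
    ((C ∩ D').card : ℝ) * ((C ∩ D').card - 1) ≤ 2 * ρ * (Fintype.card V : ℝ) ^ 2 := by
  have : (C ∩ D').offDiag ⊆ ((C ×ˢ C).filter fun p => ¬ r p.1 p.2) ∪
      ((D' ×ˢ D').filter fun p => r p.1 p.2) := by
    rintro ⟨a, b⟩ hab
    simp only [Finset.mem_offDiag, Finset.mem_inter] at hab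
    simp only [Finset.mem_union, Finset.mem_filter, Finset.mem_product]
    tauto
  have h1 := (Finset.card_le_card this).trans (Finset.card_union_le _ _)
  have h2 : ((C ∩ D').offDiag.card : ℝ) ≤ edg (fun u v => ¬ r u v) C + edg r D' := by
    rw [edg_not]; unfold edg; exact_mod_cast h1
  rw [card_offDiag_real] at h2
  linarith [h.dense, h'.sparse]

lemma le_of_mul_pred_le {a σ ρ n : ℝ} (h : a * (a - 1) ≤ 2 * ρ * n ^ 2) (hσ : 4 * ρ ≤ σ ^ 2)
    (hn : 2 < σ * n) : a ≤ σ * n := by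
  by_contra hc
  push Not at hc
  have h1 : (σ * n) * (a - 1) < a * (a - 1) := mul_lt_mul_of_pos_right hc (by linarith)
  have h2 : (σ * n) * (σ * n / 2) ≤ (σ * n) * (a - 1) :=
    mul_le_mul_of_nonneg_left (by linarith) (by linarith)
  have h3 := mul_le_mul_of_nonneg_right hσ (sq_nonneg n)
  have h4 : (σ * n) * (σ * n / 2) = σ ^ 2 * n ^ 2 / 2 := by ring
  linarith

lemma SplitStr.card_inter_le (h : SplitStr r δ η (1 / 10 ^ 15) m F R C D)
    (h' : SplitStr r δ η (1 / 10 ^ 15) m F' R' C' D') (hn : 10 ^ 30 ≤ Fintype.card V) :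
    ((C ∩ D').card : ℝ) ≤ 1 / 10 ^ 7 * Fintype.card V := by
  have hn' : (10 : ℝ) ^ 30 ≤ Fintype.card V := by exact_mod_cast hn
  exact le_of_mul_pred_le (h.card_inter h') (by norm_num) (by linarith)

lemma SplitStr.card_sdiff_le (h : SplitStr r δ η (1 / 10 ^ 15) m F R C D)
    (h' : SplitStr r δ η (1 / 10 ^ 15) m F' R' C' D') (hδ : δ ≤ 1 / 10 ^ 23)
    (hn : 10 ^ 30 ≤ Fintype.card V) :
    ((C \ C').card : ℝ) ≤ 2 / 10 ^ 7 * Fintype.card V := by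
  have h1 := h.card_inter_le h' hn
  have h2 := h'.card_compl
  have h3 : C \ C' ⊆ (C ∩ D') ∪ (C' ∪ D')ᶜ := by
    intro v
    simp only [Finset.mem_sdiff, Finset.mem_union, Finset.mem_inter, Finset.mem_compl]
    tauto
  have h4 : ((C \ C').card : ℝ) ≤ (C ∩ D').card + ((C' ∪ D')ᶜ : Finset V).card := by
    exact_mod_cast (Finset.card_le_card h3).trans (Finset.card_union_le _ _)
  have h5 := mul_le_mul_of_nonneg_right hδ (Nat.cast_nonneg (α := ℝ) (Fintype.card V))
  linarith

/-- No vertex has many neighbours in `D` and many non-neighbours in `C`. -/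
theorem SplitStr.few (h : SplitStr r δ η (1 / 10 ^ 15) m' F R C D) (G : Tame r δ m)
    (hm : m' + 2 ≤ m)
    (hF : (m' + F.card : ℝ) ≤ δ * Fintype.card V) (hδ : δ ≤ 1 / 10 ^ 23)
    (hη : η ≤ 1 / 10 ^ 21) (hn : 10 ^ 30 ≤ Fintype.card V) (v : V) :
    ((D.filter fun u => r u v).card : ℝ) < 1 / 10 ^ 6 * Fintype.card V ∨
      ((C.filter fun u => ¬ r u v).card : ℝ) < 1 / 10 ^ 6 * Fintype.card V := by
  by_contra hc
  push Not at hc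
  obtain ⟨hP, hW⟩ := hc
  have hn' : (10 : ℝ) ^ 30 ≤ Fintype.card V := by exact_mod_cast hn
  set n : ℝ := (Fintype.card V : ℝ) with hnn
  set P := D.filter fun u => r u v with hPd
  set W := C.filter fun u => ¬ r u v with hWd
  have hδn := mul_le_mul_of_nonneg_right hδ (show 0 ≤ n by linarith)
  have hηn := mul_le_mul_of_nonneg_right hη (show 0 ≤ n by linarith)
  have few := h.swap.few_atyp hF
  rw [← hnn] at few
  set W' := (W \ (insert v R)).filter fun u => inc r C R u < η * n with hW'
  have cW : (1 / 10 ^ 6 - 1 / 10 ^ 8 : ℝ) * n ≤ W'.card := by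
    have h1 : W ⊆ W' ∪ (insert v R ∪ (C.filter fun u => ¬ inc r C R u < η * n)) := by
      intro u hu
      have huC : u ∈ C := (Finset.mem_filter.1 hu).1
      simp only [hW', Finset.mem_union, Finset.mem_filter, Finset.mem_sdiff]
      tauto
    have h2 := (Finset.card_le_card h1).trans ((Finset.card_union_le _ _).trans
      (Nat.add_le_add_left (Finset.card_union_le _ _) _))
    have h3 := Finset.card_insert_le v R
    have h4 := h.card_R
    have h5 : (W.card : ℝ) ≤ W'.card + ((m' + 1) +
        (C.filter fun u => ¬ inc r C R u < η * n).card) := by exact_mod_cast h2.trans (by omega)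
    have h6 : (0 : ℝ) ≤ F.card := Nat.cast_nonneg _
    linarith
  have hW'C : W' ⊆ C := (Finset.filter_subset _ _).trans (Finset.sdiff_subset.trans
    (Finset.filter_subset _ _))
  obtain ⟨s, hs, t, ht, hst, hrst⟩ := exists_rel hW'C (r := r) (by
    refine lt_of_le_of_lt h.dense ?_
    rw [← hnn]
    have h1 : (1 / 10 ^ 7 * n) * (1 / 10 ^ 7 * n) ≤ (W'.card : ℝ) * (W'.card - 1) :=
      mul_le_mul (by linarith) (by linarith) (by linarith) (by linarith)
    have h2 : 0 < n ^ 2 := by have : 0 < n := by linarith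
                              positivity
    linarith)
  have mW : ∀ u ∈ W', ¬ r u v ∧ u ∉ insert v R ∧ inc r C R u < η * n := by
    intro u hu
    simp only [hW', hWd, Finset.mem_filter, Finset.mem_sdiff] at hu
    exact ⟨hu.1.1.2, hu.1.2, hu.2⟩
  obtain ⟨sv, sR, si⟩ := mW s hs
  obtain ⟨tv, tR, ti⟩ := mW t ht
  have dP : Det r (insert v R) P := by
    have := h.detD.side (x := v) (b := true)
    unfold side at this
    simpa using this
  have hPD : P ⊆ D := Finset.filter_subset _ _
  have spl : ∀ u, inc r C R u < η * n → Spl r P (insert v R) m ((7 * δ + η) * n) u := fun u hu =>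
    ((h.spl_of_typ G.rich hu).mono_base (Finset.subset_insert _ _)).mono_set dP hPD
  have hc1 : (insert v R).card + 1 ≤ m := by
    have := Finset.card_insert_le v R
    have := h.card_R
    omega
  have q1 := card_two_sides dP (spl s si) (spl t ti) hst sR tR hc1 true false
  have q2 := card_two_sides dP (spl s si) (spl t ti) hst sR tR hc1 false true
  have big : (5 / 10 ^ 8 : ℝ) * n ≤ P.card / 16 - 20 * ((7 * δ + η) * n) := by linarith
  obtain ⟨a, ha, b, hb, hab⟩ := exists_not_rel (r := r)
    ((side_subset.trans (side_subset.trans hPD)) :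
      side r t false (side r s true P) ⊆ D)
    ((side_subset.trans (side_subset.trans hPD)) : side r t true (side r s false P) ⊆ D) (by
      refine lt_of_le_of_lt h.sparse ?_
      rw [← hnn]
      have h1 := mul_le_mul (big.trans q1) (big.trans q2) (by linarith) (Nat.cast_nonneg _)
      refine lt_of_lt_of_le ?_ h1
      have h2 : 0 < n ^ 2 := by have : 0 < n := by linarith
                                positivity
      linarith)
  simp only [mem_side, iff_true, Bool.false_eq_true, iff_false, hPd, Finset.mem_filter] at ha hb
  exact G.noC5 v a s t b (G.symm ha.1.1.2) ha.1.2 hrst (G.symm hb.2) hb.1.1.2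
    (fun h' => sv (G.symm h')) (fun h' => tv (G.symm h')) ha.2 hab (fun h' => hb.1.2 (G.symm h'))

lemma inc_le_of_few (hC : ((C.filter fun u => r u x).card : ℝ) ≤ 2 / 10 ^ 6 * Fintype.card V) :
    inc r C R x ≤ 5 / 10 ^ 5 * Fintype.card V := by
  have h1 : inc r C R x ≤ inc r C ∅ x := inc_anti (Finset.empty_subset _)
  have h2 : inc r C ∅ x = eta (C.filter fun u => r u x).card (C.filter fun u => ¬ r u x).card := by
    simp [inc, cell, tr]
  have h3 := eta_small (Nat.cast_nonneg (α := ℝ) (C.filter fun u => r u x).card)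
    (Nat.cast_nonneg (α := ℝ) (C.filter fun u => ¬ r u x).card) 20 (by norm_num)
  have h4 := card_real_le_univ (C.filter fun u => ¬ r u x)
  rw [← h2] at h3
  push_cast at h3
  have h5 : (0 : ℝ) ≤ Fintype.card V := Nat.cast_nonneg _
  norm_num at h3
  linarith

lemma inc_le_of_few' (hC : ((C.filter fun u => ¬ r u x).card : ℝ) ≤ 2 / 10 ^ 6 * Fintype.card V) :
    inc r C R x ≤ 5 / 10 ^ 5 * Fintype.card V := by
  rw [← inc_not]; refine inc_le_of_few ?_; convert hC

/-- The conditions under which all structures are controlled. -/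
structure Ctl (r : V → V → Prop) (δ η : ℝ) (m m' : ℕ) : Prop extends Tame r δ m where
  le_m : m' + 2 ≤ m
  four : (m' + 4 : ℝ) ≤ δ * Fintype.card V
  δ_nonneg : 0 ≤ δ
  δ_le : δ ≤ 1 / 10 ^ 23
  η_nonneg : 0 ≤ η
  η_le : η ≤ 1 / 10 ^ 21
  large : 10 ^ 30 ≤ Fintype.card V

lemma Ctl.not (h : Ctl r δ η m m') : Ctl (fun u v => ¬ r u v) δ η m m' :=
  { h with toTame := h.toTame.not }

/-- Every vertex outside `K` is nearly isolated from `D`, every vertex in `K` nearly complete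
to `C`. -/
def Fits (r : V → V → Prop) (C D K : Finset V) : Prop :=
  (∀ v ∈ K, ((C.filter fun u => ¬ r u v).card : ℝ) ≤ 2 / 10 ^ 6 * Fintype.card V) ∧
    ∀ v ∉ K, ((D.filter fun u => r u v).card : ℝ) ≤ 2 / 10 ^ 6 * Fintype.card V

lemma Fits.not (h : Fits r C D K) : Fits (fun u v => ¬ r u v) D C Kᶜ := by
  refine ⟨fun v hv => ?_, fun v hv => ?_⟩
  · simp only [not_not]; exact h.2 v (Finset.mem_compl.1 hv)
  · convert h.1 v (by simpa using hv)

lemma exists_fits (G : Ctl r δ η m m') (hF₀ : F'.card ≤ 4)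
    (h₀ : SplitStr r δ η (1 / 10 ^ 15) m' F' R' C' D') :
    ∃ K : Finset V, ∀ F R C D, SplitStr r δ η (1 / 10 ^ 15) m' F R C D → Fits r C D K := by
  refine ⟨Finset.univ.filter fun v =>
    ((C'.filter fun u => ¬ r u v).card : ℝ) < 1 / 10 ^ 6 * Fintype.card V, ?_⟩
  intro F R C D h
  have hF : (m' + F'.card : ℝ) ≤ δ * Fintype.card V := by
    have : (F'.card : ℝ) ≤ 4 := by exact_mod_cast hF₀
    linarith [G.four]
  refine ⟨fun v hv => ?_, fun v hv => ?_⟩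
  · simp only [Finset.mem_filter, Finset.mem_univ, true_and] at hv
    have h1 := h.card_sdiff_le h₀ G.δ_le G.large
    have h2 : (C.filter fun u => ¬ r u v) ⊆ (C \ C') ∪ (C'.filter fun u => ¬ r u v) := by
      intro u
      simp only [Finset.mem_union, Finset.mem_filter, Finset.mem_sdiff]
      tauto
    have h3 : ((C.filter fun u => ¬ r u v).card : ℝ) ≤
        (C \ C').card + (C'.filter fun u => ¬ r u v).card := by
      exact_mod_cast (Finset.card_le_card h2).trans (Finset.card_union_le _ _)
    linarith
  · simp only [Finset.mem_filter, Finset.mem_univ, true_and] at hv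
    have h0 := (h₀.few G.toTame G.le_m hF G.δ_le G.η_le
      G.large v).resolve_right hv
    have h1 := h.dual.card_sdiff_le h₀.dual G.δ_le G.large
    have h2 : (D.filter fun u => r u v) ⊆ (D \ D') ∪ (D'.filter fun u => r u v) := by
      intro u
      simp only [Finset.mem_union, Finset.mem_filter, Finset.mem_sdiff]
      tauto
    have h3 : ((D.filter fun u => r u v).card : ℝ) ≤
        (D \ D').card + (D'.filter fun u => r u v).card := by
      exact_mod_cast (Finset.card_le_card h2).trans (Finset.card_union_le _ _)
    linarith

lemma Fits.spl (hK : Fits r C D K) (G : Ctl r δ η m m') (h : SplitStr r δ η ρ m' F R C D)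
    (hx : x ∈ K) : Spl r D R m (6 / 10 ^ 5 * Fintype.card V) x := by
  intro R' h1 h2 h3
  have := (h.spl G.rich (x := x) fun R' _ _ => inc_le_of_few' (hK.1 x hx)) R' h1 h2 h3
  have h5 := mul_le_mul_of_nonneg_right G.δ_le (Nat.cast_nonneg (α := ℝ) (Fintype.card V))
  linarith [Nat.cast_nonneg (α := ℝ) (Fintype.card V)]

lemma Fits.no_coPath (hK : Fits r C D K) (G : Ctl r δ η m m') (hm : m' + 2 ≤ m)
    (h : SplitStr r δ η (1 / 10 ^ 15) m' {x, y, z} R C D) (hx : x ∈ K) (hy : y ∈ K) (hz : z ∈ K)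
    (hxz : x ≠ z) (h1 : r x z) (h2 : ¬ r x y) (h3 : ¬ r z y) : False := by
  have hn : (10 : ℝ) ^ 30 ≤ Fintype.card V := by exact_mod_cast G.large
  have hxy : x ≠ y := by rintro rfl; exact h3 (G.symm h1)
  have hyz : y ≠ z := by rintro rfl; exact h2 h1
  have hd := h.disj_F
  rw [Finset.disjoint_right] at hd
  have xR : x ∉ R := hd (by simp)
  have yR : y ∉ R := hd (by simp)
  have zR : z ∉ R := hd (by simp)
  have hc : R.card + 2 ≤ m := by have := h.card_R; omega
  have q1 := card_three_sides' h.detD xR yR zR hxy hxz hyz hc (hK.spl G h hx) (hK.spl G h hy)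
    (hK.spl G h hz) false true true
  have q2 := card_three_sides' h.detD xR yR zR hxy hxz hyz hc (hK.spl G h hx) (hK.spl G h hy)
    (hK.spl G h hz) true true false
  have hδn := mul_le_mul_of_nonneg_right G.δ_le (Nat.cast_nonneg (α := ℝ) (Fintype.card V))
  have big : (5 / 10 ^ 3 : ℝ) * Fintype.card V ≤
      D.card / 64 - 30 * (6 / 10 ^ 5 * Fintype.card V) := by linarith [h.cardD]
  obtain ⟨a, ha, b, hb, hab⟩ := exists_not_rel (r := r)
    ((side_subset.trans (side_subset.trans side_subset)) :
      side r z true (side r y true (side r x false D)) ⊆ D)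
    ((side_subset.trans (side_subset.trans side_subset)) :
      side r z false (side r y true (side r x true D)) ⊆ D) (by
      refine lt_of_le_of_lt h.sparse ?_
      have h1 := mul_le_mul (big.trans q1) (big.trans q2) (by linarith) (Nat.cast_nonneg _)
      refine lt_of_lt_of_le ?_ h1
      have h2 : 0 < (Fintype.card V : ℝ) ^ 2 := by
        have : 0 < (Fintype.card V : ℝ) := by linarith
        positivity
      linarith)
  simp only [mem_side, iff_true, Bool.false_eq_true, iff_false] at ha hb
  exact G.noC5 x z a y b h1 (G.symm ha.2) ha.1.2 (G.symm hb.1.2) hb.1.1.2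
    (fun h' => ha.1.1.2 (G.symm h')) h2 h3 (fun h' => hb.2 (G.symm h')) hab

lemma Fits.no_square (hK : Fits r C D K) (G : Ctl r δ η m m') {p q a b : V}
    (h : SplitStr r δ η (1 / 10 ^ 15) m' {p, q, a, b} R C D) (hp : p ∈ K) (hq : q ∈ K)
    (ha : a ∉ K) (hb : b ∉ K) (hpq : ¬ r p q) (hab : r a b) (hpa : r p a) (hqb : r q b)
    (hpb : ¬ r p b) (hqa : ¬ r q a) : False := by
  have hn : (10 : ℝ) ^ 30 ≤ Fintype.card V := by exact_mod_cast G.large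
  have nab : a ≠ b := by rintro rfl; exact hpb hpa
  have hd := h.disj_F
  rw [Finset.disjoint_right] at hd
  have aR : a ∉ R := hd (by simp)
  have bR : b ∉ R := hd (by simp)
  have hc : R.card + 1 ≤ m := by have := h.card_R; have := G.le_m; omega
  have spl : ∀ x, x ∉ K → Spl r C R m (6 / 10 ^ 5 * Fintype.card V) x := by
    intro x hx R' h1 h2 h3
    have := (hK.not.spl G.not h.dual (Finset.mem_compl.2 hx)) R' h1 h2 h3
    unfold dfc at *
    rwa [inc_not] at this
  have q1 := card_two_sides h.detC (spl a ha) (spl b hb) nab aR bR hc false false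
  have hδn := mul_le_mul_of_nonneg_right G.δ_le (Nat.cast_nonneg (α := ℝ) (Fintype.card V))
  have g1 := h.cardC
  have g2 := hK.1 p hp
  have g3 := hK.1 q hq
  obtain ⟨k, hk, hk'⟩ : ∃ k ∈ side r b false (side r a false C),
      k ∉ (C.filter fun u => ¬ r u p) ∪ (C.filter fun u => ¬ r u q) := by
    by_contra hcon
    push Not at hcon
    have h1 := (Finset.card_le_card hcon).trans (Finset.card_union_le _ _)
    have h2 : ((side r b false (side r a false C)).card : ℝ) ≤
      (C.filter fun u => ¬ r u p).card + (C.filter fun u => ¬ r u q).card := by exact_mod_cast h1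
    linarith
  simp only [mem_side, Bool.false_eq_true, iff_false, Finset.mem_union, Finset.mem_filter,
    not_or, not_and, not_not] at hk hk'
  have kC := hk.1.1
  exact G.noC5 k p a b q (hk'.1 kC) hpa hab (G.symm hqb) (G.symm (hk'.2 kC)) hk.1.2 hk.2 hpb hpq
    (fun hn => hqa (G.symm hn))

/-- The vertex set splits into a co-cluster graph and a cluster graph with few squares between. -/
structure NearSplit (r : V → V → Prop) (K : Finset V) : Prop where
  no_coPath : ∀ x ∈ K, ∀ y ∈ K, ∀ z ∈ K, x ≠ z → r x z → ¬ r x y → ¬ r z y → False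
  no_path : ∀ x ∉ K, ∀ y ∉ K, ∀ z ∉ K, x ≠ z → ¬ r x z → r x y → r z y → False
  no_square : ∀ p ∈ K, ∀ q ∈ K, ∀ a ∉ K, ∀ b ∉ K, ¬ r p q → r a b → r p a → r q b →
    ¬ r p b → ¬ r q a → False

theorem exists_nearSplit (G : Ctl r δ η m m')
    (h : ∀ F : Finset V, F.card ≤ 4 → ∃ R C D, SplitStr r δ η (1 / 10 ^ 15) m' F R C D) :
    ∃ K, NearSplit r K := by
  obtain ⟨R₀, C₀, D₀, h₀⟩ := h ∅ (by simp)
  obtain ⟨K, hK⟩ := exists_fits G (by simp) h₀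
  refine ⟨K, ⟨?_, ?_, ?_⟩⟩
  · intro x hx y hy z hz nxz h1 h2 h3
    obtain ⟨R, C, D, hS⟩ := h {x, y, z} (Finset.card_le_three.trans (by norm_num))
    exact (hK _ _ _ _ hS).no_coPath G G.le_m hS hx hy hz nxz h1 h2 h3
  · intro x hx y hy z hz nxz h1 h2 h3
    obtain ⟨R, C, D, hS⟩ := h {x, y, z} (Finset.card_le_three.trans (by norm_num))
    exact (hK _ _ _ _ hS).not.no_coPath G.not G.le_m hS.dual (Finset.mem_compl.2 hx)
      (Finset.mem_compl.2 hy) (Finset.mem_compl.2 hz) nxz h1 (not_not.2 h2) (not_not.2 h3)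
  · intro p hp q hq a ha b hb h1 h2 h3 h4 h5 h6
    obtain ⟨R, C, D, hS⟩ := h {p, q, a, b} Finset.card_le_four
    exact (hK _ _ _ _ hS).no_square G hS hp hq ha hb h1 h2 h3 h4 h5 h6

end Stability

section Clusters

variable {V : Type*} [DecidableEq V] [Fintype V] {r : V → V → Prop} {A B C D R S F X Y Q : Finset V}
  {δ η ρ t : ℝ} {m' m : ℕ}

/-- `r` is transitive on `X` off the diagonal. -/
def Cluster (r : V → V → Prop) (X : Finset V) : Prop :=
  ∀ x ∈ X, ∀ y ∈ X, ∀ z ∈ X, x ≠ z → r x y → r y z → r x z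

lemma Cluster.mono (h : Cluster r Y) (hXY : X ⊆ Y) : Cluster r X :=
  fun x hx y hy z hz => h x (hXY hx) y (hXY hy) z (hXY hz)

lemma Cluster.nbhd (h : Cluster r X) (hs : ∀ ⦃u v⦄, r u v → r v u) {u : V} (hu : u ∈ X) :
    ∀ x ∈ X.filter fun v => r v u, ∀ y ∈ X.filter fun v => r v u, x ≠ y → r x y := by
  intro x hx y hy hxy
  rw [Finset.mem_filter] at hx hy
  exact h x hx.1 u hu y hy.1 hxy hx.2 (hs hy.2)

lemma Cluster.clique (h : Cluster r X) (h' : Cluster (fun u v => ¬ r u v) X)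
    (hs : ∀ ⦃u v⦄, r u v → r v u) {u v : V} (hu : u ∈ X) (hv : v ∈ X) (huv : u ≠ v)
    (hr : r u v) : ∀ x ∈ X, ∀ y ∈ X, x ≠ y → r x y := by
  have key : ∀ w ∈ X, u ≠ w → r u w := by
    intro w hw huw
    by_contra hc
    by_cases hvw : r v w
    · exact hc (h u hu v hv w hw huw hr hvw)
    · exact h' u hu w hw v hv huv hc (fun h1 => hvw (hs h1)) hr
  intro x hx y hy hxy
  by_cases hux : u = x
  · subst hux; exact key y hy hxy
  by_cases huy : u = y
  · subst huy; exact hs (key x hx hux)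
  exact h x hx u hu y hy hxy (hs (key x hx hux)) (key y hy huy)

lemma exists_large_degree (ht : ((C \ X).card : ℝ) ≤ t * Fintype.card V) (htρ : 2 * t ≤ ρ)
    (h : ρ * (Fintype.card V : ℝ) ^ 2 < edg r C) :
    ∃ u ∈ X, (ρ - 2 * t) * Fintype.card V ≤ (X.filter fun v => r v u).card := by
  by_contra hc
  push Not at hc
  have hn : (0 : ℝ) ≤ Fintype.card V := Nat.cast_nonneg _
  have hρ := mul_nonneg (sub_nonneg.2 htρ) hn
  have h1 : ∀ u, ((C.filter fun v => r v u).card : ℝ) ≤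
      (X.filter fun v => r v u).card + t * Fintype.card V := by
    intro u
    have h2 : (C.filter fun v => r v u) ⊆ (X.filter fun v => r v u) ∪ (C \ X) := by
      intro v
      simp only [Finset.mem_union, Finset.mem_filter, Finset.mem_sdiff]
      tauto
    have h3 : ((C.filter fun v => r v u).card : ℝ) ≤
        (X.filter fun v => r v u).card + (C \ X).card := by
      exact_mod_cast (Finset.card_le_card h2).trans (Finset.card_union_le _ _)
    linarith
  rw [edg_eq_sum] at h
  have h2 := sum_le_of_exceptions C (fun u => u ∈ X) (fun u => ((C.filter fun v => r v u).card : ℝ))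
    (a := (ρ - t) * Fintype.card V) (b := t * Fintype.card V) (N := Fintype.card V)
    (by linarith [(Nat.cast_nonneg (α := ℝ) (C \ X).card).trans ht])
    hn (fun u _ huX => by linarith [h1 u, hc u huX]) (fun u _ => card_real_le_univ _) ?_
    (card_real_le_univ _)
  · have : (ρ - t) * Fintype.card V * Fintype.card V + t * Fintype.card V * Fintype.card V =
      ρ * (Fintype.card V : ℝ) ^ 2 := by ring
    linarith
  · convert ht using 3
    ext; simp

lemma edg_not_eq_sum (r : V → V → Prop) (A : Finset V) :
    edg (fun u v => ¬ r u v) A = ∑ u ∈ A, ((A.filter fun v => ¬ r v u).card : ℝ) := by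
  rw [edg_eq_sum]
  exact Finset.sum_congr rfl fun u _ => by congr!

lemma exists_small_codegree (hX : X ⊆ C) (hX3 : (Fintype.card V : ℝ) / 3 ≤ X.card)
    (hV : (0 : ℝ) < Fintype.card V)
    (h : edg (fun u v => ¬ r u v) C ≤ ρ * (Fintype.card V : ℝ) ^ 2) (hρ : 0 ≤ ρ) :
    ∃ u ∈ X, (X.card : ℝ) - 3 * ρ * Fintype.card V ≤ (X.filter fun v => r v u).card := by
  by_contra hc
  push Not at hc
  have hne : X.Nonempty := by
    rw [← Finset.card_pos]
    have : (0 : ℝ) < X.card := by linarith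
    exact_mod_cast this
  have h1 : edg (fun u v => ¬ r u v) X ≤ edg (fun u v => ¬ r u v) C := by
    rw [edg_not, edg_not]
    exact_mod_cast Finset.card_le_card (Finset.filter_subset_filter _
      (Finset.product_subset_product hX hX))
  rw [edg_not_eq_sum] at h1
  have h2 : ∑ u ∈ X, 3 * ρ * Fintype.card V <
      ∑ u ∈ X, ((X.filter fun v => ¬ r v u).card : ℝ) := by
    refine Finset.sum_lt_sum_of_nonempty hne fun u hu => ?_
    linarith [hc u hu, card_filter_split X (fun v => r v u)]
  rw [Finset.sum_const, nsmul_eq_mul] at h2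
  have h4 := mul_le_mul_of_nonneg_right hX3 (show 0 ≤ 3 * ρ * (Fintype.card V : ℝ) by positivity)
  have h5 : (Fintype.card V : ℝ) / 3 * (3 * ρ * Fintype.card V) = ρ * (Fintype.card V : ℝ) ^ 2 := by
    ring
  linarith

/-- Off `S`, the vertices split into two cluster graphs having two cliques that jointly cover
more than half of everything. -/
structure TwoCluster (r : V → V → Prop) (s : ℕ) (c : ℝ) (S A Q Q' : Finset V) : Prop where
  card_S : S.card ≤ s
  disj : Disjoint S A
  left : Cluster r A
  right : Cluster r (S ∪ A)ᶜ
  subQ : Q ⊆ A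
  subQ' : Q' ⊆ (S ∪ A)ᶜ
  cliqueQ : ∀ x ∈ Q, ∀ y ∈ Q, x ≠ y → r x y
  cliqueQ' : ∀ x ∈ Q', ∀ y ∈ Q', x ≠ y → r x y
  card_le : (1 / 2 + c) * Fintype.card V ≤ (Q.card + Q'.card : ℝ)

theorem Str.twoCluster (h : Str r δ η m' F R C D) (G : Ctl r δ η m m') (hF : F.card ≤ 4)
    (hC : 1 / 10 ^ 15 * (Fintype.card V : ℝ) ^ 2 < edg r C)
    (hD : 1 / 10 ^ 15 * (Fintype.card V : ℝ) ^ 2 < edg r D) :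
    ∃ S A Q Q', TwoCluster r (m' + 4) (1 / 10 ^ 16) S A Q Q' := by
  have hn : (10 : ℝ) ^ 30 ≤ Fintype.card V := by exact_mod_cast G.large
  have hn0 : (0 : ℝ) ≤ Fintype.card V := Nat.cast_nonneg _
  have hF' : (m' + F.card : ℝ) ≤ δ * Fintype.card V := by
    have : (F.card : ℝ) ≤ 4 := by exact_mod_cast hF
    linarith [G.four]
  have hδn := mul_le_mul_of_nonneg_right G.δ_le hn0
  have hδ0 := mul_nonneg G.δ_nonneg hn0
  have hthr : ∀ e : ℝ, 1 / 10 ^ 15 * (Fintype.card V : ℝ) ^ 2 < e →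
      200000 * (7 * δ + η) * (Fintype.card V : ℝ) ^ 2 < e := fun e he =>
    lt_of_le_of_lt (mul_le_mul_of_nonneg_right (by linarith [G.δ_le, G.η_le]) (sq_nonneg _)) he
  set A := ((R ∪ F)ᶜ : Finset V).filter fun v => inc r C R v < η * Fintype.card V with hA
  have mA : ∀ x ∈ A, x ∉ R ∧ inc r C R x < η * Fintype.card V := by
    intro x hx
    simp only [hA, Finset.mem_filter, Finset.mem_compl, Finset.mem_union, not_or] at hx
    exact ⟨hx.1.1, hx.2⟩
  have mB : ∀ x ∈ (R ∪ F ∪ A)ᶜ, x ∉ R ∧ inc r D R x < η * Fintype.card V := by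
    intro x hx
    simp only [hA, Finset.mem_filter, Finset.mem_compl, Finset.mem_union, not_or] at hx
    exact ⟨hx.1.1, (h.typ x hx.1.1 hx.1.2).resolve_left fun h1 => hx.2 ⟨hx.1, h1⟩⟩
  have key1 : ∀ r' : V → V → Prop, Str r' δ η m' F R C D → Tame r' δ m →
      1 / 10 ^ 15 * (Fintype.card V : ℝ) ^ 2 < edg r' D →
      (∀ x ∈ A, inc r' C R x < η * Fintype.card V) → Cluster r' A := by
    intro r' h' G' hD' hi x hx y hy z hz hxz hxy hyz
    exact h'.no_path G' G.le_m hF' G.δ_nonneg G.η_nonneg (hthr _ hD') (mA x hx).1 (mA y hy).1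
      (mA z hz).1 (hi x hx) (hi y hy) (hi z hz) hxz hxy hyz
  have key2 : ∀ r' : V → V → Prop, Str r' δ η m' F R C D → Tame r' δ m →
      1 / 10 ^ 15 * (Fintype.card V : ℝ) ^ 2 < edg r' C →
      (∀ x ∈ (R ∪ F ∪ A)ᶜ, inc r' D R x < η * Fintype.card V) → Cluster r' (R ∪ F ∪ A)ᶜ := by
    intro r' h' G' hD' hi x hx y hy z hz hxz hxy hyz
    exact h'.swap.no_path G' G.le_m hF' G.δ_nonneg G.η_nonneg (hthr _ hD') (mB x hx).1 (mB y hy).1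
      (mB z hz).1 (hi x hx) (hi y hy) (hi z hz) hxz hxy hyz
  have cA := key1 r h G.toTame hD fun x hx => (mA x hx).2
  have cB := key2 r h G.toTame hC fun x hx => (mB x hx).2
  have cRF : ((R ∪ F).card : ℝ) ≤ δ * Fintype.card V := by
    refine le_trans ?_ hF'
    exact_mod_cast (Finset.card_union_le R F).trans (Nat.add_le_add_right h.card_R _)
  have hXC : ((C \ (C ∩ A)).card : ℝ) ≤ 12 * δ * Fintype.card V := by
    have h1 : C \ (C ∩ A) ⊆ (C.filter fun u => ¬ inc r C R u < η * Fintype.card V) ∪ (R ∪ F) := by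
      intro v
      simp only [hA, Finset.mem_union, Finset.mem_filter, Finset.mem_sdiff, Finset.mem_inter,
        Finset.mem_compl]
      tauto
    have h2 : ((C \ (C ∩ A)).card : ℝ) ≤
        (C.filter fun u => ¬ inc r C R u < η * Fintype.card V).card + (R ∪ F).card := by
      exact_mod_cast (Finset.card_le_card h1).trans (Finset.card_union_le _ _)
    have := h.swap.few_atyp hF'
    linarith
  have hYD : ((D \ (D ∩ (R ∪ F ∪ A)ᶜ)).card : ℝ) ≤ 12 * δ * Fintype.card V := by
    have h1 : D \ (D ∩ (R ∪ F ∪ A)ᶜ) ⊆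
        ((D \ (R ∪ F)).filter fun u => inc r C R u < η * Fintype.card V) ∪ (R ∪ F) := by
      intro v
      simp only [hA, Finset.mem_union, Finset.mem_filter, Finset.mem_sdiff, Finset.mem_inter,
        Finset.mem_compl]
      tauto
    have h2 : ((D \ (D ∩ (R ∪ F ∪ A)ᶜ)).card : ℝ) ≤
        ((D \ (R ∪ F)).filter fun u => inc r C R u < η * Fintype.card V).card + (R ∪ F).card := by
      exact_mod_cast (Finset.card_le_card h1).trans (Finset.card_union_le _ _)
    have := h.fewC
    linarith
  set X := C ∩ A with hX
  set Y := D ∩ (R ∪ F ∪ A)ᶜ with hY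
  have sXC : X ⊆ C := Finset.inter_subset_left
  have sXA : X ⊆ A := Finset.inter_subset_right
  have sYD : Y ⊆ D := Finset.inter_subset_left
  have sYB : Y ⊆ (R ∪ F ∪ A)ᶜ := Finset.inter_subset_right
  have eX : (X.card : ℝ) + (C \ X).card = C.card := by
    have := Finset.card_sdiff_add_card_eq_card sXC
    rw [add_comm]; exact_mod_cast this
  have eY : (Y.card : ℝ) + (D \ Y).card = D.card := by
    have := Finset.card_sdiff_add_card_eq_card sYD
    rw [add_comm]; exact_mod_cast this
  have hcC := h.cardC
  have hcD := h.cardD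
  obtain ⟨u, hu, hu'⟩ := exists_large_degree hXC
    (by linarith [G.δ_le]) hC
  obtain ⟨v, hv, hv'⟩ := exists_large_degree hYD
    (by linarith [G.δ_le]) hD
  have fin : ∀ Q Q' : Finset V, Q ⊆ X → Q' ⊆ Y → (∀ x ∈ Q, ∀ y ∈ Q, x ≠ y → r x y) →
      (∀ x ∈ Q', ∀ y ∈ Q', x ≠ y → r x y) →
      (1 / 2 + 1 / 10 ^ 16) * (Fintype.card V : ℝ) ≤ (Q.card + Q'.card : ℝ) →
      ∃ S A Q Q', TwoCluster r (m' + 4) (1 / 10 ^ 16) S A Q Q' := by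
    intro Q Q' h1 h2 h3 h4 h5
    refine ⟨R ∪ F, A, Q, Q', ?_, ?_, cA, cB, h1.trans sXA, h2.trans sYB, h3, h4, h5⟩
    · have := Finset.card_union_le R F
      have := h.card_R
      omega
    · exact Finset.disjoint_right.2 fun x hx => Finset.mem_compl.1 (Finset.mem_filter.1 hx).1
  have two : ∀ (Z : Finset V) (w : V), (1 / 10 ^ 15 - 2 * (12 * δ)) * Fintype.card V ≤
      ((Z.filter fun v => r v w).card : ℝ) → ∃ y ∈ Z, y ≠ w ∧ r y w := by
    intro Z w hw
    have : 1 < (Z.filter fun v => r v w).card := by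
      have : (1 : ℝ) < (Z.filter fun v => r v w).card := by linarith
      exact_mod_cast this
    obtain ⟨y, hy, hyw⟩ := Finset.exists_mem_ne this w
    rw [Finset.mem_filter] at hy
    exact ⟨y, hy.1, hyw, hy.2⟩
  by_cases hC' : 1 / 10 ^ 15 * (Fintype.card V : ℝ) ^ 2 < edg (fun u v => ¬ r u v) C
  · have cB' := key2 _ h.not G.toTame.not hC' fun x hx => by rw [inc_not]; exact (mB x hx).2
    obtain ⟨y, hy, hyv, hry⟩ := two Y v hv'
    refine fin (X.filter fun v => r v u) Y (Finset.filter_subset _ _) subset_rfl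
      ((cA.mono sXA).nbhd G.symm hu)
      ((cB.mono sYB).clique (cB'.mono sYB) G.symm hy hv hyv hry) ?_
    linarith
  by_cases hD' : 1 / 10 ^ 15 * (Fintype.card V : ℝ) ^ 2 < edg (fun u v => ¬ r u v) D
  · have cA' := key1 _ h.not G.toTame.not hD' fun x hx => by rw [inc_not]; exact (mA x hx).2
    obtain ⟨y, hy, hyv, hry⟩ := two X u hu'
    refine fin X (Y.filter fun w => r w v) subset_rfl (Finset.filter_subset _ _)
      ((cA.mono sXA).clique (cA'.mono sXA) G.symm hy hu hyv hry)
      ((cB.mono sYB).nbhd G.symm hv) ?_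
    linarith
  push Not at hC' hD'
  obtain ⟨u, hu, hu'⟩ := exists_small_codegree sXC (by linarith) (by linarith) hC' (by norm_num)
  obtain ⟨v, hv, hv'⟩ := exists_small_codegree sYD (by linarith) (by linarith) hD' (by norm_num)
  refine fin (X.filter fun w => r w u) (Y.filter fun w => r w v) (Finset.filter_subset _ _)
    (Finset.filter_subset _ _) ((cA.mono sXA).nbhd G.symm hu) ((cB.mono sYB).nbhd G.symm hv) ?_
  linarith

lemma edg_add_edg_not (r : V → V → Prop) (A : Finset V) :
    edg r A + edg (fun u v => ¬ r u v) A = (A.card : ℝ) ^ 2 := by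
  rw [edg_not]; unfold edg
  rw [card_filter_split, Finset.card_product]; push_cast; ring

theorem Str.cases (h : Str r δ η m' F R C D) (G : Ctl r δ η m m') (hF : F.card ≤ 4) :
    (∃ S A Q Q', TwoCluster r (m' + 4) (1 / 10 ^ 16) S A Q Q') ∨
    (∃ S A Q Q', TwoCluster (fun u v => ¬ r u v) (m' + 4) (1 / 10 ^ 16) S A Q Q') ∨
    ∃ R C D, SplitStr r δ η (1 / 10 ^ 15) m' F R C D := by
  have hn : (10 : ℝ) ^ 30 ≤ Fintype.card V := by exact_mod_cast G.large
  have hδn := mul_le_mul_of_nonneg_right G.δ_le (show (0 : ℝ) ≤ Fintype.card V by linarith)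
  have big : ∀ X : Finset V, (1 / 2 - 2 * δ) * Fintype.card V ≤ X.card →
      2 * (1 / 10 ^ 15 * (Fintype.card V : ℝ) ^ 2) < edg r X + edg (fun u v => ¬ r u v) X := by
    intro X hX
    rw [edg_add_edg_not]
    have h1 : (1 / 3 * (Fintype.card V : ℝ)) ^ 2 ≤ (X.card : ℝ) ^ 2 :=
      pow_le_pow_left₀ (by linarith) (by linarith) 2
    have h2 : 0 < (Fintype.card V : ℝ) ^ 2 := by
      have : (0 : ℝ) < Fintype.card V := by linarith
      positivity
    have h3 : (1 / 3 * (Fintype.card V : ℝ)) ^ 2 = 1 / 9 * (Fintype.card V : ℝ) ^ 2 := by ring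
    linarith
  have bC := big C h.cardC
  have bD := big D h.cardD
  by_cases e1 : 1 / 10 ^ 15 * (Fintype.card V : ℝ) ^ 2 < edg r C
  · by_cases e2 : 1 / 10 ^ 15 * (Fintype.card V : ℝ) ^ 2 < edg r D
    · exact Or.inl (h.twoCluster G hF e1 e2)
    by_cases e3 : 1 / 10 ^ 15 * (Fintype.card V : ℝ) ^ 2 < edg (fun u v => ¬ r u v) C
    · exact Or.inr (Or.inl (h.not.twoCluster G.not hF e3 (by linarith)))
    · exact Or.inr (Or.inr ⟨R, C, D, { h with dense := not_lt.1 e3, sparse := not_lt.1 e2 }⟩)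
  · by_cases e2 : 1 / 10 ^ 15 * (Fintype.card V : ℝ) ^ 2 < edg (fun u v => ¬ r u v) D
    · exact Or.inr (Or.inl (h.not.twoCluster G.not hF (by linarith) e2))
    · exact Or.inr (Or.inr ⟨R, D, C, { h.swap with dense := not_lt.1 e2, sparse := not_lt.1 e1 }⟩)

/-- The structure of a tame relation. -/
theorem Ctl.structure (G : Ctl r δ η m m')
    (h : ∀ F : Finset V, F.card ≤ 4 → ∃ R C D, Str r δ η m' F R C D) :
    (∃ S A Q Q', TwoCluster r (m' + 4) (1 / 10 ^ 16) S A Q Q') ∨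
    (∃ S A Q Q', TwoCluster (fun u v => ¬ r u v) (m' + 4) (1 / 10 ^ 16) S A Q Q') ∨
    ∃ K, NearSplit r K := by
  by_contra hc
  push Not at hc
  obtain ⟨h1, h2, h3⟩ := hc
  obtain ⟨K, hK⟩ := exists_nearSplit G fun F hF => by
    obtain ⟨R, C, D, hS⟩ := h F hF
    rcases hS.cases G hF with ⟨S, A, Q, Q', h⟩ | ⟨S, A, Q, Q', h⟩ | h
    · exact absurd h (h1 S A Q Q')
    · exact absurd h (h2 S A Q Q')
    · exact h
  exact h3 K hK

end Clusters

section ScalesExist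

lemma eventually_pow_add_one_le_exp (p : ℕ) {ε : ℝ} (hε : 0 < ε) :
    ∀ᶠ q : ℕ in atTop, (q : ℝ) ^ p + 1 ≤ Real.exp (ε * q) := by
  have h1 := (isLittleO_pow_exp_pos_mul_atTop p hε).bound (show (0 : ℝ) < 1 / 2 by norm_num)
  have h2 : ∀ᶠ x : ℝ in atTop, (2 : ℝ) ≤ Real.exp (ε * x) :=
    (Real.tendsto_exp_atTop.comp (tendsto_id.const_mul_atTop hε)).eventually_ge_atTop 2
  filter_upwards [tendsto_natCast_atTop_atTop.eventually h1,
    tendsto_natCast_atTop_atTop.eventually h2] with q h1 h2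
  rw [Real.norm_eq_abs, Real.norm_eq_abs, Real.abs_exp] at h1
  linarith [le_abs_self ((q : ℝ) ^ p)]

lemma eventually_pow_le_two_rpow (p B s : ℕ) {A c : ℝ} (hc : 0 < c) :
    ∀ᶠ q : ℕ in atTop,
      A * ((q : ℝ) ^ p + 1) ^ (B * q ^ s) ≤ (2 : ℝ) ^ (c * (q : ℝ) ^ (s + 1)) := by
  have hl := logTwo_pos
  set ε := c * Real.log 2 / (2 * (B + 1)) with hε
  have hε0 : 0 < ε := by positivity
  have h2 : ∀ᶠ x : ℝ in atTop, A ≤ Real.exp (c * Real.log 2 / 2 * x) :=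
    (Real.tendsto_exp_atTop.comp
      (tendsto_id.const_mul_atTop (by positivity))).eventually_ge_atTop A
  filter_upwards [eventually_pow_add_one_le_exp p hε0, tendsto_natCast_atTop_atTop.eventually h2,
    eventually_ge_atTop 1] with q h1 h2 hq
  have hq1 : (1 : ℝ) ≤ q := by exact_mod_cast hq
  have hqs : (q : ℝ) ≤ (q : ℝ) ^ (s + 1) := le_self_pow₀ hq1 (by omega)
  have h3 : ((q : ℝ) ^ p + 1) ^ (B * q ^ s) ≤ Real.exp (ε * B * (q : ℝ) ^ (s + 1)) := by
    calc ((q : ℝ) ^ p + 1) ^ (B * q ^ s) ≤ (Real.exp (ε * q)) ^ (B * q ^ s) :=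
          pow_le_pow_left₀ (by positivity) h1 _
      _ = _ := by
          rw [← Real.exp_nat_mul]; congr 1; push_cast; ring
  have h4 : ε * B ≤ c * Real.log 2 / 2 := by
    rw [hε, div_mul_eq_mul_div, div_le_div_iff₀ (by positivity) (by norm_num)]
    nlinarith [mul_pos hc hl]
  have h5 : A ≤ Real.exp (c * Real.log 2 / 2 * (q : ℝ) ^ (s + 1)) :=
    h2.trans (Real.exp_le_exp.2 (mul_le_mul_of_nonneg_left hqs (by positivity)))
  calc A * ((q : ℝ) ^ p + 1) ^ (B * q ^ s)
      ≤ Real.exp (c * Real.log 2 / 2 * (q : ℝ) ^ (s + 1)) *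
        Real.exp (ε * B * (q : ℝ) ^ (s + 1)) :=
        mul_le_mul h5 h3 (by positivity) (by positivity)
    _ = Real.exp ((c * Real.log 2 / 2 + ε * B) * (q : ℝ) ^ (s + 1)) := by
        rw [← Real.exp_add]; ring_nf
    _ ≤ Real.exp (c * Real.log 2 * (q : ℝ) ^ (s + 1)) :=
        Real.exp_le_exp.2 (mul_le_mul_of_nonneg_right (by linarith) (by positivity))
    _ = _ := by rw [Real.rpow_def_of_pos (by norm_num)]; ring_nf

lemma exists_scales {δ : ℝ} (hδ : 0 < δ) (hδ' : δ ≤ 1 / 100) : ∃ q k K K₂, Scales δ q k K K₂ := by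
  have hc : 0 < Real.logb 2 (16 / 15) := Real.logb_pos (by norm_num) (by norm_num)
  obtain ⟨q, h1, h2, h3, h4, h5, hq⟩ :=
    ((eventually_pow_le_two_rpow 3 2 1 (A := 4) hδ).and
    ((eventually_pow_le_two_rpow 7 2 1 (A := 4) hδ).and
    ((eventually_pow_le_two_rpow 7 2 6 (A := 2) (c := 1 / 2) (by norm_num)).and
    ((eventually_pow_le_two_rpow 14 4 1 (A := 17) hc).and
    (((tendsto_natCast_atTop_atTop (R := ℝ)).eventually (eventually_ge_atTop (3 / δ))).and
    (eventually_ge_atTop 1)))))).exists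
  set K := q ^ 7 with hK
  obtain ⟨K₂, h6, hK₂⟩ := ((eventually_pow_le_two_rpow 1 (2 * K ^ 2) 0 (A := 5) (c := 1 / 4)
    (by norm_num)).and (eventually_ge_atTop K)).exists
  have hq1 : (1 : ℝ) ≤ q := by exact_mod_cast hq
  have hqK : (q : ℝ) ≤ (q : ℝ) ^ 7 := le_self_pow₀ hq1 (by norm_num)
  refine ⟨q, q ^ 3, K, K₂, hδ, hδ', by positivity, ?_, ?_, ?_, ?_, ?_, ?_, ?_, hK₂⟩
  · push_cast
    rw [pow_one] at h1
    exact h1.trans (Real.rpow_le_rpow_of_exponent_le (by norm_num)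
      (mul_le_mul_of_nonneg_left (pow_le_pow_right₀ hq1 (by norm_num)) hδ.le))
  · rw [hK]; push_cast
    rw [pow_one] at h2
    exact h2.trans (Real.rpow_le_rpow_of_exponent_le (by norm_num)
      (mul_le_mul_of_nonneg_left (pow_le_pow_right₀ hq1 (by norm_num)) hδ.le))
  · rw [hK]; push_cast
    rw [div_le_iff₀ hδ] at h5
    have := mul_le_mul_of_nonneg_left hqK hδ.le
    linarith
  · have e : (2 : ℝ) ^ ((3 / 2 : ℝ) * K) = 2 ^ K * 2 ^ ((1 / 2 : ℝ) * (q : ℝ) ^ (6 + 1)) := by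
      rw [← Real.rpow_natCast, ← Real.rpow_add (by norm_num), hK]; push_cast; ring_nf
    have e2 : 2 * (q ^ 3) ^ 2 = 2 * q ^ 6 := by ring
    rw [e, e2]
    have h3' : (2 : ℝ) * ((K : ℝ) + 1) ^ (2 * q ^ 6) ≤ 2 ^ ((1 / 2 : ℝ) * (q : ℝ) ^ (6 + 1)) := by
      rw [hK]; push_cast; exact h3
    calc (2 : ℝ) * (2 ^ K * ((K : ℝ) + 1) ^ (2 * q ^ 6))
        = 2 ^ K * (2 * ((K : ℝ) + 1) ^ (2 * q ^ 6)) := by ring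
      _ ≤ _ := mul_le_mul_of_nonneg_left h3' (by positivity)
  · simp only [pow_one, pow_zero, mul_one, zero_add] at h6
    refine lt_of_lt_of_le ?_ h6
    have : (0 : ℝ) < ((K₂ : ℝ) + 1) ^ (2 * K ^ 2) := by positivity
    linarith
  · intro M hM
    refine exists_pStar ?_
    have g1 : (M : ℝ) ≤ (q : ℝ) ^ 14 := by
      have : M ≤ q ^ 14 := hM.trans (by rw [hK, ← pow_mul])
      exact_mod_cast this
    have g2 : (M : ℝ) ^ (4 * q) ≤ ((q : ℝ) ^ 14 + 1) ^ (4 * q) :=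
      pow_le_pow_left₀ (Nat.cast_nonneg _) (by linarith) _
    have g3 : (2 : ℝ) ^ (Real.logb 2 (16 / 15) * (q : ℝ) ^ (1 + 1)) = (16 / 15) ^ (q ^ 2) := by
      rw [show (q : ℝ) ^ (1 + 1) = ((q ^ 2 : ℕ) : ℝ) by push_cast; ring,
        Real.rpow_mul (by norm_num), Real.rpow_logb (by norm_num) (by norm_num) (by norm_num),
        Real.rpow_natCast]
    rw [g3, div_pow, le_div_iff₀ (by positivity), pow_one] at h4
    have g4 : (M : ℝ) ^ (4 * q) * 16 * 15 ^ (q ^ 2) < 16 ^ (q ^ 2) := by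
      have h0 : (0 : ℝ) < ((q : ℝ) ^ 14 + 1) ^ (4 * q) * 15 ^ (q ^ 2) := by positivity
      have h15 : (0 : ℝ) ≤ 15 ^ (q ^ 2) := by positivity
      have := mul_le_mul_of_nonneg_right g2 h15
      linarith
    exact_mod_cast g4
  · exact Nat.pow_le_pow_right hq (by norm_num)

end ScalesExist

section PerfectTame

variable {V : Type*} {G : SimpleGraph V}

lemma isPerfect_iff [Finite V] : IsPerfect G ↔ ∀ A : Finset V, ∃ K ⊆ A, G.IsClique (K : Set V) ∧
    ∃ f : V → ℕ, (∀ v ∈ A, f v < K.card) ∧ ∀ u ∈ A, ∀ v ∈ A, G.Adj u v → f u ≠ f v := by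
  constructor
  · intro h A
    have hA := h (A : Set V)
    obtain ⟨K, hK⟩ := (G.induce (A : Set V)).exists_isNClique_cliqueNum
    have hc := SimpleGraph.chromaticNumber_le_iff_colorable.1 hA.le
    obtain ⟨f⟩ := hc
    refine ⟨K.map (Function.Embedding.subtype _), ?_, ?_,
      fun v => if hv : v ∈ (A : Set V) then (f ⟨v, hv⟩ : ℕ) else 0, ?_, ?_⟩
    · intro v hv
      obtain ⟨w, -, rfl⟩ := Finset.mem_map.1 hv
      exact w.2
    · intro u hu v hv huv
      obtain ⟨u, hu', rfl⟩ := Finset.mem_map.1 (Finset.mem_coe.1 hu)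
      obtain ⟨v, hv', rfl⟩ := Finset.mem_map.1 (Finset.mem_coe.1 hv)
      exact hK.1 hu' hv' fun h => huv (by rw [h])
    · intro v hv
      simp only [Finset.card_map, hK.2, dif_pos (Finset.mem_coe.2 hv)]
      exact (f _).2
    · intro u hu v hv huv
      simp only [dif_pos (Finset.mem_coe.2 hu), dif_pos (Finset.mem_coe.2 hv)]
      intro h
      exact f.valid (v := ⟨u, hu⟩) (w := ⟨v, hv⟩) huv (Fin.ext h)
  · intro h s
    obtain ⟨K, hKs, hK, f, hf, hf'⟩ := h s.toFinite.toFinset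
    simp only [Set.Finite.mem_toFinset] at hf hf'
    refine le_antisymm ?_ SimpleGraph.cliqueNum_le_chromaticNumber
    have h1 : (G.induce s).Colorable K.card :=
      ⟨SimpleGraph.Coloring.mk (fun v => ⟨f v, hf v v.2⟩) fun {u v} huv he =>
        hf' u u.2 v v.2 huv (congrArg Fin.val he)⟩
    refine h1.chromaticNumber_le.trans (Nat.cast_le.2 ?_)
    have h2 : (G.induce s).IsClique (K.subtype (· ∈ s) : Set s) := by
      intro u hu v hv huv
      rw [Finset.mem_coe, Finset.mem_subtype] at hu hv
      exact hK hu hv fun h => huv (Subtype.ext h)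
    have h3 := h2.card_le_cliqueNum
    rwa [Finset.card_subtype, Finset.filter_true_of_mem fun v hv => by simpa using hKs hv] at h3

/-- A large set of vertices of a perfect graph contains a large clique or stable set. -/
lemma IsPerfect.ram [Fintype V] [DecidableEq V] (h : IsPerfect G) : Ram G.Adj := by
  intro A s hA
  obtain ⟨K, hKA, hK, f, hf, hf'⟩ := isPerfect_iff.1 h A
  by_cases hs : s ≤ K.card
  · obtain ⟨X, hX, hXs⟩ := Finset.exists_subset_card_eq hs
    exact ⟨X, hX.trans hKA, hXs, Or.inl fun x hx y hy hxy => hK (hX hx) (hX hy) hxy⟩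
  push Not at hs
  have hs0 : 0 < s := by omega
  obtain ⟨i, -, hi⟩ := Finset.exists_lt_card_fiber_of_mul_lt_card_of_maps_to
    (s := A) (t := Finset.range (s - 1)) (n := s) (f := f)
    (fun v hv => Finset.mem_range.2 (by have := hf v hv; omega)) (by
      rw [Finset.card_range]
      refine lt_of_lt_of_le ?_ hA
      rw [pow_two]
      exact Nat.mul_lt_mul_of_pos_right (by omega) hs0)
  obtain ⟨X, hX, hXs⟩ := Finset.exists_subset_card_eq hi.le
  refine ⟨X, fun v hv => (Finset.mem_filter.1 (hX hv)).1, hXs, Or.inr fun x hx y hy _ h => ?_⟩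
  have h1 := Finset.mem_filter.1 (hX hx)
  have h2 := Finset.mem_filter.1 (hX hy)
  exact hf' x h1.1 y h2.1 h (h1.2.trans h2.2.symm)

lemma IsPerfect.noC5 [Finite V] (h : IsPerfect G) : NoC5 G.Adj := by
  intro a b c d e hab hbc hcd hde hea hac had hbd hbe hce
  obtain ⟨K, hKA, hK, f, hf, hf'⟩ := isPerfect_iff.1 h {a, b, c, d, e}
  simp only [Finset.mem_insert, Finset.mem_singleton, forall_eq_or_imp, forall_eq] at hf hf'
  have hcard : K.card ≤ 2 := by
    by_contra! hc
    obtain ⟨x, y, z, hx, hy, hz, hxy, hxz, hyz⟩ := Finset.two_lt_card_iff.1 hc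
    have e1 := hK hx hy hxy
    have e2 := hK hx hz hxz
    have e3 := hK hy hz hyz
    have hx := hKA hx
    have hy := hKA hy
    have hz := hKA hz
    simp only [Finset.mem_insert, Finset.mem_singleton] at hx hy hz
    have hca : ¬ G.Adj c a := fun h => hac h.symm
    have hda : ¬ G.Adj d a := fun h => had h.symm
    have hdb : ¬ G.Adj d b := fun h => hbd h.symm
    have heb : ¬ G.Adj e b := fun h => hbe h.symm
    have hec : ¬ G.Adj e c := fun h => hce h.symm
    rcases hx with rfl | rfl | rfl | rfl | rfl <;>
    rcases hy with rfl | rfl | rfl | rfl | rfl <;>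
    first
      | exact hxy rfl
      | contradiction
      | (rcases hz with rfl | rfl | rfl | rfl | rfl <;>
          first
            | exact hxz rfl
            | exact hyz rfl
            | contradiction)
  obtain ⟨ha, hb, hc, hd, he⟩ := hf
  have n1 := hf'.1.2.1 hab
  have n2 := hf'.2.1.2.2.1 hbc
  have n3 := hf'.2.2.1.2.2.2.1 hcd
  have n4 := hf'.2.2.2.1.2.2.2.2 hde
  have n5 := hf'.2.2.2.2.1 hea
  omega

end PerfectTame

section Setoids

variable {α : Type*} [Fintype α]

instance Setoid.instFinite : Finite (Setoid α) :=
  Finite.of_injective (fun S : Setoid α => fun a b => S a b) fun _ _ h =>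
    Setoid.ext fun a b => (congrFun (congrFun h a) b).to_iff

instance Setoid.instFintype : Fintype (Setoid α) := Fintype.ofFinite _

/-- Partitions of a finite type are the same as equivalence relations on it. -/
def finpartitionEquivSetoid (α : Type*) [Fintype α] [DecidableEq α] :
    Finpartition (Finset.univ : Finset α) ≃ Setoid α where
  toFun P := Setoid.ker P.part
  invFun S := Finpartition.ofSetoid S
  left_inv P := by
    ext1
    have h (Q : Finpartition (Finset.univ : Finset α)) : Q.parts = Finset.univ.image Q.part := by
      ext p
      rw [Finset.mem_image]
      constructor
      · intro hp
        obtain ⟨a, ha⟩ := Q.nonempty_of_mem_parts hp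
        exact ⟨a, Finset.mem_univ _, Q.part_eq_of_mem hp ha⟩
      · rintro ⟨a, -, rfl⟩
        exact Q.part_mem.2 (Finset.mem_univ _)
    rw [h P, h]
    congr 1
    ext a b
    rw [Finpartition.mem_part_ofSetoid_iff_rel, Setoid.ker_def, eq_comm,
      ← Finpartition.mem_part_iff_part_eq_part _ (Finset.mem_univ _) (Finset.mem_univ _)]
  right_inv S := by
    ext a b
    rw [Setoid.ker_def, eq_comm,
      ← Finpartition.mem_part_iff_part_eq_part _ (Finset.mem_univ _) (Finset.mem_univ _),
      Finpartition.mem_part_ofSetoid_iff_rel]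

/-- Equivalence relations transported along a bijection. -/
def setoidCongr {α β : Type*} (e : α ≃ β) : Setoid α ≃ Setoid β where
  toFun S := S.comap e.symm
  invFun S := S.comap e
  left_inv S := by ext; simp [Setoid.comap_rel]
  right_inv S := by ext; simp [Setoid.comap_rel]

lemma card_setoid (α : Type*) [Fintype α] : Fintype.card (Setoid α) = bell (Fintype.card α) := by
  unfold bell
  rw [← Nat.card_eq_fintype_card]
  exact Nat.card_congr ((setoidCongr (Fintype.equivFin α)).trans
    (finpartitionEquivSetoid (Fin (Fintype.card α))).symm)

/-- A canonical representative of the class of `v`. -/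
def rep (S : Setoid α) (v : α) : α := (Quotient.mk S v).out

lemma rel_rep (S : Setoid α) (v : α) : S (rep S v) v := Quotient.mk_out v

lemma rep_eq_iff {S : Setoid α} {u v : α} : rep S u = rep S v ↔ S u v := by
  constructor
  · intro h
    have := rel_rep S u
    rw [h] at this
    exact S.trans (S.symm this) (rel_rep S v)
  · intro h
    unfold rep
    rw [Quotient.sound (s := S) h]

lemma rep_rep (S : Setoid α) (v : α) : rep S (rep S v) = rep S v := rep_eq_iff.2 (rel_rep S v)

lemma rep_injective : Function.Injective (rep : Setoid α → α → α) := by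
  intro S T h
  ext u v
  rw [← rep_eq_iff, ← rep_eq_iff, h]

/-- The number of elements minus the number of classes. -/
def rk (S : Setoid α) : ℕ := (Finset.univ.filter fun v => rep S v ≠ v).card

lemma sum_pow_rk {x : ℝ} (hx : 0 ≤ x) :
    ∑ S : Setoid α, x ^ rk S ≤ (1 + Fintype.card α * x) ^ Fintype.card α := by
  calc ∑ S : Setoid α, x ^ rk S
      = ∑ S : Setoid α, ∏ v, (if rep S v ≠ v then x else 1) := by
        refine Finset.sum_congr rfl fun S _ => ?_
        rw [Finset.prod_ite, Finset.prod_const, Finset.prod_const_one, mul_one, rk]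
    _ = ∑ f ∈ Finset.univ.map ⟨rep, rep_injective⟩, ∏ v : α, (if f v ≠ v then x else 1) := by
        rw [Finset.sum_map]; rfl
    _ ≤ ∑ f : α → α, ∏ v : α, (if f v ≠ v then x else 1) := by
        refine Finset.sum_le_univ_sum_of_nonneg fun f => Finset.prod_nonneg fun v _ => ?_
        split_ifs <;> positivity
    _ = ∏ v : α, ∑ w : α, (if w ≠ v then x else 1) := by
        rw [Finset.prod_univ_sum, Fintype.piFinset_univ]
    _ ≤ ∏ v : α, (1 + Fintype.card α * x) := by
        refine Finset.prod_le_prod (fun v _ => Finset.sum_nonneg fun w _ => ?_) fun v _ => ?_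
        · split_ifs <;> positivity
        · calc ∑ w : α, (if w ≠ v then x else 1) ≤ ∑ w : α, ((if w = v then 1 else 0) + x) := by
                refine Finset.sum_le_sum fun w _ => ?_
                by_cases h : w = v <;> simp [h, hx]
            _ = 1 + Fintype.card α * x := by
                rw [Finset.sum_add_distrib]; simp
    _ = _ := by simp

lemma card_rk_le (a : ℕ) :
    ((Finset.univ.filter fun S : Setoid α => rk S ≤ a).card : ℝ) ≤
      2 ^ Fintype.card α * (Fintype.card α + 1) ^ a := by
  have hn : (0 : ℝ) < Fintype.card α + 1 := by positivity
  set x : ℝ := 1 / (Fintype.card α + 1) with hx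
  have hx0 : 0 < x := by positivity
  have hx1 : x ≤ 1 := by
    rw [hx, div_le_one hn]
    linarith [Nat.cast_nonneg (α := ℝ) (Fintype.card α)]
  have h1 : ((Finset.univ.filter fun S : Setoid α => rk S ≤ a).card : ℝ) * x ^ a ≤
      ∑ S : Setoid α, x ^ rk S := by
    rw [← nsmul_eq_mul]
    refine (Finset.card_nsmul_le_sum _ (fun S => x ^ rk S) _ fun S hS => ?_).trans
      (Finset.sum_le_univ_sum_of_nonneg fun _ => by positivity)
    exact pow_le_pow_of_le_one hx0.le hx1 (Finset.mem_filter.1 hS).2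
  have h2 : (1 + Fintype.card α * x) ^ Fintype.card α ≤ 2 ^ Fintype.card α := by
    refine pow_le_pow_left₀ (by positivity) ?_ _
    have : Fintype.card α * x ≤ 1 := by rw [hx, mul_one_div, div_le_one hn]; linarith
    linarith
  have h3 := h1.trans ((sum_pow_rk hx0.le).trans h2)
  rw [hx, div_pow, one_pow, mul_one_div, div_le_iff₀ (by positivity)] at h3
  exact h3

lemma card_setoid_le_of_rel (Q : Finset α) :
    (Finset.univ.filter fun S : Setoid α => ∀ x ∈ Q, ∀ y ∈ Q, S x y).card ≤
      (Fintype.card α + 1) ^ (Fintype.card α - Q.card + 1) := by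
  let F : {S : Setoid α // ∀ x ∈ Q, ∀ y ∈ Q, S x y} → Option {x // x ∉ Q} → Option α :=
    fun S o => o.elim (if h : Q.Nonempty then some (rep S.1 h.choose) else none)
      fun v => some (rep S.1 v)
  have hF : F.Injective := by
    intro S T h
    refine Subtype.ext (rep_injective (funext fun v => ?_))
    by_cases hv : v ∈ Q
    · have hQ : Q.Nonempty := ⟨v, hv⟩
      have h0 := congrFun h none
      simp only [F, Option.elim_none, dif_pos hQ, Option.some.injEq] at h0
      rwa [rep_eq_iff.2 (S.2 _ hQ.choose_spec v hv), rep_eq_iff.2 (T.2 _ hQ.choose_spec v hv)] at h0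
    · have := congrFun h (some ⟨v, hv⟩)
      simpa [F] using this
  have h1 := Fintype.card_le_of_injective F hF
  rw [Fintype.card_fun, Fintype.card_option, Fintype.card_option, Fintype.card_subtype] at h1
  refine h1.trans_eq ?_
  congr 2
  have h2 : Fintype.card {x // x ∉ Q} = Fintype.card α - Q.card := by
    rw [Fintype.card_subtype_compl, Fintype.card_coe]
  exact h2

lemma exists_matching (S : Setoid α) : ∃ (t : ℕ) (e : Fin t × Bool → α), e.Injective ∧
    rk S ≤ 2 * t ∧ ∀ i, S (e (i, false)) (e (i, true)) := by
  have hbd : ∀ t, (∃ e : Fin t × Bool → α, e.Injective ∧ ∀ i, S (e (i, false)) (e (i, true))) →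
      t ≤ Fintype.card α := by
    rintro t ⟨e, he, -⟩
    have := Fintype.card_le_of_injective e he
    simp only [Fintype.card_prod, Fintype.card_fin, Fintype.card_bool] at this
    omega
  obtain ⟨t, ⟨e, he, heS⟩, hmax⟩ : ∃ t, (∃ e : Fin t × Bool → α, e.Injective ∧
      ∀ i, S (e (i, false)) (e (i, true))) ∧ ¬ ∃ e : Fin (t + 1) × Bool → α, e.Injective ∧
      ∀ i, S (e (i, false)) (e (i, true)) := by
    by_contra! hc
    have : ∀ t, ∃ e : Fin t × Bool → α, e.Injective ∧ ∀ i, S (e (i, false)) (e (i, true)) := by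
      intro t
      induction t with
      | zero => exact ⟨fun x => x.1.elim0, fun x => x.1.elim0, fun x => x.elim0⟩
      | succ t ih => exact hc t ih
    have := hbd _ (this (Fintype.card α + 1))
    omega
  refine ⟨t, e, he, ?_, heS⟩
  have hun : ∀ u v, u ∉ Set.range e → v ∉ Set.range e → S u v → u = v := by
    intro u v hu hv huv
    by_contra hne
    refine hmax ⟨fun p => Fin.lastCases (motive := fun _ => α) (if p.2 then v else u)
      (fun i => e (i, p.2)) p.1, ?_, ?_⟩
    · rintro ⟨i, a⟩ ⟨j, b⟩ h
      induction i using Fin.lastCases with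
      | last =>
        induction j using Fin.lastCases with
        | last =>
          simp only [Fin.lastCases_last] at h
          cases a <;> cases b <;> simp_all
        | cast j =>
          simp only [Fin.lastCases_last, Fin.lastCases_castSucc] at h
          cases a
          · exact absurd ⟨_, h.symm⟩ hu
          · exact absurd ⟨_, h.symm⟩ hv
      | cast i =>
        induction j using Fin.lastCases with
        | last =>
          simp only [Fin.lastCases_last, Fin.lastCases_castSucc] at h
          cases b
          · exact absurd ⟨_, h⟩ hu
          · exact absurd ⟨_, h⟩ hv
        | cast j =>
          simp only [Fin.lastCases_castSucc] at h
          have := he h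
          simp only [Prod.mk.injEq] at this
          rw [this.1, this.2]
    · intro i
      induction i using Fin.lastCases with
      | last => simpa using huv
      | cast i => simpa using heS i
  have h1 : (Finset.univ.filter fun v => v ∉ Set.range e).card ≤
      (Finset.univ.filter fun v => rep S v = v).card := by
    refine Finset.card_le_card_of_injOn (rep S) ?_ ?_
    · intro v _
      simp [rep_rep]
    · intro u hu v hv h
      simp only [Finset.coe_filter, Finset.mem_univ, true_and] at hu hv
      exact hun u v hu hv (rep_eq_iff.1 h)
  have h2 : (Finset.univ.filter fun v => v ∈ Set.range e).card ≤ 2 * t := by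
    have : (Finset.univ.filter fun v => v ∈ Set.range e) = Finset.univ.image e := by
      ext v; simp
    rw [this]
    refine Finset.card_image_le.trans ?_
    simp [mul_comm]
  have h3 := Finset.card_filter_add_card_filter_not (s := (Finset.univ : Finset α))
    (fun v => v ∈ Set.range e)
  have h4 := Finset.card_filter_add_card_filter_not (s := (Finset.univ : Finset α))
    (fun v => rep S v = v)
  have h5 : rk S = (Finset.univ.filter fun v => ¬ rep S v = v).card := rfl
  omega

lemma card_setoid_le_classes (r : ℕ) :
    (Finset.univ.filter fun S : Setoid α => Nat.card (Quotient S) ≤ r).card ≤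
      r ^ Fintype.card α := by
  have : (Finset.univ.filter fun S : Setoid α => Nat.card (Quotient S) ≤ r) ⊆
      Finset.univ.image fun f : α → Fin r => Setoid.ker f := by
    intro S hS
    rw [Finset.mem_filter] at hS
    have e := Finite.equivFin (Quotient S)
    refine Finset.mem_image.2 ⟨fun v => Fin.castLE hS.2 (e (Quotient.mk S v)), Finset.mem_univ _, ?_⟩
    ext u v
    rw [Setoid.ker_def, (Fin.castLE_injective hS.2).eq_iff, e.injective.eq_iff]
    exact Quotient.eq
  refine (Finset.card_le_card this).trans (Finset.card_image_le.trans ?_)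
  simp

lemma sum_card_quotient_le : ∑ S : Setoid α, Nat.card (Quotient S) ≤
    bell (Fintype.card α + 1) := by
  have h1 : Fintype.card (Setoid (Option α)) = bell (Fintype.card α + 1) := by
    rw [card_setoid, Fintype.card_option]
  let F : ((S : Setoid α) × Quotient S) → Setoid (Option α) := fun p =>
    Setoid.ker fun o : Option α => o.elim p.2 fun v => Quotient.mk p.1 v
  have hF : F.Injective := by
    rintro ⟨S, q⟩ ⟨T, q'⟩ h
    have hrel : ∀ a b, F ⟨S, q⟩ a b ↔ F ⟨T, q'⟩ a b := fun a b => by rw [h]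
    have hST : S = T := by
      ext u v
      have := hrel (some u) (some v)
      simpa only [F, Setoid.ker_def, Option.elim_some, Quotient.eq] using this
    subst hST
    obtain ⟨v, rfl⟩ := Quotient.exists_rep q
    have := (hrel none (some v)).1
    simp only [F, Setoid.ker_def, Option.elim_some, Option.elim_none] at this
    rw [this (by trivial)]
  have h2 := Nat.card_le_card_of_injective F hF
  rw [Nat.card_sigma, Nat.card_eq_fintype_card, h1] at h2
  exact h2

end Setoids

section Bell

lemma card_setoid_fin (m : ℕ) : Fintype.card (Setoid (Fin m)) = bell m := by
  rw [card_setoid, Fintype.card_fin]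

lemma bell_pos (m : ℕ) : 0 < bell m := by
  rw [← card_setoid_fin]
  exact Fintype.card_pos

lemma bell_le_succ (m : ℕ) : bell m ≤ bell (m + 1) := by
  rcases Nat.eq_zero_or_pos m with rfl | hm
  · have h0 : bell 0 = 1 := by
      rw [← card_setoid_fin, Fintype.card_eq_one_iff]
      exact ⟨⊥, fun S => by ext a; exact a.elim0⟩
    rw [h0]; exact bell_pos _
  have h := sum_card_quotient_le (α := Fin m)
  rw [Fintype.card_fin] at h
  refine le_trans ?_ h
  rw [← card_setoid_fin, ← Finset.card_univ, Finset.card_eq_sum_ones]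
  refine Finset.sum_le_sum fun S _ => ?_
  have : Nonempty (Quotient S) := ⟨Quotient.mk S ⟨0, hm⟩⟩
  exact Nat.card_pos

lemma pow_le_bell {s m : ℕ} (h : s ≤ m) : s ^ (m - s) ≤ bell m := by
  obtain ⟨d, rfl⟩ := Nat.exists_eq_add_of_le h
  have h1 : Fintype.card (Setoid (Fin s ⊕ Fin d)) = bell (s + d) := by
    rw [card_setoid, Fintype.card_sum, Fintype.card_fin, Fintype.card_fin]
  rw [← h1, Nat.add_sub_cancel_left]
  let F : (Fin d → Fin s) → Setoid (Fin s ⊕ Fin d) := fun f => Setoid.ker (Sum.elim id f)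
  have hF : F.Injective := by
    intro f g hfg
    ext i : 1
    have : F f (Sum.inl (f i)) (Sum.inr i) := by simp [F, Setoid.ker_def]
    rw [hfg] at this
    simpa [F, Setoid.ker_def] using this
  simpa using Fintype.card_le_of_injective F hF

lemma mul_bell_le (r m : ℕ) : (r + 1) * bell m ≤ bell (m + 1) + (r + 1) * r ^ m := by
  have h := sum_card_quotient_le (α := Fin m)
  have h2 := card_setoid_le_classes (α := Fin m) r
  rw [Fintype.card_fin] at h h2
  have h3 := Finset.card_filter_add_card_filter_not (s := (Finset.univ : Finset (Setoid (Fin m))))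
    (fun S => Nat.card (Quotient S) ≤ r)
  rw [Finset.card_univ, card_setoid_fin] at h3
  have h4 : (Finset.univ.filter fun S : Setoid (Fin m) => ¬ Nat.card (Quotient S) ≤ r).card *
      (r + 1) ≤ ∑ S : Setoid (Fin m), Nat.card (Quotient S) := by
    rw [← smul_eq_mul]
    refine (Finset.card_nsmul_le_sum _ (fun S : Setoid (Fin m) => Nat.card (Quotient S)) _
      fun S hS => ?_).trans (Finset.sum_le_sum_of_subset (Finset.subset_univ _))
    have := (Finset.mem_filter.1 hS).2
    omega
  rw [← h3, mul_add]
  have h5 := Nat.mul_le_mul_left (r + 1) h2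
  rw [mul_comm] at h4
  omega

end Bell

section LowerBound

lemma eventually_le_log (D : ℝ) : ∀ᶠ n : ℕ in atTop, D ≤ Real.log n :=
  (Real.tendsto_log_atTop.comp tendsto_natCast_atTop_atTop).eventually_ge_atTop D

lemma eventually_le_cast (D : ℝ) : ∀ᶠ n : ℕ in atTop, D ≤ n :=
  tendsto_natCast_atTop_atTop.eventually_ge_atTop D

lemma exp_le_bell {a : ℝ} (ha : a < 1) :
    ∀ᶠ m : ℕ in atTop, Real.exp (a * m * Real.log m) ≤ bell m := by
  obtain ⟨N, hN⟩ := exists_nat_gt (max (2 / (1 - a)) 2)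
  obtain ⟨hN, hN2⟩ := max_lt_iff.1 hN
  have h1a : 0 < 1 - a := by linarith
  have hN0 : (0 : ℝ) < N := by linarith
  have hN1 : 1 / (N : ℝ) ≤ (1 - a) / 2 := by
    rw [div_lt_iff₀ h1a] at hN
    rw [div_le_iff₀ hN0]; linarith
  filter_upwards [eventually_le_log (2 / (1 - a) * (Real.log N + 1)),
    eventually_ge_atTop (N + 2)] with m hm hm2
  have hm0 : (0 : ℝ) < m := by exact_mod_cast (by omega : 0 < m)
  set s := m / N + 1 with hs
  have hN2 : 2 < N := by exact_mod_cast hN2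
  have hsm : s ≤ m := by
    have : m / N ≤ m / 2 := Nat.div_le_div_left hN2.le (by norm_num)
    omega
  have hs1 : (m : ℝ) / N ≤ s := by
    have := Nat.lt_floor_add_one ((m : ℝ) / N)
    rw [Nat.floor_div_eq_div] at this
    rw [hs]; push_cast; exact this.le
  have hs2 : (s : ℝ) ≤ m / N + 1 := by
    rw [hs]; push_cast
    linarith [Nat.cast_div_le (α := ℝ) (m := m) (n := N)]
  have hs0 : (0 : ℝ) < s := lt_of_lt_of_le (by positivity) hs1
  have hb : ((s : ℝ)) ^ (m - s) ≤ bell m := by exact_mod_cast pow_le_bell hsm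
  refine le_trans ?_ hb
  have hls : Real.log m - Real.log N ≤ Real.log s := by
    rw [← Real.log_div hm0.ne' hN0.ne']
    exact Real.log_le_log (by positivity) hs1
  have hlN : 0 ≤ Real.log N := Real.log_natCast_nonneg N
  have hlm : Real.log m ≤ m := (Real.log_le_sub_one_of_pos hm0).trans (by linarith)
  have hmN : Real.log N ≤ Real.log m :=
    Real.log_le_log hN0 (by exact_mod_cast (by omega : N ≤ m))
  rw [← Real.exp_log (pow_pos hs0 _), Real.log_pow, Nat.cast_sub hsm]
  apply Real.exp_le_exp.2
  have e1 : (m : ℝ) * (1 - (1 - a) / 2) - 1 ≤ m - s := by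
    have : (m : ℝ) / N ≤ m * ((1 - a) / 2) := by
      rw [div_eq_mul_one_div]; exact mul_le_mul_of_nonneg_left hN1 hm0.le
    linarith
  have e2 : (m * (1 - (1 - a) / 2) - 1 : ℝ) * (Real.log m - Real.log N) ≤
      (m - s) * Real.log s :=
    mul_le_mul e1 hls (by linarith) (by
      have : (s : ℝ) ≤ m := by exact_mod_cast hsm
      linarith)
  refine le_trans ?_ e2
  have e3 : (1 - a) / 2 * Real.log m ≥ Real.log N + 1 := by
    have := mul_le_mul_of_nonneg_left hm (by positivity : 0 ≤ (1 - a) / 2)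
    have e : (1 - a) / 2 * (2 / (1 - a) * (Real.log N + 1)) = Real.log N + 1 := by
      field_simp
    linarith
  have e4 := mul_le_mul_of_nonneg_left e3 hm0.le
  have e5 : 0 ≤ (1 - a) / 2 * m * Real.log N := by positivity
  linarith

lemma ell_pos {n k : ℕ} (h : k ≤ n) : 0 < ell n k :=
  Nat.mul_pos (Nat.mul_pos (Nat.choose_pos h) (by positivity)) (bell_pos _)

lemma ell_le_scrL {n k : ℕ} (h : k ≤ n) : ell n k ≤ scrL n :=
  Finset.single_le_sum (f := fun k => ell n k) (fun _ _ => Nat.zero_le _)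
    (Finset.mem_range.2 (by omega))

lemma scrL_pos (n : ℕ) : 0 < scrL n := (ell_pos le_rfl).trans_le (ell_le_scrL le_rfl)

lemma exp_le_scrL {ε : ℝ} (hε : 0 < ε) (D : ℝ) : ∀ᶠ n : ℕ in atTop,
    Real.exp (n ^ 2 / 4 * Real.log 2 + (1 / 2 - ε) * n * Real.log n + D * n) ≤ scrL n := by
  wlog h1 : ε < 1 / 4 generalizing ε
  · filter_upwards [this (ε := 1 / 5) (by norm_num) (by norm_num), eventually_ge_atTop 1] with n hn h0
    refine le_trans (Real.exp_le_exp.2 ?_) hn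
    have : 0 ≤ (n : ℝ) * Real.log n := mul_nonneg (Nat.cast_nonneg _) (Real.log_natCast_nonneg n)
    have := mul_le_mul_of_nonneg_right (show (1 / 2 - ε) ≤ 1 / 2 - 1 / 5 by linarith) this
    linarith
  have hb : ∀ᶠ n : ℕ in atTop, Real.exp ((1 - ε) * (n / 2 : ℕ) * Real.log (n / 2 : ℕ)) ≤
      bell (n / 2) :=
    (Nat.tendsto_div_const_atTop (by norm_num)).eventually (exp_le_bell (by linarith))
  filter_upwards [hb, eventually_le_log (2 / ε * (D + 6)), eventually_ge_atTop 3]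
    with n hb hl hn
  have hn0 : (3 : ℝ) ≤ n := by exact_mod_cast hn
  set m := n / 2 with hm
  have h2 : 2 ^ ((n - m) * m) * bell m ≤ scrL n := by
    have := ell_le_scrL (Nat.sub_le n m)
    unfold ell at this
    rw [Nat.sub_sub_self (by omega)] at this
    refine le_trans ?_ this
    exact Nat.mul_le_mul_right _ (Nat.le_mul_of_pos_left _ (Nat.choose_pos (by omega)))
  have h3 : (2 : ℝ) ^ ((n - m) * m) * bell m ≤ scrL n := by exact_mod_cast h2
  refine le_trans ?_ ((mul_le_mul_of_nonneg_left hb (by positivity)).trans h3)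
  rw [← Real.exp_log (show (0 : ℝ) < 2 ^ ((n - m) * m) by positivity), ← Real.exp_add, Real.log_pow]
  apply Real.exp_le_exp.2
  have hm1 : ((n : ℝ) - 1) / 2 ≤ m := by
    have : n ≤ 2 * m + 1 := by omega
    have : (n : ℝ) ≤ 2 * m + 1 := by exact_mod_cast this
    linarith
  have hm2 : (m : ℝ) ≤ n / 2 := Nat.cast_div_le
  have h4 : (n : ℝ) ^ 2 / 4 - 1 / 4 ≤ ((n - m) * m : ℕ) := by
    rw [Nat.cast_mul, Nat.cast_sub (by omega)]
    have : 0 ≤ (m - ((n : ℝ) - 1) / 2) * (n / 2 - m) :=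
      mul_nonneg (by linarith) (by linarith)
    have h' : 0 ≤ (m - ((n : ℝ) - 1) / 2) := by linarith
    have e : ((n : ℝ) - m) * m = n ^ 2 / 4 - (n / 2 - m) ^ 2 := by ring
    rw [e]
    have : (n / 2 - m : ℝ) ^ 2 ≤ (1 / 2) ^ 2 := pow_le_pow_left₀ (by linarith) (by linarith) 2
    linarith
  have hl2 := logTwo_pos
  have hl2' : Real.log 2 ≤ 1 := by
    have := Real.log_le_sub_one_of_pos (show (0 : ℝ) < 2 by norm_num); linarith
  have h5 := mul_le_mul_of_nonneg_right h4 hl2.le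
  have hl3 : Real.log n - 2 ≤ Real.log m := by
    have h6 : (n : ℝ) / 3 ≤ m := by linarith
    have h7 := Real.log_le_log (by positivity) h6
    rw [Real.log_div (by positivity) (by norm_num)] at h7
    have := Real.log_le_sub_one_of_pos (show (0 : ℝ) < 3 by norm_num)
    linarith
  have hln : Real.log n ≤ n := (Real.log_le_sub_one_of_pos (by positivity)).trans (by linarith)
  have hlm : 0 ≤ Real.log m := Real.log_natCast_nonneg m
  have hl0 : 0 ≤ Real.log n := Real.log_natCast_nonneg n
  have h8 : (1 - ε) * (((n : ℝ) - 1) / 2) * (Real.log n - 2) ≤ (1 - ε) * m * Real.log m := by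
    have a1 : (1 - ε) * (((n : ℝ) - 1) / 2) ≤ (1 - ε) * m :=
      mul_le_mul_of_nonneg_left hm1 (by linarith)
    have a2 : 0 ≤ (1 - ε) * (((n : ℝ) - 1) / 2) := mul_nonneg (by linarith) (by linarith)
    exact (mul_le_mul_of_nonneg_left hl3 a2).trans (mul_le_mul_of_nonneg_right a1 hlm)
  have h9 : D + 6 ≤ ε / 2 * Real.log n := by
    have := mul_le_mul_of_nonneg_left hl (show 0 ≤ ε / 2 by positivity)
    have e : ε / 2 * (2 / ε * (D + 6)) = D + 6 := by field_simp
    linarith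
  have h10 := mul_le_mul_of_nonneg_right h9 (show (0 : ℝ) ≤ n by positivity)
  have h11 : (1 - ε) / 2 * Real.log n ≤ n := by
    have : (1 - ε) / 2 * Real.log n ≤ 1 * Real.log n :=
      mul_le_mul_of_nonneg_right (by linarith) hl0
    linarith
  have h12 : 0 ≤ ε * n := by positivity
  linarith

lemma scrL_succ (n : ℕ) : (2 : ℝ) ^ ((n : ℝ) / 2) * scrL n ≤ scrL (n + 1) := by
  have h1 : ∑ k ∈ Finset.range (n + 1), ell (n + 1) k ≤ scrL (n + 1) :=
    Finset.sum_le_sum_of_subset (Finset.range_subset_range.2 (by omega))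
  have h2 : ∑ k ∈ Finset.range (n + 1), ell (n + 1) (k + 1) ≤ scrL (n + 1) := by
    unfold scrL
    rw [Finset.sum_range_succ' _ (n + 1)]
    omega
  have h3 : ∀ k ∈ Finset.range (n + 1),
      (2 * (2 : ℝ) ^ ((n : ℝ) / 2)) * ell n k ≤ (ell (n + 1) k + ell (n + 1) (k + 1) : ℕ) := by
    intro k hk
    have hk : k ≤ n := by have := Finset.mem_range.1 hk; omega
    have a1 : 2 ^ k * ell n k ≤ ell (n + 1) k := by
      unfold ell
      calc 2 ^ k * (n.choose k * 2 ^ (k * (n - k)) * bell (n - k))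
          = n.choose k * 2 ^ (k * (n + 1 - k)) * bell (n - k) := by
            rw [show n + 1 - k = (n - k) + 1 by omega, mul_add, pow_add]; ring
        _ ≤ _ := by
            refine Nat.mul_le_mul (Nat.mul_le_mul_right _ (Nat.choose_le_choose k (by omega))) ?_
            rw [show n + 1 - k = (n - k) + 1 by omega]
            exact bell_le_succ _
    have a2 : 2 ^ (n - k) * ell n k ≤ ell (n + 1) (k + 1) := by
      unfold ell
      calc 2 ^ (n - k) * (n.choose k * 2 ^ (k * (n - k)) * bell (n - k))
          = n.choose k * 2 ^ ((k + 1) * (n - k)) * bell (n - k) := by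
            rw [add_mul, pow_add, one_mul]; ring
        _ ≤ _ := by
            rw [show n + 1 - (k + 1) = n - k by omega]
            refine Nat.mul_le_mul_right _ (Nat.mul_le_mul_right _ ?_)
            rw [Nat.choose_succ_succ]
            omega
    have a3 : (2 : ℝ) * 2 ^ ((n : ℝ) / 2) ≤ 2 ^ k + 2 ^ (n - k) := by
      set x := (2 : ℝ) ^ ((k : ℝ) / 2)
      set y := (2 : ℝ) ^ (((n - k : ℕ) : ℝ) / 2)
      have hx : x ^ 2 = 2 ^ k := by
        rw [← Real.rpow_natCast, ← Real.rpow_mul (by norm_num), ← Real.rpow_natCast]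
        congr 1; push_cast; ring
      have hy : y ^ 2 = 2 ^ (n - k) := by
        rw [← Real.rpow_natCast, ← Real.rpow_mul (by norm_num), ← Real.rpow_natCast]
        congr 1; push_cast; ring
      have hxy : (2 : ℝ) ^ ((n : ℝ) / 2) = x * y := by
        rw [← Real.rpow_add (by norm_num)]
        congr 1; rw [Nat.cast_sub hk]; ring
      rw [← hx, ← hy, hxy]
      linarith [two_mul_le_add_sq x y]
    have a4 : (2 ^ k + 2 ^ (n - k)) * (ell n k : ℝ) ≤ (ell (n + 1) k + ell (n + 1) (k + 1) : ℕ) := by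
      rw [← Nat.cast_ofNat]
      norm_cast
      rw [add_mul]
      omega
    exact (mul_le_mul_of_nonneg_right a3 (Nat.cast_nonneg _)).trans a4
  have h4 := Finset.sum_le_sum h3
  rw [← Finset.mul_sum, ← Nat.cast_sum, ← Nat.cast_sum, Finset.sum_add_distrib] at h4
  have h5 : ((∑ k ∈ Finset.range (n + 1), ell (n + 1) k +
      ∑ k ∈ Finset.range (n + 1), ell (n + 1) (k + 1) : ℕ) : ℝ) ≤ 2 * scrL (n + 1) := by
    exact_mod_cast (by omega : _ ≤ 2 * scrL (n + 1))
  unfold scrL at *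
  linarith

lemma sum_card_eq_scrL (n : ℕ) :
    ∑ K : Finset (Fin n), 2 ^ (K.card * (n - K.card)) * bell (n - K.card) = scrL n := by
  rw [← Finset.powerset_univ, Finset.sum_powerset_apply_card
    (fun k => 2 ^ (k * (n - k)) * bell (n - k)), Finset.card_univ, Fintype.card_fin]
  refine Finset.sum_congr rfl fun k _ => ?_
  rw [smul_eq_mul, ell]; ring

end LowerBound

section PerfectCount

lemma IsPerfect.comap {V W : Type*} [Finite V] [Finite W] {G : SimpleGraph V} (h : IsPerfect G)
    (e : W ↪ V) : IsPerfect (G.comap e) := by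
  rw [isPerfect_iff] at *
  intro A
  obtain ⟨K, hKA, hK, f, hf, hf'⟩ := h (A.map e)
  refine ⟨A.filter fun a => e a ∈ K, Finset.filter_subset _ _, ?_, f ∘ e, ?_, ?_⟩
  · intro u hu v hv huv
    simp only [Finset.coe_filter, Set.mem_ofPred_eq] at hu hv
    exact hK hu.2 hv.2 (e.injective.ne huv)
  · have hc : (A.filter fun a => e a ∈ K).card = K.card := by
      rw [← Finset.card_map e]
      congr 1
      ext v
      simp only [Finset.mem_map, Finset.mem_filter]
      constructor
      · rintro ⟨a, ⟨-, h⟩, rfl⟩; exact h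
      · intro hv
        obtain ⟨a, ha, rfl⟩ := Finset.mem_map.1 (hKA hv)
        exact ⟨a, ⟨ha, hv⟩, rfl⟩
    intro v hv
    rw [hc]
    exact hf _ (Finset.mem_map_of_mem e hv)
  · intro u hu v hv huv
    exact hf' _ (Finset.mem_map_of_mem e hu) _ (Finset.mem_map_of_mem e hv) huv

lemma card_isPerfect (W : Type*) [Fintype W] :
    (Finset.univ.filter fun G : SimpleGraph W => IsPerfect G).card =
      perfectCount (Fintype.card W) := by
  rw [← Fintype.card_subtype, ← Nat.card_eq_fintype_card]
  have e := Fintype.equivFin W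
  refine Nat.card_congr (e.simpleGraph.subtypeEquiv fun G => ⟨fun h => ?_, fun h => ?_⟩)
  · exact h.comap e.symm.toEmbedding
  · have := h.comap e.toEmbedding
    convert this using 1
    ext u v
    simp [Equiv.simpleGraph]

end PerfectCount

section Poor

variable {V ι : Type*} [Fintype V] [DecidableEq V] [DecidableEq ι]

/-- The number of ways of splitting the cells of a partition with bounded total entropy. -/
lemma card_split_le (W : Finset V) (t : V → ι) (I : Finset ι) (hI : ∀ v ∈ W, t v ∈ I) (θ : ℝ) :
    ((W.powerset.filter fun N => ∑ i ∈ I, eta ((W.filter fun v => t v = i) ∩ N).card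
      ((W.filter fun v => t v = i) \ N).card ≤ θ).card : ℝ) ≤
      (Fintype.card V + 1) ^ I.card * 2 ^ θ := by
  set P := W.powerset.filter fun N => ∑ i ∈ I, eta ((W.filter fun v => t v = i) ∩ N).card
      ((W.filter fun v => t v = i) \ N).card ≤ θ with hP
  let F : Finset V → I → ℕ := fun N i => ((W.filter fun v => t v = i) ∩ N).card
  have hF : ∀ N ∈ P, F N ∈ Fintype.piFinset fun _ : I => Finset.range (Fintype.card V + 1) := by
    intro N _
    rw [Fintype.mem_piFinset]
    exact fun i => Finset.mem_range.2 (Nat.lt_succ_of_le (Finset.card_le_univ _))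
  have hfib : ∀ a ∈ Fintype.piFinset fun _ : I => Finset.range (Fintype.card V + 1),
      (P.filter fun N => F N = a).card ≤ ⌊(2 : ℝ) ^ θ⌋₊ := by
    intro a _
    rcases (P.filter fun N => F N = a).eq_empty_or_nonempty with h | ⟨N₀, hN₀⟩
    · rw [h]; simp
    rw [Finset.mem_filter, hP, Finset.mem_filter] at hN₀
    obtain ⟨⟨-, h0⟩, rfl⟩ := hN₀
    have h1 : (P.filter fun N => F N = F N₀).card ≤
        (Fintype.piFinset fun i : I =>
          Finset.powersetCard (F N₀ i) (W.filter fun v => t v = i)).card := by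
      refine Finset.card_le_card_of_injOn (fun N i => (W.filter fun v => t v = i) ∩ N) ?_ ?_
      · intro N hN
        rw [Finset.mem_coe, Finset.mem_filter] at hN
        rw [Finset.mem_coe, Fintype.mem_piFinset]
        intro i
        exact Finset.mem_powersetCard.2 ⟨Finset.inter_subset_left, congrFun hN.2 i⟩
      · intro N hN M hM h
        rw [Finset.mem_coe, Finset.mem_filter, hP, Finset.mem_filter, Finset.mem_powerset] at hN hM
        ext v
        have key : v ∈ W → (v ∈ N ↔ v ∈ M) := by
          intro hv
          have := Finset.ext_iff.1 (congrFun h ⟨t v, hI v hv⟩) v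
          simpa [hv] using this
        exact ⟨fun hv => (key (hN.1.1 hv)).1 hv, fun hv => (key (hM.1.1 hv)).2 hv⟩
    refine h1.trans (Nat.le_floor ?_)
    rw [Fintype.card_piFinset]
    push_cast
    calc ∏ i : I, ((Finset.powersetCard (F N₀ i) (W.filter fun v => t v = i)).card : ℝ)
        ≤ ∏ i : I, (2 : ℝ) ^ (eta ((W.filter fun v => t v = (i : ι)) ∩ N₀).card
            ((W.filter fun v => t v = (i : ι)) \ N₀).card) := by
          refine Finset.prod_le_prod (fun _ _ => Nat.cast_nonneg _) fun i _ => ?_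
          rw [Finset.card_powersetCard, ← Finset.card_inter_add_card_sdiff _ N₀]
          exact choose_le_two_rpow_eta _ _
      _ = 2 ^ (∑ i ∈ I, eta ((W.filter fun v => t v = i) ∩ N₀).card
            ((W.filter fun v => t v = i) \ N₀).card) := by
          rw [Finset.prod_coe_sort I (fun i => (2 : ℝ) ^ (eta ((W.filter fun v => t v = i) ∩ N₀).card
            ((W.filter fun v => t v = i) \ N₀).card)), ← Real.rpow_sum_of_pos (by norm_num)]
      _ ≤ 2 ^ θ := Real.rpow_le_rpow_of_exponent_le (by norm_num) h0
  have h2 := Finset.card_le_mul_card_image_of_maps_to hF _ hfib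
  rw [Fintype.card_piFinset] at h2
  simp only [Finset.card_range, Finset.prod_const, Finset.card_univ, Fintype.card_coe] at h2
  calc (P.card : ℝ) ≤ (⌊(2 : ℝ) ^ θ⌋₊ * (Fintype.card V + 1) ^ I.card : ℕ) := by exact_mod_cast h2
    _ ≤ 2 ^ θ * (Fintype.card V + 1) ^ I.card := by
        push_cast
        exact mul_le_mul_of_nonneg_right (Nat.floor_le (by positivity)) (by positivity)
    _ = _ := mul_comm _ _

/-- The number of perfect graphs in which `x` reveals little about the cells of `R`. -/
lemma card_low_inc_le (R : Finset V) (x : V) (hx : x ∉ R) (θ : ℝ) :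
    ((Finset.univ.filter fun G : SimpleGraph V => IsPerfect G ∧
      inc G.Adj Finset.univ R x < θ).card : ℝ) ≤
      (Fintype.card V + 1) ^ 2 ^ R.card * 2 ^ θ * perfectCount (Fintype.card V - 1) := by
  set Z := Finset.univ.filter fun G : SimpleGraph V => IsPerfect G ∧
      inc G.Adj Finset.univ R x < θ with hZ
  let W := Finset.univ.erase x
  let e : {v // v ≠ x} ↪ V := Function.Embedding.subtype _
  have h1 : ∀ G ∈ Z, G.comap e ∈ Finset.univ.filter fun H : SimpleGraph {v // v ≠ x} =>
      IsPerfect H := by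
    intro G hG
    exact Finset.mem_filter.2 ⟨Finset.mem_univ _, (Finset.mem_filter.1 hG).2.1.comap e⟩
  have h2 : ∀ H ∈ Finset.univ.filter fun H : SimpleGraph {v // v ≠ x} => IsPerfect H,
      (Z.filter fun G => G.comap e = H).card ≤
        ⌊(Fintype.card V + 1 : ℝ) ^ 2 ^ R.card * 2 ^ θ⌋₊ := by
    intro H _
    rcases (Z.filter fun G => G.comap e = H).eq_empty_or_nonempty with h | ⟨G₀, hG₀⟩
    · rw [h]; simp
    have h0 := (Finset.mem_filter.1 hG₀).2
    have hadj : ∀ G ∈ Z.filter fun G => G.comap e = H, ∀ u v, u ≠ x → v ≠ x →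
        (G.Adj u v ↔ G₀.Adj u v) := by
      intro G hG u v hu hv
      have := (Finset.mem_filter.1 hG).2.trans h0.symm
      exact (congrFun (congrFun (congrArg SimpleGraph.Adj this) ⟨u, hu⟩) ⟨v, hv⟩).to_iff
    have h3 := card_split_le W (tr G₀.Adj R) R.powerset
      (fun v _ => Finset.mem_powerset.2 (tr_subset v)) θ
    rw [Finset.card_powerset] at h3
    refine Nat.le_floor (le_trans (Nat.cast_le.2 ?_) h3)
    refine Finset.card_le_card_of_injOn (fun G => W.filter fun v => G.Adj v x) ?_ ?_
    · intro G hG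
      have hG' := (Finset.mem_filter.1 (Finset.mem_filter.1 hG).1).2
      rw [Finset.mem_coe, Finset.mem_filter, Finset.mem_powerset]
      refine ⟨Finset.filter_subset _ _, le_trans (le_of_eq ?_)
        ((inc_mono (Finset.subset_univ W)).trans hG'.2.le)⟩
      refine Finset.sum_congr rfl fun T _ => ?_
      have hcell : cell G.Adj W R T = W.filter fun v => tr G₀.Adj R v = T := by
        ext v
        simp only [mem_cell, Finset.mem_filter]
        refine and_congr_right fun hv => ?_
        have : tr G.Adj R v = tr G₀.Adj R v := by
          ext u
          rw [mem_tr, mem_tr]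
          refine and_congr_right fun hu => hadj G hG v u (Finset.ne_of_mem_erase hv) ?_
          rintro rfl; exact hx hu
        rw [this]
      rw [hcell]
      congr 3
      · ext v; simp only [Finset.mem_inter, Finset.mem_filter]; tauto
      · ext v; simp only [Finset.mem_sdiff, Finset.mem_filter]; tauto
    · intro G hG G' hG' h
      ext u v
      have hN : ∀ w, w ≠ x → (G.Adj w x ↔ G'.Adj w x) := by
        intro w hw
        have := Finset.ext_iff.1 h w
        simpa [W, hw] using this
      by_cases hu : u = x
      · by_cases hv : v = x
        · rw [hu, hv]; simp
        · rw [hu, G.adj_comm, G'.adj_comm]; exact hN v hv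
      · by_cases hv : v = x
        · rw [hv]; exact hN u hu
        · rw [hadj G hG u v hu hv, hadj G' hG' u v hu hv]
  have h4 := Finset.card_le_mul_card_image_of_maps_to h1 _ h2
  have h6 : (Finset.univ.filter fun H : SimpleGraph {v // v ≠ x} => IsPerfect H).card =
      perfectCount (Fintype.card {v // v ≠ x}) := by convert card_isPerfect {v // v ≠ x}
  rw [h6] at h4
  have h5 : Fintype.card {v // v ≠ x} = Fintype.card V - 1 := by
    simp [Fintype.card_subtype_compl]
  rw [h5] at h4
  calc (Z.card : ℝ) ≤ (_ : ℕ) := Nat.cast_le.2 h4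
    _ ≤ _ := by
        push_cast
        exact mul_le_mul_of_nonneg_right (Nat.floor_le (by positivity)) (Nat.cast_nonneg _)

lemma card_poor_le (δ : ℝ) (m : ℕ) :
    ((Finset.univ.filter fun G : SimpleGraph V => IsPerfect G ∧ ¬ Rich G.Adj δ m).card : ℝ) ≤
      (Fintype.card V + 1) ^ (m + 1 + 2 ^ m) * 2 ^ ((1 / 2 - δ) * Fintype.card V) *
        perfectCount (Fintype.card V - 1) := by
  set θ := (1 / 2 - δ) * Fintype.card V
  let P := ((Finset.univ.powerset.filter fun R : Finset V => R.card ≤ m) ×ˢ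
    (Finset.univ : Finset V)).filter fun p => p.2 ∉ p.1
  have hsub : (Finset.univ.filter fun G : SimpleGraph V => IsPerfect G ∧ ¬ Rich G.Adj δ m) ⊆
      P.biUnion fun p => Finset.univ.filter fun G : SimpleGraph V => IsPerfect G ∧
      inc G.Adj Finset.univ p.1 p.2 < θ := by
    intro G hG
    obtain ⟨hp, hr⟩ := (Finset.mem_filter.1 hG).2
    unfold Rich at hr
    push Not at hr
    obtain ⟨R, x, hR, hx, hlt⟩ := hr
    refine Finset.mem_biUnion.2 ⟨(R, x), ?_, ?_⟩
    · simp [P, hR, hx]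
    · exact Finset.mem_filter.2 ⟨Finset.mem_univ _, hp, hlt⟩
  have hP : (P.card : ℝ) ≤ (Fintype.card V + 1) ^ (m + 1) := by
    have h1 : P.card ≤ (Fintype.card V + 1) ^ m * Fintype.card V := by
      refine (Finset.card_filter_le _ _).trans ?_
      rw [Finset.card_product, Finset.card_univ]
      refine Nat.mul_le_mul_right _ ?_
      have := card_powerset_filter_card_le (Finset.univ : Finset V) m
      rwa [Finset.card_univ] at this
    calc (P.card : ℝ) ≤ ((Fintype.card V + 1) ^ m * Fintype.card V : ℕ) := Nat.cast_le.2 h1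
      _ ≤ _ := by
        push_cast
        rw [pow_succ]
        exact mul_le_mul_of_nonneg_left (by linarith) (by positivity)
  calc _ ≤ ((∑ p ∈ P, (Finset.univ.filter fun G : SimpleGraph V => IsPerfect G ∧
        inc G.Adj Finset.univ p.1 p.2 < θ).card : ℕ) : ℝ) :=
        Nat.cast_le.2 ((Finset.card_le_card hsub).trans Finset.card_biUnion_le)
    _ ≤ ∑ p ∈ P, (Fintype.card V + 1 : ℝ) ^ 2 ^ m * 2 ^ θ * perfectCount (Fintype.card V - 1) := by
        push_cast
        refine Finset.sum_le_sum fun p hp => ?_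
        have hp := Finset.mem_filter.1 hp
        have hpm : p.1.card ≤ m := (Finset.mem_filter.1 (Finset.mem_product.1 hp.1).1).2
        refine (card_low_inc_le p.1 p.2 hp.2 θ).trans ?_
        gcongr
        · linarith [Nat.cast_nonneg (α := ℝ) (Fintype.card V)]
        · norm_num
    _ = P.card * ((Fintype.card V + 1 : ℝ) ^ 2 ^ m * 2 ^ θ * perfectCount (Fintype.card V - 1)) := by
        rw [Finset.sum_const, nsmul_eq_mul]
    _ ≤ (Fintype.card V + 1) ^ (m + 1) *
          ((Fintype.card V + 1 : ℝ) ^ 2 ^ m * 2 ^ θ * perfectCount (Fintype.card V - 1)) :=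
        mul_le_mul_of_nonneg_right hP (by positivity)
    _ = _ := by rw [pow_add]; ring

end Poor

section TwoClusterCount

variable {V : Type*} [DecidableEq V] [Fintype V] {S A Q Q' : Finset V} {s : ℕ} {c : ℝ}

lemma card_setoid_le_of_rel_two (Q : Bool → Finset V) :
    (Finset.univ.filter fun S : Setoid V => ∀ b, ∀ x ∈ Q b, ∀ y ∈ Q b, S x y).card ≤
      (Fintype.card V + 1) ^ (2 + (Fintype.card V - (Q false ∪ Q true).card)) := by
  let F : {S : Setoid V // ∀ b, ∀ x ∈ Q b, ∀ y ∈ Q b, S x y} →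
      Bool ⊕ {x // x ∉ Q false ∪ Q true} → Option V :=
    fun S => Sum.elim (fun b => if h : (Q b).Nonempty then some (rep S.1 h.choose) else none)
      fun v => some (rep S.1 v.1)
  have hF : F.Injective := by
    intro S T h
    refine Subtype.ext (rep_injective (funext fun v => ?_))
    by_cases hv : ∃ b, v ∈ Q b
    · obtain ⟨b, hv⟩ := hv
      have hQ : (Q b).Nonempty := ⟨v, hv⟩
      have h0 := congrFun h (Sum.inl b)
      simp only [F, Sum.elim_inl, dif_pos hQ, Option.some.injEq] at h0
      rwa [rep_eq_iff.2 (S.2 b _ hQ.choose_spec v hv),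
        rep_eq_iff.2 (T.2 b _ hQ.choose_spec v hv)] at h0
    · have := congrFun h (Sum.inr ⟨v, fun hc => hv (by
        rcases Finset.mem_union.1 hc with hc | hc
        exacts [⟨_, hc⟩, ⟨_, hc⟩])⟩)
      simpa [F] using this
  have h1 := Fintype.card_le_of_injective F hF
  rw [Fintype.card_fun, Fintype.card_option, Fintype.card_sum, Fintype.card_bool,
    Fintype.card_subtype] at h1
  refine h1.trans_eq ?_
  congr 2
  rw [Fintype.card_subtype_compl, Fintype.card_coe]

/-- The partition of the vertices into the blocks of `A`, the blocks of `B` and singletons. -/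
def blockSetoid (G : SimpleGraph V) (A B : Finset V) (hA : Cluster G.Adj A)
    (hB : Cluster G.Adj B) (hAB : Disjoint A B) : Setoid V where
  r u v := u = v ∨ (u ∈ A ∧ v ∈ A ∧ G.Adj u v) ∨ (u ∈ B ∧ v ∈ B ∧ G.Adj u v)
  iseqv := by
    refine ⟨fun _ => Or.inl rfl, ?_, ?_⟩
    · rintro x y (rfl | h | h)
      · exact Or.inl rfl
      · exact Or.inr (Or.inl ⟨h.2.1, h.1, h.2.2.symm⟩)
      · exact Or.inr (Or.inr ⟨h.2.1, h.1, h.2.2.symm⟩)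
    · intro x y z h h'
      by_cases hxz : x = z
      · exact Or.inl hxz
      rcases h with rfl | h | h
      · exact h'
      · rcases h' with rfl | h' | h'
        · exact Or.inr (Or.inl h)
        · exact Or.inr (Or.inl ⟨h.1, h'.2.1, hA _ h.1 _ h.2.1 _ h'.2.1 hxz h.2.2 h'.2.2⟩)
        · exact absurd h'.1 (Finset.disjoint_left.1 hAB h.2.1)
      · rcases h' with rfl | h' | h'
        · exact Or.inr (Or.inr h)
        · exact absurd h.2.1 (Finset.disjoint_left.1 hAB h'.1)
        · exact Or.inr (Or.inr ⟨h.1, h'.2.1, hB _ h.1 _ h.2.1 _ h'.2.1 hxz h.2.2 h'.2.2⟩)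

lemma blockSetoid_iff {G : SimpleGraph V} {A B : Finset V} {hA : Cluster G.Adj A}
    {hB : Cluster G.Adj B} {hAB : Disjoint A B} {u v : V} : blockSetoid G A B hA hB hAB u v ↔
      u = v ∨ (u ∈ A ∧ v ∈ A ∧ G.Adj u v) ∨ (u ∈ B ∧ v ∈ B ∧ G.Adj u v) := Iff.rfl

lemma TwoCluster.disjoint {r : V → V → Prop} (_h : TwoCluster r s c S A Q Q') :
    Disjoint A (S ∪ A)ᶜ :=
  Finset.disjoint_left.2 fun _ hv hv' => Finset.mem_compl.1 hv' (Finset.mem_union_right _ hv)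

lemma card_twoCluster_le (s : ℕ) (c : ℝ) (S A Q Q' : Finset V) :
    (Finset.univ.filter fun G : SimpleGraph V => TwoCluster G.Adj s c S A Q Q').card ≤
      2 ^ (S.card * Fintype.card V) * 2 ^ (A.card * ((S ∪ A)ᶜ).card) *
        (Fintype.card V + 1) ^ (2 + (Fintype.card V - (Q ∪ Q').card)) := by
  let Qb : Bool → Finset V := fun b => bif b then Q' else Q
  let F : {G : SimpleGraph V // TwoCluster G.Adj s c S A Q Q'} →
      ((S × V → Bool) × (A × ((S ∪ A)ᶜ : Finset V) → Bool)) ×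
        {T : Setoid V // ∀ b, ∀ x ∈ Qb b, ∀ y ∈ Qb b, T x y} := fun G =>
    ((fun p => decide (G.1.Adj p.1 p.2), fun p => decide (G.1.Adj p.1 p.2)),
      ⟨blockSetoid G.1 A (S ∪ A)ᶜ G.2.left G.2.right G.2.disjoint, by
        rintro (_ | _) x hx y hy <;> by_cases hxy : x = y
        · exact Or.inl hxy
        · exact Or.inr (Or.inl ⟨G.2.subQ hx, G.2.subQ hy, G.2.cliqueQ x hx y hy hxy⟩)
        · exact Or.inl hxy
        · exact Or.inr (Or.inr ⟨G.2.subQ' hx, G.2.subQ' hy, G.2.cliqueQ' x hx y hy hxy⟩)⟩)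
  have hF : F.Injective := by
    rintro ⟨G, hG⟩ ⟨H, hH⟩ h
    simp only [F, Prod.mk.injEq, Subtype.mk.injEq] at h
    obtain ⟨⟨h1, h2⟩, h3⟩ := h
    have k1 : ∀ u ∈ S, ∀ v, G.Adj u v ↔ H.Adj u v := fun u hu v => by
      simpa using congrFun h1 (⟨u, hu⟩, v)
    have k2 : ∀ u ∈ A, ∀ v ∈ (S ∪ A)ᶜ, (G.Adj u v ↔ H.Adj u v) := fun u hu v hv => by
      simpa using congrFun h2 (⟨u, hu⟩, ⟨v, hv⟩)
    have k3 : ∀ u v, (u ∈ A ∧ v ∈ A) ∨ (u ∈ (S ∪ A)ᶜ ∧ v ∈ (S ∪ A)ᶜ) →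
        (G.Adj u v ↔ H.Adj u v) := by
      intro u v huv
      by_cases e : u = v
      · rw [e]; simp
      have h4 : blockSetoid G A (S ∪ A)ᶜ hG.left hG.right hG.disjoint u v ↔
          blockSetoid H A (S ∪ A)ᶜ hH.left hH.right hH.disjoint u v := by rw [h3]
      have h5 : ∀ (G : SimpleGraph V) (hG : TwoCluster G.Adj s c S A Q Q'),
          blockSetoid G A (S ∪ A)ᶜ hG.left hG.right hG.disjoint u v ↔ G.Adj u v := by
        intro G hG
        rw [blockSetoid_iff]
        constructor
        · rintro (h | h | h)
          exacts [absurd h e, h.2.2, h.2.2]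
        · intro h
          rcases huv with h' | h'
          exacts [Or.inr (Or.inl ⟨h'.1, h'.2, h⟩), Or.inr (Or.inr ⟨h'.1, h'.2, h⟩)]
      rwa [h5 G hG, h5 H hH] at h4
    refine Subtype.ext (SimpleGraph.ext (funext fun u => funext fun v => propext ?_))
    by_cases hu : u ∈ S
    · exact k1 u hu v
    by_cases hv : v ∈ S
    · rw [G.adj_comm, H.adj_comm]; exact k1 v hv u
    have hc : ∀ w, w ∉ S → w ∉ A → w ∈ (S ∪ A)ᶜ := fun w h h' =>
      Finset.mem_compl.2 fun hw => (Finset.mem_union.1 hw).elim h h'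
    by_cases hu' : u ∈ A <;> by_cases hv' : v ∈ A
    · exact k3 u v (Or.inl ⟨hu', hv'⟩)
    · exact k2 u hu' v (hc v hv hv')
    · rw [G.adj_comm, H.adj_comm]; exact k2 v hv' u (hc u hu hu')
    · exact k3 u v (Or.inr ⟨hc u hu hu', hc v hv hv'⟩)
  have h1 := Fintype.card_le_of_injective F hF
  rw [Fintype.card_prod, Fintype.card_prod, Fintype.card_fun, Fintype.card_fun, Fintype.card_prod,
    Fintype.card_prod, Fintype.card_bool, Fintype.card_coe, Fintype.card_coe, Fintype.card_coe,
    Fintype.card_subtype, Fintype.card_subtype] at h1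
  exact h1.trans (Nat.mul_le_mul_left _ (card_setoid_le_of_rel_two Qb))

lemma four_mul_mul_le_sq {a b n : ℕ} (h : a + b ≤ n) : 4 * (a * b) ≤ n ^ 2 := by
  zify at *
  nlinarith [sq_nonneg ((a : ℤ) - b)]

lemma card_exists_twoCluster_le (s : ℕ) (c : ℝ) (hV : 0 < Fintype.card V) :
    ((Finset.univ.filter fun G : SimpleGraph V =>
      ∃ S A Q Q', TwoCluster G.Adj s c S A Q Q').card : ℝ) ≤
      Real.exp (Fintype.card V ^ 2 / 4 * Real.log 2 + Fintype.card V * (4 + s) * Real.log 2 +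
        (2 + (1 / 2 - c) * Fintype.card V) * Real.log (Fintype.card V + 1)) := by
  set n := Fintype.card V with hn
  have hlog : 0 ≤ Real.log ((n : ℝ) + 1) := Real.log_nonneg (by linarith [Nat.cast_nonneg (α := ℝ) n])
  have hsub : (Finset.univ.filter fun G : SimpleGraph V =>
      ∃ S A Q Q', TwoCluster G.Adj s c S A Q Q') ⊆
      (Finset.univ : Finset (Finset V × Finset V × Finset V × Finset V)).biUnion fun p =>
        Finset.univ.filter fun G : SimpleGraph V => TwoCluster G.Adj s c p.1 p.2.1 p.2.2.1 p.2.2.2 := by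
    intro G hG
    obtain ⟨S, A, Q, Q', h⟩ := (Finset.mem_filter.1 hG).2
    exact Finset.mem_biUnion.2 ⟨(S, A, Q, Q'), Finset.mem_univ _,
      Finset.mem_filter.2 ⟨Finset.mem_univ _, h⟩⟩
  have h1 := (Finset.card_le_card hsub).trans Finset.card_biUnion_le
  have h2 : ∀ p : Finset V × Finset V × Finset V × Finset V,
      ((Finset.univ.filter fun G : SimpleGraph V =>
        TwoCluster G.Adj s c p.1 p.2.1 p.2.2.1 p.2.2.2).card : ℝ) ≤
      Real.exp (n ^ 2 / 4 * Real.log 2 + n * s * Real.log 2 +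
        (2 + (1 / 2 - c) * n) * Real.log (n + 1)) := by
    rintro ⟨S, A, Q, Q'⟩
    rcases (Finset.univ.filter fun G : SimpleGraph V =>
        TwoCluster G.Adj s c S A Q Q').eq_empty_or_nonempty with he | ⟨G, hG⟩
    · simp only [he, Finset.card_empty, Nat.cast_zero]; positivity
    have hG := (Finset.mem_filter.1 hG).2
    have h3 := card_twoCluster_le s c S A Q Q'
    have h4 : ((Finset.univ.filter fun G : SimpleGraph V =>
        TwoCluster G.Adj s c S A Q Q').card : ℝ) ≤ 2 ^ (S.card * n) *
        2 ^ (A.card * ((S ∪ A)ᶜ).card) * (n + 1) ^ (2 + (n - (Q ∪ Q').card)) := by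
      exact_mod_cast h3
    refine h4.trans ?_
    rw [← Real.exp_log (show (0 : ℝ) < 2 ^ (S.card * n) * 2 ^ (A.card * ((S ∪ A)ᶜ).card) *
      (n + 1) ^ (2 + (n - (Q ∪ Q').card)) by positivity),
      Real.log_mul (by positivity) (by positivity), Real.log_mul (by positivity) (by positivity),
      Real.log_pow, Real.log_pow, Real.log_pow]
    apply Real.exp_le_exp.2
    have e1 : ((S.card * n : ℕ) : ℝ) ≤ n * s := by
      have : (S.card : ℝ) ≤ s := by exact_mod_cast hG.card_S
      push_cast
      rw [mul_comm]
      exact mul_le_mul_of_nonneg_left this (Nat.cast_nonneg _)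
    have e2 : ((A.card * ((S ∪ A)ᶜ).card : ℕ) : ℝ) ≤ n ^ 2 / 4 := by
      have h5 : A.card + ((S ∪ A)ᶜ).card ≤ n := by
        rw [← Finset.card_union_of_disjoint hG.disjoint]
        exact Finset.card_le_univ _
      have : ((4 * (A.card * ((S ∪ A)ᶜ).card) : ℕ) : ℝ) ≤ (n ^ 2 : ℕ) :=
        Nat.cast_le.2 (four_mul_mul_le_sq h5)
      push_cast at this ⊢
      linarith
    have e3 : ((2 + (n - (Q ∪ Q').card) : ℕ) : ℝ) ≤ 2 + (1 / 2 - c) * n := by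
      have h5 : (Q ∪ Q').card = Q.card + Q'.card :=
        Finset.card_union_of_disjoint (hG.disjoint.mono hG.subQ hG.subQ')
      have h6 : (Q ∪ Q').card ≤ n := Finset.card_le_univ _
      rw [Nat.cast_add, Nat.cast_sub h6, h5]
      push_cast
      have := hG.card_le
      rw [← hn] at this
      linarith
    have l2 := Real.log_pos (show (1 : ℝ) < 2 by norm_num)
    have f1 := mul_le_mul_of_nonneg_right e1 l2.le
    have f2 := mul_le_mul_of_nonneg_right e2 l2.le
    have f3 := mul_le_mul_of_nonneg_right e3 hlog
    linarith
  calc _ ≤ ((∑ p : Finset V × Finset V × Finset V × Finset V,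
        (Finset.univ.filter fun G : SimpleGraph V =>
          TwoCluster G.Adj s c p.1 p.2.1 p.2.2.1 p.2.2.2).card : ℕ) : ℝ) := Nat.cast_le.2 h1
    _ ≤ ∑ p : Finset V × Finset V × Finset V × Finset V,
        Real.exp (n ^ 2 / 4 * Real.log 2 + n * s * Real.log 2 +
        (2 + (1 / 2 - c) * n) * Real.log (n + 1)) := by
      push_cast
      exact Finset.sum_le_sum fun p _ => h2 p
    _ = _ := by
      rw [Finset.sum_const, Finset.card_univ, Fintype.card_prod, Fintype.card_prod,
        Fintype.card_prod, Fintype.card_finset, nsmul_eq_mul]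
      push_cast
      rw [show (2 : ℝ) ^ n * (2 ^ n * (2 ^ n * 2 ^ n)) = Real.exp (n * 4 * Real.log 2) by
        rw [← pow_add, ← pow_add, ← pow_add,
          ← Real.exp_log (show (0 : ℝ) < 2 ^ (n + (n + (n + n))) by positivity), Real.log_pow]
        push_cast; congr 1; ring, ← Real.exp_add]
      congr 1; ring

lemma eventually_card_twoCluster_le (s : ℕ) {c : ℝ} (hc : 0 < c) : ∀ᶠ n : ℕ in atTop,
    ((Finset.univ.filter fun G : SimpleGraph (Fin n) =>
      ∃ S A Q Q', TwoCluster G.Adj s c S A Q Q').card : ℝ) ≤ Real.exp (-n) * scrL n := by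
  wlog hc2 : c < 1 / 2 generalizing c
  · filter_upwards [this (c := 1 / 4) (by norm_num) (by norm_num)] with n hn
    refine le_trans ?_ hn
    refine Nat.cast_le.2 (Finset.card_le_card fun G hG => ?_)
    obtain ⟨S, A, Q, Q', h⟩ := (Finset.mem_filter.1 hG).2
    refine Finset.mem_filter.2 ⟨Finset.mem_univ _, S, A, Q, Q', { h with card_le := ?_ }⟩
    exact (mul_le_mul_of_nonneg_right (by linarith) (Nat.cast_nonneg _)).trans h.card_le
  filter_upwards [exp_le_scrL (ε := c / 2) (by linarith) ((4 + s) * Real.log 2 + 4),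
    eventually_ge_atTop 1, eventually_le_cast (4 / c)] with n hn h1 h2
  have hn1 : (1 : ℝ) ≤ n := by exact_mod_cast h1
  have hlog0 : 0 ≤ Real.log n := Real.log_natCast_nonneg n
  have hlog : Real.log (n + 1) ≤ Real.log n + 1 / n := by
    have : (n : ℝ) + 1 = n * (1 + 1 / n) := by field_simp
    rw [this, Real.log_mul (by positivity) (by positivity)]
    have := Real.log_le_sub_one_of_pos (show 0 < 1 + 1 / (n : ℝ) by positivity)
    linarith
  have h3 := card_exists_twoCluster_le (V := Fin n) s c (by rw [Fintype.card_fin]; exact h1)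
  rw [Fintype.card_fin] at h3
  refine le_trans ?_ (mul_le_mul_of_nonneg_left hn (Real.exp_nonneg _))
  rw [← Real.exp_add]
  refine le_trans (le_of_eq (by congr!)) (h3.trans ?_)
  apply Real.exp_le_exp.2
  have h4 : (2 + (1 / 2 - c) * n) * Real.log (n + 1) ≤
      (2 + (1 / 2 - c) * n) * (Real.log n + 1 / n) := by
    refine mul_le_mul_of_nonneg_left hlog ?_
    have : 0 ≤ (1 / 2 - c) * n := mul_nonneg (by linarith) (by linarith)
    linarith
  have h5 : (2 + (1 / 2 - c) * n) * (Real.log n + 1 / n) =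
      (2 + (1 / 2 - c) * n) * Real.log n + 2 / n + (1 / 2 - c) := by
    field_simp
    ring
  have h6 : 2 / (n : ℝ) ≤ 2 := by rw [div_le_iff₀ (by linarith)]; linarith
  have h7 : 2 ≤ c / 2 * n := by
    rw [div_le_iff₀ hc] at h2
    linarith
  have h8 := mul_le_mul_of_nonneg_right h7 hlog0
  linarith

lemma TwoCluster.compl {G : SimpleGraph V} (h : TwoCluster (fun u v => ¬ G.Adj u v) s c S A Q Q') :
    TwoCluster Gᶜ.Adj s c S A Q Q' where
  card_S := h.card_S
  disj := h.disj
  left x hx y hy z hz hxz h1 h2 := ⟨hxz, h.left x hx y hy z hz hxz h1.2 h2.2⟩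
  right x hx y hy z hz hxz h1 h2 := ⟨hxz, h.right x hx y hy z hz hxz h1.2 h2.2⟩
  subQ := h.subQ
  subQ' := h.subQ'
  cliqueQ x hx y hy hxy := ⟨hxy, h.cliqueQ x hx y hy hxy⟩
  cliqueQ' x hx y hy hxy := ⟨hxy, h.cliqueQ' x hx y hy hxy⟩
  card_le := h.card_le

lemma card_filter_compl (p : SimpleGraph V → Prop) :
    (Finset.univ.filter fun G : SimpleGraph V => p Gᶜ).card =
      (Finset.univ.filter fun G : SimpleGraph V => p G).card := by
  refine Finset.card_bij (fun G _ => Gᶜ) ?_ ?_ ?_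
  · intro G hG
    simpa using hG
  · intro G _ H _ h
    exact compl_injective h
  · intro G hG
    exact ⟨Gᶜ, by simpa using hG, compl_compl _⟩

end TwoClusterCount

section NearSplitCount

variable {V : Type*} [DecidableEq V] [Fintype V]

lemma isUnipolarArrangement_iff {G : SimpleGraph V} {C : Set V} : IsUnipolarArrangement G C ↔
    G.IsClique C ∧ ∀ x ∉ C, ∀ y ∉ C, ∀ z ∉ C, x ≠ z → G.Adj x y → G.Adj y z → G.Adj x z := by
  refine and_congr_right fun _ => ⟨fun h x hx y hy z hz hxz h1 h2 => ?_, fun h => ?_⟩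
  · have e1 : (G.induce Cᶜ).Adj ⟨x, hx⟩ ⟨y, hy⟩ := h1
    have e2 : (G.induce Cᶜ).Adj ⟨y, hy⟩ ⟨z, hz⟩ := h2
    exact h ⟨x, hx⟩ ⟨z, hz⟩ (e1.reachable.trans e2.reachable) fun e => hxz (congrArg Subtype.val e)
  · rintro u v ⟨w⟩
    induction w with
    | nil => exact fun h => absurd rfl h
    | @cons u w v huw p ih =>
      intro huv
      by_cases hwv : w = v
      · rwa [← hwv]
      · exact h u u.2 w w.2 v v.2 (fun e => huv (Subtype.ext e)) huw (ih hwv)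

lemma NearSplit.isGenSplit {G : SimpleGraph V} {K : Finset V} (h : NearSplit G.Adj K)
    (hK : G.IsClique (K : Set V) ∨ G.IsIndepSet ((Kᶜ : Finset V) : Set V)) : IsGenSplit G := by
  rcases hK with hK | hK
  · refine Or.inl ⟨K, isUnipolarArrangement_iff.2 ⟨hK, fun x hx y hy z hz hxz h1 h2 => ?_⟩⟩
    by_contra hc
    exact h.no_path x hx y hy z hz hxz hc h1 h2.symm
  · refine Or.inr ⟨((Kᶜ : Finset V) : Set V), isUnipolarArrangement_iff.2
      ⟨fun x hx y hy hxy => ⟨hxy, hK hx hy hxy⟩, fun x hx y hy z hz hxz h1 h2 => ⟨hxz, ?_⟩⟩⟩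
    simp only [Finset.coe_compl, Set.mem_compl_iff, not_not, Finset.mem_coe] at hx hy hz
    intro hc
    exact h.no_coPath x hx y hy z hz hxz hc h1.2 fun e => h2.2 e.symm

/-- The base of the decay rate in the count of nearly split graphs. -/
def decay : ℝ := (15 / 16 : ℝ) ^ ((1 : ℝ) / 4)

lemma decay_pos : 0 < decay := Real.rpow_pos_of_pos (by norm_num) _

lemma decay_lt_one : decay < 1 := Real.rpow_lt_one (by norm_num) (by norm_num) (by norm_num)

lemma decay_pow_four : decay ^ 4 = 15 / 16 := by
  rw [decay, ← Real.rpow_natCast, ← Real.rpow_mul (by norm_num)]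
  norm_num

/-- The forbidden pattern across two partitions. -/
def NoSquare {α β : Type*} (S : Setoid α) (T : Setoid β) (ω : α × β → Bool) : Prop :=
  ∀ p q, S p q → ∀ a b, T a b → a ≠ b → ω (p, a) = true → ω (q, b) = true →
    ω (p, b) = false → ω (q, a) = false → False

lemma card_noSquare_le {α β : Type*} [Fintype α] [Fintype β] [DecidableEq α] [DecidableEq β]
    (S : Setoid α) (T : Setoid β) :
    ((Finset.univ.filter fun ω : α × β → Bool => NoSquare S T ω).card : ℝ) ≤
      decay ^ (rk S * rk T) * 2 ^ (Fintype.card α * Fintype.card β) := by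
  obtain ⟨t, e, he, ht, heS⟩ := exists_matching S
  obtain ⟨t', e', he', ht', heT⟩ := exists_matching T
  let E : (Fin t × Fin t') × (Bool × Bool) → α × β := fun z => (e (z.1.1, z.2.1), e' (z.1.2, z.2.2))
  have hE : E.Injective := by
    rintro ⟨⟨i, j⟩, ⟨a, b⟩⟩ ⟨⟨i', j'⟩, ⟨a', b'⟩⟩ h
    simp only [E, Prod.mk.injEq] at h
    have h1 := he h.1
    have h2 := he' h.2
    simp only [Prod.mk.injEq] at h1 h2 ⊢
    tauto
  have h1 := card_avoid E hE fun _ z => z.1 == z.2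
  simp only [Fintype.card_prod, Fintype.card_bool, Fintype.card_fin] at h1
  have h2 : (Finset.univ.filter fun ω : α × β → Bool => NoSquare S T ω).card ≤
      Nat.card {ω : α × β → Bool // ∀ i, ∃ t, ω (E (i, t)) ≠ (t.1 == t.2)} := by
    rw [Nat.card_eq_fintype_card, Fintype.card_subtype]
    refine Finset.card_le_card fun ω hω => ?_
    have hω := (Finset.mem_filter.1 hω).2
    refine Finset.mem_filter.2 ⟨Finset.mem_univ _, ?_⟩
    rintro ⟨i, j⟩
    by_contra hc
    push Not at hc
    refine hω _ _ (heS i) _ _ (heT j) (fun h => ?_) (hc (false, false)) (hc (true, true))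
      (hc (false, true)) (hc (true, false))
    have := he' h
    simp at this
  have h3 : ((Finset.univ.filter fun ω : α × β → Bool => NoSquare S T ω).card : ℝ) *
      16 ^ (t * t') ≤ 15 ^ (t * t') * 2 ^ (Fintype.card α * Fintype.card β) := by
    have := (Nat.mul_le_mul_right _ h2).trans h1
    norm_num at this
    exact_mod_cast this
  have h4 : (15 / 16 : ℝ) ^ (t * t') ≤ decay ^ (rk S * rk T) := by
    rw [← decay_pow_four, ← pow_mul]
    refine pow_le_pow_of_le_one decay_pos.le decay_lt_one.le ?_
    calc rk S * rk T ≤ 2 * t * (2 * t') := Nat.mul_le_mul ht ht'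
      _ = _ := by ring
  rw [← le_div_iff₀ (by positivity)] at h3
  calc _ ≤ _ := h3
    _ = (15 / 16 : ℝ) ^ (t * t') * 2 ^ (Fintype.card α * Fintype.card β) := by
      rw [div_pow]; ring
    _ ≤ _ := mul_le_mul_of_nonneg_right h4 (by positivity)

lemma rk_eq_zero {α : Type*} [Fintype α] [DecidableEq α] {S : Setoid α} (h : rk S = 0) {u v : α}
    (huv : S u v) : u = v := by
  have key : ∀ w, rep S w = w := by
    intro w
    have := Finset.ext_iff.1 (Finset.card_eq_zero.1 h) w
    simpa using this
  rw [← key u, ← key v, rep_eq_iff.2 huv]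

lemma rk_bot {α : Type*} [Fintype α] [DecidableEq α] : rk (⊥ : Setoid α) = 0 := by
  rw [rk, Finset.card_eq_zero]
  ext v
  simpa using rel_rep ⊥ v

lemma sum_pow_rk_pos_le {γ : Type*} [Fintype γ] [DecidableEq γ] {x : ℝ} (hx0 : 0 < x) {n : ℕ}
    (hγ : Fintype.card γ ≤ n) :
    ∑ S ∈ Finset.univ.filter (fun S : Setoid γ => 0 < rk S), x ^ rk S ≤ (1 + n * x) ^ n - 1 := by
  have h1 := sum_pow_rk (α := γ) hx0.le
  have h2 : (1 + Fintype.card γ * x) ^ Fintype.card γ ≤ (1 + n * x) ^ n := by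
    have hγ' : (Fintype.card γ : ℝ) ≤ n := by exact_mod_cast hγ
    calc _ ≤ (1 + n * x) ^ Fintype.card γ := by gcongr
      _ ≤ _ := pow_le_pow_right₀ (by
        have : 0 ≤ (n : ℝ) * x := by positivity
        linarith) hγ
  have h3 : (1 : ℝ) ≤ ∑ S ∈ Finset.univ.filter (fun S : Setoid γ => ¬ 0 < rk S), x ^ rk S := by
    have := Finset.single_le_sum (s := Finset.univ.filter (fun S : Setoid γ => ¬ 0 < rk S))
      (f := fun S : Setoid γ => x ^ rk S) (a := ⊥) (fun S _ => (pow_pos hx0 _).le)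
      (Finset.mem_filter.2 ⟨Finset.mem_univ _, by rw [rk_bot]; simp⟩)
    rwa [rk_bot, pow_zero] at this
  have h4 := Finset.sum_filter_add_sum_filter_not Finset.univ (fun S : Setoid γ => 0 < rk S)
    fun S => x ^ rk S
  linarith

/-- Sum of the weights of the pairs of nontrivial partitions. -/
lemma sum_decay_le {α β : Type*} [Fintype α] [Fintype β] [DecidableEq α] [DecidableEq β]
    (a : ℕ) {n : ℕ} (hα : Fintype.card α ≤ n) (hβ : Fintype.card β ≤ n) :
    ∑ p ∈ Finset.univ.filter (fun p : Setoid α × Setoid β => 0 < rk p.1 ∧ 0 < rk p.2),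
      decay ^ (rk p.1 * rk p.2) ≤
      bell (Fintype.card β) * ((1 + n * decay ^ a) ^ n - 1) +
      bell (Fintype.card α) * ((1 + n * decay ^ a) ^ n - 1) +
      2 ^ Fintype.card α * (Fintype.card α + 1) ^ a * (2 ^ Fintype.card β * (Fintype.card β + 1) ^ a) := by
  have hd := decay_pos
  set x := decay ^ a with hx
  have hx0 : 0 < x := pow_pos hd _
  have hpt : ∀ p ∈ Finset.univ.filter (fun p : Setoid α × Setoid β => 0 < rk p.1 ∧ 0 < rk p.2),
      decay ^ (rk p.1 * rk p.2) ≤ (if 0 < rk p.1 then x ^ rk p.1 else 0) +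
        (if 0 < rk p.2 then x ^ rk p.2 else 0) +
        (if rk p.1 ≤ a then 1 else 0) * (if rk p.2 ≤ a then 1 else 0) := by
    intro p hp
    obtain ⟨h1, h2⟩ := (Finset.mem_filter.1 hp).2
    rw [if_pos h1, if_pos h2]
    have p1 := pow_pos hx0 (rk p.1)
    have p2 := pow_pos hx0 (rk p.2)
    by_cases c2 : rk p.2 ≤ a
    · by_cases c1 : rk p.1 ≤ a
      · rw [if_pos c1, if_pos c2]
        have := pow_le_one₀ (n := rk p.1 * rk p.2) hd.le decay_lt_one.le
        linarith
      · have : decay ^ (rk p.1 * rk p.2) ≤ x ^ rk p.2 := by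
          rw [hx, ← pow_mul]
          exact pow_le_pow_of_le_one hd.le decay_lt_one.le (Nat.mul_le_mul_right _ (by omega))
        rw [if_neg c1]
        linarith
    · have : decay ^ (rk p.1 * rk p.2) ≤ x ^ rk p.1 := by
        rw [hx, ← pow_mul, mul_comm]
        exact pow_le_pow_of_le_one hd.le decay_lt_one.le (Nat.mul_le_mul_right _ (by omega))
      rw [if_neg c2]
      linarith
  refine (Finset.sum_le_sum hpt).trans ((Finset.sum_le_univ_sum_of_nonneg fun p => ?_).trans ?_)
  · have p1 := pow_pos hx0 (rk p.1)
    have p2 := pow_pos hx0 (rk p.2)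
    split_ifs <;> positivity
  rw [Finset.sum_add_distrib, Finset.sum_add_distrib, Fintype.sum_prod_type, Fintype.sum_prod_type,
    Fintype.sum_prod_type]
  refine add_le_add (add_le_add ?_ ?_) ?_
  · simp only [Finset.sum_const, Finset.card_univ, nsmul_eq_mul, ← Finset.mul_sum]
    rw [card_setoid, ← Finset.sum_filter]
    exact mul_le_mul_of_nonneg_left (sum_pow_rk_pos_le hx0 hα) (Nat.cast_nonneg _)
  · simp only [Finset.sum_const, Finset.card_univ, nsmul_eq_mul]
    rw [card_setoid, ← Finset.sum_filter]
    exact mul_le_mul_of_nonneg_left (sum_pow_rk_pos_le hx0 hβ) (Nat.cast_nonneg _)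
  · refine (Finset.sum_mul_sum _ _ (fun S : Setoid α => if rk S ≤ a then (1 : ℝ) else 0)
      fun T : Setoid β => if rk T ≤ a then (1 : ℝ) else 0).symm.le.trans ?_
    rw [Finset.sum_boole, Finset.sum_boole]
    exact mul_le_mul (card_rk_le a) (card_rk_le a) (Nat.cast_nonneg _) (by positivity)

/-- The partition of the first part of a nearly split graph. -/
def NearSplit.fstSetoid {G : SimpleGraph V} {K : Finset V} (h : NearSplit G.Adj K) : Setoid K where
  r u v := ¬ G.Adj u v
  iseqv := ⟨fun u => G.loopless.irrefl u, fun h h' => h h'.symm, fun {x y z} h1 h2 h3 =>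
    h.no_coPath x x.2 y y.2 z z.2 h3.ne h3 h1 fun e => h2 e.symm⟩

/-- The partition of the second part of a nearly split graph. -/
def NearSplit.sndSetoid {G : SimpleGraph V} {K : Finset V} (h : NearSplit G.Adj K) :
    Setoid {v // v ∉ K} where
  r u v := u = v ∨ G.Adj u v
  iseqv := by
    refine ⟨fun _ => Or.inl rfl, ?_, ?_⟩
    · rintro x y (h | h)
      exacts [Or.inl h.symm, Or.inr h.symm]
    · rintro x y z (rfl | h1) h2
      · exact h2
      rcases h2 with rfl | h2
      · exact Or.inr h1
      by_cases e : x = z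
      · exact Or.inl e
      · refine Or.inr ?_
        by_contra hc
        exact h.no_path x x.2 y y.2 z z.2 (fun h => e (Subtype.ext h)) hc h1 h2.symm

lemma card_nearSplit_le (K : Finset V) (a : ℕ) :
    ((Finset.univ.filter fun G : SimpleGraph V => NearSplit G.Adj K ∧ ¬ IsGenSplit G).card : ℝ) ≤
      2 ^ (K.card * (Fintype.card V - K.card)) *
      (bell (Fintype.card V - K.card) * ((1 + Fintype.card V * decay ^ a) ^ Fintype.card V - 1) +
      bell K.card * ((1 + Fintype.card V * decay ^ a) ^ Fintype.card V - 1) +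
      2 ^ Fintype.card V * (Fintype.card V + 1) ^ (2 * a)) := by
  set n := Fintype.card V with hn
  have hKn : K.card ≤ n := Finset.card_le_univ _
  have c1 : Fintype.card K = K.card := Fintype.card_coe K
  have c2 : Fintype.card {v // v ∉ K} = n - K.card := by
    rw [Fintype.card_subtype_compl, Fintype.card_coe]
  let T : Finset (Σ _ : Setoid K × Setoid {v // v ∉ K}, K × {v // v ∉ K} → Bool) :=
    (Finset.univ.filter fun p => 0 < rk p.1 ∧ 0 < rk p.2).sigma
      fun p => Finset.univ.filter fun ω => NoSquare p.1 p.2 ω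
  let F : SimpleGraph V → Σ _ : Setoid K × Setoid {v // v ∉ K}, K × {v // v ∉ K} → Bool := fun G =>
    if h : NearSplit G.Adj K then ⟨(h.fstSetoid, h.sndSetoid), fun z => decide (G.Adj z.1 z.2)⟩
    else ⟨(⊥, ⊥), fun _ => false⟩
  have h1 : (Finset.univ.filter fun G : SimpleGraph V => NearSplit G.Adj K ∧ ¬ IsGenSplit G).card ≤
      T.card := by
    refine Finset.card_le_card_of_injOn F ?_ ?_
    · intro G hG
      obtain ⟨h, hg⟩ := (Finset.mem_filter.1 hG).2
      rw [Finset.mem_coe, Finset.mem_sigma, Finset.mem_filter, Finset.mem_filter]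
      simp only [F, dif_pos h, Finset.mem_univ, true_and]
      refine ⟨⟨?_, ?_⟩, ?_⟩
      · by_contra h0
        refine hg (h.isGenSplit (Or.inl fun x hx y hy hxy => ?_))
        by_contra hc
        exact hxy (congrArg Subtype.val (rk_eq_zero (u := ⟨x, hx⟩) (v := ⟨y, hy⟩)
          (Nat.eq_zero_of_not_pos h0) hc))
      · by_contra h0
        refine hg (h.isGenSplit (Or.inr fun x hx y hy hxy hc => ?_))
        rw [Finset.mem_coe, Finset.mem_compl] at hx hy
        exact hxy (congrArg Subtype.val (rk_eq_zero (u := ⟨x, hx⟩) (v := ⟨y, hy⟩)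
          (Nat.eq_zero_of_not_pos h0) (Or.inr hc)))
      · intro p q hpq a b hab hne h1 h2 h3 h4
        simp only [decide_eq_true_eq, decide_eq_false_iff_not] at h1 h2 h3 h4
        exact h.no_square p p.2 q q.2 a a.2 b b.2 hpq (hab.resolve_left hne) h1 h2 h3 h4
    · intro G hG H hH hGH
      have hg := (Finset.mem_filter.1 hG).2.1
      have hh := (Finset.mem_filter.1 hH).2.1
      simp only [F, dif_pos hg, dif_pos hh, Sigma.mk.injEq, heq_eq_eq, Prod.mk.injEq] at hGH
      obtain ⟨⟨e1, e2⟩, e3⟩ := hGH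
      have k1 : ∀ u ∈ K, ∀ v ∉ K, (G.Adj u v ↔ H.Adj u v) := fun u hu v hv => by
        simpa using congrFun e3 (⟨u, hu⟩, ⟨v, hv⟩)
      ext u v
      by_cases hu : u ∈ K <;> by_cases hv : v ∈ K
      · have : hg.fstSetoid ⟨u, hu⟩ ⟨v, hv⟩ ↔ hh.fstSetoid ⟨u, hu⟩ ⟨v, hv⟩ := by rw [e1]
        exact not_iff_not.1 this
      · exact k1 u hu v hv
      · rw [G.adj_comm, H.adj_comm]; exact k1 v hv u hu
      · by_cases e : u = v
        · rw [e]; simp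
        have e' : (⟨u, hu⟩ : {v // v ∉ K}) ≠ ⟨v, hv⟩ := fun h => e (congrArg Subtype.val h)
        have : hg.sndSetoid ⟨u, hu⟩ ⟨v, hv⟩ ↔ hh.sndSetoid ⟨u, hu⟩ ⟨v, hv⟩ := by rw [e2]
        exact ⟨fun h => (this.1 (Or.inr h)).resolve_left e',
          fun h => (this.2 (Or.inr h)).resolve_left e'⟩
  have h2 : (T.card : ℝ) ≤ 2 ^ (K.card * (n - K.card)) *
      ∑ p ∈ Finset.univ.filter (fun p : Setoid K × Setoid {v // v ∉ K} => 0 < rk p.1 ∧ 0 < rk p.2),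
      decay ^ (rk p.1 * rk p.2) := by
    rw [Finset.card_sigma, Finset.mul_sum]
    push_cast
    refine Finset.sum_le_sum fun p _ => ?_
    have := card_noSquare_le p.1 p.2
    rw [c1, c2] at this
    rw [mul_comm]
    exact this
  have h3 := sum_decay_le (α := K) (β := {v // v ∉ K}) a (n := n) (by rw [c1]; exact hKn)
    (by rw [c2]; exact Nat.sub_le _ _)
  rw [c1, c2] at h3
  refine (Nat.cast_le.2 h1).trans (h2.trans (mul_le_mul_of_nonneg_left (h3.trans ?_) (by positivity)))
  gcongr ?_ + ?_
  · exact le_rfl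
  · calc (2 : ℝ) ^ K.card * (K.card + 1) ^ a * (2 ^ (n - K.card) * (((n - K.card : ℕ) : ℝ) + 1) ^ a)
        = 2 ^ n * ((K.card + 1) ^ a * (((n - K.card : ℕ) : ℝ) + 1) ^ a) := by
          rw [← Nat.add_sub_cancel' hKn, pow_add]
          simp only [Nat.add_sub_cancel_left]
          ring
      _ ≤ 2 ^ n * ((n + 1) ^ a * ((n : ℝ) + 1) ^ a) := by
          have i1 : (K.card : ℝ) ≤ n := by exact_mod_cast hKn
          have i2 : ((n - K.card : ℕ) : ℝ) ≤ n := by exact_mod_cast Nat.sub_le _ _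
          gcongr
      _ = _ := by rw [← pow_add, two_mul]

end NearSplitCount

section Negligible

lemma eventually_add_one_pow_le_exp (p : ℕ) {ε : ℝ} (hε : 0 < ε) :
    ∀ᶠ n : ℕ in atTop, ((n : ℝ) + 1) ^ p ≤ Real.exp (ε * n) := by
  filter_upwards [eventually_pow_add_one_le_exp (p + 1) hε, eventually_le_cast (2 ^ p),
    eventually_ge_atTop 1] with n h1 h2 h3
  have h3 : (1 : ℝ) ≤ n := by exact_mod_cast h3
  calc ((n : ℝ) + 1) ^ p ≤ (2 * n) ^ p := pow_le_pow_left₀ (by positivity) (by linarith) _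
    _ = 2 ^ p * n ^ p := mul_pow _ _ _
    _ ≤ n * n ^ p := mul_le_mul_of_nonneg_right h2 (by positivity)
    _ = n ^ (p + 1) := by ring
    _ ≤ _ := by linarith

/-- `f` is exponentially small compared with the number of unipolar arrangements. -/
def Negl (f : ℕ → ℝ) : Prop :=
  ∃ c : ℝ, 0 < c ∧ ∀ᶠ n : ℕ in atTop, f n ≤ Real.exp (-(c * n)) * scrL n

lemma Negl.mono {f g : ℕ → ℝ} (hg : Negl g) (h : ∀ᶠ n in atTop, f n ≤ g n) : Negl f := by
  obtain ⟨c, hc, hg⟩ := hg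
  exact ⟨c, hc, by filter_upwards [hg, h] with n h1 h2 using h2.trans h1⟩

lemma Negl.pow_mul {f : ℕ → ℝ} (hf : Negl f) (p : ℕ) : Negl fun n => (n + 1) ^ p * f n := by
  obtain ⟨c, hc, hf⟩ := hf
  refine ⟨c / 2, by linarith, ?_⟩
  filter_upwards [hf, eventually_add_one_pow_le_exp p (half_pos hc)] with n h1 h2
  calc ((n : ℝ) + 1) ^ p * f n ≤ (n + 1) ^ p * (Real.exp (-(c * n)) * scrL n) :=
        mul_le_mul_of_nonneg_left h1 (by positivity)
    _ ≤ Real.exp (c / 2 * n) * (Real.exp (-(c * n)) * scrL n) :=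
        mul_le_mul_of_nonneg_right h2 (by positivity)
    _ = _ := by rw [← mul_assoc, ← Real.exp_add]; congr 2; ring

lemma negl_exp_mul {c : ℝ} (hc : 0 < c) : Negl fun n => Real.exp (-(c * n)) * scrL n :=
  ⟨c, hc, Eventually.of_forall fun _ => le_rfl⟩

lemma Negl.const_mul {f : ℕ → ℝ} (hf : Negl f) (D : ℝ) (h0 : ∀ᶠ n in atTop, 0 ≤ f n) :
    Negl fun n => D * f n := by
  refine (hf.pow_mul 1).mono ?_
  filter_upwards [h0, eventually_le_cast D] with n h0 h
  rw [pow_one]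
  exact mul_le_mul_of_nonneg_right (by linarith) h0

lemma Negl.add {f g : ℕ → ℝ} (hf : Negl f) (hg : Negl g) : Negl fun n => f n + g n := by
  obtain ⟨c, hc, hf⟩ := hf
  obtain ⟨d, hd, hg⟩ := hg
  have h0 := (negl_exp_mul (lt_min hc hd)).const_mul 2 (Eventually.of_forall fun _ => by positivity)
  refine h0.mono ?_
  filter_upwards [hf, hg] with n h1 h2
  have e : ∀ e : ℝ, min c d ≤ e →
      Real.exp (-(e * n)) * scrL n ≤ Real.exp (-(min c d * n)) * scrL n := fun e he => by
    have : (0 : ℝ) ≤ n := Nat.cast_nonneg _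
    gcongr
  linarith [e c (min_le_left _ _), e d (min_le_right _ _)]

lemma negl_twoCluster (s : ℕ) {c : ℝ} (hc : 0 < c) : Negl fun n =>
    ((Finset.univ.filter fun G : SimpleGraph (Fin n) =>
      ∃ S A Q Q', TwoCluster G.Adj s c S A Q Q').card : ℝ) :=
  ⟨1, one_pos, by simpa using eventually_card_twoCluster_le s hc⟩

lemma negl_twoCluster_compl (s : ℕ) {c : ℝ} (hc : 0 < c) : Negl fun n =>
    ((Finset.univ.filter fun G : SimpleGraph (Fin n) =>
      ∃ S A Q Q', TwoCluster (fun u v => ¬ G.Adj u v) s c S A Q Q').card : ℝ) := by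
  refine (negl_twoCluster s hc).mono (Eventually.of_forall fun n => ?_)
  have h0 := card_filter_compl fun G : SimpleGraph (Fin n) =>
    ∃ S A Q Q', TwoCluster G.Adj s c S A Q Q'
  refine Nat.cast_le.2 (le_trans (Finset.card_le_card fun G hG => ?_) (h0.trans (by congr!)).le)
  obtain ⟨S, A, Q, Q', h⟩ := (Finset.mem_filter.1 hG).2
  simp only [Finset.mem_filter, Finset.mem_univ, true_and]
  exact ⟨S, A, Q, Q', h.compl⟩

/-- The error term of the count of nearly split graphs. -/
lemma exists_decay_bound : ∃ c : ℝ, 0 < c ∧ ∀ᶠ n : ℕ in atTop,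
    (1 + n * decay ^ (n / 16 + 1)) ^ n - 1 ≤ Real.exp (-(c * n)) := by
  set γ : ℝ := -Real.log decay / 16 with hγ
  have hl : Real.log decay < 0 := Real.log_neg decay_pos decay_lt_one
  have hγ0 : 0 < γ := by rw [hγ]; linarith
  refine ⟨γ / 2, by linarith, ?_⟩
  filter_upwards [eventually_add_one_pow_le_exp 3 (half_pos hγ0), eventually_ge_atTop 2]
    with n hn h2
  have hn2 : (2 : ℝ) ≤ n := by exact_mod_cast h2
  set x := decay ^ (n / 16 + 1) with hx
  have hx0 : 0 < x := pow_pos decay_pos _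
  have hxe : x ≤ Real.exp (-(γ * n)) := by
    rw [hx, ← Real.exp_log (pow_pos decay_pos _), Real.log_pow]
    apply Real.exp_le_exp.2
    have h3 : (n : ℝ) / 16 ≤ (n / 16 + 1 : ℕ) := by
      have : n ≤ 16 * (n / 16 + 1) := by omega
      have : (n : ℝ) ≤ 16 * (n / 16 + 1 : ℕ) := by exact_mod_cast this
      linarith
    have := mul_le_mul_of_nonneg_right h3 (by linarith : 0 ≤ -Real.log decay)
    rw [hγ]
    linarith
  have h3 : 2 * (n * (n * x)) ≤ Real.exp (-(γ / 2 * n)) := by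
    calc 2 * (n * (n * x)) ≤ (n + 1) ^ 3 * x := by
          have : 2 * (n : ℝ) * n ≤ (n + 1) ^ 3 := by
            have : ((n : ℝ) + 1) ^ 3 = n ^ 2 * n + 3 * n ^ 2 + 3 * n + 1 := by ring
            nlinarith [mul_nonneg (sq_nonneg (n : ℝ)) (Nat.cast_nonneg (α := ℝ) n)]
          nlinarith
      _ ≤ Real.exp (γ / 2 * n) * Real.exp (-(γ * n)) :=
          mul_le_mul hn hxe hx0.le (Real.exp_nonneg _)
      _ = _ := by rw [← Real.exp_add]; congr 1; ring
  have h4 : (1 + n * x) ^ n ≤ Real.exp (n * (n * x)) := by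
    rw [Real.exp_nat_mul]
    refine pow_le_pow_left₀ (by positivity) ?_ _
    rw [add_comm]
    exact Real.add_one_le_exp _
  have h5 : Real.exp (-(γ / 2 * n)) ≤ 1 := Real.exp_le_one_iff.2 (by
    have : 0 ≤ γ / 2 * n := by positivity
    linarith)
  have h6 : 0 ≤ (n : ℝ) * (n * x) := by positivity
  have h7 := Real.abs_exp_sub_one_le (x := n * (n * x)) (by rw [abs_of_nonneg h6]; linarith)
  rw [abs_of_nonneg h6] at h7
  linarith [le_abs_self (Real.exp (n * (n * x)) - 1)]

lemma sum_card_eq_scrL' (n : ℕ) :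
    ∑ K : Finset (Fin n), 2 ^ (K.card * (n - K.card)) * bell K.card = scrL n := by
  rw [← sum_card_eq_scrL]
  refine Finset.sum_nbij' compl compl (by simp) (by simp) (by simp) (by simp) fun K _ => ?_
  have : K.card ≤ n := by simpa using Finset.card_le_univ K
  rw [Finset.card_compl, Fintype.card_fin, Nat.sub_sub_self this, mul_comm K.card]

lemma negl_small_ranks : Negl fun n =>
    2 ^ n * (2 : ℝ) ^ ((n : ℝ) ^ 2 / 4) * (2 ^ n * ((n : ℝ) + 1) ^ (2 * (n / 16 + 1))) := by
  refine ⟨1, one_pos, ?_⟩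
  filter_upwards [exp_le_scrL (ε := 1 / 4) (by norm_num) (2 * Real.log 2 + 2),
    eventually_ge_atTop 16] with n hn h1
  have hn16 : (16 : ℝ) ≤ n := by exact_mod_cast h1
  refine le_trans ?_ (mul_le_mul_of_nonneg_left hn (Real.exp_nonneg _))
  rw [← Real.exp_add, ← Real.exp_log (show (0 : ℝ) < 2 ^ n * (2 : ℝ) ^ ((n : ℝ) ^ 2 / 4) *
    (2 ^ n * ((n : ℝ) + 1) ^ (2 * (n / 16 + 1))) by positivity),
    Real.log_mul (by positivity) (by positivity), Real.log_mul (by positivity) (by positivity),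
    Real.log_mul (by positivity) (by positivity), Real.log_pow, Real.log_pow,
    Real.log_rpow (by norm_num)]
  apply Real.exp_le_exp.2
  have hlog0 : 0 ≤ Real.log n := Real.log_natCast_nonneg n
  have hlog : Real.log (n + 1) ≤ Real.log n + 1 / n := by
    have : (n : ℝ) + 1 = n * (1 + 1 / n) := by field_simp
    rw [this, Real.log_mul (by positivity) (by positivity)]
    have := Real.log_le_sub_one_of_pos (show 0 < 1 + 1 / (n : ℝ) by positivity)
    linarith
  have e1 : ((2 * (n / 16 + 1) : ℕ) : ℝ) ≤ n / 4 := by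
    have : 4 * (2 * (n / 16 + 1)) ≤ n := by omega
    have : (4 : ℝ) * ((2 * (n / 16 + 1) : ℕ) : ℝ) ≤ n := by exact_mod_cast this
    linarith
  have e2 : ((2 * (n / 16 + 1) : ℕ) : ℝ) * Real.log (n + 1) ≤ n / 4 * (Real.log n + 1 / n) :=
    mul_le_mul e1 hlog (Real.log_nonneg (by linarith)) (by positivity)
  have e3 : (n : ℝ) / 4 * (Real.log n + 1 / n) = n / 4 * Real.log n + 1 / 4 := by field_simp
  linarith

lemma negl_nearSplit : Negl fun n =>
    ((Finset.univ.filter fun G : SimpleGraph (Fin n) =>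
      ¬ IsGenSplit G ∧ ∃ K, NearSplit G.Adj K).card : ℝ) := by
  obtain ⟨c, hc, hx⟩ := exists_decay_bound
  have h0 := ((negl_exp_mul hc).const_mul 2 (Eventually.of_forall fun _ => by positivity)).add
    negl_small_ranks
  refine h0.mono ?_
  filter_upwards [hx] with n hx
  have hsub : (Finset.univ.filter fun G : SimpleGraph (Fin n) =>
      ¬ IsGenSplit G ∧ ∃ K, NearSplit G.Adj K) ⊆ (Finset.univ : Finset (Finset (Fin n))).biUnion
      fun K => Finset.univ.filter fun G : SimpleGraph (Fin n) => NearSplit G.Adj K ∧ ¬ IsGenSplit G := by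
    intro G hG
    obtain ⟨h, K, hK⟩ := (Finset.mem_filter.1 hG).2
    exact Finset.mem_biUnion.2 ⟨K, Finset.mem_univ _, Finset.mem_filter.2 ⟨Finset.mem_univ _, hK, h⟩⟩
  have h1 : ((Finset.univ.filter fun G : SimpleGraph (Fin n) =>
      ¬ IsGenSplit G ∧ ∃ K, NearSplit G.Adj K).card : ℝ) ≤ ∑ K : Finset (Fin n),
      ((Finset.univ.filter fun G : SimpleGraph (Fin n) =>
        NearSplit G.Adj K ∧ ¬ IsGenSplit G).card : ℝ) := by
    exact_mod_cast (Finset.card_le_card hsub).trans Finset.card_biUnion_le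
  have h2 : ∀ K : Finset (Fin n), ((Finset.univ.filter fun G : SimpleGraph (Fin n) =>
        NearSplit G.Adj K ∧ ¬ IsGenSplit G).card : ℝ) ≤
      (2 ^ (K.card * (n - K.card)) * bell (n - K.card) : ℕ) * Real.exp (-(c * n)) +
      (2 ^ (K.card * (n - K.card)) * bell K.card : ℕ) * Real.exp (-(c * n)) +
      (2 : ℝ) ^ ((n : ℝ) ^ 2 / 4) * (2 ^ n * ((n : ℝ) + 1) ^ (2 * (n / 16 + 1))) := by
    intro K
    have h3 := card_nearSplit_le K (n / 16 + 1)
    rw [Fintype.card_fin] at h3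
    refine le_trans (le_of_eq (by congr!)) (h3.trans ?_)
    have hK : K.card ≤ n := by simpa using Finset.card_le_univ K
    have h4 : (2 : ℝ) ^ (K.card * (n - K.card)) ≤ (2 : ℝ) ^ ((n : ℝ) ^ 2 / 4) := by
      rw [← Real.rpow_natCast]
      refine Real.rpow_le_rpow_of_exponent_le (by norm_num) ?_
      have := four_mul_mul_le_sq (Nat.add_sub_cancel' hK).le
      have : ((4 * (K.card * (n - K.card)) : ℕ) : ℝ) ≤ (n ^ 2 : ℕ) := Nat.cast_le.2 this
      push_cast at this ⊢
      linarith
    rw [mul_add, mul_add]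
    push_cast
    refine add_le_add (add_le_add ?_ ?_) ?_
    · rw [mul_assoc]
      gcongr
    · rw [mul_assoc]
      gcongr
    · gcongr
  refine h1.trans ((Finset.sum_le_sum fun K _ => h2 K).trans (le_of_eq ?_))
  rw [Finset.sum_add_distrib, Finset.sum_add_distrib, ← Finset.sum_mul, ← Finset.sum_mul,
    ← Nat.cast_sum, ← Nat.cast_sum, sum_card_eq_scrL, sum_card_eq_scrL', Finset.sum_const,
    Finset.card_univ, Fintype.card_finset, Fintype.card_fin, nsmul_eq_mul]
  push_cast
  ring

end Negligible

section Arrangement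

variable {V : Type*} [DecidableEq V] [Fintype V]

/-- The graph in which `K` is a clique, the classes of `S` are the components outside `K`, and the
edges across are given by `ω`. -/
def arrGraph (K : Finset V) (S : Setoid {v // v ∉ K}) (ω : K × {v // v ∉ K} → Bool) :
    SimpleGraph V where
  Adj u v := u ≠ v ∧ ((u ∈ K ∧ v ∈ K) ∨ (∃ (hu : u ∉ K) (hv : v ∉ K), S ⟨u, hu⟩ ⟨v, hv⟩) ∨
    (∃ (hu : u ∈ K) (hv : v ∉ K), ω (⟨u, hu⟩, ⟨v, hv⟩) = true) ∨
    ∃ (hu : u ∉ K) (hv : v ∈ K), ω (⟨v, hv⟩, ⟨u, hu⟩) = true)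
  symm := ⟨by
    rintro u v ⟨h, ⟨h1, h2⟩ | ⟨h1, h2, h3⟩ | ⟨h1, h2, h3⟩ | ⟨h1, h2, h3⟩⟩
    · exact ⟨h.symm, Or.inl ⟨h2, h1⟩⟩
    · exact ⟨h.symm, Or.inr (Or.inl ⟨h2, h1, S.symm h3⟩)⟩
    · exact ⟨h.symm, Or.inr (Or.inr (Or.inr ⟨h2, h1, h3⟩))⟩
    · exact ⟨h.symm, Or.inr (Or.inr (Or.inl ⟨h2, h1, h3⟩))⟩⟩
  loopless := ⟨fun v h => h.1 rfl⟩

variable {K : Finset V} {S : Setoid {v // v ∉ K}} {ω : K × {v // v ∉ K} → Bool} {u v : V}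

lemma arrGraph_adj_mem (hu : u ∈ K) (hv : v ∈ K) : (arrGraph K S ω).Adj u v ↔ u ≠ v := by
  simp [arrGraph, hu, hv]

lemma arrGraph_adj_notMem (hu : u ∉ K) (hv : v ∉ K) :
    (arrGraph K S ω).Adj u v ↔ u ≠ v ∧ S ⟨u, hu⟩ ⟨v, hv⟩ := by
  simp [arrGraph, hu, hv]

lemma arrGraph_adj_cross (hu : u ∈ K) (hv : v ∉ K) :
    (arrGraph K S ω).Adj u v ↔ ω (⟨u, hu⟩, ⟨v, hv⟩) = true := by
  have : u ≠ v := fun h => hv (h ▸ hu)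
  simp [arrGraph, hu, hv, this]

lemma arrGraph_isUnipolarArrangement : IsUnipolarArrangement (arrGraph K S ω) K := by
  refine isUnipolarArrangement_iff.2 ⟨fun x hx y hy hxy => (arrGraph_adj_mem hx hy).2 hxy,
    fun x hx y hy z hz hxz h1 h2 => ?_⟩
  rw [Finset.mem_coe] at hx hy hz
  exact (arrGraph_adj_notMem hx hz).2 ⟨hxz, S.trans ((arrGraph_adj_notMem hx hy).1 h1).2
    ((arrGraph_adj_notMem hy hz).1 h2).2⟩

lemma arrGraph_injective : Function.Injective
    fun p : Setoid {v // v ∉ K} × (K × {v // v ∉ K} → Bool) => arrGraph K p.1 p.2 := by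
  rintro ⟨S, ω⟩ ⟨T, ψ⟩ h
  have h : arrGraph K S ω = arrGraph K T ψ := h
  refine Prod.ext (Setoid.ext fun u v => ?_) (funext fun z => ?_)
  · have h1 := arrGraph_adj_notMem (S := S) (ω := ω) u.2 v.2
    have h2 := arrGraph_adj_notMem (S := T) (ω := ψ) u.2 v.2
    rw [h, h2] at h1
    by_cases e : u = v
    · rw [e]; exact ⟨fun _ => T.refl _, fun _ => S.refl _⟩
    · have e' : (u : V) ≠ v := fun h => e (Subtype.ext h)
      simp only [ne_eq, e', not_false_eq_true, true_and] at h1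
      exact h1.symm
  · have h1 := arrGraph_adj_cross (S := S) (ω := ω) z.1.2 z.2.2
    have h2 := arrGraph_adj_cross (S := T) (ω := ψ) z.1.2 z.2.2
    rw [h, h2] at h1
    exact (Bool.eq_iff_iff.2 h1).symm

lemma IsUnipolarArrangement.exists_arrGraph {G : SimpleGraph V}
    (h : IsUnipolarArrangement G (K : Set V)) : ∃ S ω, arrGraph K S ω = G := by
  rw [isUnipolarArrangement_iff] at h
  obtain ⟨h1, h2⟩ := h
  refine ⟨⟨fun u v => u = v ∨ G.Adj u v, fun _ => Or.inl rfl, ?_, ?_⟩,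
    fun z => decide (G.Adj z.1 z.2), ?_⟩
  · rintro x y (h | h)
    exacts [Or.inl h.symm, Or.inr h.symm]
  · rintro x y z (rfl | h3) h4
    · exact h4
    rcases h4 with rfl | h4
    · exact Or.inr h3
    by_cases e : x = z
    · exact Or.inl e
    · exact Or.inr (h2 x x.2 y y.2 z z.2 (fun h => e (Subtype.ext h)) h3 h4)
  · ext u v
    by_cases hu : u ∈ K <;> by_cases hv : v ∈ K
    · rw [arrGraph_adj_mem hu hv]
      exact ⟨fun h => h1 hu hv h, fun h => h.ne⟩
    · rw [arrGraph_adj_cross hu hv]; simp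
    · rw [SimpleGraph.adj_comm, arrGraph_adj_cross hv hu, G.adj_comm]; simp
    · rw [arrGraph_adj_notMem hu hv]
      by_cases e : u = v
      · simp [e]
      · have e' : (⟨u, hu⟩ : {v // v ∉ K}) ≠ ⟨v, hv⟩ := fun h => e (congrArg Subtype.val h)
        exact ⟨fun h => h.2.resolve_left e', fun h => ⟨e, Or.inr h⟩⟩

/-- The edges across and the components outside `K` of an arrangement are arbitrary. -/
lemma card_arrangement (K : Finset V) (P : SimpleGraph V → Prop) :
    (Finset.univ.filter fun G : SimpleGraph V => IsUnipolarArrangement G K ∧ P G).card =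
      ∑ S : Setoid {v // v ∉ K}, (Finset.univ.filter fun ω => P (arrGraph K S ω)).card := by
  rw [← Finset.card_sigma]
  symm
  refine Finset.card_bij (fun p _ => arrGraph K p.1 p.2) ?_ ?_ ?_
  · intro p hp
    rw [Finset.mem_sigma, Finset.mem_filter] at hp
    exact Finset.mem_filter.2 ⟨Finset.mem_univ _, arrGraph_isUnipolarArrangement, hp.2.2⟩
  · rintro ⟨S, ω⟩ _ ⟨T, ψ⟩ _ h
    have := arrGraph_injective (a₁ := (S, ω)) (a₂ := (T, ψ)) h
    simp only [Prod.mk.injEq] at this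
    rw [this.1, this.2]
  · intro G hG
    obtain ⟨h1, h2⟩ := (Finset.mem_filter.1 hG).2
    obtain ⟨S, ω, rfl⟩ := h1.exists_arrGraph
    exact ⟨⟨S, ω⟩, by simpa using h2, rfl⟩

lemma card_compl_subtype (K : Finset V) :
    Fintype.card {v // v ∉ K} = Fintype.card V - K.card := by
  rw [Fintype.card_subtype_compl, Fintype.card_coe]

lemma card_isUnipolarArrangement (K : Finset V) :
    (Finset.univ.filter fun G : SimpleGraph V => IsUnipolarArrangement G K).card =
      2 ^ (K.card * (Fintype.card V - K.card)) * bell (Fintype.card V - K.card) := by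
  have h := card_arrangement K fun _ => True
  simp only [and_true, Finset.filter_true, Finset.card_univ, Fintype.card_fun, Fintype.card_prod,
    Fintype.card_bool, Fintype.card_coe, Finset.sum_const, card_setoid, card_compl_subtype,
    smul_eq_mul] at h
  rw [mul_comm]
  exact h

lemma sum_card_isUnipolarArrangement (n : ℕ) : ∑ K : Finset (Fin n),
    (Finset.univ.filter fun G : SimpleGraph (Fin n) => IsUnipolarArrangement G K).card = scrL n := by
  rw [← sum_card_eq_scrL]
  refine Finset.sum_congr rfl fun K _ => ?_
  have h := card_isUnipolarArrangement K
  rw [Fintype.card_fin] at h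
  exact h

lemma card_isUnipolar_le (n : ℕ) :
    (Finset.univ.filter fun G : SimpleGraph (Fin n) => IsUnipolar G).card ≤ scrL n := by
  rw [← sum_card_isUnipolarArrangement]
  refine le_trans (Finset.card_le_card fun G hG => ?_) Finset.card_biUnion_le
  obtain ⟨C, hC⟩ := (Finset.mem_filter.1 hG).2
  refine Finset.mem_biUnion.2 ⟨C.toFinset, Finset.mem_univ _, Finset.mem_filter.2
    ⟨Finset.mem_univ _, ?_⟩⟩
  rwa [Set.coe_toFinset]

lemma card_isGenSplit_le (n : ℕ) :
    (Finset.univ.filter fun G : SimpleGraph (Fin n) => IsGenSplit G).card ≤ 2 * scrL n := by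
  have h1 : (Finset.univ.filter fun G : SimpleGraph (Fin n) => IsGenSplit G) ⊆
      (Finset.univ.filter fun G : SimpleGraph (Fin n) => IsUnipolar G) ∪
      (Finset.univ.filter fun G : SimpleGraph (Fin n) => IsUnipolar Gᶜ) := by
    intro G hG
    rcases (Finset.mem_filter.1 hG).2 with h | h
    · exact Finset.mem_union_left _ (Finset.mem_filter.2 ⟨Finset.mem_univ _, h⟩)
    · exact Finset.mem_union_right _ (Finset.mem_filter.2 ⟨Finset.mem_univ _, h⟩)
  have h2 := card_filter_compl fun G : SimpleGraph (Fin n) => IsUnipolar G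
  have h3 := card_isUnipolar_le n
  have h4 := (Finset.card_le_card h1).trans (Finset.card_union_le _ _)
  omega

end Arrangement

section PromelSteger

lemma exists_cases_of_rich : ∃ m s : ℕ, ∀ᶠ n : ℕ in atTop, ∀ G : SimpleGraph (Fin n),
    IsPerfect G → Rich G.Adj (1 / 10 ^ 23) m →
    (∃ S A Q Q', TwoCluster G.Adj s (1 / 10 ^ 16) S A Q Q') ∨
    (∃ S A Q Q', TwoCluster (fun u v => ¬ G.Adj u v) s (1 / 10 ^ 16) S A Q Q') ∨
    ∃ K, NearSplit G.Adj K := by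
  obtain ⟨q, k, K, K₂, P⟩ := exists_scales (δ := 1 / 10 ^ 23) (by norm_num) (by norm_num)
  refine ⟨2 * K + K₂ ^ 2 + 2 * K₂ + 2, 2 * K + K₂ ^ 2 + 4, ?_⟩
  filter_upwards [eventually_ge_atTop (10 ^ 30), eventually_ge_atTop ((K₂ + 4 + 2 * K + K₂ ^ 2) ^ 2),
    eventually_le_cast (((2 * K + K₂ ^ 2 : ℕ) + 4 : ℝ) * 10 ^ 23)] with n h1 h2 h3 G hG hR
  have T : Tame G.Adj (1 / 10 ^ 23) (2 * K + K₂ ^ 2 + 2 * K₂ + 2) :=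
    ⟨fun u v h => h.symm, hG.noC5, hG.ram, hR⟩
  have C : Ctl G.Adj (1 / 10 ^ 23) (1 / 10 ^ 21) (2 * K + K₂ ^ 2 + 2 * K₂ + 2) (2 * K + K₂ ^ 2) :=
    { T with
      le_m := by omega
      four := by
        rw [Fintype.card_fin, one_div, inv_mul_eq_div, le_div_iff₀ (by positivity)]
        exact h3
      δ_nonneg := by positivity
      δ_le := le_rfl
      η_nonneg := by positivity
      η_le := le_rfl
      large := by rwa [Fintype.card_fin] }
  refine C.structure fun F hF => exists_str P T (by omega) ?_ (by norm_num) (by norm_num)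
  rw [Fintype.card_fin]
  refine le_trans (Nat.pow_le_pow_left ?_ 2) h2
  omega

lemma perfectCount_eq_card (n : ℕ) : perfectCount n =
    (Finset.univ.filter fun G : SimpleGraph (Fin n) => IsPerfect G).card := by
  rw [perfectCount, Nat.card_eq_fintype_card, Fintype.card_subtype]

lemma two_rpow_mul_scrL_pred_le {δ : ℝ} {n : ℕ} (hn : 1 ≤ n) :
    (2 : ℝ) ^ ((1 / 2 - δ) * n) * scrL (n - 1) ≤ 2 * Real.exp (-(δ * Real.log 2 * n)) * scrL n := by
  obtain ⟨k, rfl⟩ : ∃ k, n = k + 1 := ⟨n - 1, by omega⟩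
  have h := scrL_succ k
  rw [Nat.add_sub_cancel]
  have e : (2 : ℝ) ^ ((1 / 2 - δ) * (k + 1 : ℕ)) =
      2 ^ (1 / 2 : ℝ) * Real.exp (-(δ * Real.log 2 * (k + 1 : ℕ))) * 2 ^ ((k : ℝ) / 2) := by
    rw [Real.rpow_def_of_pos two_pos, Real.rpow_def_of_pos two_pos, Real.rpow_def_of_pos two_pos,
      ← Real.exp_add, ← Real.exp_add]
    congr 1
    push_cast
    ring
  have h2 : (2 : ℝ) ^ (1 / 2 : ℝ) ≤ 2 := by
    calc (2 : ℝ) ^ (1 / 2 : ℝ) ≤ 2 ^ (1 : ℝ) :=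
          Real.rpow_le_rpow_of_exponent_le (by norm_num) (by norm_num)
      _ = 2 := Real.rpow_one 2
  rw [e, mul_assoc _ ((2 : ℝ) ^ ((k : ℝ) / 2))]
  have := Real.exp_pos (-(δ * Real.log 2 * (k + 1 : ℕ)))
  gcongr

/-- The number of perfect graphs that are not generalised split, in terms of the number of perfect
graphs with one vertex less. -/
lemma exists_card_not_isGenSplit_le : ∃ (p : ℕ) (g : ℕ → ℝ), Negl g ∧ ∀ᶠ n : ℕ in atTop,
    ((Finset.univ.filter fun G : SimpleGraph (Fin n) => IsPerfect G ∧ ¬ IsGenSplit G).card : ℝ) ≤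
    (n + 1) ^ p * (2 : ℝ) ^ ((1 / 2 - 1 / 10 ^ 23 : ℝ) * n) * perfectCount (n - 1) + g n := by
  obtain ⟨m, s, h⟩ := exists_cases_of_rich
  refine ⟨m + 1 + 2 ^ m, _, ((negl_twoCluster s (c := 1 / 10 ^ 16) (by norm_num)).add
    (negl_twoCluster_compl s (c := 1 / 10 ^ 16) (by norm_num))).add negl_nearSplit, ?_⟩
  filter_upwards [h] with n h
  have h1 := card_poor_le (V := Fin n) (1 / 10 ^ 23) m
  rw [Fintype.card_fin] at h1
  have hsub : (Finset.univ.filter fun G : SimpleGraph (Fin n) => IsPerfect G ∧ ¬ IsGenSplit G) ⊆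
      (Finset.univ.filter fun G : SimpleGraph (Fin n) => IsPerfect G ∧
        ¬ Rich G.Adj (1 / 10 ^ 23) m) ∪
      ((Finset.univ.filter fun G : SimpleGraph (Fin n) =>
        ∃ S A Q Q', TwoCluster G.Adj s (1 / 10 ^ 16) S A Q Q') ∪
      (Finset.univ.filter fun G : SimpleGraph (Fin n) =>
        ∃ S A Q Q', TwoCluster (fun u v => ¬ G.Adj u v) s (1 / 10 ^ 16) S A Q Q') ∪
      (Finset.univ.filter fun G : SimpleGraph (Fin n) =>
        ¬ IsGenSplit G ∧ ∃ K, NearSplit G.Adj K)) := by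
    intro G hG
    obtain ⟨hP, hS⟩ := (Finset.mem_filter.1 hG).2
    simp only [Finset.mem_union, Finset.mem_filter, Finset.mem_univ, true_and]
    by_cases hR : Rich G.Adj (1 / 10 ^ 23) m
    · rcases h G hP hR with h | h | h
      · exact Or.inr (Or.inl (Or.inl h))
      · exact Or.inr (Or.inl (Or.inr h))
      · exact Or.inr (Or.inr ⟨hS, h⟩)
    · exact Or.inl ⟨hP, hR⟩
  have h2 := (Finset.card_le_card hsub).trans (Finset.card_union_le _ _)
  have h3 := h2.trans (Nat.add_le_add_left ((Finset.card_union_le _ _).trans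
    (Nat.add_le_add_right (Finset.card_union_le _ _) _)) _)
  refine (Nat.cast_le.2 h3).trans ?_
  push_cast
  refine add_le_add (le_trans (le_of_eq (by congr!)) h1) ?_
  exact le_rfl

lemma exists_perfectCount_le : ∃ M : ℝ, ∀ n, (perfectCount n : ℝ) ≤ M * scrL n := by
  obtain ⟨p, g, ⟨c, hc, hg⟩, h⟩ := exists_card_not_isGenSplit_le
  have hl : (0 : ℝ) < 1 / 10 ^ 23 * Real.log 2 := by positivity
  obtain ⟨n₀, hn₀⟩ := eventually_atTop.1 ((hg.and h).and
    ((eventually_add_one_pow_le_exp p (half_pos hl)).and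
    (((tendsto_natCast_atTop_atTop (R := ℝ)).eventually
      (eventually_ge_atTop (8 / (1 / 10 ^ 23 * Real.log 2)))).and (eventually_ge_atTop 1))))
  set M : ℝ := 6 + ∑ i ∈ Finset.range n₀, (perfectCount i : ℝ) with hM
  have hM6 : 6 ≤ M := by
    rw [hM]; linarith [Finset.sum_nonneg fun i (_ : i ∈ Finset.range n₀) =>
      Nat.cast_nonneg (α := ℝ) (perfectCount i)]
  refine ⟨M, fun n => ?_⟩
  induction n using Nat.strong_induction_on with
  | _ n ih =>
    have hs : (1 : ℝ) ≤ scrL n := by exact_mod_cast scrL_pos n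
    by_cases hn : n < n₀
    · have h1 := Finset.single_le_sum (f := fun i => (perfectCount i : ℝ))
        (fun i _ => Nat.cast_nonneg _) (Finset.mem_range.2 hn)
      have h2 : (perfectCount n : ℝ) ≤ M := by rw [hM]; linarith
      nlinarith
    obtain ⟨⟨h1, h2⟩, h3, h4, h5⟩ := hn₀ n (not_lt.1 hn)
    have h6 : (perfectCount n : ℝ) ≤ (2 * scrL n : ℕ) +
        (Finset.univ.filter fun G : SimpleGraph (Fin n) => IsPerfect G ∧ ¬ IsGenSplit G).card := by
      rw [perfectCount_eq_card]
      have hsub : (Finset.univ.filter fun G : SimpleGraph (Fin n) => IsPerfect G) ⊆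
          (Finset.univ.filter fun G : SimpleGraph (Fin n) => IsGenSplit G) ∪
          (Finset.univ.filter fun G : SimpleGraph (Fin n) => IsPerfect G ∧ ¬ IsGenSplit G) := by
        intro G hG
        have hG := (Finset.mem_filter.1 hG).2
        simp only [Finset.mem_union, Finset.mem_filter, Finset.mem_univ, true_and, hG]
        exact em _
      exact_mod_cast ((Finset.card_le_card hsub).trans (Finset.card_union_le _ _)).trans
        (Nat.add_le_add_right (card_isGenSplit_le n) _)
    have h7 := ih (n - 1) (by omega)
    have h8 := two_rpow_mul_scrL_pred_le (δ := 1 / 10 ^ 23) h5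
    have h9 : Real.exp (-(c * n)) * scrL n ≤ 1 * scrL n := by
      refine mul_le_mul_of_nonneg_right (Real.exp_le_one_iff.2 ?_) (by linarith)
      have : 0 ≤ c * n := by positivity
      linarith
    have h10 : ((n : ℝ) + 1) ^ p * (2 : ℝ) ^ ((1 / 2 - 1 / 10 ^ 23 : ℝ) * n) * perfectCount (n - 1) ≤
        M / 2 * scrL n := by
      set E := 1 / 10 ^ 23 * Real.log 2 with hE
      have hx : Real.exp (-(E / 2 * n)) ≤ 1 / 4 := by
        have : (8 : ℝ) ≤ E * n := by
          rw [div_le_iff₀ hl] at h4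
          linarith
        calc Real.exp (-(E / 2 * n)) ≤ Real.exp (-4) := Real.exp_le_exp.2 (by linarith)
          _ = (Real.exp 4)⁻¹ := Real.exp_neg 4
          _ ≤ 4⁻¹ := by
            gcongr
            linarith [Real.add_one_le_exp (4 : ℝ)]
          _ = _ := by norm_num
      calc ((n : ℝ) + 1) ^ p * (2 : ℝ) ^ ((1 / 2 - 1 / 10 ^ 23 : ℝ) * n) * perfectCount (n - 1)
          ≤ Real.exp (E / 2 * n) * (2 : ℝ) ^ ((1 / 2 - 1 / 10 ^ 23 : ℝ) * n) *
              (M * scrL (n - 1)) := by gcongr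
        _ = Real.exp (E / 2 * n) * M * ((2 : ℝ) ^ ((1 / 2 - 1 / 10 ^ 23 : ℝ) * n) *
              scrL (n - 1)) := by ring
        _ ≤ Real.exp (E / 2 * n) * M * (2 * Real.exp (-(E * n)) * scrL n) := by gcongr
        _ = (Real.exp (E / 2 * n) * Real.exp (-(E * n))) * (2 * M * scrL n) := by ring
        _ = Real.exp (-(E / 2 * n)) * (2 * M * scrL n) := by rw [← Real.exp_add]; congr 2; ring
        _ ≤ 1 / 4 * (2 * M * scrL n) := by gcongr
        _ = _ := by ring
    push_cast at h6
    nlinarith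

/-- Almost all perfect graphs are generalised split. -/
theorem negl_not_isGenSplit : Negl fun n =>
    ((Finset.univ.filter fun G : SimpleGraph (Fin n) => IsPerfect G ∧ ¬ IsGenSplit G).card : ℝ) := by
  obtain ⟨p, g, hg, h⟩ := exists_card_not_isGenSplit_le
  obtain ⟨M, hM⟩ := exists_perfectCount_le
  have hl : (0 : ℝ) < 1 / 10 ^ 23 * Real.log 2 := by positivity
  have hM0 : 0 ≤ M := by
    have h0 := hM 0
    have : (0 : ℝ) < scrL 0 := by exact_mod_cast scrL_pos 0
    exact nonneg_of_mul_nonneg_left (le_trans (Nat.cast_nonneg _) h0) this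
  refine ((((negl_exp_mul hl).pow_mul p).const_mul (2 * M)
    (Eventually.of_forall fun _ => by positivity)).add hg).mono ?_
  filter_upwards [h, eventually_ge_atTop 1] with n h1 h2
  refine h1.trans (add_le_add_left ?_ _)
  have h8 := two_rpow_mul_scrL_pred_le (δ := 1 / 10 ^ 23) h2
  calc _ ≤ ((n : ℝ) + 1) ^ p * (2 : ℝ) ^ ((1 / 2 - 1 / 10 ^ 23 : ℝ) * n) * (M * scrL (n - 1)) := by
        gcongr
        exact hM _
    _ = ((n : ℝ) + 1) ^ p * M * ((2 : ℝ) ^ ((1 / 2 - 1 / 10 ^ 23 : ℝ) * n) * scrL (n - 1)) := by ring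
    _ ≤ ((n : ℝ) + 1) ^ p * M * (2 * Real.exp (-(1 / 10 ^ 23 * Real.log 2 * n)) * scrL n) := by gcongr
    _ = _ := by ring

end PromelSteger

section Perfect

variable {V : Type*} [DecidableEq V] [Fintype V] {G : SimpleGraph V}

lemma exists_index {α : Type*} (R : Finset α) :
    ∃ f : α → ℕ, (∀ q ∈ R, f q < R.card) ∧ ∀ p ∈ R, ∀ q ∈ R, f p = f q → p = q := by
  refine ⟨fun q => if h : q ∈ R then (R.equivFin ⟨q, h⟩ : ℕ) else 0, fun q hq => ?_,
    fun p hp q hq h => ?_⟩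
  · simp only [dif_pos hq]
    exact (R.equivFin ⟨q, hq⟩).2
  · simp only [dif_pos hp, dif_pos hq] at h
    exact congrArg Subtype.val (R.equivFin.injective (Fin.ext h))

/-- The colouring of a block that is compatible with distinct colours on the central clique. -/
lemma exists_block_colouring {C B : Finset V} (hC : G.IsClique (C : Set V))
    (hB : G.IsClique (B : Set V)) (hBC : Disjoint B C) {w : ℕ}
    (hw : ∀ K ⊆ B ∪ C, G.IsClique (K : Set V) → K.card ≤ w) {c : V → ℕ}
    (hci : ∀ u ∈ C, ∀ v ∈ C, c u = c v → u = v) :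
    ∃ f : V → ℕ, (∀ v ∈ B, f v < w) ∧ (∀ u ∈ B, ∀ v ∈ B, f u = f v → u = v) ∧
      ∀ u ∈ B, ∀ v ∈ C, G.Adj u v → f u ≠ c v := by
  let t : B → Finset ℕ := fun b => (Finset.range w) \ ((C.filter fun v => G.Adj b v).image c)
  have hall : ∀ X : Finset B, X.card ≤ (X.biUnion t).card := by
    intro X
    rcases X.eq_empty_or_nonempty with rfl | ⟨x₀, hx₀⟩
    · simp
    set Y := C.filter fun v => ∀ x ∈ X, G.Adj (x : B) v with hY
    have h1 : Finset.range w \ Y.image c ⊆ X.biUnion t := by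
      intro i hi
      rw [Finset.mem_sdiff] at hi
      rw [Finset.mem_biUnion]
      by_contra! hn
      have hx : ∀ x ∈ X, ∃ v ∈ C, G.Adj (x : B) v ∧ c v = i := by
        intro x hx
        have := hn x hx
        simp only [t, Finset.mem_sdiff, hi.1, true_and, not_not, Finset.mem_image,
          Finset.mem_filter] at this
        obtain ⟨v, ⟨h1, h2⟩, h3⟩ := this
        exact ⟨v, h1, h2, h3⟩
      obtain ⟨v, hv, -, hvi⟩ := hx x₀ hx₀
      refine hi.2 (Finset.mem_image.2 ⟨v, Finset.mem_filter.2 ⟨hv, fun x hxX => ?_⟩, hvi⟩)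
      obtain ⟨u, hu, hxu, hui⟩ := hx x hxX
      rwa [hci v hv u hu (hvi.trans hui.symm)]
    have h2 : (X.map (Function.Embedding.subtype _) ∪ Y).card ≤ w := by
      refine hw _ (Finset.union_subset_union ?_ (Finset.filter_subset _ _)) ?_
      · intro v hv
        obtain ⟨x, -, rfl⟩ := Finset.mem_map.1 hv
        exact x.2
      · intro u hu v hv huv
        simp only [Finset.coe_union, Finset.coe_map, Set.mem_union, Set.mem_image, Finset.mem_coe,
          Function.Embedding.coe_subtype, hY, Finset.mem_filter] at hu hv
        rcases hu with ⟨x, hx, rfl⟩ | hu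
        · rcases hv with ⟨y, hy, rfl⟩ | hv
          · exact hB x.2 y.2 huv
          · exact hv.2 x hx
        · rcases hv with ⟨y, hy, rfl⟩ | hv
          · exact (hu.2 y hy).symm
          · exact hC hu.1 hv.1 huv
    rw [Finset.card_union_of_disjoint, Finset.card_map] at h2
    · have h3 := Finset.card_le_card h1
      have h4 := Finset.le_card_sdiff (Y.image c) (Finset.range w)
      have h5 : (Y.image c).card ≤ Y.card := Finset.card_image_le
      rw [Finset.card_range] at h4
      omega
    · rw [Finset.disjoint_left]
      intro v hv hvY
      obtain ⟨x, -, rfl⟩ := Finset.mem_map.1 hv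
      exact Finset.disjoint_left.1 hBC x.2 (Finset.mem_filter.1 hvY).1
  obtain ⟨f, hf, hft⟩ := (Finset.all_card_le_biUnion_card_iff_exists_injective t).1 hall
  refine ⟨fun v => if h : v ∈ B then f ⟨v, h⟩ else 0, fun v hv => ?_, fun u hu v hv h => ?_,
    fun u hu v hv huv h => ?_⟩
  · simp only [dif_pos hv]
    exact Finset.mem_range.1 (Finset.mem_sdiff.1 (hft ⟨v, hv⟩)).1
  · simp only [dif_pos hu, dif_pos hv] at h
    exact congrArg Subtype.val (hf h)
  · simp only [dif_pos hu] at h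
    exact (Finset.mem_sdiff.1 (hft ⟨u, hu⟩)).2
      (Finset.mem_image.2 ⟨v, Finset.mem_filter.2 ⟨hv, huv⟩, h.symm⟩)

lemma IsUnipolarArrangement.isPerfect {C : Finset V} (h : IsUnipolarArrangement G (C : Set V)) :
    IsPerfect G := by
  rw [isUnipolarArrangement_iff] at h
  obtain ⟨hC, hD⟩ := h
  rw [isPerfect_iff]
  intro A
  obtain ⟨K, hK, hmax⟩ := Finset.exists_max_image
    (A.powerset.filter fun K : Finset V => G.IsClique (K : Set V)) Finset.card
    ⟨∅, Finset.mem_filter.2 ⟨Finset.empty_mem_powerset _, by simp⟩⟩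
  rw [Finset.mem_filter, Finset.mem_powerset] at hK
  have hmax : ∀ L ⊆ A, G.IsClique (L : Set V) → L.card ≤ K.card := fun L hL hc =>
    hmax L (Finset.mem_filter.2 ⟨Finset.mem_powerset.2 hL, hc⟩)
  have hCA : G.IsClique ((A ∩ C : Finset V) : Set V) :=
    hC.subset (Finset.coe_subset.2 Finset.inter_subset_right)
  obtain ⟨c, hc, hci⟩ := exists_index (A ∩ C)
  have hcw := hmax _ Finset.inter_subset_left hCA
  let B : V → Finset V := fun v => (A \ C).filter fun u => u = v ∨ G.Adj u v
  have hBA : ∀ v, B v ⊆ A \ C := fun v => Finset.filter_subset _ _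
  have hB : ∀ v ∈ A \ C, G.IsClique (B v : Set V) := by
    intro v hv x hx y hy hxy
    rw [Finset.mem_coe, Finset.mem_filter, Finset.mem_sdiff] at hx hy
    rcases hx.2 with rfl | h1
    · exact (hy.2.resolve_left hxy.symm).symm
    rcases hy.2 with rfl | h2
    · exact h1
    · exact hD x hx.1.2 v (Finset.mem_sdiff.1 hv).2 y hy.1.2 hxy h1 h2.symm
  have hB' : ∀ u ∈ A \ C, ∀ v ∈ A \ C, G.Adj u v → B u = B v := by
    have key : ∀ u ∈ A \ C, ∀ v ∈ A \ C, G.Adj u v → B u ⊆ B v := by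
      intro u hu v hv huv x hx
      rw [Finset.mem_filter] at hx ⊢
      refine ⟨hx.1, ?_⟩
      rcases hx.2 with rfl | h1
      · exact Or.inr huv
      · by_cases e : x = v
        · exact Or.inl e
        · exact Or.inr (hD x (Finset.mem_sdiff.1 hx.1).2 u (Finset.mem_sdiff.1 hu).2 v
            (Finset.mem_sdiff.1 hv).2 e h1 huv)
    exact fun u hu v hv huv => (key u hu v hv huv).antisymm (key v hv u hu huv.symm)
  have hf : ∀ v, ∃ f : V → ℕ, v ∈ A \ C → (∀ x ∈ B v, f x < K.card) ∧
      (∀ x ∈ B v, ∀ y ∈ B v, f x = f y → x = y) ∧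
      ∀ x ∈ B v, ∀ y ∈ A ∩ C, G.Adj x y → f x ≠ c y := by
    intro v
    by_cases hv : v ∈ A \ C
    · obtain ⟨f, hf⟩ := exists_block_colouring (G := G) hCA (hB v hv) (Finset.disjoint_left.2
        fun x hx hx' => (Finset.mem_sdiff.1 (hBA v hx)).2 (Finset.mem_inter.1 hx').2)
        (w := K.card) (fun L hL => hmax L (hL.trans (Finset.union_subset
          ((hBA v).trans Finset.sdiff_subset) Finset.inter_subset_left)))
        hci
      exact ⟨f, fun _ => hf⟩
    · exact ⟨fun _ => 0, fun h => absurd h hv⟩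
  choose f hf using hf
  -- the colour of a vertex outside the central clique depends only on its block
  have hfB : ∃ F : Finset V → V → ℕ, ∀ v ∈ A \ C, (∀ x ∈ B v, F (B v) x < K.card) ∧
      (∀ x ∈ B v, ∀ y ∈ B v, F (B v) x = F (B v) y → x = y) ∧
      ∀ x ∈ B v, ∀ y ∈ A ∩ C, G.Adj x y → F (B v) x ≠ c y := by
    refine ⟨fun b => if hb : ∃ v ∈ A \ C, B v = b then f hb.choose else fun _ => 0,
      fun v hv => ?_⟩
    have hb : ∃ u ∈ A \ C, B u = B v := ⟨v, hv, rfl⟩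
    have h1 := hb.choose_spec
    simp only [dif_pos hb]
    have := hf hb.choose h1.1
    rwa [h1.2] at this
  obtain ⟨F, hF⟩ := hfB
  have hself : ∀ v ∈ A \ C, v ∈ B v := fun v hv => Finset.mem_filter.2 ⟨hv, Or.inl rfl⟩
  refine ⟨K, hK.1, hK.2, fun v => if v ∈ C then c v else F (B v) v, fun v hv => ?_,
    fun u hu v hv huv => ?_⟩
  · by_cases hvC : v ∈ C
    · simp only [if_pos hvC]
      exact (hc v (Finset.mem_inter.2 ⟨hv, hvC⟩)).trans_le hcw
    · simp only [if_neg hvC]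
      have hv' := Finset.mem_sdiff.2 ⟨hv, hvC⟩
      exact (hF v hv').1 v (hself v hv')
  · by_cases huC : u ∈ C <;> by_cases hvC : v ∈ C
    · simp only [if_pos huC, if_pos hvC]
      exact fun e => huv.ne (hci u (Finset.mem_inter.2 ⟨hu, huC⟩) v
        (Finset.mem_inter.2 ⟨hv, hvC⟩) e)
    · simp only [if_pos huC, if_neg hvC]
      have hv' := Finset.mem_sdiff.2 ⟨hv, hvC⟩
      exact ((hF v hv').2.2 v (hself v hv') u (Finset.mem_inter.2 ⟨hu, huC⟩) huv.symm).symm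
    · simp only [if_neg huC, if_pos hvC]
      have hu' := Finset.mem_sdiff.2 ⟨hu, huC⟩
      exact (hF u hu').2.2 u (hself u hu') v (Finset.mem_inter.2 ⟨hv, hvC⟩) huv
    · simp only [if_neg huC, if_neg hvC]
      have hv' := Finset.mem_sdiff.2 ⟨hv, hvC⟩
      have hu' := Finset.mem_sdiff.2 ⟨hu, huC⟩
      rw [hB' u hu' v hv' huv]
      exact fun e => huv.ne ((hF v hv').2.1 u (Finset.mem_filter.2 ⟨hu', Or.inr huv⟩) v
        (hself v hv') e)

lemma arrGraph_compl_isPerfect (C : Finset V) (S : Setoid {v // v ∉ C})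
    (ω : C × {v // v ∉ C} → Bool) : IsPerfect (arrGraph C S ω)ᶜ := by
  set G := (arrGraph C S ω)ᶜ with hG
  have hCC : ∀ u ∈ C, ∀ v ∈ C, ¬ G.Adj u v := fun u hu v hv h => by
    rw [hG, SimpleGraph.compl_adj, arrGraph_adj_mem hu hv] at h
    exact h.2 h.1
  have hDD : ∀ u v : {v // v ∉ C}, G.Adj u v ↔ rep S u ≠ rep S v := fun u v => by
    rw [hG, SimpleGraph.compl_adj, arrGraph_adj_notMem u.2 v.2, ne_eq (rep S u), rep_eq_iff]
    constructor
    · exact fun h h' => h.2 ⟨h.1, h'⟩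
    · exact fun h => ⟨fun e => h (by rw [Subtype.ext e]), fun h' => h h'.2⟩
  rw [isPerfect_iff]
  intro A
  set D := Finset.univ.filter fun v : {v // v ∉ C} => (v : V) ∈ A with hD
  have hDA : ∀ {v}, v ∈ D ↔ (v : V) ∈ A := fun {v} => by rw [hD, Finset.mem_filter]; simp
  set R := D.image (rep S) with hR
  have hRD : ∀ v ∈ D, rep S v ∈ R := fun v hv => Finset.mem_image_of_mem _ hv
  obtain ⟨i, hi, hii⟩ := exists_index R
  have clq : ∀ p : {v // v ∉ C} → {v // v ∉ C}, (∀ q ∈ R, p q ∈ D ∧ rep S (p q) = q) →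
      (R.image fun q => (p q : V)) ⊆ A ∧ G.IsClique ((R.image fun q => (p q : V)) : Set V) ∧
      (R.image fun q => (p q : V)).card = R.card := by
    intro p hp
    refine ⟨fun v hv => ?_, fun u hu v hv huv => ?_,
      Finset.card_image_of_injOn fun q hq q' hq' e => ?_⟩
    · obtain ⟨q, hq, rfl⟩ := Finset.mem_image.1 hv
      exact hDA.1 (hp q hq).1
    · obtain ⟨q, hq, rfl⟩ := Finset.mem_image.1 hu
      obtain ⟨q', hq', rfl⟩ := Finset.mem_image.1 hv
      rw [hDD, (hp q hq).2, (hp q' hq').2]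
      rintro rfl
      exact huv rfl
    · rw [← (hp q hq).2, ← (hp q' hq').2, Subtype.ext e]
  have hcol : ∀ u : {v // v ∉ C}, u ∈ D → ∀ v : {v // v ∉ C}, v ∈ D → G.Adj u v →
      i (rep S u) ≠ i (rep S v) := fun u hu v hv huv e =>
    (hDD u v).1 huv (hii _ (hRD u hu) _ (hRD v hv) e)
  by_cases hc : ∃ c ∈ C, c ∈ A ∧ ∀ q ∈ R, ∃ v ∈ D, rep S v = q ∧ G.Adj c v
  · obtain ⟨c, hcC, hcA, hc⟩ := hc
    have hp : ∀ q, ∃ p : {v // v ∉ C}, q ∈ R → p ∈ D ∧ rep S p = q ∧ G.Adj c p := fun q => by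
      by_cases hq : q ∈ R
      · obtain ⟨p, hp⟩ := hc q hq
        exact ⟨p, fun _ => hp⟩
      · exact ⟨q, fun h => absurd h hq⟩
    choose p hp using hp
    obtain ⟨h1, h2, h3⟩ := clq p fun q hq => ⟨(hp q hq).1, (hp q hq).2.1⟩
    have hcn : c ∉ R.image fun q => (p q : V) := fun h => by
      obtain ⟨q, -, hq⟩ := Finset.mem_image.1 h
      exact (p q).2 (hq ▸ hcC)
    refine ⟨insert c (R.image fun q => (p q : V)), Finset.insert_subset hcA h1, ?_,
      fun v => if h : v ∈ C then R.card else i (rep S ⟨v, h⟩), fun v hv => ?_, fun u hu v hv huv => ?_⟩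
    · rw [Finset.coe_insert, SimpleGraph.isClique_insert]
      refine ⟨h2, fun v hv _ => ?_⟩
      obtain ⟨q, hq, rfl⟩ := Finset.mem_image.1 hv
      exact (hp q hq).2.2
    · rw [Finset.card_insert_of_notMem hcn, h3]
      by_cases h : v ∈ C
      · simp only [dif_pos h]; omega
      · simp only [dif_neg h]
        have := hi _ (hRD ⟨v, h⟩ (hDA.2 hv))
        omega
    · by_cases h : u ∈ C <;> by_cases h' : v ∈ C
      · exact absurd huv (hCC u h v h')
      · simp only [dif_pos h, dif_neg h']
        exact (hi _ (hRD ⟨v, h'⟩ (hDA.2 hv))).ne'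
      · simp only [dif_neg h, dif_pos h']
        exact (hi _ (hRD ⟨u, h⟩ (hDA.2 hu))).ne
      · simp only [dif_neg h, dif_neg h']
        exact hcol ⟨u, h⟩ (hDA.2 hu) ⟨v, h'⟩ (hDA.2 hv) huv
  · push Not at hc
    have hp : ∀ q, ∃ p : {v // v ∉ C}, q ∈ R → p ∈ D ∧ rep S p = q := fun q => by
      by_cases hq : q ∈ R
      · obtain ⟨p, hp, hpq⟩ := Finset.mem_image.1 hq
        exact ⟨p, fun _ => ⟨hp, hpq⟩⟩
      · exact ⟨q, fun h => absurd h hq⟩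
    choose p hp using hp
    obtain ⟨h1, h2, h3⟩ := clq p hp
    have hg : ∀ c, ∃ k : ℕ, c ∈ C → c ∈ A → k < R.card ∧
        ∀ v ∈ D, G.Adj c v → i (rep S v) ≠ k := fun c => by
      by_cases h : c ∈ C ∧ c ∈ A
      · obtain ⟨q, hq, h4⟩ := hc c h.1 h.2
        exact ⟨i q, fun _ _ => ⟨hi q hq, fun v hv hcv e =>
          h4 v hv (hii _ (hRD v hv) _ hq e) hcv⟩⟩
      · exact ⟨0, fun h1 h2 => absurd ⟨h1, h2⟩ h⟩
    choose g hg using hg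
    refine ⟨R.image fun q => (p q : V), h1, h2,
      fun v => if h : v ∈ C then g v else i (rep S ⟨v, h⟩), fun v hv => ?_, fun u hu v hv huv => ?_⟩
    · rw [h3]
      by_cases h : v ∈ C
      · simp only [dif_pos h]
        exact (hg v h hv).1
      · simp only [dif_neg h]
        exact hi _ (hRD ⟨v, h⟩ (hDA.2 hv))
    · by_cases h : u ∈ C <;> by_cases h' : v ∈ C
      · exact absurd huv (hCC u h v h')
      · simp only [dif_pos h, dif_neg h']
        exact ((hg u h hu).2 ⟨v, h'⟩ (hDA.2 hv) huv).symm
      · simp only [dif_neg h, dif_pos h']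
        exact (hg v h' hv).2 ⟨u, h⟩ (hDA.2 hu) huv.symm
      · simp only [dif_neg h, dif_neg h']
        exact hcol ⟨u, h⟩ (hDA.2 hu) ⟨v, h'⟩ (hDA.2 hv) huv

lemma IsUnipolarArrangement.isPerfect_compl {C : Finset V}
    (h : IsUnipolarArrangement G (C : Set V)) : IsPerfect Gᶜ := by
  obtain ⟨S, ω, rfl⟩ := h.exists_arrGraph
  exact arrGraph_compl_isPerfect C S ω

end Perfect

section Hamiltonian

variable {V : Type*} [DecidableEq V] [Fintype V] {G : SimpleGraph V}

lemma isHamiltonian_of_list (l : List V) (hcover : ∀ v, v ∈ l) (hlen : l.length ≤ Fintype.card V)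
    (hl : l.IsChain G.Adj) (hadj : ∀ x ∈ l.getLast?, ∀ y ∈ l.head?, G.Adj x y)
    (hV : 3 ≤ Fintype.card V) : G.IsHamiltonian := by
  intro _
  have huniv : l.toFinset = Finset.univ :=
    Finset.eq_univ_of_forall fun v => List.mem_toFinset.2 (hcover v)
  have h1 : l.toFinset.card ≤ l.length := List.toFinset_card_le l
  rw [huniv, Finset.card_univ] at h1
  have hlen : l.length = Fintype.card V := le_antisymm hlen h1
  have hnd : l.Nodup := by
    have := (Multiset.toFinset_card_eq_card_iff_nodup (m := (l : Multiset V))).1 (by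
      rw [Multiset.coe_card, hlen, ← Finset.card_univ, ← huniv]; rfl)
    simpa using this
  have hne : l ≠ [] := by rintro rfl; simp at hlen; omega
  have had : G.Adj (l.getLast hne) (l.head hne) :=
    hadj _ (List.getLast_mem_getLast? hne) _ (List.head_mem_head? hne)
  have hp : (SimpleGraph.Walk.ofSupport l hne hl).IsPath :=
    SimpleGraph.Walk.IsPath.mk' (by rwa [SimpleGraph.Walk.support_ofSupport])
  refine ⟨_, SimpleGraph.Walk.cons had (SimpleGraph.Walk.ofSupport l hne hl), ?_⟩
  rw [SimpleGraph.Walk.isHamiltonianCycle_iff_isCycle_and_length_eq,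
    SimpleGraph.Walk.cons_isCycle_iff]
  refine ⟨⟨hp, fun h => ?_⟩, ?_⟩
  · rw [Sym2.eq_swap] at h
    have := hp.length_eq_one_of_mem_edges h
    rw [SimpleGraph.Walk.length_ofSupport] at this
    omega
  · rw [SimpleGraph.Walk.length_cons, SimpleGraph.Walk.length_ofSupport]
    omega

/-- Pieces `p i` that are paths from `h i` to `l i`, joined cyclically through the `c i`. -/
lemma isHamiltonian_of_pieces {g : ℕ} (hg : 0 < g) (p : ℕ → List V) (h l c : ℕ → V)
    (hh : ∀ i < g, (p i).head? = some (h i)) (hl : ∀ i < g, (p i).getLast? = some (l i))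
    (hp : ∀ i < g, (p i).IsChain G.Adj) (hlc : ∀ i < g, G.Adj (l i) (c i))
    (hch : ∀ i, i + 1 < g → G.Adj (c i) (h (i + 1))) (hc0 : G.Adj (c (g - 1)) (h 0))
    (hcover : ∀ v, ∃ i < g, v ∈ p i ∨ v = c i)
    (hlen : ∑ i ∈ Finset.range g, ((p i).length + 1) ≤ Fintype.card V)
    (hV : 3 ≤ Fintype.card V) : G.IsHamiltonian := by
  have key : ∀ t, t + 1 ≤ g → ∃ L : List V, (∀ v, (∃ i < t + 1, v ∈ p i ∨ v = c i) → v ∈ L) ∧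
      L.length = ∑ i ∈ Finset.range (t + 1), ((p i).length + 1) ∧ L.IsChain G.Adj ∧
      L.head? = some (h 0) ∧ L.getLast? = some (c t) := by
    intro t
    induction t with
    | zero =>
      intro ht
      refine ⟨p 0 ++ [c 0], ?_, by simp, ?_, ?_, by simp⟩
      · rintro v ⟨i, hi, hv⟩
        obtain rfl : i = 0 := by omega
        simpa using hv
      · refine List.isChain_append.2 ⟨hp 0 (by omega), List.isChain_singleton _, ?_⟩
        intro x hx y hy
        rw [hl 0 (by omega), Option.mem_some_iff] at hx
        rw [List.head?_singleton, Option.mem_some_iff] at hy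
        subst hx hy
        exact hlc 0 (by omega)
      · rw [List.head?_append, hh 0 (by omega)]; rfl
    | succ t ih =>
      intro ht
      obtain ⟨L, h1, h2, h3, h4, h5⟩ := ih (by omega)
      refine ⟨L ++ (p (t + 1) ++ [c (t + 1)]), ?_, ?_, ?_, ?_, by simp⟩
      · rintro v ⟨i, hi, hv⟩
        rw [List.mem_append]
        by_cases e : i < t + 1
        · exact Or.inl (h1 v ⟨i, e, hv⟩)
        · obtain rfl : i = t + 1 := by omega
          right
          simpa using hv
      · rw [Finset.sum_range_succ, ← h2]
        simp
      · refine List.isChain_append.2 ⟨h3, List.isChain_append.2 ⟨hp _ (by omega),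
          List.isChain_singleton _, ?_⟩, ?_⟩
        · intro x hx y hy
          rw [hl _ (by omega), Option.mem_some_iff] at hx
          rw [List.head?_singleton, Option.mem_some_iff] at hy
          subst hx hy
          exact hlc _ (by omega)
        · intro x hx y hy
          rw [h5, Option.mem_some_iff] at hx
          rw [List.head?_append, hh _ (by omega), Option.some_or, Option.mem_some_iff] at hy
          subst hx hy
          exact hch t (by omega)
      · rw [List.head?_append, h4]; rfl
  obtain ⟨L, h1, h2, h3, h4, h5⟩ := key (g - 1) (by omega)
  rw [Nat.sub_add_cancel hg] at h1 h2
  refine isHamiltonian_of_list L (fun v => h1 v (hcover v)) (h2.trans_le hlen) h3 ?_ hV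
  intro x hx y hy
  rw [h5, Option.mem_some_iff] at hx
  rw [h4, Option.mem_some_iff] at hy
  subst hx hy
  exact hc0

lemma two_mul_card_le_of_isHamiltonian (hG : G.IsHamiltonian) (hV : 2 ≤ Fintype.card V)
    {I : Finset V} (hI : ∀ u ∈ I, ∀ v ∈ I, ¬ G.Adj u v) : 2 * I.card ≤ Fintype.card V := by
  obtain ⟨a, p, hp⟩ := hG (by omega)
  have hlen := hp.length_eq
  set n := Fintype.card V
  have hmem : ∀ v, ∃ i < n, p.getVert i = v := by
    intro v
    obtain ⟨i, hi, hin⟩ := SimpleGraph.Walk.mem_support_iff_exists_getVert.1 (hp.mem_support v)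
    by_cases e : i < n
    · exact ⟨i, e, hi⟩
    · obtain rfl : i = p.length := by omega
      refine ⟨0, by omega, ?_⟩
      rw [SimpleGraph.Walk.getVert_zero, ← hi, SimpleGraph.Walk.getVert_length]
  have hmem' : ∀ v, ∃ i < n, p.getVert (i + 1) = v := by
    intro v
    obtain ⟨i, hi, hv⟩ := hmem v
    rcases Nat.eq_zero_or_pos i with rfl | h0
    · refine ⟨n - 1, by omega, ?_⟩
      rw [Nat.sub_add_cancel (by omega), ← hlen, SimpleGraph.Walk.getVert_length, ← hv,
        SimpleGraph.Walk.getVert_zero]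
    · exact ⟨i - 1, by omega, by rwa [Nat.sub_add_cancel h0]⟩
  set J := (Finset.range n).filter fun i => p.getVert i ∈ I with hJ
  set J' := (Finset.range n).filter fun i => p.getVert (i + 1) ∈ I with hJ'
  have h1 : I.card ≤ J.card := by
    refine le_trans (Finset.card_le_card fun v hv => ?_) (Finset.card_image_le (f := p.getVert))
    obtain ⟨i, hi, rfl⟩ := hmem v
    exact Finset.mem_image_of_mem _ (Finset.mem_filter.2 ⟨Finset.mem_range.2 hi, hv⟩)
  have h2 : I.card ≤ J'.card := by
    refine le_trans (Finset.card_le_card fun v hv => ?_)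
      (Finset.card_image_le (f := fun i => p.getVert (i + 1)))
    obtain ⟨i, hi, rfl⟩ := hmem' v
    exact Finset.mem_image.2 ⟨i, Finset.mem_filter.2 ⟨Finset.mem_range.2 hi, hv⟩, rfl⟩
  have h3 : (J ∪ J').card ≤ n := by
    refine (Finset.card_le_card (Finset.union_subset (Finset.filter_subset _ _)
      (Finset.filter_subset _ _))).trans_eq (Finset.card_range n)
  rw [Finset.card_union_of_disjoint] at h3
  · omega
  · rw [Finset.disjoint_left]
    intro i hi hi'
    rw [Finset.mem_filter, Finset.mem_range] at hi hi'
    exact hI _ hi.2 _ hi'.2 (p.adj_getVert_succ (by omega))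

/-- A form of Hall's theorem. -/
lemma exists_injOn_of_good {K : Type*} [Fintype K] {g a : ℕ} (hg : 0 < g) (good : ℕ → K → Prop)
    (h1 : ∀ i < g, a ≤ (Finset.univ.filter (good i)).card)
    (h2 : ∀ I ⊆ Finset.range g, ∀ U : Finset K, a ≤ I.card → a ≤ U.card →
      ∃ i ∈ I, ∃ c ∈ U, good i c)
    (h3 : g + a ≤ Fintype.card K ∨ (g ≤ Fintype.card K ∧
      ∀ c, a ≤ ((Finset.range g).filter fun i => good i c).card)) :
    ∃ c : ℕ → K, Set.InjOn c (Set.Iio g) ∧ ∀ i < g, good i (c i) := by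
  have hall : ∀ I : Finset (Fin g),
      I.card ≤ (I.biUnion fun i => Finset.univ.filter (good i)).card := by
    intro I
    rcases I.eq_empty_or_nonempty with rfl | ⟨i₀, hi₀⟩
    · simp
    set N := I.biUnion fun i => Finset.univ.filter (good i) with hN
    by_cases hI : I.card < a
    · have h5 : (Finset.univ.filter (good i₀)).card ≤ N.card := Finset.card_le_card
        (Finset.subset_biUnion_of_mem (fun i : Fin g => Finset.univ.filter (good i)) hi₀)
      have := h1 i₀ i₀.2
      omega
    have hU : Nᶜ.card < a := by
      by_contra! hU
      obtain ⟨i, hi, c, hc, hic⟩ := h2 (I.map Fin.valEmbedding) (fun i hi => by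
        obtain ⟨j, -, rfl⟩ := Finset.mem_map.1 hi
        exact Finset.mem_range.2 j.2) Nᶜ (by rw [Finset.card_map]; omega) hU
      obtain ⟨j, hj, rfl⟩ := Finset.mem_map.1 hi
      exact Finset.mem_compl.1 hc (Finset.mem_biUnion.2 ⟨j, hj, by simpa using hic⟩)
    have hcard := Finset.card_add_card_compl N
    have hIg : I.card ≤ g := (Finset.card_le_univ I).trans_eq (Fintype.card_fin g)
    rcases h3 with h3 | ⟨h3, h4⟩
    · omega
    rcases Nᶜ.eq_empty_or_nonempty with h0 | ⟨c, hc⟩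
    · rw [h0, Finset.card_empty] at hcard
      omega
    have h5 : Disjoint ((Finset.range g).filter fun i => good i c) (I.map Fin.valEmbedding) := by
      rw [Finset.disjoint_left]
      intro i hi hi'
      obtain ⟨j, hj, rfl⟩ := Finset.mem_map.1 hi'
      exact Finset.mem_compl.1 hc (Finset.mem_biUnion.2
        ⟨j, hj, by simpa using (Finset.mem_filter.1 hi).2⟩)
    have h6 : (((Finset.range g).filter fun i => good i c) ∪ I.map Fin.valEmbedding).card ≤ g := by
      refine (Finset.card_le_card (Finset.union_subset (Finset.filter_subset _ _)
        fun i hi => ?_)).trans_eq (Finset.card_range g)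
      obtain ⟨j, -, rfl⟩ := Finset.mem_map.1 hi
      exact Finset.mem_range.2 j.2
    rw [Finset.card_union_of_disjoint h5, Finset.card_map] at h6
    have := h4 c
    omega
  obtain ⟨f, hf, hfg⟩ := (Finset.all_card_le_biUnion_card_iff_exists_injective _).1 hall
  refine ⟨fun i => if h : i < g then f ⟨i, h⟩ else f ⟨0, hg⟩, fun i hi j hj e => ?_, fun i hi => ?_⟩
  · rw [Set.mem_Iio] at hi hj
    simp only [dif_pos hi, dif_pos hj] at e
    exact congrArg Fin.val (hf e)
  · simp only [dif_pos hi]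
    exact (Finset.mem_filter.1 (hfg ⟨i, hi⟩)).2

end Hamiltonian

section Spread

variable {A D : Type*} [Fintype A] [Fintype D] [DecidableEq A] [DecidableEq D]

/-- Every two vertices have many common (non-)neighbours, and large families of disjoint pairs meet
large sets. -/
def Spread (ω : A × D → Bool) (a s : ℕ) : Prop :=
  (∀ b, ∀ x y, x ≠ y → a ≤ (Finset.univ.filter fun c => ω (c, x) = b ∧ ω (c, y) = b).card) ∧
  ∀ b, ∀ e : Fin s × Bool → D, e.Injective → ∀ U : Finset A, s ≤ U.card →
    ∃ i, ∃ c ∈ U, ω (c, e (i, false)) = b ∧ ω (c, e (i, true)) = b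

/-- `c` can be inserted with value `b` into the gap after the `i`-th of `G` pieces in cyclic order,
the `i`-th piece going from `h i` to `l i`. -/
def FitsGap (ω : A × D → Bool) (h l : ℕ → D) (G : ℕ) (b : Bool) (i : ℕ) (c : A) : Prop :=
  ω (c, l (min i (G - 1))) = b ∧ ω (c, if i + 1 < G then h (i + 1) else h 0) = b

variable {ω : A × D → Bool} {h l : ℕ → D} {π : D → ℕ} {a s G g : ℕ} {b : Bool}

lemma injective_pairs (hh : ∀ i < G, π (h i) = i) (hl : ∀ i < G, π (l i) = i) {t q : ℕ}
    (f : Fin t → ℕ) (hf : f.Injective) (hfG : ∀ j, f j + 1 < G) (hq : ∀ j, f j % 2 = q) :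
    (fun z : Fin t × Bool => if z.2 = true then h (f z.1 + 1) else l (f z.1)).Injective := by
  have h1 : ∀ z : Fin t × Bool, π (if z.2 = true then h (f z.1 + 1) else l (f z.1)) =
      f z.1 + (if z.2 = true then 1 else 0) := by
    rintro ⟨j, _ | _⟩
    · simpa using hl (f j) (by have := hfG j; omega)
    · simpa using hh (f j + 1) (hfG j)
  rintro ⟨i, x⟩ ⟨j, y⟩ e
  have h2 := h1 ⟨i, x⟩
  rw [show (if (i, x).2 = true then h (f (i, x).1 + 1) else l (f (i, x).1)) = _ from e, h1] at h2
  have hi := hq i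
  have hj := hq j
  rcases x with _ | _ <;> rcases y with _ | _ <;> simp at h2 <;> first | omega | rw [hf h2]

lemma Spread.exists_fits (hsp : Spread ω a s) (has : 2 * s + 3 ≤ a) (hh : ∀ i < G, π (h i) = i)
    (hl : ∀ i < G, π (l i) = i) (hG : 2 ≤ G) (hGg : G ≤ g) (hgG : g ≤ G + 1)
    (h3 : g + a ≤ Fintype.card A ∨ (g ≤ Fintype.card A ∧
      ∀ c, a ≤ ((Finset.range g).filter fun i => FitsGap ω h l G b i c).card)) :
    ∃ c : ℕ → A, Set.InjOn c (Set.Iio g) ∧ ∀ i < g, FitsGap ω h l G b i (c i) := by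
  refine exists_injOn_of_good (a := a) (by omega) _ (fun i hi => ?_) (fun I hI U hIa hU => ?_) h3
  · refine (hsp.1 b (l (min i (G - 1))) (if i + 1 < G then h (i + 1) else h 0) fun e => ?_).trans
      (Finset.card_le_card fun c hc => Finset.mem_filter.2 ⟨Finset.mem_univ _,
        (Finset.mem_filter.1 hc).2⟩)
    have := congrArg π e
    rw [hl _ (by omega)] at this
    split_ifs at this with h1
    · rw [hh _ h1] at this; omega
    · rw [hh _ (by omega)] at this; omega
  · have h4 : ∃ q, s ≤ (I.filter fun i => i + 1 < G ∧ i % 2 = q).card := by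
      by_contra! hn
      have h5 : I ⊆ (I.filter fun i => i + 1 < G ∧ i % 2 = 0) ∪
          (I.filter fun i => i + 1 < G ∧ i % 2 = 1) ∪ {G - 1, G} := by
        intro i hi
        have := Finset.mem_range.1 (hI hi)
        simp only [Finset.mem_union, Finset.mem_filter, hi, true_and, Finset.mem_insert,
          Finset.mem_singleton]
        omega
      have h6 := Finset.card_le_card h5
      have h7 := Finset.card_union_le ((I.filter fun i => i + 1 < G ∧ i % 2 = 0) ∪
          (I.filter fun i => i + 1 < G ∧ i % 2 = 1)) {G - 1, G}
      have h8 := Finset.card_union_le (I.filter fun i => i + 1 < G ∧ i % 2 = 0)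
          (I.filter fun i => i + 1 < G ∧ i % 2 = 1)
      have h9 : ({G - 1, G} : Finset ℕ).card ≤ 2 := Finset.card_le_two
      have := hn 0
      have := hn 1
      omega
    obtain ⟨q, hq⟩ := h4
    obtain ⟨J, hJ, hJs⟩ := Finset.exists_subset_card_eq hq
    have hJ : ∀ i ∈ J, i ∈ I ∧ i + 1 < G ∧ i % 2 = q := fun i hi => Finset.mem_filter.1 (hJ hi)
    let f := J.orderEmbOfFin hJs
    have hfJ : ∀ j, f j ∈ J := fun j => Finset.orderEmbOfFin_mem J hJs j
    obtain ⟨j, c, hc, h1, h2⟩ := hsp.2 b _ (injective_pairs hh hl f f.injective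
      (fun j => (hJ _ (hfJ j)).2.1) fun j => (hJ _ (hfJ j)).2.2) U (by omega)
    obtain ⟨h5, h6, -⟩ := hJ _ (hfJ j)
    refine ⟨f j, h5, c, hc, ?_, ?_⟩
    · rw [min_eq_left (by omega)]
      simpa using h1
    · rw [if_pos h6]
      simpa using h2

/-- Few functions `ω` are constantly `b` on only few out of many disjoint pairs. -/
lemma card_few_good {ι α : Type*} [Fintype ι] [Fintype α] [DecidableEq α]
    (e : ι × Bool → α) (he : e.Injective)
    (b : Bool) (a : ℕ) : ((Finset.univ.filter fun ω : α → Bool =>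
      (Finset.univ.filter fun i => ω (e (i, false)) = b ∧ ω (e (i, true)) = b).card ≤ a).card : ℝ) ≤
      16 ^ a * (13 / 16) ^ Fintype.card ι * 2 ^ Fintype.card α := by
  set E : Finset ι → Finset (α → Bool) := fun T =>
    Finset.univ.filter fun ω => ∀ i : {i // i ∉ T}, ∃ t, ω (e (i, t)) ≠ b with hE
  have hcard : ∀ T : Finset ι, ((E T).card : ℝ) ≤
      (3 / 4) ^ (Fintype.card ι - T.card) * 2 ^ Fintype.card α := by
    intro T
    have h1 := card_avoid (ι := {i // i ∉ T}) (β := Bool) (fun z => e ((z.1 : ι), z.2))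
      (fun y z hyz => by
        have := he hyz
        simp only [Prod.mk.injEq] at this
        exact Prod.ext (Subtype.ext this.1) this.2) fun _ _ => b
    rw [card_compl_subtype, Fintype.card_bool, Nat.card_eq_fintype_card, Fintype.card_subtype] at h1
    have h2 : ((E T).card : ℝ) * 4 ^ (Fintype.card ι - T.card) ≤
        3 ^ (Fintype.card ι - T.card) * 2 ^ Fintype.card α := by
      have : (E T).card * 4 ^ (Fintype.card ι - T.card) ≤
        3 ^ (Fintype.card ι - T.card) * 2 ^ Fintype.card α := by
        convert h1 using 2 <;> norm_num
      exact_mod_cast this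
    rw [div_pow, div_mul_eq_mul_div, le_div_iff₀ (by positivity)]
    exact h2
  have hsub : (Finset.univ.filter fun ω : α → Bool =>
      (Finset.univ.filter fun i => ω (e (i, false)) = b ∧ ω (e (i, true)) = b).card ≤ a) ⊆
      ((Finset.univ : Finset ι).powerset.filter fun T => T.card ≤ a).biUnion E := by
    intro ω hω
    refine Finset.mem_biUnion.2 ⟨Finset.univ.filter fun i => ω (e (i, false)) = b ∧
      ω (e (i, true)) = b, Finset.mem_filter.2 ⟨by simp, (Finset.mem_filter.1 hω).2⟩,
      Finset.mem_filter.2 ⟨Finset.mem_univ _, fun i => ?_⟩⟩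
    by_contra! hn
    exact i.2 (Finset.mem_filter.2 ⟨Finset.mem_univ _, hn false, hn true⟩)
  have h1 : ((Finset.univ.filter fun ω : α → Bool =>
      (Finset.univ.filter fun i => ω (e (i, false)) = b ∧ ω (e (i, true)) = b).card ≤ a).card : ℝ) ≤
      ∑ T ∈ (Finset.univ : Finset ι).powerset.filter fun T => T.card ≤ a, ((E T).card : ℝ) := by
    exact_mod_cast (Finset.card_le_card hsub).trans Finset.card_biUnion_le
  refine h1.trans ?_
  have h2 : ∀ T ∈ (Finset.univ : Finset ι).powerset.filter fun T => T.card ≤ a,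
      ((E T).card : ℝ) ≤ 16 ^ a * 2 ^ Fintype.card α *
        ((1 / 16) ^ T.card * (3 / 4) ^ (Fintype.card ι - T.card)) := by
    intro T hT
    have hTa := (Finset.mem_filter.1 hT).2
    refine (hcard T).trans ?_
    have h3 : (1 : ℝ) ≤ 16 ^ a * (1 / 16) ^ T.card := by
      rw [one_div, inv_pow, ← div_eq_mul_inv, one_le_div (by positivity)]
      exact pow_le_pow_right₀ (by norm_num) hTa
    calc _ ≤ (16 ^ a * (1 / 16) ^ T.card) *
          ((3 / 4) ^ (Fintype.card ι - T.card) * 2 ^ Fintype.card α : ℝ) :=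
          le_mul_of_one_le_left (by positivity) h3
      _ = _ := by ring
  refine (Finset.sum_le_sum h2).trans ?_
  rw [← Finset.mul_sum]
  have h4 : ∑ T ∈ (Finset.univ : Finset ι).powerset.filter fun T => T.card ≤ a,
      ((1 / 16 : ℝ) ^ T.card * (3 / 4) ^ (Fintype.card ι - T.card)) ≤ (13 / 16) ^ Fintype.card ι := by
    refine (Finset.sum_le_sum_of_subset_of_nonneg (Finset.filter_subset _ _)
      fun _ _ _ => by positivity).trans_eq ?_
    have := Finset.sum_pow_mul_eq_add_pow (1 / 16 : ℝ) (3 / 4) (Finset.univ : Finset ι)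
    rw [Finset.card_univ] at this
    rw [this]
    norm_num
  calc _ ≤ _ := mul_le_mul_of_nonneg_left h4 (by positivity)
    _ = _ := by ring

lemma card_not_common (a : ℕ) : ((Finset.univ.filter fun ω : A × D → Bool =>
    ∃ b, ∃ x y, x ≠ y ∧
      (Finset.univ.filter fun c => ω (c, x) = b ∧ ω (c, y) = b).card < a).card : ℝ) ≤
      2 * (Fintype.card D) ^ 2 * (16 ^ a * (13 / 16) ^ Fintype.card A) *
        2 ^ (Fintype.card A * Fintype.card D) := by
  set E : Bool × {z : D × D // z.1 ≠ z.2} → Finset (A × D → Bool) := fun z =>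
    Finset.univ.filter fun ω => (Finset.univ.filter fun c =>
      ω (c, z.2.1.1) = z.1 ∧ ω (c, z.2.1.2) = z.1).card ≤ a with hE
  have hcard : ∀ z, ((E z).card : ℝ) ≤ 16 ^ a * (13 / 16) ^ Fintype.card A *
      2 ^ (Fintype.card A * Fintype.card D) := by
    rintro ⟨b, ⟨x, y⟩, hxy⟩
    have h := card_few_good (fun z : A × Bool => (z.1, if z.2 = true then y else x)) ?_ b a
    · rw [Fintype.card_prod] at h
      simpa [hE] using h
    · rintro ⟨c, _ | _⟩ ⟨c', _ | _⟩ h <;> simp_all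
  have hsub : (Finset.univ.filter fun ω : A × D → Bool => ∃ b, ∃ x y, x ≠ y ∧
      (Finset.univ.filter fun c => ω (c, x) = b ∧ ω (c, y) = b).card < a) ⊆
      Finset.univ.biUnion E := by
    intro ω hω
    obtain ⟨b, x, y, hxy, h⟩ := (Finset.mem_filter.1 hω).2
    exact Finset.mem_biUnion.2 ⟨(b, ⟨(x, y), hxy⟩), Finset.mem_univ _,
      Finset.mem_filter.2 ⟨Finset.mem_univ _, h.le⟩⟩
  have h1 : ((Finset.univ.filter fun ω : A × D → Bool => ∃ b, ∃ x y, x ≠ y ∧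
      (Finset.univ.filter fun c => ω (c, x) = b ∧ ω (c, y) = b).card < a).card : ℝ) ≤
      ∑ z, ((E z).card : ℝ) := by
    exact_mod_cast (Finset.card_le_card hsub).trans Finset.card_biUnion_le
  refine (h1.trans (Finset.sum_le_card_nsmul _ _ _ fun z _ => hcard z)).trans ?_
  have h2 : (Fintype.card (Bool × {z : D × D // z.1 ≠ z.2}) : ℝ) ≤ 2 * (Fintype.card D) ^ 2 := by
    rw [Fintype.card_prod, Fintype.card_bool]
    have := Fintype.card_subtype_le fun z : D × D => z.1 ≠ z.2
    rw [Fintype.card_prod] at this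
    have h3 : (Fintype.card {z : D × D // z.1 ≠ z.2} : ℝ) ≤ Fintype.card D * Fintype.card D := by
      exact_mod_cast this
    push_cast
    nlinarith
  rw [Finset.card_univ, nsmul_eq_mul, mul_assoc (2 * _ : ℝ)]
  exact mul_le_mul_of_nonneg_right h2 (by positivity)

lemma card_not_meet (s : ℕ) : ((Finset.univ.filter fun ω : A × D → Bool =>
    ∃ b, ∃ e : Fin s × Bool → D, e.Injective ∧ ∃ U : Finset A, s ≤ U.card ∧
      ∀ i, ∀ c ∈ U, ¬ (ω (c, e (i, false)) = b ∧ ω (c, e (i, true)) = b)).card : ℝ) ≤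
      2 * (Fintype.card D) ^ (2 * s) * 2 ^ Fintype.card A * (3 / 4) ^ (s * s) *
        2 ^ (Fintype.card A * Fintype.card D) := by
  set E : Bool × {e : Fin s × Bool → D // e.Injective} × {U : Finset A // s ≤ U.card} →
      Finset (A × D → Bool) := fun z =>
    Finset.univ.filter fun ω => ∀ i : Fin s × z.2.2.1, ∃ t, ω (i.2, z.2.1.1 (i.1, t)) ≠ z.1 with hE
  have hcard : ∀ z, ((E z).card : ℝ) ≤ (3 / 4) ^ (s * s) *
      2 ^ (Fintype.card A * Fintype.card D) := by
    rintro ⟨b, ⟨e, he⟩, ⟨U, hU⟩⟩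
    have h1 := card_avoid (ι := Fin s × U) (β := Bool)
      (fun z => ((z.1.2 : A), e (z.1.1, z.2))) (fun y z hyz => by
        simp only [Prod.mk.injEq] at hyz
        have := he hyz.2
        simp only [Prod.mk.injEq] at this
        exact Prod.ext (Prod.ext this.1 (Subtype.ext hyz.1)) this.2) fun _ _ => b
    rw [Fintype.card_bool, Nat.card_eq_fintype_card, Fintype.card_subtype, Fintype.card_prod,
      Fintype.card_prod, Fintype.card_fin, Fintype.card_coe] at h1
    have h2 : ((E (b, ⟨e, he⟩, ⟨U, hU⟩)).card : ℝ) * 4 ^ (s * U.card) ≤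
        3 ^ (s * U.card) * 2 ^ (Fintype.card A * Fintype.card D) := by
      have : (E (b, ⟨e, he⟩, ⟨U, hU⟩)).card * 4 ^ (s * U.card) ≤
        3 ^ (s * U.card) * 2 ^ (Fintype.card A * Fintype.card D) := by
        convert h1 using 2 <;> norm_num
      exact_mod_cast this
    have h3 : ((E (b, ⟨e, he⟩, ⟨U, hU⟩)).card : ℝ) ≤
        (3 / 4) ^ (s * U.card) * 2 ^ (Fintype.card A * Fintype.card D) := by
      rw [div_pow, div_mul_eq_mul_div, le_div_iff₀ (by positivity)]
      exact h2
    exact h3.trans (mul_le_mul_of_nonneg_right (pow_le_pow_of_le_one (by norm_num) (by norm_num)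
      (Nat.mul_le_mul_left s hU)) (by positivity))
  have hsub : (Finset.univ.filter fun ω : A × D → Bool =>
    ∃ b, ∃ e : Fin s × Bool → D, e.Injective ∧ ∃ U : Finset A, s ≤ U.card ∧
      ∀ i, ∀ c ∈ U, ¬ (ω (c, e (i, false)) = b ∧ ω (c, e (i, true)) = b)) ⊆
      Finset.univ.biUnion E := by
    intro ω hω
    obtain ⟨b, e, he, U, hU, h⟩ := (Finset.mem_filter.1 hω).2
    refine Finset.mem_biUnion.2 ⟨(b, ⟨e, he⟩, ⟨U, hU⟩), Finset.mem_univ _,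
      Finset.mem_filter.2 ⟨Finset.mem_univ _, fun i => ?_⟩⟩
    by_contra! hn
    exact h i.1 i.2 i.2.2 ⟨hn false, hn true⟩
  have h1 : ((Finset.univ.filter fun ω : A × D → Bool =>
    ∃ b, ∃ e : Fin s × Bool → D, e.Injective ∧ ∃ U : Finset A, s ≤ U.card ∧
      ∀ i, ∀ c ∈ U, ¬ (ω (c, e (i, false)) = b ∧ ω (c, e (i, true)) = b)).card : ℝ) ≤
      ∑ z, ((E z).card : ℝ) := by
    exact_mod_cast (Finset.card_le_card hsub).trans Finset.card_biUnion_le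
  refine (h1.trans (Finset.sum_le_card_nsmul _ _ _ fun z _ => hcard z)).trans ?_
  have h2 : (Fintype.card (Bool × {e : Fin s × Bool → D // e.Injective} ×
      {U : Finset A // s ≤ U.card}) : ℝ) ≤
      2 * (Fintype.card D) ^ (2 * s) * 2 ^ Fintype.card A := by
    rw [Fintype.card_prod, Fintype.card_prod, Fintype.card_bool]
    have h3 := Fintype.card_subtype_le fun e : Fin s × Bool → D => e.Injective
    have h4 := Fintype.card_subtype_le fun U : Finset A => s ≤ U.card
    rw [Fintype.card_fun, Fintype.card_prod, Fintype.card_fin, Fintype.card_bool, mul_comm s] at h3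
    rw [Fintype.card_finset] at h4
    have := Nat.mul_le_mul_left 2 (Nat.mul_le_mul h3 h4)
    rw [mul_assoc (2 : ℝ)]
    exact_mod_cast this
  rw [Finset.card_univ, nsmul_eq_mul, mul_assoc _ ((3 / 4 : ℝ) ^ (s * s))]
  exact mul_le_mul_of_nonneg_right h2 (by positivity)

lemma card_not_spread_le (a s : ℕ) :
    ((Finset.univ.filter fun ω : A × D → Bool => ¬ Spread ω a s).card : ℝ) ≤
      (2 * (Fintype.card D) ^ 2 * (16 ^ a * (13 / 16) ^ Fintype.card A) +
        2 * (Fintype.card D) ^ (2 * s) * 2 ^ Fintype.card A * (3 / 4) ^ (s * s)) *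
        2 ^ (Fintype.card A * Fintype.card D) := by
  rw [add_mul]
  refine le_trans ?_ (add_le_add (card_not_common a) (card_not_meet s))
  rw [← Nat.cast_add, Nat.cast_le]
  refine (Finset.card_le_card fun ω hω => ?_).trans (Finset.card_union_le _ _)
  have h := (Finset.mem_filter.1 hω).2
  rw [Finset.mem_union, Finset.mem_filter, Finset.mem_filter]
  rw [Spread, not_and_or] at h
  push Not at h
  rcases h with ⟨b, x, y, h⟩ | ⟨b, e, he, U, h⟩
  · exact Or.inl ⟨Finset.mem_univ _, b, x, y, h⟩
  · exact Or.inr ⟨Finset.mem_univ _, b, e, he, U, h.1, fun i c hc hn => h.2 i c hc hn.1 hn.2⟩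

/-- For most `ω` each `c` fits into many gaps. -/
lemma card_not_full_le (hh : ∀ i < G, π (h i) = i) (hl : ∀ i < G, π (l i) = i) (b : Bool) (a : ℕ) :
    ((Finset.univ.filter fun ω : A × D → Bool =>
      ¬ ∀ c, a ≤ ((Finset.range G).filter fun i => FitsGap ω h l G b i c).card).card : ℝ) ≤
      Fintype.card A * (16 ^ a * (13 / 16) ^ (G / 2)) *
        2 ^ (Fintype.card A * Fintype.card D) := by
  set E : A → Finset (A × D → Bool) := fun c => Finset.univ.filter fun ω =>
    (Finset.univ.filter fun j : Fin (G / 2) => ω (c, l (2 * j)) = b ∧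
      ω (c, h (2 * j + 1)) = b).card ≤ a with hE
  have hcard : ∀ c, ((E c).card : ℝ) ≤ 16 ^ a * (13 / 16) ^ (G / 2) *
      2 ^ (Fintype.card A * Fintype.card D) := by
    intro c
    have h1 := injective_pairs hh hl (fun j : Fin (G / 2) => 2 * (j : ℕ)) (q := 0)
      (fun i j hij => Fin.ext (by simpa using hij)) (fun j => by have := j.2; omega)
      (fun j => by omega)
    have h := card_few_good (fun z : Fin (G / 2) × Bool =>
      (c, if z.2 = true then h (2 * (z.1 : ℕ) + 1) else l (2 * (z.1 : ℕ)))) (fun y z hyz => h1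
        (congrArg Prod.snd hyz)) b a
    rw [Fintype.card_prod, Fintype.card_fin] at h
    simpa [hE] using h
  have hsub : (Finset.univ.filter fun ω : A × D → Bool =>
      ¬ ∀ c, a ≤ ((Finset.range G).filter fun i => FitsGap ω h l G b i c).card) ⊆
      Finset.univ.biUnion E := by
    intro ω hω
    have h1 := (Finset.mem_filter.1 hω).2
    push Not at h1
    obtain ⟨c, hc⟩ := h1
    refine Finset.mem_biUnion.2 ⟨c, Finset.mem_univ _, Finset.mem_filter.2 ⟨Finset.mem_univ _,
      le_trans ?_ hc.le⟩⟩
    refine Finset.card_le_card_of_injOn (fun j => 2 * (j : ℕ)) (fun j hj => ?_)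
      (fun i _ j _ hij => Fin.ext (by simpa using hij))
    have h2 := (Finset.mem_filter.1 hj).2
    dsimp only
    have h3 : 2 * (j : ℕ) + 1 < G := by have := j.2; omega
    refine Finset.mem_filter.2 ⟨Finset.mem_range.2 (by omega), ?_, ?_⟩
    · rw [min_eq_left (by omega)]; exact h2.1
    · rw [if_pos h3]; exact h2.2
  have h1 : ((Finset.univ.filter fun ω : A × D → Bool =>
      ¬ ∀ c, a ≤ ((Finset.range G).filter fun i => FitsGap ω h l G b i c).card).card : ℝ) ≤
      ∑ z, ((E z).card : ℝ) := by
    exact_mod_cast (Finset.card_le_card hsub).trans Finset.card_biUnion_le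
  refine (h1.trans (Finset.sum_le_card_nsmul _ _ _ fun z _ => hcard z)).trans_eq ?_
  rw [Finset.card_univ, nsmul_eq_mul, mul_assoc]
  ring

end Spread

section Layout

variable {D : Type*} [Fintype D] [DecidableEq D]

lemma exists_layout [Nonempty D] (π : D → ℕ) : ∃ (p : ℕ → List D) (h l : ℕ → D),
    (∀ i d, d ∈ p i ↔ π d = i) ∧ (∀ i, (p i).Nodup) ∧
    ∀ i, (∃ d, π d = i) → (p i).head? = some (h i) ∧ (p i).getLast? = some (l i) := by
  let p : ℕ → List D := fun i => (Finset.univ.filter fun d => π d = i).toList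
  have hp : ∀ i d, d ∈ p i ↔ π d = i := fun i d => by simp [p]
  refine ⟨p, fun i => (p i).head?.getD (Classical.arbitrary D),
    fun i => (p i).getLast?.getD (Classical.arbitrary D), hp, fun i => Finset.nodup_toList _,
    fun i hi => ?_⟩
  obtain ⟨d, hd⟩ := hi
  have hne : p i ≠ [] := List.ne_nil_of_mem ((hp i d).2 hd)
  simp only [List.head?_eq_some_head hne, List.getLast?_eq_some_getLast hne, Option.getD_some,
    and_self]

lemma sum_length_layout {p : ℕ → List D} {π : D → ℕ} (hp : ∀ i d, d ∈ p i ↔ π d = i)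
    (hnd : ∀ i, (p i).Nodup) {G : ℕ} (hπ : ∀ d, π d < G) :
    ∑ i ∈ Finset.range G, (p i).length = Fintype.card D := by
  rw [← Finset.card_univ, Finset.card_eq_sum_card_fiberwise (f := π) (t := Finset.range G)
    (fun d _ => by simpa using hπ d)]
  refine Finset.sum_congr rfl fun i _ => ?_
  rw [← List.toFinset_card_of_nodup (hnd i)]
  congr 1
  ext d
  simp [hp]

lemma exists_class_index (S : Setoid D) : ∃ π : D → ℕ,
    (∀ d, π d < (Finset.univ.image (rep S)).card) ∧
    (∀ i < (Finset.univ.image (rep S)).card, ∃ d, π d = i) ∧ ∀ x y, π x = π y ↔ S x y := by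
  set R := Finset.univ.image (rep S) with hR
  have hm : ∀ d, rep S d ∈ R := fun d => Finset.mem_image_of_mem _ (Finset.mem_univ _)
  refine ⟨fun d => R.equivFin ⟨rep S d, hm d⟩, fun d => Fin.is_lt _, fun i hi => ?_,
    fun x y => ?_⟩
  · obtain ⟨d, -, hd⟩ := Finset.mem_image.1 (R.equivFin.symm ⟨i, hi⟩).2
    refine ⟨d, ?_⟩
    have : (⟨rep S d, hm d⟩ : R) = R.equivFin.symm ⟨i, hi⟩ := Subtype.ext hd
    simp only [this, Equiv.apply_symm_apply]
  · rw [← rep_eq_iff, Fin.val_inj, R.equivFin.apply_eq_iff_eq, Subtype.mk.injEq]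

lemma exists_disjoint_pairs (S : Setoid D) {M : ℕ}
    (hM : ∀ Q : Finset D, (∀ x ∈ Q, ∀ y ∈ Q, S x y) → Q.card ≤ M) (e : ℕ)
    (he : 2 * e + M ≤ Fintype.card D) [Nonempty D] : ∃ a b : ℕ → D,
      (∀ i < e, ∀ j < e, a i = a j → i = j) ∧ (∀ i < e, ∀ j < e, b i = b j → i = j) ∧
      (∀ i < e, ∀ j < e, a i ≠ b j) ∧ ∀ i < e, ¬ S (a i) (b i) := by
  induction e with
  | zero => exact ⟨fun _ => Classical.arbitrary D, fun _ => Classical.arbitrary D, by simp⟩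
  | succ e ih =>
    obtain ⟨a, b, h1, h2, h3, h4⟩ := ih (by omega)
    set W := (Finset.range e).image a ∪ (Finset.range e).image b with hW
    have hWc : W.card ≤ e + e := (Finset.card_union_le _ _).trans (add_le_add
      (Finset.card_image_le.trans_eq (Finset.card_range e))
      (Finset.card_image_le.trans_eq (Finset.card_range e)))
    have hx : ∃ x ∈ Wᶜ, ∃ y ∈ Wᶜ, ¬ S x y := by
      by_contra! hn
      have := hM _ hn
      rw [Finset.card_compl] at this
      omega
    obtain ⟨x, hx, y, hy, hxy⟩ := hx
    have hxy' : x ≠ y := fun h => hxy (h ▸ S.refl x)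
    have hn : ∀ z ∈ Wᶜ, ∀ i < e, a i ≠ z ∧ b i ≠ z := by
      intro z hz i hi
      refine ⟨?_, ?_⟩ <;> rintro rfl <;> refine Finset.mem_compl.1 hz ?_
      · exact Finset.mem_union_left _ (Finset.mem_image_of_mem _ (Finset.mem_range.2 hi))
      · exact Finset.mem_union_right _ (Finset.mem_image_of_mem _ (Finset.mem_range.2 hi))
    have hnx := hn x hx
    have hny := hn y hy
    refine ⟨Function.update a e x, Function.update b e y, ?_, ?_, ?_, ?_⟩
    · intro i hi j hj
      simp only [Function.update_apply]
      split_ifs <;> grind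
    · intro i hi j hj
      simp only [Function.update_apply]
      split_ifs <;> grind
    · intro i hi j hj
      simp only [Function.update_apply]
      split_ifs <;> grind
    · intro i hi
      simp only [Function.update_apply]
      split_ifs
      · exact hxy
      · exact h4 i (by omega)

lemma exists_pair_index (S : Setoid D) {M : ℕ}
    (hM : ∀ Q : Finset D, (∀ x ∈ Q, ∀ y ∈ Q, S x y) → Q.card ≤ M) (k e : ℕ)
    (hk : k + e = Fintype.card D) (he : 2 * e + M ≤ Fintype.card D) (hk0 : 0 < k) : ∃ π : D → ℕ,
    (∀ d, π d < k) ∧ (∀ i < k, ∃ d, π d = i) ∧ ∀ x y, π x = π y → x ≠ y → ¬ S x y := by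
  have : Nonempty D := Fintype.card_pos_iff.1 (by omega)
  obtain ⟨a, b, h1, h2, h3, h4⟩ := exists_disjoint_pairs S hM e he
  set W := (Finset.range e).image a ∪ (Finset.range e).image b with hW
  have hWc : W.card = e + e := by
    rw [hW, Finset.card_union_of_disjoint, Finset.card_image_of_injOn, Finset.card_image_of_injOn,
      Finset.card_range]
    · exact fun i hi j hj h => h2 i (by simpa using hi) j (by simpa using hj) h
    · exact fun i hi j hj h => h1 i (by simpa using hi) j (by simpa using hj) h
    · rw [Finset.disjoint_left]
      intro z hz hz'
      obtain ⟨i, hi, rfl⟩ := Finset.mem_image.1 hz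
      obtain ⟨j, hj, hij⟩ := Finset.mem_image.1 hz'
      exact h3 i (Finset.mem_range.1 hi) j (Finset.mem_range.1 hj) hij.symm
  have hcW : Wᶜ.card = k - e := by rw [Finset.card_compl]; omega
  have hpr : ∀ d, ∃ i, d ∉ Wᶜ → i < e ∧ (d = a i ∨ d = b i) := by
    intro d
    by_cases hd : d ∈ Wᶜ
    · exact ⟨0, fun h => absurd hd h⟩
    · rw [Finset.mem_compl, not_not, hW, Finset.mem_union] at hd
      rcases hd with hd | hd <;> obtain ⟨i, hi, rfl⟩ := Finset.mem_image.1 hd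
      · exact ⟨i, fun _ => ⟨Finset.mem_range.1 hi, Or.inl rfl⟩⟩
      · exact ⟨i, fun _ => ⟨Finset.mem_range.1 hi, Or.inr rfl⟩⟩
  choose q hq using hpr
  have hpos : ∀ d (h : d ∈ Wᶜ), e + (Wᶜ.equivFin ⟨d, h⟩ : ℕ) < k := fun d h => by
    have := (Wᶜ.equivFin ⟨d, h⟩).2
    omega
  have hek : e ≤ k := by
    have := Finset.card_le_univ W
    omega
  refine ⟨fun d => if h : d ∈ Wᶜ then e + Wᶜ.equivFin ⟨d, h⟩ else q d, fun d => ?_, fun i hi => ?_,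
    fun x y hxy hne => ?_⟩
  · by_cases h : d ∈ Wᶜ
    · simp only [dif_pos h]; exact hpos d h
    · simp only [dif_neg h]; have := (hq d h).1; omega
  · by_cases hie : i < e
    · have h : a i ∉ Wᶜ := fun h => Finset.mem_compl.1 h
        (Finset.mem_union_left _ (Finset.mem_image_of_mem _ (Finset.mem_range.2 hie)))
      refine ⟨a i, ?_⟩
      simp only [dif_neg h]
      obtain ⟨h5, h6 | h6⟩ := hq _ h
      · exact (h1 _ hie _ h5 h6).symm
      · exact absurd h6 (h3 _ hie _ h5)
    · refine ⟨Wᶜ.equivFin.symm ⟨i - e, by omega⟩, ?_⟩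
      simp only [Subtype.prop, dite_true, Subtype.coe_eta, Equiv.apply_symm_apply]
      omega
  · by_cases hx : x ∈ Wᶜ <;> by_cases hy : y ∈ Wᶜ
    · simp only [dif_pos hx, dif_pos hy] at hxy
      have := Wᶜ.equivFin.injective (Fin.ext (Nat.add_left_cancel hxy))
      exact absurd (congrArg Subtype.val this) hne
    · simp only [dif_pos hx, dif_neg hy] at hxy
      have := (hq y hy).1
      omega
    · simp only [dif_neg hx, dif_pos hy] at hxy
      have := (hq x hx).1
      omega
    · simp only [dif_neg hx, dif_neg hy] at hxy
      obtain ⟨h5, h6⟩ := hq x hx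
      obtain ⟨-, h7⟩ := hq y hy
      rw [← hxy] at h7
      rcases h6 with h6 | h6 <;> rcases h7 with h7 | h7
      · exact absurd (h6.trans h7.symm) hne
      · rw [h6, h7]; exact h4 _ h5
      · rw [h6, h7]; exact fun h => h4 _ h5 (S.symm h)
      · exact absurd (h6.trans h7.symm) hne

end Layout

section ArrangementHamiltonian

variable {V : Type*} [DecidableEq V] [Fintype V] {K : Finset V} {S : Setoid {v // v ∉ K}}
  {ω : K × {v // v ∉ K} → Bool} {p : ℕ → List {v // v ∉ K}} {h l : ℕ → {v // v ∉ K}}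
  {c : ℕ → K} {r : ℕ}

lemma isChain_of_nodup {α : Type*} {R : α → α → Prop} {L : List α} (hL : L.Nodup)
    (hR : ∀ x ∈ L, ∀ y ∈ L, x ≠ y → R x y) : L.IsChain R :=
  (hL.pairwise_of_forall_ne hR).isChain

lemma isHamiltonian_arrGraph_of_fits (hr : 0 < r) (hrK : r + 1 < K.card)
    (hh : ∀ i < r, (p i).head? = some (h i)) (hl : ∀ i < r, (p i).getLast? = some (l i))
    (hnd : ∀ i, (p i).Nodup) (hp : ∀ i, ∀ x ∈ p i, ∀ y ∈ p i, S x y)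
    (hcov : ∀ d, ∃ i < r, d ∈ p i)
    (hlen : ∑ i ∈ Finset.range r, (p i).length = Fintype.card {v // v ∉ K})
    (hc : Set.InjOn c (Set.Iio (r + 1))) (hf : ∀ i < r + 1, FitsGap ω h l r true i (c i)) :
    (arrGraph K S ω).IsHamiltonian := by
  set C : Finset V := (Finset.range (r + 1)).image fun i => (c i : V) with hC
  have hCK : C ⊆ K := by
    intro v hv
    obtain ⟨i, -, rfl⟩ := Finset.mem_image.1 hv
    exact (c i).2
  have hCc : C.card = r + 1 := by
    rw [hC, Finset.card_image_of_injOn, Finset.card_range]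
    exact fun i hi j hj hij => hc (by simpa using hi) (by simpa using hj) (Subtype.ext hij)
  have hRc : (K \ C).card = K.card - (r + 1) := by rw [Finset.card_sdiff_of_subset hCK, hCc]
  have hne : (K \ C).toList ≠ [] := by
    intro h0
    have := congrArg List.length h0
    rw [Finset.length_toList, hRc, List.length_nil] at this
    omega
  set L := (K \ C).toList with hL
  have hLm : ∀ v, v ∈ L ↔ v ∈ K ∧ v ∉ C := fun v => by rw [hL, Finset.mem_toList, Finset.mem_sdiff]
  have hcC : ∀ i < r + 1, (c i : V) ∈ C := fun i hi =>
    Finset.mem_image_of_mem _ (Finset.mem_range.2 hi)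
  have hcard : K.card + Fintype.card {v // v ∉ K} = Fintype.card V := by
    have := Finset.card_le_univ K
    rw [card_compl_subtype]
    omega
  refine isHamiltonian_of_pieces (g := r + 1) (Nat.succ_pos r)
    (fun i => if i < r then (p i).map Subtype.val else L)
    (fun i => if i < r then h i else L.head hne) (fun i => if i < r then l i else L.getLast hne)
    (fun i => c i) (fun i hi => ?_) (fun i hi => ?_) (fun i hi => ?_) (fun i hi => ?_)
    (fun i hi => ?_) ?_ (fun v => ?_) ?_ (by omega)
  · by_cases hir : i < r
    · simp only [hir, if_true, List.head?_map, hh i hir, Option.map_some]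
    · simp [hir, List.head?_eq_some_head hne]
  · by_cases hir : i < r
    · simp only [hir, if_true, List.getLast?_map, hl i hir, Option.map_some]
    · simp [hir, List.getLast?_eq_some_getLast hne]
  · by_cases hir : i < r
    · simp only [hir, if_true]
      refine isChain_of_nodup ((hnd i).map Subtype.val_injective) fun x hx y hy hxy => ?_
      obtain ⟨x, hx', rfl⟩ := List.mem_map.1 hx
      obtain ⟨y, hy', rfl⟩ := List.mem_map.1 hy
      exact (arrGraph_adj_notMem x.2 y.2).2 ⟨hxy, hp i x hx' y hy'⟩
    · simp only [hir, if_false]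
      refine isChain_of_nodup (Finset.nodup_toList _) fun x hx y hy hxy => ?_
      exact (arrGraph_adj_mem ((hLm x).1 hx).1 ((hLm y).1 hy).1).2 hxy
  · have h1 := (hf i hi).1
    by_cases hir : i < r
    · rw [min_eq_left (by omega)] at h1
      simp only [hir, if_true]
      exact ((arrGraph_adj_cross (c i).2 (l i).2).2 h1).symm
    · simp only [hir, if_false]
      have := (hLm _).1 (List.getLast_mem hne)
      exact (arrGraph_adj_mem this.1 (c i).2).2 fun e => this.2 (e ▸ hcC i hi)
  · have h1 := (hf i (by omega)).2
    by_cases hir : i + 1 < r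
    · rw [if_pos hir] at h1
      simp only [hir, if_true]
      exact (arrGraph_adj_cross (c i).2 (h (i + 1)).2).2 h1
    · simp only [hir, if_false]
      have := (hLm _).1 (List.head_mem hne)
      exact (arrGraph_adj_mem (c i).2 this.1).2 fun e => this.2 (e ▸ hcC i (by omega))
  · have h1 := (hf r (by omega)).2
    rw [if_neg (by omega)] at h1
    simp only [hr, if_true, Nat.add_sub_cancel]
    exact (arrGraph_adj_cross (c r).2 (h 0).2).2 h1
  · by_cases hv : v ∈ K
    · by_cases hvC : v ∈ C
      · obtain ⟨i, hi, rfl⟩ := Finset.mem_image.1 hvC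
        exact ⟨i, Finset.mem_range.1 hi, Or.inr rfl⟩
      · exact ⟨r, by omega, Or.inl (by simp [hLm, hv, hvC])⟩
    · obtain ⟨i, hi, hd⟩ := hcov ⟨v, hv⟩
      refine ⟨i, by omega, Or.inl ?_⟩
      simp only [hi, if_true]
      exact List.mem_map.2 ⟨_, hd, rfl⟩
  · rw [Finset.sum_range_succ, Finset.sum_add_distrib, Finset.sum_congr rfl fun i hi =>
      show _ = (p i).length by rw [if_pos (Finset.mem_range.1 hi), List.length_map], hlen]
    simp only [lt_irrefl, if_false, Finset.sum_const, Finset.card_range, smul_eq_mul, mul_one, hL,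
      Finset.length_toList, hRc]
    omega

lemma isHamiltonian_compl_arrGraph_of_fits (hV : 3 ≤ Fintype.card V) (hr : 0 < K.card)
    (hh : ∀ i < K.card, (p i).head? = some (h i)) (hl : ∀ i < K.card, (p i).getLast? = some (l i))
    (hnd : ∀ i, (p i).Nodup) (hp : ∀ i, ∀ x ∈ p i, ∀ y ∈ p i, x ≠ y → ¬ S x y)
    (hcov : ∀ d, ∃ i < K.card, d ∈ p i)
    (hlen : ∑ i ∈ Finset.range K.card, (p i).length = Fintype.card {v // v ∉ K})
    (hc : Set.InjOn c (Set.Iio K.card))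
    (hf : ∀ i < K.card, FitsGap ω h l K.card false i (c i)) :
    (arrGraph K S ω)ᶜ.IsHamiltonian := by
  have hcard : K.card + Fintype.card {v // v ∉ K} = Fintype.card V := by
    have := Finset.card_le_univ K
    rw [card_compl_subtype]
    omega
  have hadj : ∀ (u : K) (d : {v // v ∉ K}), ω (u, d) = false →
      (arrGraph K S ω)ᶜ.Adj u d := by
    intro u d hud
    refine (SimpleGraph.compl_adj _ _ _).2 ⟨fun e => d.2 (e ▸ u.2), fun h1 => ?_⟩
    have := (arrGraph_adj_cross u.2 d.2).1 h1
    exact absurd (this.symm.trans hud) (by simp)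
  refine isHamiltonian_of_pieces hr (fun i => (p i).map Subtype.val) (fun i => h i) (fun i => l i)
    (fun i => c i) (fun i hi => ?_) (fun i hi => ?_) (fun i hi => ?_) (fun i hi => ?_)
    (fun i hi => ?_) ?_ (fun v => ?_) ?_ hV
  · simp only [List.head?_map, hh i hi, Option.map_some]
  · simp only [List.getLast?_map, hl i hi, Option.map_some]
  · refine isChain_of_nodup ((hnd i).map Subtype.val_injective) fun x hx y hy hxy => ?_
    obtain ⟨x, hx', rfl⟩ := List.mem_map.1 hx
    obtain ⟨y, hy', rfl⟩ := List.mem_map.1 hy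
    refine (SimpleGraph.compl_adj _ _ _).2 ⟨hxy, fun h1 => ?_⟩
    exact hp i x hx' y hy' (fun e => hxy (e ▸ rfl)) ((arrGraph_adj_notMem x.2 y.2).1 h1).2
  · have h1 := (hf i hi).1
    rw [min_eq_left (by omega)] at h1
    exact (hadj _ _ h1).symm
  · have h1 := (hf i (by omega)).2
    rw [if_pos hi] at h1
    exact hadj _ _ h1
  · have h1 := (hf (K.card - 1) (by omega)).2
    rw [if_neg (by omega)] at h1
    exact hadj _ _ h1
  · by_cases hv : v ∈ K
    · have hs : (Finset.range K.card).image (fun i => (c i : V)) = K := by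
        refine Finset.eq_of_subset_of_card_le (fun v hv => ?_) ?_
        · obtain ⟨i, -, rfl⟩ := Finset.mem_image.1 hv
          exact (c i).2
        · rw [Finset.card_image_of_injOn, Finset.card_range]
          exact fun i hi j hj hij => hc (by simpa using hi) (by simpa using hj) (Subtype.ext hij)
      obtain ⟨i, hi, h1⟩ := Finset.mem_image.1 (hs.symm ▸ hv : v ∈ _)
      exact ⟨i, Finset.mem_range.1 hi, Or.inr h1.symm⟩
    · obtain ⟨i, hi, hd⟩ := hcov ⟨v, hv⟩
      exact ⟨i, hi, Or.inl (List.mem_map.2 ⟨_, hd, rfl⟩)⟩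
  · simp only [List.length_map, Finset.sum_add_distrib, hlen, Finset.sum_const, Finset.card_range,
      smul_eq_mul, mul_one]
    omega

end ArrangementHamiltonian

section Typical

variable {V : Type*} [DecidableEq V] [Fintype V] {K : Finset V} {S : Setoid {v // v ∉ K}}
  {ω : K × {v // v ∉ K} → Bool} {a s M : ℕ}

lemma isHamiltonian_arrGraph_of_spread (hω : Spread ω a s) (has : 2 * s + 3 ≤ a)
    (hr : 2 ≤ (Finset.univ.image (rep S)).card)
    (hrK : (Finset.univ.image (rep S)).card + 1 + a ≤ K.card) :
    (arrGraph K S ω).IsHamiltonian := by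
  obtain ⟨π, h1, h2, h3⟩ := exists_class_index S
  set r := (Finset.univ.image (rep S)).card
  have : Nonempty {v // v ∉ K} := by
    obtain ⟨d, -⟩ := h2 0 (by omega)
    exact ⟨d⟩
  obtain ⟨p, h, l, hp, hnd, hhl⟩ := exists_layout π
  have hh : ∀ i < r, π (h i) = i := fun i hi =>
    (hp _ _).1 (List.mem_of_mem_head? (hhl i (h2 i hi)).1)
  have hl : ∀ i < r, π (l i) = i := fun i hi =>
    (hp _ _).1 (List.mem_of_mem_getLast? (hhl i (h2 i hi)).2)
  obtain ⟨c, hc, hf⟩ := hω.exists_fits (b := true) (g := r + 1) has hh hl hr (by omega) le_rfl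
    (Or.inl (by rw [Fintype.card_coe]; omega))
  exact isHamiltonian_arrGraph_of_fits (by omega) (by omega) (fun i hi => (hhl i (h2 i hi)).1)
    (fun i hi => (hhl i (h2 i hi)).2) hnd
    (fun i x hx y hy => (h3 x y).1 (((hp i x).1 hx).trans ((hp i y).1 hy).symm))
    (fun d => ⟨π d, h1 d, (hp _ _).2 rfl⟩) (sum_length_layout hp hnd h1) hc hf

lemma exists_exceptional_compl
    (hM : ∀ Q : Finset {v // v ∉ K}, (∀ x ∈ Q, ∀ y ∈ Q, S x y) → Q.card ≤ M)
    (has : 2 * s + 3 ≤ a) (hK : 2 ≤ K.card) (e : ℕ)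
    (hk : K.card + e = Fintype.card {v // v ∉ K})
    (he : 2 * e + M ≤ Fintype.card {v // v ∉ K}) :
    ∃ F : Finset (K × {v // v ∉ K} → Bool),
      (F.card : ℝ) ≤ K.card * (16 ^ a * (13 / 16) ^ (K.card / 2)) *
        2 ^ (K.card * Fintype.card {v // v ∉ K}) ∧
      ∀ ω ∉ F, Spread ω a s → (arrGraph K S ω)ᶜ.IsHamiltonian := by
  obtain ⟨π, h1, h2, h3⟩ := exists_pair_index S hM K.card e hk he (by omega)
  have : Nonempty {v // v ∉ K} := by
    obtain ⟨d, -⟩ := h2 0 (by omega)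
    exact ⟨d⟩
  have hV : K.card + Fintype.card {v // v ∉ K} = Fintype.card V := by
    have := Finset.card_le_univ K
    rw [card_compl_subtype]
    omega
  obtain ⟨p, h, l, hp, hnd, hhl⟩ := exists_layout π
  have hh : ∀ i < K.card, π (h i) = i := fun i hi =>
    (hp _ _).1 (List.mem_of_mem_head? (hhl i (h2 i hi)).1)
  have hl : ∀ i < K.card, π (l i) = i := fun i hi =>
    (hp _ _).1 (List.mem_of_mem_getLast? (hhl i (h2 i hi)).2)
  have hcard := card_not_full_le (A := K) hh hl false a
  rw [Fintype.card_coe] at hcard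
  refine ⟨_, hcard, fun ω hω hsp => ?_⟩
  simp only [Finset.mem_filter, Finset.mem_univ, true_and, not_not] at hω
  obtain ⟨c, hc, hf⟩ := hsp.exists_fits (b := false) (g := K.card) has hh hl hK le_rfl (by omega)
    (Or.inr ⟨by rw [Fintype.card_coe], hω⟩)
  exact isHamiltonian_compl_arrGraph_of_fits (by omega) (by omega)
    (fun i hi => (hhl i (h2 i hi)).1) (fun i hi => (hhl i (h2 i hi)).2) hnd
    (fun i x hx y hy => h3 x y (((hp i x).1 hx).trans ((hp i y).1 hy).symm))
    (fun d => ⟨π d, h1 d, (hp _ _).2 rfl⟩) (sum_length_layout hp hnd h1) hc hf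

/-- The clique `K` of `G` has size close to half of the vertices, vertices outside `K` span small
cliques and not too large independent sets and miss many vertices of `K`, the graph is
Hamiltonian, and so is its complement when `K` has at most half of the vertices. -/
def Typical (G : SimpleGraph V) (K : Finset V) : Prop :=
  (499 * Fintype.card V ≤ 1000 * K.card ∧ 1000 * K.card ≤ 501 * Fintype.card V) ∧
  (∀ Q : Finset V, Disjoint Q K → G.IsClique Q → 1000 * Q.card ≤ Fintype.card V) ∧
  (∀ Q : Finset V, Disjoint Q K → Gᶜ.IsClique Q → 5 * Q.card + 4 * K.card ≤ 4 * Fintype.card V) ∧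
  (∀ d ∉ K, Fintype.card V / 100 ≤ (K.filter fun c => ¬ G.Adj c d).card) ∧
  G.IsHamiltonian ∧ (2 * K.card ≤ Fintype.card V → Gᶜ.IsHamiltonian)

lemma typical_arrGraph (hω : Spread ω (Fintype.card V / 100) (Fintype.card V / 1000))
    (hn : 1000 ≤ Fintype.card V)
    (h1 : 499 * Fintype.card V ≤ 1000 * K.card ∧ 1000 * K.card ≤ 501 * Fintype.card V)
    (h2 : ∀ Q : Finset {v // v ∉ K}, (∀ x ∈ Q, ∀ y ∈ Q, S x y) → 1000 * Q.card ≤ Fintype.card V)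
    (h3 : 5 * (Finset.univ.image (rep S)).card + 4 * K.card ≤ 4 * Fintype.card V)
    (h4 : 2 * K.card ≤ Fintype.card V → (arrGraph K S ω)ᶜ.IsHamiltonian) :
    Typical (arrGraph K S ω) K := by
  have hV : K.card + Fintype.card {v // v ∉ K} = Fintype.card V := by
    have := Finset.card_le_univ K
    rw [card_compl_subtype]
    omega
  have hsub : ∀ Q : Finset V, Disjoint Q K → (Q.subtype (· ∉ K)).card = Q.card := by
    intro Q hQ
    rw [Finset.card_subtype, Finset.filter_true_of_mem]
    exact fun x hx => Finset.disjoint_left.1 hQ hx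
  refine ⟨h1, fun Q hQ hcl => ?_, fun Q hQ hcl => ?_, fun d hd => ?_,
    isHamiltonian_arrGraph_of_spread hω (by omega) ?_ (by omega), h4⟩
  · rw [← hsub Q hQ]
    refine h2 _ fun x hx y hy => ?_
    by_cases hxy : x = y
    · exact hxy ▸ S.refl x
    · exact ((arrGraph_adj_notMem x.2 y.2).1 (hcl (Finset.mem_subtype.1 hx)
        (Finset.mem_subtype.1 hy) fun e => hxy (Subtype.ext e))).2
  · have : Q.card ≤ (Finset.univ.image (rep S)).card := by
      rw [← hsub Q hQ]
      refine Finset.card_le_card_of_injOn (rep S)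
        (fun x _ => Finset.mem_image_of_mem _ (Finset.mem_univ _)) fun x hx y hy hxy => ?_
      by_contra hne
      have hne' : (x : V) ≠ y := fun e => hne (Subtype.ext e)
      exact ((SimpleGraph.compl_adj _ _ _).1 (hcl (Finset.mem_subtype.1 hx)
        (Finset.mem_subtype.1 hy) hne')).2
        ((arrGraph_adj_notMem x.2 y.2).2 ⟨hne', rep_eq_iff.1 hxy⟩)
    omega
  · have hcd : 2 ≤ Fintype.card {v // v ∉ K} := by omega
    obtain ⟨y, hy⟩ := Fintype.exists_ne_of_one_lt_card hcd ⟨d, hd⟩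
    refine (hω.1 false ⟨d, hd⟩ y hy.symm).trans ?_
    refine Finset.card_le_card_of_injOn Subtype.val (fun c hc => ?_) Subtype.val_injective.injOn
    have := (Finset.mem_filter.1 hc).2.1
    refine Finset.mem_filter.2 ⟨c.2, fun hadj => ?_⟩
    exact absurd (((arrGraph_adj_cross c.2 hd).1 hadj).symm.trans this) (by simp)
  · by_contra! hlt
    have := h2 Finset.univ fun x _ y _ => rep_eq_iff.1
      (Finset.card_le_one.1 (by omega) _ (Finset.mem_image_of_mem (rep S) (Finset.mem_univ x)) _
        (Finset.mem_image_of_mem (rep S) (Finset.mem_univ y)))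
    rw [Finset.card_univ] at this
    omega

lemma card_not_typical_le (hn : 1000 ≤ Fintype.card V)
    (h1 : 499 * Fintype.card V ≤ 1000 * K.card ∧ 1000 * K.card ≤ 501 * Fintype.card V)
    (h2 : ∀ Q : Finset {v // v ∉ K}, (∀ x ∈ Q, ∀ y ∈ Q, S x y) → 1000 * Q.card ≤ Fintype.card V)
    (h3 : 5 * (Finset.univ.image (rep S)).card + 4 * K.card ≤ 4 * Fintype.card V) :
    ((Finset.univ.filter fun ω => ¬ Typical (arrGraph K S ω) K).card : ℝ) ≤
      (2 * (Fintype.card V - K.card : ℕ) ^ 2 *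
          (16 ^ (Fintype.card V / 100) * (13 / 16) ^ K.card) +
        2 * (Fintype.card V - K.card : ℕ) ^ (2 * (Fintype.card V / 1000)) * 2 ^ K.card *
          (3 / 4) ^ (Fintype.card V / 1000 * (Fintype.card V / 1000)) +
        K.card * (16 ^ (Fintype.card V / 100) * (13 / 16) ^ (K.card / 2))) *
        2 ^ (K.card * (Fintype.card V - K.card)) := by
  have hV : K.card + Fintype.card {v // v ∉ K} = Fintype.card V := by
    have := Finset.card_le_univ K
    rw [card_compl_subtype]
    omega
  have hF : ∃ F : Finset (K × {v // v ∉ K} → Bool),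
      (F.card : ℝ) ≤ K.card * (16 ^ (Fintype.card V / 100) * (13 / 16) ^ (K.card / 2)) *
        2 ^ (K.card * Fintype.card {v // v ∉ K}) ∧
      ∀ ω ∉ F, Spread ω (Fintype.card V / 100) (Fintype.card V / 1000) →
        2 * K.card ≤ Fintype.card V → (arrGraph K S ω)ᶜ.IsHamiltonian := by
    by_cases hK : 2 * K.card ≤ Fintype.card V
    · obtain ⟨F, hF1, hF2⟩ := exists_exceptional_compl (S := S) (a := Fintype.card V / 100)
        (s := Fintype.card V / 1000) (M := Fintype.card V / 1000)
        (fun Q hQ => by have := h2 Q hQ; omega) (by omega) (by omega)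
        (Fintype.card {v // v ∉ K} - K.card) (by omega) (by omega)
      exact ⟨F, hF1, fun ω hω hs _ => hF2 ω hω hs⟩
    · exact ⟨∅, by simp only [Finset.card_empty, Nat.cast_zero]; positivity,
        fun _ _ _ h => absurd h hK⟩
  obtain ⟨F, hF1, hF2⟩ := hF
  have hS := card_not_spread_le (A := K) (D := {v // v ∉ K}) (Fintype.card V / 100)
    (Fintype.card V / 1000)
  rw [Fintype.card_coe] at hS
  rw [card_compl_subtype] at hS hF1
  rw [add_mul]
  refine le_trans ?_ (add_le_add hS hF1)
  rw [← Nat.cast_add, Nat.cast_le]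
  refine (Finset.card_le_card fun ω hω => ?_).trans (Finset.card_union_le _ _)
  have h := (Finset.mem_filter.1 hω).2
  by_contra hnot
  rw [Finset.mem_union, not_or, Finset.mem_filter, not_and, not_not] at hnot
  exact h (typical_arrGraph (hnot.1 (Finset.mem_univ _)) hn h1 h2 h3
    (hF2 ω hnot.2 (hnot.1 (Finset.mem_univ _))))

end Typical

section TypicalUnique

variable {V : Type*} [DecidableEq V] [Fintype V] {G : SimpleGraph V} {K K' : Finset V}

lemma Typical.subset (hn : 1000 ≤ Fintype.card V) (h : Typical G K) (hK' : G.IsClique (K' : Set V))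
    (h' : Typical G K') : K' ⊆ K := by
  intro d hd
  by_contra hdK
  have h1 := h.2.1 (K' \ K) Finset.sdiff_disjoint
    (hK'.subset (by exact_mod_cast Finset.sdiff_subset))
  have h2 := h.2.2.2.1 d hdK
  have h3 : (K.filter fun c => ¬ G.Adj c d).card + (K' ∩ K).card ≤ K.card := by
    rw [← Finset.card_union_of_disjoint]
    · exact Finset.card_le_card (Finset.union_subset (Finset.filter_subset _ _)
        Finset.inter_subset_right)
    · rw [Finset.disjoint_left]
      intro c hc hc'
      have hc1 := (Finset.mem_filter.1 hc)
      have hc2 := Finset.mem_inter.1 hc'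
      exact hc1.2 (hK' hc2.1 hd fun e => hdK (e ▸ hc1.1))
  have h4 := Finset.card_sdiff_add_card_inter K' K
  have h5 := h.1
  have h6 := h'.1
  omega

lemma Typical.eq (hn : 1000 ≤ Fintype.card V) (hK : G.IsClique (K : Set V)) (h : Typical G K)
    (hK' : G.IsClique (K' : Set V)) (h' : Typical G K') : K = K' :=
  (h'.subset hn hK h).antisymm (h.subset hn hK' h')

lemma Typical.not_compl (hn : 1000 ≤ Fintype.card V) (hK : G.IsClique (K : Set V))
    (h : Typical G K) (hK' : Gᶜ.IsClique (K' : Set V)) : ¬ Typical Gᶜ K' := by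
  intro h'
  have h1 := h.2.2.1 (K' \ K) Finset.sdiff_disjoint
    (hK'.subset (by exact_mod_cast Finset.sdiff_subset))
  have h2 : (K' ∩ K).card ≤ 1 := by
    refine Finset.card_le_one.2 fun x hx y hy => ?_
    by_contra hxy
    rw [Finset.mem_inter] at hx hy
    exact ((SimpleGraph.compl_adj _ _ _).1 (hK' hx.1 hy.1 hxy)).2 (hK hx.2 hy.2 hxy)
  have h4 := Finset.card_sdiff_add_card_inter K' K
  have h5 := h.1
  have h6 := h'.1
  omega

end TypicalUnique

section FewAtypical

lemma eventually_pow_le_bell {b : ℝ} (hb : b < 1) : ∀ᶠ m : ℕ in atTop, ∀ t : ℕ, (t : ℝ) ≤ b * m →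
    (2 : ℝ) ^ m * ((m : ℝ) + 1) ^ t ≤ Real.exp (-m) * bell m := by
  filter_upwards [exp_le_bell (a := (1 + b) / 2) (by linarith), eventually_ge_atTop 1,
    eventually_le_log (6 / (1 - b))] with m h1 h2 h3 t ht
  have hb' : 0 < 1 - b := by linarith
  have hm : (1 : ℝ) ≤ m := by exact_mod_cast h2
  have hl2 : Real.log 2 ≤ 1 := by linarith [Real.log_two_lt_d9]
  have hl : Real.log (m + 1) ≤ Real.log m + 1 := by
    refine (Real.log_le_log (by linarith) (show (m : ℝ) + 1 ≤ m * 2 by linarith)).trans ?_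
    rw [Real.log_mul (by linarith) (by norm_num)]
    linarith
  refine le_trans ?_ (mul_le_mul_of_nonneg_left h1 (Real.exp_nonneg _))
  rw [← Real.exp_add, ← Real.exp_log (show (0 : ℝ) < 2 ^ m * ((m : ℝ) + 1) ^ t by positivity),
    Real.log_mul (by positivity) (by positivity), Real.log_pow, Real.log_pow, Real.exp_le_exp]
  rw [div_le_iff₀ hb'] at h3
  have h0 : 0 ≤ Real.log (m + 1) := Real.log_nonneg (by linarith)
  have ht' : t * Real.log (m + 1) ≤ b * m * (Real.log m + 1) := by
    refine (mul_le_mul_of_nonneg_right ht h0).trans (mul_le_mul_of_nonneg_left hl ?_)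
    exact (Nat.cast_nonneg t).trans ht
  nlinarith

variable {α : Type*} [Fintype α]

lemma card_image_rep (S : Setoid α) :
    (Finset.univ.image (rep S)).card + rk S = Fintype.card α := by
  have : Finset.univ.image (rep S) = Finset.univ.filter fun v => ¬ rep S v ≠ v := by
    ext v
    simp only [Finset.mem_image, Finset.mem_univ, true_and, Finset.mem_filter, not_not]
    refine ⟨?_, fun h => ⟨v, h⟩⟩
    rintro ⟨w, rfl⟩
    exact rep_eq_iff.2 (rel_rep S w)
  rw [this, rk, add_comm, Finset.card_filter_add_card_filter_not, Finset.card_univ]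

lemma eventually_card_large_class_le : ∀ᶠ m : ℕ in atTop, ∀ {α : Type} [Fintype α],
    Fintype.card α = m → ∃ B : Finset (Setoid α), (∀ S : Setoid α, ∀ Q : Finset α,
      (∀ x ∈ Q, ∀ y ∈ Q, S x y) → m ≤ 600 * Q.card → S ∈ B) ∧
      (B.card : ℝ) ≤ Real.exp (-m) * bell m := by
  filter_upwards [eventually_pow_le_bell (b := 9999 / 10000) (by norm_num),
    eventually_ge_atTop 10000] with m hm h1 α _ hα
  have h2 : ((m - m / 600 + 1 : ℕ) : ℝ) ≤ 9999 / 10000 * m := by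
    have : 10000 * (m - m / 600 + 1) ≤ 9999 * m := by omega
    have : ((10000 * (m - m / 600 + 1) : ℕ) : ℝ) ≤ (9999 * m : ℕ) := by exact_mod_cast this
    push_cast at this ⊢
    linarith
  refine ⟨Finset.univ.filter fun S : Setoid α =>
    ∃ Q : Finset α, (∀ x ∈ Q, ∀ y ∈ Q, S x y) ∧ m ≤ 600 * Q.card,
    fun S Q h3 h4 => Finset.mem_filter.2 ⟨Finset.mem_univ _, Q, h3, h4⟩, le_trans ?_ (hm _ h2)⟩
  set E := (Finset.univ : Finset (Finset α)).filter fun Q => m ≤ 600 * Q.card with hE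
  have hEc : E.card ≤ 2 ^ m := by
    rw [← hα, ← Fintype.card_finset]
    exact Finset.card_le_univ _
  have h4 : ∀ Q ∈ E, (Finset.univ.filter fun S : Setoid α => ∀ x ∈ Q, ∀ y ∈ Q, S x y).card ≤
      (m + 1) ^ (m - m / 600 + 1) := by
    intro Q hQ
    have h5 := card_setoid_le_of_rel Q
    rw [hα] at h5
    have := (Finset.mem_filter.1 hQ).2
    have h6 : (m + 1) ^ (m - Q.card + 1) ≤ (m + 1) ^ (m - m / 600 + 1) :=
      Nat.pow_le_pow_right (Nat.succ_pos m) (by omega)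
    refine le_trans (Finset.card_le_card fun S hS => ?_) (h5.trans h6)
    rw [Finset.mem_filter] at hS ⊢
    exact hS
  generalize m - m / 600 + 1 = t at h4
  have h3 : (Finset.univ.filter fun S : Setoid α =>
      ∃ Q : Finset α, (∀ x ∈ Q, ∀ y ∈ Q, S x y) ∧ m ≤ 600 * Q.card).card ≤
      2 ^ m * (m + 1) ^ t := by
    refine le_trans (Finset.card_le_card fun S hS => ?_)
      ((Finset.card_biUnion_le_card_mul E _ _ h4).trans (Nat.mul_le_mul_right _ hEc))
    obtain ⟨Q, h5, h6⟩ := (Finset.mem_filter.1 hS).2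
    simp only [Finset.mem_biUnion, Finset.mem_filter, Finset.mem_univ, true_and, hE]
    exact ⟨Q, h6, h5⟩
  exact_mod_cast h3

lemma eventually_card_many_classes_le : ∀ᶠ m : ℕ in atTop, ∀ {α : Type} [Fintype α],
    Fintype.card α = m → ∃ B : Finset (Setoid α), (∀ S : Setoid α, 5 * rk S < m → S ∈ B) ∧
      (B.card : ℝ) ≤ Real.exp (-m) * bell m := by
  filter_upwards [eventually_pow_le_bell (b := 1 / 5) (by norm_num)] with m hm α _ hα
  have h := card_rk_le (α := α) (m / 5)
  rw [hα] at h
  refine ⟨_, fun S hS => Finset.mem_filter.2 ⟨Finset.mem_univ _, by omega⟩, h.trans (hm (m / 5) ?_)⟩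
  have : ((5 * (m / 5) : ℕ) : ℝ) ≤ m := by exact_mod_cast (by omega)
  push_cast at this
  linarith

end FewAtypical

section NegligibleAtypical

lemma pow_le_exp_neg {x δ : ℝ} (hx : 0 ≤ x) (h : x ≤ 1 - δ) (t : ℕ) :
    x ^ t ≤ Real.exp (-(δ * t)) := by
  have h1 : x ≤ Real.exp (-δ) := h.trans (by linarith [Real.add_one_le_exp (-δ)])
  refine (pow_le_pow_left₀ hx h1 t).trans_eq ?_
  rw [← Real.exp_nat_mul]
  congr 1
  ring

lemma eventually_atypical_factor_le : ∀ᶠ n : ℕ in atTop, ∀ k : ℕ, 499 * n ≤ 1000 * k → k ≤ n →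
    (2 * (n - k : ℕ) ^ 2 * (16 ^ (n / 100) * (13 / 16) ^ k) +
      2 * (n - k : ℕ) ^ (2 * (n / 1000)) * 2 ^ k * (3 / 4) ^ (n / 1000 * (n / 1000)) +
      k * (16 ^ (n / 100) * (13 / 16) ^ (k / 2)) : ℝ) ≤ 3 * Real.exp (-(n / 100)) := by
  filter_upwards [eventually_add_one_pow_le_exp 1 (show (0 : ℝ) < 1 / 100000 by norm_num),
    eventually_add_one_pow_le_exp 2 (show (0 : ℝ) < 1 / 1000 by norm_num),
    eventually_ge_atTop 100000000] with n h1 h2 h3 k hk hkn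
  have hn : (100000000 : ℝ) ≤ n := by exact_mod_cast h3
  rw [pow_one] at h1
  have hkn' : (k : ℝ) ≤ n := by exact_mod_cast hkn
  have hm : ((n - k : ℕ) : ℝ) ≤ n + 1 := by
    have : n - k ≤ n + 1 := by omega
    exact_mod_cast this
  have hm0 : (0 : ℝ) ≤ ((n - k : ℕ) : ℝ) := Nat.cast_nonneg _
  have h16 : (16 : ℝ) ^ (n / 100) ≤ Real.exp (28 / 1000 * n) := by
    have h4 : (16 : ℝ) ≤ Real.exp (28 / 10) := by
      rw [← Real.log_le_iff_le_exp (by norm_num), show (16 : ℝ) = 2 ^ 4 by norm_num, Real.log_pow]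
      push_cast
      linarith [Real.log_two_lt_d9]
    refine (pow_le_pow_left₀ (by norm_num) h4 _).trans ?_
    rw [← Real.exp_nat_mul, Real.exp_le_exp]
    have : ((n / 100 : ℕ) : ℝ) ≤ n / 100 := Nat.cast_div_le
    linarith
  have hk2 : (499 / 2000 * n - 1 : ℝ) ≤ (k / 2 : ℕ) := by
    have h5 : 499 * n ≤ 2000 * (k / 2) + 2000 := by omega
    have : ((499 * n : ℕ) : ℝ) ≤ (2000 * (k / 2) + 2000 : ℕ) := by exact_mod_cast h5
    push_cast at this
    linarith
  have h13 : (13 / 16 : ℝ) ^ (k / 2) ≤ Real.exp (-(46 / 1000 * n)) := by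
    refine (pow_le_exp_neg (δ := 3 / 16) (by norm_num) (by norm_num) _).trans ?_
    rw [Real.exp_le_exp]
    linarith
  have h13' : (13 / 16 : ℝ) ^ k ≤ Real.exp (-(46 / 1000 * n)) :=
    (pow_le_pow_of_le_one (by norm_num) (by norm_num) (Nat.div_le_self k 2)).trans h13
  have hprod : (16 : ℝ) ^ (n / 100) * (13 / 16) ^ (k / 2) ≤ Real.exp (-(18 / 1000 * n)) := by
    refine (mul_le_mul h16 h13 (by positivity) (Real.exp_nonneg _)).trans_eq ?_
    rw [← Real.exp_add]
    congr 1
    ring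
  have hprod' : (16 : ℝ) ^ (n / 100) * (13 / 16) ^ k ≤ Real.exp (-(18 / 1000 * n)) := by
    refine (mul_le_mul h16 h13' (by positivity) (Real.exp_nonneg _)).trans_eq ?_
    rw [← Real.exp_add]
    congr 1
    ring
  have he2 : (2 : ℝ) ≤ Real.exp 1 := by linarith [Real.add_one_le_exp 1]
  have hA : (2 * (n - k : ℕ) ^ 2 * (16 ^ (n / 100) * (13 / 16) ^ k) : ℝ) ≤
      Real.exp (-(n / 100)) := by
    calc _ ≤ Real.exp 1 * Real.exp (1 / 1000 * n) * Real.exp (-(18 / 1000 * n)) :=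
          mul_le_mul (mul_le_mul he2 ((pow_le_pow_left₀ hm0 hm 2).trans h2) (by positivity)
            (Real.exp_nonneg _)) hprod' (by positivity) (by positivity)
      _ ≤ _ := by
          rw [← Real.exp_add, ← Real.exp_add, Real.exp_le_exp]
          linarith
  have hC : (k * (16 ^ (n / 100) * (13 / 16) ^ (k / 2)) : ℝ) ≤ Real.exp (-(n / 100)) := by
    calc _ ≤ Real.exp (1 / 100000 * n) * Real.exp (-(18 / 1000 * n)) :=
          mul_le_mul ((by linarith : (k : ℝ) ≤ n + 1).trans h1) hprod (by positivity)
            (Real.exp_nonneg _)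
      _ ≤ _ := by
          rw [← Real.exp_add, Real.exp_le_exp]
          linarith
  have hs : (n / 2000 : ℝ) ≤ (n / 1000 : ℕ) := by
    have : n ≤ 2000 * (n / 1000) := by omega
    have : (n : ℝ) ≤ (2000 * (n / 1000) : ℕ) := by exact_mod_cast this
    push_cast at this
    linarith
  have hs' : ((n / 1000 : ℕ) : ℝ) ≤ n / 1000 := Nat.cast_div_le
  have hB : (2 * (n - k : ℕ) ^ (2 * (n / 1000)) * 2 ^ k * (3 / 4) ^ (n / 1000 * (n / 1000)) : ℝ) ≤
      Real.exp (-(n / 100)) := by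
    have hp : ((n - k : ℕ) : ℝ) ^ (2 * (n / 1000)) ≤ Real.exp (1 / 100000 * n * (2 * (n / 1000))) := by
      refine (pow_le_pow_left₀ hm0 (hm.trans h1) _).trans ?_
      rw [← Real.exp_nat_mul, Real.exp_le_exp, mul_comm]
      push_cast
      exact mul_le_mul_of_nonneg_left (by linarith) (by positivity)
    have h2k : (2 : ℝ) ^ k ≤ Real.exp n := by
      refine (pow_le_pow_left₀ (by norm_num) he2 _).trans ?_
      rw [← Real.exp_nat_mul, Real.exp_le_exp]
      linarith
    have h34 : (3 / 4 : ℝ) ^ (n / 1000 * (n / 1000)) ≤ Real.exp (-(1 / 4 * (n / 2000) ^ 2)) := by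
      refine (pow_le_exp_neg (δ := 1 / 4) (by norm_num) (by norm_num) _).trans ?_
      rw [Real.exp_le_exp]
      push_cast
      have := mul_self_le_mul_self (by positivity) hs
      nlinarith
    calc _ ≤ Real.exp 1 * Real.exp (1 / 100000 * n * (2 * (n / 1000))) * Real.exp n *
          Real.exp (-(1 / 4 * (n / 2000) ^ 2)) :=
          mul_le_mul (mul_le_mul (mul_le_mul he2 hp (by positivity) (Real.exp_nonneg _)) h2k
            (by positivity) (by positivity)) h34 (by positivity) (by positivity)
      _ ≤ _ := by
          rw [← Real.exp_add, ← Real.exp_add, ← Real.exp_add, Real.exp_le_exp]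
          nlinarith
  linarith

lemma card_atypical_le : ∀ᶠ n : ℕ in atTop, ∀ K : Finset (Fin n),
    499 * n ≤ 1000 * K.card ∧ 1000 * K.card ≤ 501 * n →
    ((Finset.univ.filter fun G : SimpleGraph (Fin n) =>
      IsUnipolarArrangement G K ∧ ¬ Typical G K).card : ℝ) ≤
      5 * Real.exp (-(n / 100)) * (2 ^ (K.card * (n - K.card)) * bell (n - K.card) : ℕ) := by
  have hlift : ∀ {P : ℕ → Prop}, (∀ᶠ m in atTop, P m) → ∀ᶠ n : ℕ in atTop, ∀ m, n ≤ 4 * m → P m := by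
    intro P hP
    obtain ⟨N, hN⟩ := eventually_atTop.1 hP
    filter_upwards [eventually_ge_atTop (4 * N)] with n hn m hm
    exact hN m (by omega)
  filter_upwards [hlift eventually_card_large_class_le, hlift eventually_card_many_classes_le,
    eventually_atypical_factor_le, eventually_ge_atTop 1000] with n hB1 hB2 herr hn K hK
  have hKn : K.card ≤ n := by simpa using Finset.card_le_univ K
  have hm : Fintype.card {v // v ∉ K} = n - K.card := by rw [card_compl_subtype, Fintype.card_fin]
  have herr := herr K.card hK.1 hKn
  obtain ⟨B1, hB1m, hB1⟩ := hB1 (n - K.card) (by omega) hm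
  obtain ⟨B2, hB2m, hB2⟩ := hB2 (n - K.card) (by omega) hm
  have hexp : Real.exp (-((n - K.card : ℕ) : ℝ)) ≤ Real.exp (-(n / 100)) := by
    rw [Real.exp_le_exp, Nat.cast_sub hKn]
    have : ((1000 * K.card : ℕ) : ℝ) ≤ (501 * n : ℕ) := by exact_mod_cast hK.2
    push_cast at this
    linarith
  set X : ℝ := 2 ^ (K.card * (n - K.card)) with hX
  have hX0 : 0 ≤ X := by positivity
  have hb0 : (0 : ℝ) ≤ bell (n - K.card) := Nat.cast_nonneg _
  have hsum : ∀ S : Setoid {v // v ∉ K},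
      ((Finset.univ.filter fun ω => ¬ Typical (arrGraph K S ω) K).card : ℝ) ≤
        (if S ∈ B1 then X else 0) + (if S ∈ B2 then X else 0) +
          3 * Real.exp (-(n / 100)) * X := by
    intro S
    have h0 : 0 ≤ 3 * Real.exp (-(n / 100)) * X := by positivity
    have htot : ((Finset.univ.filter fun ω => ¬ Typical (arrGraph K S ω) K).card : ℝ) ≤ X := by
      rw [hX, ← hm]
      refine le_trans (Nat.cast_le.2 (Finset.card_le_univ _)) ?_
      simp [Fintype.card_coe]
    by_cases h1 : S ∈ B1
    · rw [if_pos h1]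
      have : 0 ≤ (if S ∈ B2 then X else 0) := by split_ifs <;> linarith
      linarith
    · by_cases h2 : S ∈ B2
      · rw [if_pos h2, if_neg h1]
        linarith
      · rw [if_neg h1, if_neg h2, add_zero, zero_add]
        have h4 : ∀ Q : Finset {v // v ∉ K}, (∀ x ∈ Q, ∀ y ∈ Q, S x y) →
            1000 * Q.card ≤ Fintype.card (Fin n) := fun Q hQ => by
          by_contra hlt
          rw [Fintype.card_fin] at hlt
          exact h1 (hB1m S Q hQ (by omega))
        have h5 : 5 * (Finset.univ.image (rep S)).card + 4 * K.card ≤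
            4 * Fintype.card (Fin n) := by
          by_contra hlt
          have : (Finset.univ.image (rep S)).card + rk S = Fintype.card {v // v ∉ K} := by
            convert card_image_rep S
          rw [Fintype.card_fin] at hlt
          exact h2 (hB2m S (by omega))
        have h3 := card_not_typical_le (K := K) (S := S) (by simpa using hn) (by simpa using hK)
          h4 h5
        rw [Fintype.card_fin] at h3
        exact h3.trans (mul_le_mul_of_nonneg_right herr hX0)
  have hcard : Fintype.card (Setoid {v // v ∉ K}) = bell (n - K.card) := by rw [card_setoid, hm]
  have hc : (Finset.univ.filter fun G : SimpleGraph (Fin n) =>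
      IsUnipolarArrangement G K ∧ ¬ Typical G K).card = ∑ S : Setoid {v // v ∉ K},
        (Finset.univ.filter fun ω => ¬ Typical (arrGraph K S ω) K).card := by
    convert card_arrangement K fun G => ¬ Typical G K
  rw [hc, Nat.cast_sum]
  refine (Finset.sum_le_sum fun S _ => hsum S).trans ?_
  rw [Finset.sum_add_distrib, Finset.sum_add_distrib, ← Finset.sum_filter, ← Finset.sum_filter,
    Finset.filter_mem_eq_inter, Finset.filter_mem_eq_inter, Finset.univ_inter, Finset.univ_inter,
    Finset.sum_const, Finset.sum_const, Finset.sum_const, Finset.card_univ, hcard]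
  simp only [nsmul_eq_mul]
  have e1 := mul_le_mul_of_nonneg_right (hB1.trans (mul_le_mul_of_nonneg_right hexp hb0)) hX0
  have e2 := mul_le_mul_of_nonneg_right (hB2.trans (mul_le_mul_of_nonneg_right hexp hb0)) hX0
  push_cast
  rw [← hX]
  linarith

end NegligibleAtypical

section NegligibleUnbalanced

lemma bell_le_pow (m : ℕ) : bell m ≤ (m + 1) ^ (m + 1) := by
  have h := card_setoid_le_of_rel (∅ : Finset (Fin m))
  simp only [Finset.notMem_empty, false_imp_iff, implies_true, Finset.filter_true,
    Finset.card_univ, card_setoid, Fintype.card_fin, Finset.card_empty, Nat.sub_zero] at h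
  exact h

lemma eventually_unbalanced_le : ∀ᶠ n : ℕ in atTop, ∀ k ≤ n,
    ¬ (499 * n ≤ 1000 * k ∧ 1000 * k ≤ 501 * n) →
    ((2 ^ (k * (n - k)) * bell (n - k) : ℕ) : ℝ) ≤ Real.exp (-(2 * n)) * scrL n := by
  filter_upwards [exp_le_scrL (ε := 1 / 2) (by norm_num) 0,
    eventually_add_one_pow_le_exp 1 (show (0 : ℝ) < 1 / 10000000 by norm_num),
    eventually_ge_atTop 100000000] with n h1 h2 h3 k hk hbal
  have hn : (100000000 : ℝ) ≤ n := by exact_mod_cast h3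
  rw [pow_one] at h2
  have hb : (bell (n - k) : ℝ) ≤ Real.exp (1 / 10000000 * n * (n + 1)) := by
    calc (bell (n - k) : ℝ) ≤ ((n - k : ℕ) + 1) ^ (n - k + 1) := by
          exact_mod_cast bell_le_pow (n - k)
      _ ≤ ((n : ℝ) + 1) ^ (n - k + 1) := by
          refine pow_le_pow_left₀ (by positivity) ?_ _
          have : ((n - k : ℕ) : ℝ) ≤ n := by exact_mod_cast Nat.sub_le n k
          linarith
      _ ≤ ((n : ℝ) + 1) ^ (n + 1) := pow_le_pow_right₀ (by linarith) (by omega)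
      _ ≤ Real.exp (1 / 10000000 * n) ^ (n + 1) := pow_le_pow_left₀ (by positivity) h2 _
      _ = _ := by
          rw [← Real.exp_nat_mul]
          congr 1
          push_cast
          ring
  have hk2 : (k * (n - k : ℕ) : ℝ) ≤ n ^ 2 / 4 - n ^ 2 / 1000000 := by
    rw [Nat.cast_sub hk]
    have hsq : ((n : ℝ) / 500) ^ 2 ≤ (2 * k - n) ^ 2 := by
      rw [not_and_or, not_le, not_le] at hbal
      rcases hbal with h | h
      · have : ((1000 * k : ℕ) : ℝ) ≤ (499 * n : ℕ) := by exact_mod_cast h.le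
        push_cast at this
        nlinarith
      · have : ((501 * n : ℕ) : ℝ) ≤ (1000 * k : ℕ) := by exact_mod_cast h.le
        push_cast at this
        nlinarith
    nlinarith
  have h2k : (2 : ℝ) ^ (k * (n - k)) ≤ Real.exp ((n ^ 2 / 4 - n ^ 2 / 1000000) * Real.log 2) := by
    rw [← Real.exp_log (show (0 : ℝ) < 2 ^ (k * (n - k)) by positivity), Real.log_pow,
      Real.exp_le_exp]
    push_cast
    exact mul_le_mul_of_nonneg_right hk2 (Real.log_nonneg (by norm_num))
  refine le_trans ?_ (mul_le_mul_of_nonneg_left h1 (Real.exp_nonneg _))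
  push_cast
  refine (mul_le_mul h2k hb (Nat.cast_nonneg _) (Real.exp_nonneg _)).trans ?_
  rw [← Real.exp_add, ← Real.exp_add, Real.exp_le_exp]
  nlinarith [Real.log_two_gt_d9]

lemma negl_atypical : Negl fun n => ((∑ K : Finset (Fin n),
    (Finset.univ.filter fun G : SimpleGraph (Fin n) =>
      IsUnipolarArrangement G K ∧ ¬ Typical G K).card : ℕ) : ℝ) := by
  have h5 : Negl fun n => 5 * (Real.exp (-(1 / 100 * n)) * scrL n) :=
    (negl_exp_mul (by norm_num)).const_mul 5 (Eventually.of_forall fun n => by positivity)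
  refine (h5.add (negl_exp_mul one_pos)).mono ?_
  filter_upwards [card_atypical_le, eventually_unbalanced_le] with n h1 h2
  have hL : (0 : ℝ) ≤ scrL n := Nat.cast_nonneg _
  have hK : ∀ K : Finset (Fin n), ((Finset.univ.filter fun G : SimpleGraph (Fin n) =>
      IsUnipolarArrangement G K ∧ ¬ Typical G K).card : ℝ) ≤ 5 * Real.exp (-(n / 100)) *
        (2 ^ (K.card * (n - K.card)) * bell (n - K.card) : ℕ) + Real.exp (-(2 * n)) * scrL n := by
    intro K
    by_cases hb : 499 * n ≤ 1000 * K.card ∧ 1000 * K.card ≤ 501 * n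
    · exact (h1 K hb).trans (le_add_of_nonneg_right (by positivity))
    · refine le_trans ?_ ((h2 K.card (by simpa using Finset.card_le_univ K) hb).trans
        (le_add_of_nonneg_left (by positivity)))
      have h3 := card_isUnipolarArrangement K
      rw [Fintype.card_fin] at h3
      rw [← h3, Nat.cast_le]
      exact Finset.card_le_card fun G hG => by
        rw [Finset.mem_filter] at hG ⊢
        exact ⟨hG.1, hG.2.1⟩
  push_cast
  refine (Finset.sum_le_sum fun K _ => hK K).trans ?_
  rw [Finset.sum_add_distrib, ← Finset.mul_sum, ← Nat.cast_sum, sum_card_eq_scrL, Finset.sum_const,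
    Finset.card_univ, Fintype.card_finset, Fintype.card_fin, nsmul_eq_mul]
  push_cast
  have h2n : (2 : ℝ) ^ n * Real.exp (-(2 * n)) ≤ Real.exp (-(1 * n)) := by
    have he2 : (2 : ℝ) ≤ Real.exp 1 := by linarith [Real.add_one_le_exp 1]
    calc (2 : ℝ) ^ n * Real.exp (-(2 * n)) ≤ Real.exp 1 ^ n * Real.exp (-(2 * n)) :=
          mul_le_mul_of_nonneg_right (pow_le_pow_left₀ (by norm_num) he2 n) (Real.exp_nonneg _)
      _ = _ := by
          rw [← Real.exp_nat_mul, ← Real.exp_add]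
          congr 1
          ring
  have := mul_le_mul_of_nonneg_right h2n hL
  rw [show -((1 : ℝ) / 100 * n) = -(n / 100) by ring]
  linarith

end NegligibleUnbalanced

section Counting

lemma ncard_pairs {V : Type*} [Fintype V] (p : Finset V → Prop)
    (r : Finset V → SimpleGraph V → Prop) :
    {x : Finset V × SimpleGraph V | p x.1 ∧ r x.1 x.2}.ncard =
      ∑ K ∈ Finset.univ.filter p, (Finset.univ.filter fun G => r K G).card := by
  rw [← Finset.card_sigma, ← Set.ncard_coe_finset]
  refine Set.ncard_congr (fun x _ => ⟨x.1, x.2⟩) ?_ ?_ ?_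
  · rintro ⟨K, G⟩ ⟨h1, h2⟩
    simp only [Finset.coe_sigma, Set.mem_sigma_iff, Finset.coe_filter, Finset.mem_univ, true_and]
    exact ⟨h1, h2⟩
  · rintro ⟨K, G⟩ ⟨K', G'⟩ _ _ h
    simpa using h
  · rintro ⟨K, G⟩ h
    simp only [Finset.coe_sigma, Set.mem_sigma_iff, Finset.coe_filter, Finset.mem_univ, true_and] at h
    exact ⟨(K, G), h, rfl⟩

/-- The number of arrangements on `n` vertices whose clique has more than `n / 2` vertices. -/
def bigL (n : ℕ) : ℕ := ∑ k ∈ (Finset.range (n + 1)).filter (fun k => n < 2 * k), ell n k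

lemma bigL_le_scrL (n : ℕ) : bigL n ≤ scrL n :=
  Finset.sum_le_sum_of_subset (Finset.filter_subset _ _)

lemma ncard_arrangements (n : ℕ) : {x : Finset (Fin n) × SimpleGraph (Fin n) |
    IsUnipolarArrangement x.2 x.1}.ncard = scrL n := by
  rw [← sum_card_isUnipolarArrangement]
  have := ncard_pairs (V := Fin n) (fun _ => True) fun K G => IsUnipolarArrangement G K
  simp only [true_and] at this
  rw [this]
  congr!
  simp

lemma ncard_big_arrangements (n : ℕ) : {x : Finset (Fin n) × SimpleGraph (Fin n) |
    n < 2 * x.1.card ∧ IsUnipolarArrangement x.2 x.1}.ncard = bigL n := by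
  have h := Finset.sum_powerset_apply_card
    (fun k => if n < 2 * k then 2 ^ (k * (n - k)) * bell (n - k) else 0)
    (x := (Finset.univ : Finset (Fin n)))
  rw [ncard_pairs (fun K => n < 2 * K.card) fun K G => IsUnipolarArrangement G K, bigL,
    Finset.sum_filter, Finset.sum_filter]
  rw [Finset.powerset_univ] at h
  refine Eq.trans (Finset.sum_congr rfl fun K _ => ?_) (h.trans ?_)
  · have h3 := card_isUnipolarArrangement K
    rw [Fintype.card_fin] at h3
    rw [← h3]
    congr!
  rw [Finset.card_univ, Fintype.card_fin]
  refine Finset.sum_congr rfl fun k _ => ?_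
  rw [ell]
  split_ifs
  · rw [smul_eq_mul, mul_assoc]
  · rw [smul_zero]

/-- The number of atypical arrangements on `n` vertices. -/
def badL (n : ℕ) : ℕ :=
  {x : Finset (Fin n) × SimpleGraph (Fin n) |
    IsUnipolarArrangement x.2 x.1 ∧ ¬ Typical x.2 x.1}.ncard

lemma negl_badL : Negl fun n => (badL n : ℝ) := by
  refine negl_atypical.mono (Eventually.of_forall fun n => Nat.cast_le.2 (le_of_eq ?_))
  have := ncard_pairs (V := Fin n) (fun _ => True)
    fun K G => IsUnipolarArrangement G K ∧ ¬ Typical G K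
  simp only [true_and] at this
  rw [badL, this]
  congr!
  simp

lemma ncard_le_typical (n : ℕ) (p : Finset (Fin n) → Prop) :
    {x : Finset (Fin n) × SimpleGraph (Fin n) | p x.1 ∧ IsUnipolarArrangement x.2 x.1}.ncard ≤
    {x : Finset (Fin n) × SimpleGraph (Fin n) | p x.1 ∧ IsUnipolarArrangement x.2 x.1 ∧
      Typical x.2 x.1}.ncard + badL n := by
  refine (Set.ncard_le_ncard ?_ (Set.toFinite _)).trans (Set.ncard_union_le _ _)
  rintro ⟨K, G⟩ ⟨h1, h2⟩
  by_cases h : Typical G K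
  · exact Or.inl ⟨h1, h2, h⟩
  · exact Or.inr ⟨h2, h⟩

/-- The number of Hamiltonian perfect graphs on `n` vertices. -/
def hamCount (n : ℕ) : ℕ := {G : SimpleGraph (Fin n) | IsPerfect G ∧ G.IsHamiltonian}.ncard

lemma injOn_snd_typical {n : ℕ} (hn : 1000 ≤ n) : Set.InjOn Prod.snd
    {x : Finset (Fin n) × SimpleGraph (Fin n) |
      IsUnipolarArrangement x.2 x.1 ∧ Typical x.2 x.1} := by
  rintro ⟨K, G⟩ ⟨h1, h2⟩ ⟨K', G'⟩ ⟨h1', h2'⟩ h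
  dsimp only at h1 h2 h1' h2' h
  subst h
  rw [Typical.eq (by simpa using hn) h1.1 h2 h1'.1 h2']

lemma two_mul_scrL_le {n : ℕ} (hn : 1000 ≤ n) :
    2 * scrL n ≤ hamCount n + bigL n + 2 * badL n := by
  set T := {x : Finset (Fin n) × SimpleGraph (Fin n) |
    IsUnipolarArrangement x.2 x.1 ∧ Typical x.2 x.1}
  set U := {x : Finset (Fin n) × SimpleGraph (Fin n) | ¬ n < 2 * x.1.card ∧
    IsUnipolarArrangement x.2 x.1 ∧ Typical x.2 x.1}
  have hT : scrL n ≤ T.ncard + badL n := by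
    have := ncard_le_typical n fun _ => True
    simp only [true_and] at this
    rwa [ncard_arrangements] at this
  have hU : scrL n ≤ bigL n + (U.ncard + badL n) := by
    refine le_trans ?_ (Nat.add_le_add_left (ncard_le_typical n fun K => ¬ n < 2 * K.card) _)
    rw [← ncard_big_arrangements, ← ncard_arrangements]
    refine (Set.ncard_le_ncard ?_ (Set.toFinite _)).trans (Set.ncard_union_le _ _)
    intro x hx
    by_cases h : n < 2 * x.1.card
    · exact Or.inl ⟨h, hx⟩
    · exact Or.inr ⟨h, hx⟩
  have hinj : Set.InjOn Prod.snd T := injOn_snd_typical hn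
  have hinj' : Set.InjOn (fun x : Finset (Fin n) × SimpleGraph (Fin n) => x.2ᶜ) U :=
    fun x hx y hy h => hinj hx.2 hy.2 (compl_injective h)
  have hdisj : Disjoint (Prod.snd '' T) ((fun x => x.2ᶜ) '' U) := by
    rw [Set.disjoint_left]
    rintro _ ⟨⟨K, G⟩, ⟨h1, h2⟩, rfl⟩ ⟨⟨K', H⟩, ⟨_, h1', h2'⟩, h⟩
    dsimp only at h1 h2 h1' h2' h
    subst h
    refine Typical.not_compl (by simpa using hn) h1'.1 h2' h1.1 h2
  have hsub : Prod.snd '' T ∪ (fun x => x.2ᶜ) '' U ⊆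
      {G : SimpleGraph (Fin n) | IsPerfect G ∧ G.IsHamiltonian} := by
    rintro _ (⟨x, ⟨h1, h2⟩, rfl⟩ | ⟨x, ⟨h0, h1, h2⟩, rfl⟩)
    · exact ⟨h1.isPerfect, h2.2.2.2.2.1⟩
    · exact ⟨h1.isPerfect_compl, h2.2.2.2.2.2 (by rw [Fintype.card_fin]; omega)⟩
  have h := Set.ncard_le_ncard hsub (Set.toFinite _)
  rw [Set.ncard_union_eq hdisj (Set.toFinite _) (Set.toFinite _), hinj.ncard_image,
    hinj'.ncard_image] at h
  change _ ≤ hamCount n at h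
  omega

lemma perfectCount_eq_ncard (n : ℕ) :
    perfectCount n = {G : SimpleGraph (Fin n) | IsPerfect G}.ncard := rfl

lemma hamCount_add_bigL_le {n : ℕ} (hn : 1000 ≤ n) :
    hamCount n + bigL n ≤ perfectCount n + badL n := by
  set T := {x : Finset (Fin n) × SimpleGraph (Fin n) | n < 2 * x.1.card ∧
    IsUnipolarArrangement x.2 x.1 ∧ Typical x.2 x.1}
  have hT : bigL n ≤ T.ncard + badL n :=
    (ncard_big_arrangements n).ge.trans (ncard_le_typical n fun K => n < 2 * K.card)
  have hinj : Set.InjOn (fun x : Finset (Fin n) × SimpleGraph (Fin n) => x.2ᶜ) T :=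
    fun x hx y hy h => injOn_snd_typical hn hx.2 hy.2 (compl_injective h)
  have hdisj : Disjoint {G : SimpleGraph (Fin n) | IsPerfect G ∧ G.IsHamiltonian}
      ((fun x => x.2ᶜ) '' T) := by
    rw [Set.disjoint_left]
    rintro _ ⟨_, hG⟩ ⟨⟨K, H⟩, ⟨h0, h1, h2⟩, rfl⟩
    dsimp only at h0 h1 h2 hG
    have := two_mul_card_le_of_isHamiltonian hG (by simpa using by omega) (I := K)
      fun u hu v hv h => h.2 (h1.1 hu hv h.1)
    rw [Fintype.card_fin] at this
    omega
  have hsub : {G : SimpleGraph (Fin n) | IsPerfect G ∧ G.IsHamiltonian} ∪ (fun x => x.2ᶜ) '' T ⊆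
      {G : SimpleGraph (Fin n) | IsPerfect G} := by
    rintro _ (h | ⟨x, ⟨h0, h1, h2⟩, rfl⟩)
    · exact h.1
    · exact h1.isPerfect_compl
  have h := Set.ncard_le_ncard hsub (Set.toFinite _)
  rw [Set.ncard_union_eq hdisj (Set.toFinite _) (Set.toFinite _),
    hinj.ncard_image, ← perfectCount_eq_ncard] at h
  change hamCount n + _ ≤ _ at h
  omega

/-- The number of perfect graphs on `n` vertices which are not generalised split graphs. -/
def oddCount (n : ℕ) : ℕ := {G : SimpleGraph (Fin n) | IsPerfect G ∧ ¬ IsGenSplit G}.ncard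

lemma negl_oddCount : Negl fun n => (oddCount n : ℝ) := by
  refine negl_not_isGenSplit.mono (Eventually.of_forall fun n => Nat.cast_le.2 (le_of_eq ?_))
  rw [oddCount, ← Set.ncard_coe_finset]
  congr 1
  ext G
  simp

lemma perfectCount_le (n : ℕ) : perfectCount n ≤ 2 * scrL n + oddCount n := by
  have h : {G : SimpleGraph (Fin n) | IsGenSplit G}.ncard ≤ 2 * scrL n := by
    refine le_trans (le_of_eq ?_) (card_isGenSplit_le n)
    rw [← Set.ncard_coe_finset]
    congr 1
    ext G
    simp
  rw [perfectCount_eq_ncard]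
  refine le_trans ?_ (Nat.add_le_add_right h _)
  refine (Set.ncard_le_ncard ?_ (Set.toFinite _)).trans (Set.ncard_union_le _ _)
  intro G hG
  by_cases h : IsGenSplit G
  · exact Or.inl h
  · exact Or.inr ⟨hG, h⟩

lemma hamProb_eq (n : ℕ) : hamProb n = (hamCount n : ℝ) / perfectCount n := rfl

lemma exists_hamProb_estimate : ∃ c : ℝ, 0 < c ∧ ∀ᶠ n : ℕ in atTop,
    |hamProb n - (1 - 1 / 2 * ((bigL n : ℝ) / scrL n))| ≤ Real.exp (-(c * n)) := by
  obtain ⟨c, hc, h⟩ := (negl_badL.const_mul 2 (Eventually.of_forall fun n => by positivity)).add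
    negl_oddCount
  refine ⟨c, hc, ?_⟩
  filter_upwards [h, eventually_ge_atTop 1000, eventually_le_cast (1 / c)] with n h1 hn h2
  have hL : (0 : ℝ) < scrL n := Nat.cast_pos.2 (scrL_pos n)
  have hb : (bigL n : ℝ) ≤ scrL n := Nat.cast_le.2 (bigL_le_scrL n)
  have e1 : (2 : ℝ) * scrL n ≤ hamCount n + bigL n + 2 * badL n := by
    exact_mod_cast two_mul_scrL_le hn
  have e2 : (hamCount n : ℝ) + bigL n ≤ perfectCount n + badL n := by
    exact_mod_cast hamCount_add_bigL_le hn
  have e3 : (perfectCount n : ℝ) ≤ 2 * scrL n + oddCount n := by exact_mod_cast perfectCount_le n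
  have hbad : (0 : ℝ) ≤ badL n := Nat.cast_nonneg _
  have hodd : (0 : ℝ) ≤ oddCount n := Nat.cast_nonneg _
  have hexp : Real.exp (-(c * n)) ≤ 1 / 2 := by
    rw [div_le_iff₀ hc] at h2
    have he2 : (2 : ℝ) ≤ Real.exp (c * n) := by linarith [Real.add_one_le_exp (c * n)]
    rw [Real.exp_neg, one_div]
    exact inv_anti₀ two_pos he2
  have hbad4 : 4 * (badL n : ℝ) ≤ scrL n := by
    have := mul_le_mul_of_nonneg_right hexp hL.le
    linarith
  have hN : (scrL n : ℝ) ≤ perfectCount n := by linarith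
  have hN0 : (0 : ℝ) < perfectCount n := hL.trans_le hN
  set t : ℝ := bigL n / scrL n with ht
  have htL : (bigL n : ℝ) = t * scrL n := by rw [ht]; field_simp
  have ht0 : 0 ≤ t := by positivity
  have ht1 : t ≤ 1 := (div_le_one hL).2 hb
  have hexp0 := Real.exp_pos (-(c * n))
  rw [hamProb_eq, show (hamCount n : ℝ) / perfectCount n - (1 - 1 / 2 * t) =
    (hamCount n - (1 - 1 / 2 * t) * perfectCount n) / perfectCount n by field_simp, abs_div,
    abs_of_pos hN0, div_le_iff₀ hN0]
  refine le_trans ?_ (h1.trans (mul_le_mul_of_nonneg_left hN hexp0.le))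
  rw [htL] at e1 e2
  rw [abs_le]
  constructor
  · nlinarith [mul_nonneg ht0 hodd, mul_nonneg (sub_nonneg.2 ht1) (sub_nonneg.2 e3)]
  · nlinarith [mul_nonneg ht0 (sub_nonneg.2 e3), mul_nonneg (sub_nonneg.2 ht1) hodd]

end Counting

section LargeCliques

lemma eventually_mul_bell_le (r : ℕ) : ∀ᶠ m : ℕ in atTop, r * bell m ≤ bell (m + 1) := by
  filter_upwards [exp_le_bell (a := 1 / 2) (by norm_num), eventually_ge_atTop 1,
    eventually_le_log (4 * Real.log (r + 1))] with m h1 h2 h3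
  have h4 : (r + 1) * r ^ m ≤ bell m := by
    refine (Nat.mul_le_mul_left _ (Nat.pow_le_pow_left r.le_succ m)).trans ?_
    rw [← pow_succ']
    refine (Nat.pow_le_pow_right r.succ_pos (show m + 1 ≤ 2 * m by omega)).trans ?_
    have h5 : (((r + 1) ^ (2 * m) : ℕ) : ℝ) ≤ bell m := by
      refine le_trans ?_ h1
      push_cast
      rw [← Real.exp_log (show (0 : ℝ) < (r + 1) ^ (2 * m) by positivity), Real.log_pow,
        Real.exp_le_exp]
      push_cast
      nlinarith [mul_le_mul_of_nonneg_left h3 (Nat.cast_nonneg (α := ℝ) m)]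
    exact_mod_cast h5
  have := mul_bell_le r m
  linarith

lemma mul_ell_succ_le {r j m : ℕ} (hjm : m ≤ j) (h : r ≤ j - m ∨ r * bell m ≤ bell (m + 1)) :
    r * ell (j + 1 + m) (j + 1) ≤ ell (j + 1 + m) j := by
  have hc : (j + 1 + m).choose (j + 1) ≤ (j + 1 + m).choose j := by
    have h1 := Nat.choose_succ_right_eq (j + 1 + m) j
    rw [show j + 1 + m - j = m + 1 by omega] at h1
    have h2 := Nat.mul_le_mul_left ((j + 1 + m).choose (j + 1)) (Nat.succ_le_succ hjm)
    exact Nat.le_of_mul_le_mul_right (h2.trans h1.le) m.succ_pos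
  have hb : r * bell m ≤ 2 ^ (j - m) * bell (m + 1) := by
    rcases h with h | h
    · exact Nat.mul_le_mul (h.trans Nat.lt_two_pow_self.le) (bell_le_succ m)
    · exact h.trans (Nat.le_mul_of_pos_left _ (by positivity))
  rw [ell, ell, show j + 1 + m - j = m + 1 by omega, Nat.add_sub_cancel_left,
    show j * (m + 1) = (j + 1) * m + (j - m) by zify [hjm]; ring, pow_add]
  calc r * ((j + 1 + m).choose (j + 1) * 2 ^ ((j + 1) * m) * bell m)
      = (j + 1 + m).choose (j + 1) * 2 ^ ((j + 1) * m) * (r * bell m) := by ring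
    _ ≤ (j + 1 + m).choose j * 2 ^ ((j + 1) * m) * (2 ^ (j - m) * bell (m + 1)) :=
        Nat.mul_le_mul (Nat.mul_le_mul_right _ hc) hb
    _ = _ := by ring

lemma eventually_mul_bigL_le (r : ℕ) : ∀ᶠ n : ℕ in atTop, r * bigL n ≤ scrL n := by
  obtain ⟨M, hM⟩ := eventually_atTop.1 (eventually_mul_bell_le r)
  filter_upwards [eventually_ge_atTop (2 * M + r + 2)] with n hn
  rw [bigL, Finset.mul_sum]
  calc ∑ k ∈ (Finset.range (n + 1)).filter (fun k => n < 2 * k), r * ell n k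
      ≤ ∑ k ∈ (Finset.range (n + 1)).filter (fun k => n < 2 * k), ell n (k - 1) := by
        refine Finset.sum_le_sum fun k hk => ?_
        simp only [Finset.mem_filter, Finset.mem_range] at hk
        obtain ⟨j, rfl⟩ : ∃ j, k = j + 1 := ⟨k - 1, by omega⟩
        obtain ⟨m, rfl⟩ : ∃ m, n = j + 1 + m := ⟨n - (j + 1), by omega⟩
        refine mul_ell_succ_le (by omega) ?_
        by_cases h : M ≤ m
        · exact Or.inr (hM m h)
        · exact Or.inl (by omega)
    _ = ∑ k ∈ ((Finset.range (n + 1)).filter (fun k => n < 2 * k)).image (· - 1), ell n k := by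
        rw [Finset.sum_image]
        intro a ha b hb h
        simp only [Finset.coe_filter, Finset.mem_range, Set.mem_ofPred_eq] at ha hb h
        omega
    _ ≤ scrL n := by
        refine Finset.sum_le_sum_of_subset fun k hk => ?_
        simp only [Finset.mem_image, Finset.mem_filter, Finset.mem_range] at hk ⊢
        omega

lemma tendsto_bigL_div : Tendsto (fun n => (bigL n : ℝ) / scrL n) atTop (nhds 0) := by
  refine tendsto_order.2 ⟨fun a ha => Eventually.of_forall fun n => ha.trans_le (by positivity),
    fun a ha => ?_⟩
  obtain ⟨r, hr⟩ := exists_nat_gt (1 / a)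
  filter_upwards [eventually_mul_bigL_le r] with n hn
  have hL : (0 : ℝ) < scrL n := Nat.cast_pos.2 (scrL_pos n)
  have hr0 : (0 : ℝ) < r := (one_div_pos.2 ha).trans hr
  rw [div_lt_iff₀ ha] at hr
  rw [div_lt_iff₀ hL]
  have hn : (r : ℝ) * bigL n ≤ scrL n := by exact_mod_cast hn
  refine lt_of_mul_lt_mul_left (hn.trans_lt ?_) hr0.le
  nlinarith

lemma sum_ell_div_eq (n : ℕ) : ∑ k ∈ (Finset.range (n + 1)).filter
    (fun k : ℕ => (n : ℝ) / 2 < (k : ℝ)), (ell n k : ℝ) / (scrL n : ℝ) = bigL n / scrL n := by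
  rw [← Finset.sum_div, bigL, Nat.cast_sum]
  congr 1
  refine Finset.sum_congr (Finset.ext fun k => ?_) fun _ _ => rfl
  simp only [Finset.mem_filter, and_congr_right_iff]
  intro _
  rw [div_lt_iff₀ two_pos, ← Nat.cast_lt (α := ℝ), mul_comm 2 k, Nat.cast_mul, Nat.cast_two]

lemma tendsto_hamProb : Tendsto hamProb atTop (nhds 1) := by
  obtain ⟨c, hc, h⟩ := exists_hamProb_estimate
  have h1 : Tendsto (fun n : ℕ => Real.exp (-(c * n))) atTop (nhds 0) :=
    Real.tendsto_exp_neg_atTop_nhds_zero.comp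
      (tendsto_natCast_atTop_atTop.const_mul_atTop hc)
  have h2 := squeeze_zero_norm' (f := fun n => hamProb n - (1 - 1 / 2 * ((bigL n : ℝ) / scrL n))) h h1
  have h3 := h2.add ((tendsto_bigL_div.const_mul (1 / 2)).const_sub 1)
  simpa using h3

end LargeCliques

/-- The probability that a uniformly random perfect graph on `{1,…,n}` is Hamiltonian is
within `e^{−Ω(n)}` of `1 − (1/2)·P(X > n/2)` for `X ~ L(n)`; in particular almost all
perfect graphs are Hamiltonian. -/
theorem almost_all_perfect_hamiltonian :
    (∃ c : ℝ, 0 < c ∧ ∃ n₀ : ℕ, ∀ n : ℕ, n₀ ≤ n →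
      |hamProb n -
        (1 - (1 / 2) * ∑ k ∈ (Finset.range (n + 1)).filter
            (fun k : ℕ => (n : ℝ) / 2 < (k : ℝ)), (ell n k : ℝ) / (scrL n : ℝ))| ≤
        Real.exp (-(c * n))) ∧
      Tendsto (fun n : ℕ => hamProb n) atTop (nhds 1) := by
  refine ⟨?_, tendsto_hamProb⟩
  obtain ⟨c, hc, h⟩ := exists_hamProb_estimate
  obtain ⟨n₀, h⟩ := eventually_atTop.1 h
  exact ⟨c, hc, n₀, fun n hn => by simpa only [sum_ell_div_eq] using h n hn⟩
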